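/- Let d = 2 and write p′ for the conjugate exponent of p. The following hold with constants independent of j ≥ 0. (B₁) If 1/(3p′) ≤ 1/q ≤ 1/p, 2 < q ≤ 4, 2 < p ≤ 4, and 0 < r ≤ p, then for every ε > 0, ‖𝒜_j f‖_{L^q(L^r)} ≲_ε 2^{−j(1/2)(1/q + 1/p′) + jε} ‖f‖_{L^p}. (B₂) If 1/q ≤ min{1/(3p′), 1/p}, 4 ≤ q ≤ 6, and 0 < r ≤ p, then for every ε > 0, ‖𝒜_j f‖_{L^q(L^r)} ≲_ε 2^{−2j/q + jε} ‖f‖_{L^p}. -/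

import Mathlib

open MeasureTheory Metric Set
open scoped ENNReal NNReal FourierTransform

noncomputable section

/-- Euclidean `d`-space. -/
abbrev Euc (d : ℕ) : Type := EuclideanSpace ℝ (Fin d)

/-- The normalized surface measure `σ` on the unit sphere `S^{d-1} ⊆ ℝ^d`. -/
def sphereMeasure (d : ℕ) : Measure (Euc d) :=
  (((volume : Measure (Euc d)).toSphere Set.univ)⁻¹ : ℝ≥0∞) •
    ((volume : Measure (Euc d)).toSphere.map Subtype.val)

/-- The spherical average `A_t f(x) = ∫_{S^{d-1}} f(x - t y) dσ(y)`. -/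
def sphAvg {d : ℕ} (f : Euc d → ℂ) (t : ℝ) (x : Euc d) : ℂ :=
  ∫ y, f (x - t • y) ∂(sphereMeasure d)

/-- The dyadic symbols `β_j` built from the bump `β₀`:
`β_j(s) = β₀(2^{-j} s) - β₀(2^{1-j} s)` for `j ≥ 1`. -/
def betaJ (β₀ : ℝ → ℝ) : ℕ → ℝ → ℝ
  | 0 => β₀
  | (j + 1) => fun s => β₀ ((2 : ℝ) ^ (-(j + 1 : ℤ)) * s) - β₀ ((2 : ℝ) ^ (-(j : ℤ)) * s)

/-- The frequency localization `L_j` with symbol `β_j(|ξ|)`. -/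
def freqLoc (d : ℕ) (β₀ : ℝ → ℝ) (j : ℕ) (f : Euc d → ℂ) : Euc d → ℂ :=
  𝓕⁻ (fun ξ => (betaJ β₀ j ‖ξ‖ : ℂ) * 𝓕 f ξ)

/-- `χ` is an admissible time cutoff: smooth, `χ = 1` on a neighborhood of `[1,2]`,
supported in `[1/2,4]`. -/
def IsCutoff (χ : ℝ → ℝ) : Prop :=
  ContDiff ℝ (⊤ : ℕ∞) χ ∧ (∃ U : Set ℝ, IsOpen U ∧ Set.Icc 1 2 ⊆ U ∧ Set.EqOn χ 1 U) ∧
    Function.support χ ⊆ Set.Icc (1 / 2 : ℝ) 4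

/-- `β₀` is an admissible frequency bump: smooth, `β₀(s) = 1` for `|s| < 1/2` and
`β₀(s) = 0` for `|s| > 1`. -/
def IsBump (β₀ : ℝ → ℝ) : Prop :=
  ContDiff ℝ (⊤ : ℕ∞) β₀ ∧ (∀ s : ℝ, |s| < 1 / 2 → β₀ s = 1) ∧ ∀ s : ℝ, 1 < |s| → β₀ s = 0

/-- The frequency-localized operator `𝒜_j f(x,t) = χ(t) A_t L_j f(x)`. -/
def Aj (d : ℕ) (χ β₀ : ℝ → ℝ) (j : ℕ) (f : Euc d → ℂ) (x : Euc d) (t : ℝ) : ℂ :=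
  (χ t : ℂ) * sphAvg (freqLoc d β₀ j f) t x

/-- `L^q` norm (with respect to `μ`) of an `ℝ≥0∞`-valued function, `1 ≤ q ≤ ∞`. -/
def lqNorm {α : Type*} [MeasurableSpace α] (q : ℝ≥0∞) (g : α → ℝ≥0∞)
    (μ : Measure α) : ℝ≥0∞ :=
  if q = ∞ then essSup g μ else (∫⁻ x, g x ^ q.toReal ∂μ) ^ (1 / q.toReal)

/-- The mixed norm `‖F‖_{L^q(L^r)}` of `F : ℝ^d × ℝ → ℂ`. -/
def mixedNorm (d : ℕ) (q r : ℝ≥0∞) (F : Euc d → ℝ → ℂ) : ℝ≥0∞ :=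
  lqNorm q (fun x => lqNorm r (fun t => (‖F x t‖₊ : ℝ≥0∞)) volume) volume

set_option linter.unusedSectionVars false

open ENNReal (rpow_natCast rpow_mul ofReal ofReal_pow ofReal_mul ofReal_ne_top ofReal_le_ofReal
  ofReal_add ofReal_le_one rpow_le_rpow mul_rpow_of_nonneg ofReal_ofNat toReal_inv toReal_ofReal
  ofReal_one inv_mul_cancel rpow_ne_top_of_nonneg rpow_add_of_nonneg ofReal_inv_of_pos
  rpow_le_rpow_of_exponent_le rpow_one one_le_ofReal inv_rpow rpow_neg rpow_add coe_rpow_of_nonneg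
  coe_toNNReal ofReal_toReal inv_le_inv toReal_mono)
open Finset (mem_filter mem_product sum_filter sum_congr sum_comm mul_sum sum_le_sum sum_const
  sum_nonneg sum_eq_zero sum_range_succ card_range sum_image sum_range_succ' smul_sum sum_mul)
open Real (norm_of_nonneg fourierInv_eq fourier_eq norm_eq_abs sq_sqrt sqrt_nonneg volume_Ioc
  volume_Icc sqrt_pos pi_pos pi_ne_zero cos_le_one)
open Complex (norm_real real_smul ofRealCLM)
open Circle (smul_def coe_mul)
open Function (uncurry)

attribute [fun_prop] Real.continuous_fourierChar

/-! ### Bounded compactly supported functions and their correlations -/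

instance : (volume : Measure (Euc 2 × ℝ)).IsAddHaarMeasure :=
  inferInstanceAs (Measure.prod (volume : Measure (Euc 2)) (volume : Measure ℝ)).IsAddHaarMeasure

/-- Bounded measurable functions with bounded support. -/
structure Nice {V : Type*} [Norm V] [MeasurableSpace V] (F : V → ℂ) : Prop where
  meas : Measurable F
  bdd : ∃ M : ℝ, 0 ≤ M ∧ ∀ x, ‖F x‖ ≤ M
  supp : ∃ ρ : ℝ, 0 ≤ ρ ∧ ∀ x, F x ≠ 0 → ‖x‖ ≤ ρ

section Correlation

variable {V : Type*} [NormedAddCommGroup V] [NormedSpace ℝ V] [FiniteDimensional ℝ V]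
  [MeasureSpace V] [BorelSpace V] [(volume : Measure V).IsAddHaarMeasure]

/-- Additive convolution. -/
def conv (F G : V → ℂ) (η : V) : ℂ := ∫ ζ, F ζ * G (η - ζ)

/-- The cross-correlation `ω ↦ ∫ F(ζ) conj G(ζ - ω) dζ`. -/
def acor (F G : V → ℂ) (ω : V) : ℂ := ∫ ζ, F ζ * (starRingEnd ℂ) (G (ζ - ω))

theorem Nice.mul_bdd {F g : V → ℂ} (hF : Nice F) (hg : Measurable g) (hb : ∃ M : ℝ, ∀ x, ‖g x‖ ≤ M) :
    Nice (fun x => F x * g x) := by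
  obtain ⟨M, hM0, hM⟩ := hF.bdd
  obtain ⟨N, hN⟩ := hb
  obtain ⟨ρ, hρ0, hρ⟩ := hF.supp
  refine ⟨hF.meas.mul hg, ⟨M * |N|, by positivity, fun x => ?_⟩, ⟨ρ, hρ0, fun x hx => hρ x ?_⟩⟩
  · rw [norm_mul]; exact mul_le_mul (hM x) ((hN x).trans (le_abs_self N)) (norm_nonneg _) hM0
  · grind

theorem Nice.indicator {F : V → ℂ} (hF : Nice F) {s : Set V} (hs : MeasurableSet s) :
    Nice (s.indicator F) := by
  obtain ⟨M, hM0, hM⟩ := hF.bdd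
  obtain ⟨ρ, hρ0, hρ⟩ := hF.supp
  refine ⟨hF.meas.indicator hs, ⟨M, hM0, fun x => ?_⟩, ⟨ρ, hρ0, fun x hx => hρ x ?_⟩⟩
  · exact (norm_indicator_le_norm_self _ _).trans (hM x)
  · simp_all

theorem Nice.star {F : V → ℂ} (hF : Nice F) : Nice (fun x => (starRingEnd ℂ) (F x)) := by
  obtain ⟨M, hM0, hM⟩ := hF.bdd
  obtain ⟨ρ, hρ0, hρ⟩ := hF.supp
  refine ⟨RCLike.continuous_conj.measurable.comp hF.meas, ⟨M, hM0, fun x => by simpa using hM x⟩,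
    ⟨ρ, hρ0, fun x hx => hρ x (by simpa using hx)⟩⟩

theorem Nice.comp_neg {F : V → ℂ} (hF : Nice F) : Nice (fun x => F (-x)) := by
  obtain ⟨M, hM0, hM⟩ := hF.bdd
  obtain ⟨ρ, hρ0, hρ⟩ := hF.supp
  exact ⟨hF.meas.comp measurable_neg, ⟨M, hM0, fun x => hM _⟩,
    ⟨ρ, hρ0, fun x hx => by simpa using hρ _ hx⟩⟩

theorem Nice.sub {F G : V → ℂ} (hF : Nice F) (hG : Nice G) : Nice (fun x => F x - G x) := by
  obtain ⟨M, hM0, hM⟩ := hF.bdd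
  obtain ⟨ρ, hρ0, hρ⟩ := hF.supp
  obtain ⟨M', hM0', hM'⟩ := hG.bdd
  obtain ⟨ρ', hρ0', hρ'⟩ := hG.supp
  refine ⟨hF.meas.sub hG.meas, ⟨M + M', by positivity, fun x => (norm_sub_le _ _).trans
    (add_le_add (hM x) (hM' x))⟩, ⟨max ρ ρ', by positivity, fun x hx => ?_⟩⟩
  grind

theorem integrable_of_bdd_supp {E : Type*} [NormedAddCommGroup E] {F : V → E}
    (hm : AEStronglyMeasurable F volume) {M ρ : ℝ} (hM : ∀ x, ‖F x‖ ≤ M)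
    (hρ : ∀ x, F x ≠ 0 → ‖x‖ ≤ ρ) : Integrable F := by
  have h : Integrable ((closedBall (0 : V) ρ).indicator F) := by
    rw [integrable_indicator_iff measurableSet_closedBall]
    exact Measure.integrableOn_of_bounded (measure_closedBall_lt_top).ne hm (M := M)
      (.of_forall hM)
  convert h using 1
  funext x
  by_cases hx : F x = 0
  · simp [indicator, hx]
  · simp_all

theorem Nice.integrable {F : V → ℂ} (hF : Nice F) : Integrable F := by
  obtain ⟨M, hM0, hM⟩ := hF.bdd
  obtain ⟨ρ, hρ0, hρ⟩ := hF.supp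
  exact integrable_of_bdd_supp hF.meas.aestronglyMeasurable hM hρ

theorem Nice.integrable_sq {F : V → ℂ} (hF : Nice F) : Integrable (fun x => ‖F x‖ ^ 2) := by
  obtain ⟨M, hM0, hM⟩ := hF.bdd
  obtain ⟨ρ, hρ0, hρ⟩ := hF.supp
  refine integrable_of_bdd_supp (M := M ^ 2) (ρ := ρ)
    (hF.meas.norm.pow_const 2).aestronglyMeasurable (fun x => ?_) (fun x hx => hρ x ?_)
  · rw [norm_of_nonneg (by positivity)]
    bound
  · simp_all

theorem nice_param_integral {F G : V → ℂ} (hF : Nice F) (hG : Nice G) {T : V → V → V}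
    (hT : Measurable (uncurry T)) (hTb : ∀ η ζ, ‖η‖ ≤ ‖ζ‖ + ‖T η ζ‖) :
    Nice (fun η => ∫ ζ, F ζ * G (T η ζ)) := by
  obtain ⟨M, hM0, hM⟩ := hF.bdd
  obtain ⟨ρ, hρ0, hρ⟩ := hF.supp
  obtain ⟨M', hM0', hM'⟩ := hG.bdd
  obtain ⟨ρ', hρ0', hρ'⟩ := hG.supp
  refine ⟨?_, ⟨M' * ∫ ζ, ‖F ζ‖, by positivity, fun η => ?_⟩, ⟨ρ + ρ', by positivity, fun η hη => ?_⟩⟩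
  · have : StronglyMeasurable (fun η => ∫ ζ, F ζ * G (T η ζ)) := by
      apply StronglyMeasurable.integral_prod_right (f := fun η ζ => F ζ * G (T η ζ))
      apply Measurable.stronglyMeasurable; exact (hF.meas.comp measurable_snd).mul (hG.meas.comp hT)
    exact this.measurable
  · rw [← integral_const_mul]
    refine norm_integral_le_of_norm_le (hF.integrable.norm.const_mul M')
      (.of_forall fun ζ => ?_)
    rw [norm_mul, mul_comm]
    bound
  · by_contra hcon
    apply hη; rw [← integral_zero V ℂ]; congr 1
    funext ζ
    by_contra h
    have h1 := hρ ζ (left_ne_zero_of_mul h)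
    have h2 := hρ' _ (right_ne_zero_of_mul h)
    grind

theorem Nice.conv {F G : V → ℂ} (hF : Nice F) (hG : Nice G) : Nice (conv F G) := by
  apply nice_param_integral hF hG (T := fun η ζ => η - ζ)
  · fun_prop
  · intro η ζ
    have := norm_add_le ζ (η - ζ)
    simpa using this

theorem Nice.acor {F G : V → ℂ} (hF : Nice F) (hG : Nice G) : Nice (acor F G) := by
  apply nice_param_integral hF hG.star (T := fun η ζ => ζ - η)
  · fun_prop
  · intro η ζ
    have := norm_sub_le ζ (ζ - η)
    simpa using this

theorem acor_neg (F : V → ℂ) (ω : V) :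
    acor F F (-ω) = (starRingEnd ℂ) (acor F F ω) := by
  unfold acor; rw [← integral_conj, ← integral_sub_right_eq_self _ ω]; congr 1
  funext ζ
  simp [mul_comm]

theorem acor_eq_conv (F G : V → ℂ) : acor F G = conv F (fun x => (starRingEnd ℂ) (G (-x))) := by
  funext ω
  simp [acor, conv]

theorem acor_reflect (G : V → ℂ) :
    acor (fun x => (starRingEnd ℂ) (G (-x))) (fun x => (starRingEnd ℂ) (G (-x))) = acor G G := by
  funext ω
  unfold acor; rw [← integral_neg_eq_self, ← integral_sub_right_eq_self _ ω]; congr 1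
  funext ζ
  simp [mul_comm]

/-- Products over three translated variables are integrable. -/
theorem integrable_prod_nice {F G : V → ℂ} (hF : Nice F) (hG : Nice G) {K : V × V → ℂ}
    (hK : Measurable K) (hb : ∃ M : ℝ, ∀ p, ‖K p‖ ≤ M) :
    Integrable (fun p : V × V => F p.1 * G p.2 * K p) (volume.prod volume) := by
  have h := hF.integrable.mul_prod hG.integrable
  obtain ⟨M, hM⟩ := hb
  exact h.mul_bdd (c := M) hK.aestronglyMeasurable (.of_forall hM)

theorem integral_conv_mul_conj {F G : V → ℂ} (hF : Nice F) (hG : Nice G) :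
    ∫ η, conv F G η * (starRingEnd ℂ) (conv F G η) =
      ∫ ω, acor F F ω * (starRingEnd ℂ) (acor G G ω) := by
  obtain ⟨MG, hMG0, hMG⟩ := hG.bdd
  have hC := hF.conv hG
  have mstar : Measurable (starRingEnd ℂ) := RCLike.continuous_conj.measurable
  -- first exchange
  have e1 : ∫ η, conv F G η * (starRingEnd ℂ) (conv F G η) =
      ∫ ζ, F ζ * ∫ η, G (η - ζ) * (starRingEnd ℂ) (conv F G η) := by
    have : ∀ η, conv F G η * (starRingEnd ℂ) (conv F G η) =
        ∫ ζ, F ζ * (starRingEnd ℂ) (conv F G η) * G (η - ζ) := by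
      intro η; rw [conv, ← integral_mul_const]; grind
    simp_rw [this]; rw [integral_integral_swap]
    · congr 1; funext ζ
      rw [← integral_const_mul]; grind
    · have := integrable_prod_nice hC.star hF (K := fun p => G (p.1 - p.2))
        (hG.meas.comp (measurable_fst.sub measurable_snd)) ⟨MG, fun p => hMG _⟩
      refine this.congr (.of_forall fun p => ?_)
      grind
  have e2 : ∀ ζ, ∫ η, G (η - ζ) * (starRingEnd ℂ) (conv F G η) =
      ∫ ζ', (starRingEnd ℂ) (F ζ') * acor G G (ζ' - ζ) := by
    intro ζ
    have : ∀ η, G (η - ζ) * (starRingEnd ℂ) (conv F G η) =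
        ∫ ζ', G (η - ζ) * (starRingEnd ℂ) (F ζ') * (starRingEnd ℂ) (G (η - ζ')) := by
      intro η; rw [conv, ← integral_conj, ← integral_const_mul]; grind
    simp_rw [this]
    have hGt : Nice (fun η => G (η - ζ)) := by
      obtain ⟨ρ, hρ0, hρ⟩ := hG.supp
      refine ⟨hG.meas.comp (measurable_id.sub_const ζ), ⟨MG, hMG0, fun x => hMG _⟩,
        ⟨ρ + ‖ζ‖, by positivity, fun x hx => ?_⟩⟩
      have := hρ _ hx
      have h2 := norm_add_le (x - ζ) ζ
      simp only [sub_add_cancel] at h2; linarith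
    rw [integral_integral_swap]
    · congr 1; funext ζ'
      rw [acor, ← integral_const_mul,
        ← integral_sub_right_eq_self (fun η => (starRingEnd ℂ) (F ζ') * _) ζ]
      congr 1; funext η
      have : η - ζ - (ζ' - ζ) = η - ζ' := by abel
      rw [this]; ring
    · exact integrable_prod_nice hGt hF.star (K := fun p => (starRingEnd ℂ) (G (p.1 - p.2)))
        (mstar.comp (hG.meas.comp (measurable_fst.sub measurable_snd)))
        ⟨MG, fun p => by simpa using hMG _⟩
  have hA := hG.acor hG
  obtain ⟨MA, hMA0, hMA⟩ := hA.bdd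
  rw [e1]; simp_rw [e2]
  have e3 : ∀ ζ, F ζ * ∫ ζ', (starRingEnd ℂ) (F ζ') * acor G G (ζ' - ζ) =
      ∫ ω, F ζ * (starRingEnd ℂ) (F (ζ - ω)) * (starRingEnd ℂ) (acor G G ω) := by
    intro ζ; rw [← integral_const_mul, ← integral_sub_left_eq_self _ volume ζ]; congr 1; funext ω
    have : ζ - ω - ζ = -ω := by abel
    rw [this, acor_neg G]; ring
  simp_rw [e3]; rw [integral_integral_swap]
  · congr 1; funext ω
    rw [acor.eq_def F, ← integral_mul_const]
  · have := integrable_prod_nice hF hA.star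
      (K := fun p => (starRingEnd ℂ) (F (p.1 - p.2)))
      (mstar.comp (hF.meas.comp (measurable_fst.sub measurable_snd)))
      (by obtain ⟨M, hM0, hM⟩ := hF.bdd; exact ⟨M, fun p => by simpa using hM _⟩)
    refine this.congr (.of_forall fun p => ?_)
    grind

/-- The squared `L²` norm of the autocorrelation, equivalently the fourth power of the `L⁴` norm
of the inverse Fourier transform. -/
def quartic (F : V → ℂ) : ℝ := ∫ ω, ‖acor F F ω‖ ^ 2

theorem ofReal_integral_sq (F : V → ℂ) :
    ((∫ x, ‖F x‖ ^ 2 : ℝ) : ℂ) = ∫ x, F x * (starRingEnd ℂ) (F x) := by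
  rw [← integral_complex_ofReal]; congr 1; funext x
  rw [Complex.mul_conj, Complex.normSq_eq_norm_sq]

theorem integral_conv_sq_self {F : V → ℂ} (hF : Nice F) :
    ∫ η, ‖conv F F η‖ ^ 2 = quartic F := by
  have := integral_conv_mul_conj hF hF
  rw [← ofReal_integral_sq, ← ofReal_integral_sq] at this
  aesop

theorem Nice.integrable_mul_norm {F G : V → ℂ} (hF : Nice F) (hG : Nice G) :
    Integrable (fun x => ‖F x‖ * ‖G x‖) := by
  obtain ⟨M, hM0, hM⟩ := hG.bdd
  exact hF.integrable.norm.mul_bdd (c := M) hG.meas.norm.aestronglyMeasurable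
    (.of_forall fun x => by simpa using hM x)

theorem integral_conv_sq_le {F G : V → ℂ} (hF : Nice F) (hG : Nice G) :
    ∫ η, ‖conv F G η‖ ^ 2 ≤ ∫ ω, ‖acor F F ω‖ * ‖acor G G ω‖ := by
  have := integral_conv_mul_conj hF hG
  rw [← ofReal_integral_sq] at this
  have h2 : ∫ η, ‖conv F G η‖ ^ 2 = ‖∫ ω, acor F F ω * (starRingEnd ℂ) (acor G G ω)‖ := by
    rw [← this, norm_real, norm_of_nonneg (integral_nonneg fun _ => by positivity)]
  rw [h2]
  refine norm_integral_le_of_norm_le ((hF.acor hF).integrable_mul_norm (hG.acor hG))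
    (.of_forall fun ω => by simp)

theorem quartic_nonneg (F : V → ℂ) : 0 ≤ quartic F := integral_nonneg fun _ => by positivity

theorem Nice.memLp_two_norm {F : V → ℂ} (hF : Nice F) :
    MemLp (fun x => ‖F x‖) 2 (volume : Measure V) := by
  rw [memLp_two_iff_integrable_sq_norm hF.meas.norm.aestronglyMeasurable]
  simpa using hF.integrable_sq

theorem integral_mul_le_sqrt {F G : V → ℂ} (hF : Nice F) (hG : Nice G) :
    ∫ ω, ‖F ω‖ * ‖G ω‖ ≤ √(∫ ω, ‖F ω‖ ^ 2) * √(∫ ω, ‖G ω‖ ^ 2) := by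
  have h := integral_mul_le_Lp_mul_Lq_of_nonneg (μ := (volume : Measure V))
    (Real.HolderConjugate.two_two) (f := fun x => ‖F x‖) (g := fun x => ‖G x‖)
    (.of_forall fun x => norm_nonneg _)
    (.of_forall fun x => norm_nonneg _)
    (by simpa using hF.memLp_two_norm) (by simpa using hG.memLp_two_norm)
  simpa [Real.sqrt_eq_rpow] using h

theorem integral_conv_sq_le_sqrt {F G : V → ℂ} (hF : Nice F) (hG : Nice G) :
    ∫ η, ‖conv F G η‖ ^ 2 ≤ √(quartic F) * √(quartic G) :=
  (integral_conv_sq_le hF hG).trans (integral_mul_le_sqrt (hF.acor hF) (hG.acor hG))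

theorem integral_acor_sq_le_sqrt {F G : V → ℂ} (hF : Nice F) (hG : Nice G) :
    ∫ η, ‖acor F G η‖ ^ 2 ≤ √(quartic F) * √(quartic G) := by
  rw [acor_eq_conv]
  refine (integral_conv_sq_le_sqrt hF hG.comp_neg.star).trans (le_of_eq ?_)
  rw [quartic, quartic, quartic, acor_reflect]

end Correlation

/-! ### Dyadic arcs with half-step overlaps -/

/-- Left endpoint of the arc with index `(k, m)`. -/
def arcLeft (τ : ℕ × ℕ) : ℝ := τ.2 / 2 ^ (τ.1 + 1)

/-- Length `2^{-k}` of the arc with index `(k, m)`. -/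
def arcLen (τ : ℕ × ℕ) : ℝ := 1 / 2 ^ τ.1

/-- The half-open arc with index `(k, m)`. -/
def arc (τ : ℕ × ℕ) : Set ℝ := Ico (arcLeft τ) (arcLeft τ + arcLen τ)

/-- Containment of arcs, in terms of the indices. -/
def SubArc (τ' τ : ℕ × ℕ) : Prop :=
  τ.1 ≤ τ'.1 ∧ τ.2 * 2 ^ (τ'.1 - τ.1) ≤ τ'.2 ∧ τ'.2 + 2 ≤ (τ.2 + 2) * 2 ^ (τ'.1 - τ.1)

instance : DecidableRel SubArc := fun _ _ => by unfold SubArc; infer_instance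

/-- The sub-arcs of `τ` of level at most `N`. -/
def subArcs (τ : ℕ × ℕ) (N : ℕ) : Finset (ℕ × ℕ) :=
  (Finset.range (N + 1) ×ˢ Finset.range ((τ.2 + 2) * 2 ^ N)).filter fun τ' => SubArc τ' τ

theorem mem_subArcs {τ τ' : ℕ × ℕ} {N : ℕ} : τ' ∈ subArcs τ N ↔ τ'.1 ≤ N ∧ SubArc τ' τ := by
  simp only [subArcs, mem_filter, mem_product, Finset.mem_range]
  constructor
  · grind
  · rintro ⟨h1, h2⟩
    refine ⟨⟨by omega, ?_⟩, h2⟩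
    have := h2.2.2
    have h4 : 2 ^ (τ'.1 - τ.1) ≤ 2 ^ N := Nat.pow_le_pow_right (by norm_num) (by omega)
    nlinarith

theorem arcLen_pos (τ : ℕ × ℕ) : 0 < arcLen τ := by unfold arcLen; positivity

theorem arcLen_le_one (τ : ℕ × ℕ) : arcLen τ ≤ 1 := by unfold arcLen; bound

theorem arcLeft_nonneg (τ : ℕ × ℕ) : 0 ≤ arcLeft τ := by unfold arcLeft; positivity

theorem SubArc.refl (τ : ℕ × ℕ) : SubArc τ τ := by simp [SubArc]

theorem SubArc.trans {τ₁ τ₂ τ₃ : ℕ × ℕ} (h : SubArc τ₁ τ₂) (h' : SubArc τ₂ τ₃) : SubArc τ₁ τ₃ := by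
  obtain ⟨a1, a2, a3⟩ := h
  obtain ⟨b1, b2, b3⟩ := h'
  have e : 2 ^ (τ₁.1 - τ₃.1) = 2 ^ (τ₂.1 - τ₃.1) * 2 ^ (τ₁.1 - τ₂.1) := by
    rw [← pow_add]; congr 1; omega
  refine ⟨b1.trans a1, ?_, ?_⟩
  · nlinarith
  · nlinarith

theorem arcLeft_eq (τ : ℕ × ℕ) : arcLeft τ = τ.2 * arcLen τ / 2 := by
  unfold arcLeft arcLen; rw [pow_succ]; field_simp

theorem arcLen_sub {τ τ' : ℕ × ℕ} (h : τ.1 ≤ τ'.1) :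
    arcLen τ = 2 ^ (τ'.1 - τ.1) * arcLen τ' := by
  unfold arcLen
  have : (2 : ℝ) ^ τ'.1 = 2 ^ (τ'.1 - τ.1) * 2 ^ τ.1 := by rw [← pow_add]; congr 1; omega
  rw [this]; field_simp

theorem SubArc.le {τ' τ : ℕ × ℕ} (h : SubArc τ' τ) :
    arcLeft τ ≤ arcLeft τ' ∧ arcLeft τ' + arcLen τ' ≤ arcLeft τ + arcLen τ := by
  obtain ⟨h1, h2, h3⟩ := h
  have hp := arcLen_pos τ'
  rw [arcLeft_eq, arcLeft_eq, arcLen_sub h1]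
  have h2' : (τ.2 : ℝ) * 2 ^ (τ'.1 - τ.1) ≤ τ'.2 := by exact_mod_cast h2
  have h3' : (τ'.2 : ℝ) + 2 ≤ (τ.2 + 2) * 2 ^ (τ'.1 - τ.1) := by exact_mod_cast h3
  constructor <;> nlinarith

theorem SubArc.subset {τ' τ : ℕ × ℕ} (h : SubArc τ' τ) : arc τ' ⊆ arc τ :=
  Ico_subset_Ico h.le.1 h.le.2

/-- At most three arcs of each level contain a given arc. -/
theorem card_superArcs_le (τ τ'' : ℕ × ℕ) (N : ℕ) :
    ((subArcs τ N).filter fun τ' => SubArc τ'' τ').card ≤ 3 * (N + 1 - τ.1) := by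
  have hsub : ((subArcs τ N).filter fun τ' => SubArc τ'' τ') ⊆
      (Finset.Ico τ.1 (N + 1)).biUnion fun k => (Finset.range 3).image fun i =>
        (k, τ''.2 / 2 ^ (τ''.1 - k) - i) := by
    intro τ' h; rw [mem_filter, mem_subArcs] at h
    obtain ⟨⟨h1, h2⟩, h3, h4, h5⟩ := h
    rw [Finset.mem_biUnion]
    refine ⟨τ'.1, Finset.mem_Ico.2 ⟨h2.1, by omega⟩, ?_⟩
    rw [Finset.mem_image]
    have hpos : 0 < 2 ^ (τ''.1 - τ'.1) := by positivity
    have ha : τ'.2 ≤ τ''.2 / 2 ^ (τ''.1 - τ'.1) := (Nat.le_div_iff_mul_le hpos).2 h4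
    have hb : τ''.2 / 2 ^ (τ''.1 - τ'.1) < τ'.2 + 2 :=
      (Nat.div_lt_iff_lt_mul hpos).2 (by omega)
    refine ⟨τ''.2 / 2 ^ (τ''.1 - τ'.1) - τ'.2, Finset.mem_range.2 (by omega), ?_⟩
    grind
  refine (Finset.card_le_card hsub).trans (Finset.card_biUnion_le.trans ?_)
  refine (Finset.sum_le_card_nsmul _ _ 3 fun k _ => ?_).trans (by simp [mul_comm])
  grind

theorem sum_subArcs_subArcs_le (τ : ℕ × ℕ) (N N' : ℕ) (E : ℕ × ℕ → ℝ) (hE : ∀ x, 0 ≤ E x)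
     :
    ∑ τ' ∈ subArcs τ N, ∑ τ'' ∈ subArcs τ' N', E τ'' ≤
      (3 * (N + 1 - τ.1) : ℕ) * ∑ τ'' ∈ subArcs τ N', E τ'' := by
  have h1 : ∀ τ' ∈ subArcs τ N, ∑ τ'' ∈ subArcs τ' N', E τ'' =
      ∑ τ'' ∈ subArcs τ N', if SubArc τ'' τ' then E τ'' else 0 := by
    intro τ' h'; rw [← sum_filter]; congr 1
    ext τ''; rw [mem_filter, mem_subArcs, mem_subArcs]; rw [mem_subArcs] at h'
    constructor
    · rintro ⟨a, b⟩; exact ⟨⟨a, b.trans h'.2⟩, b⟩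
    · grind
  rw [sum_congr rfl h1, sum_comm, mul_sum]
  refine sum_le_sum fun τ'' _ => ?_
  rw [← sum_filter, sum_const, nsmul_eq_mul]
  exact mul_le_mul_of_nonneg_right (by exact_mod_cast card_superArcs_le τ τ'' N) (hE _)

/-- A set of diameter at most `2^{-l-1}` inside an arc fits into a sub-arc of level `l`. -/
theorem exists_subArc_of_diam {τ : ℕ × ℕ} {P : Set ℝ} (hP : P ⊆ arc τ) (hne : P.Nonempty) {l : ℕ}
    (hl : τ.1 < l) (hd : ∀ y ∈ P, ∀ z ∈ P, |y - z| ≤ 1 / 2 ^ (l + 1)) :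
    ∃ τ', τ'.1 = l ∧ SubArc τ' τ ∧ P ⊆ arc τ' := by
  classical
  have hnn : ∀ y ∈ P, 0 ≤ y := fun y hy => (arcLeft_nonneg τ).trans (hP hy).1
  have hex : ∃ i : ℕ, ∃ y ∈ P, ⌊y * 2 ^ (l + 1)⌋₊ = i := by aesop
  set i := Nat.find hex with hi
  obtain ⟨y₀, hy₀, hfl⟩ := Nat.find_spec hex
  have hp : (0 : ℝ) < 2 ^ (l + 1) := by positivity
  have hlow : ∀ y ∈ P, (i : ℝ) ≤ y * 2 ^ (l + 1) := fun y hy =>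
    (Nat.cast_le.2 (Nat.find_min' hex ⟨y, hy, rfl⟩)).trans
      (Nat.floor_le (mul_nonneg (hnn y hy) hp.le))
  have hy₀' : y₀ * 2 ^ (l + 1) < i + 1 := by
    have := Nat.lt_floor_add_one (y₀ * 2 ^ (l + 1))
    grind
  have hup : ∀ y ∈ P, y * 2 ^ (l + 1) < i + 2 := fun y hy => by
    have := (abs_le.1 (hd y hy y₀ hy₀)).2
    have h2 : (y - y₀) * 2 ^ (l + 1) ≤ 1 := by
      calc (y - y₀) * 2 ^ (l + 1) ≤ 1 / 2 ^ (l + 1) * 2 ^ (l + 1) :=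
            mul_le_mul_of_nonneg_right this hp.le
        _ = 1 := by field_simp
    nlinarith
  set T : ℕ := 2 ^ (l - τ.1) with hT
  have hT2 : 2 ≤ T := by bound
  have hscale : (2 : ℝ) ^ (l + 1) = T * 2 ^ (τ.1 + 1) := by
    rw [hT]; push_cast; rw [← pow_add]; congr 1; omega
  have hPτ : ∀ y ∈ P, (τ.2 : ℝ) * T ≤ y * 2 ^ (l + 1) ∧ y * 2 ^ (l + 1) < (τ.2 + 2) * T := by
    intro y hy
    have h := hP hy
    have hq : (0 : ℝ) < 2 ^ (τ.1 + 1) := by positivity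
    have h1 : (τ.2 : ℝ) ≤ y * 2 ^ (τ.1 + 1) := (div_le_iff₀ hq).1 h.1
    have h2 : y * 2 ^ (τ.1 + 1) < τ.2 + 2 := by
      have := h.2
      have e : arcLeft τ + arcLen τ = (τ.2 + 2) / 2 ^ (τ.1 + 1) := by
        unfold arcLeft arcLen; rw [pow_succ]; field_simp
      rw [e, lt_div_iff₀ hq] at this; exact this
    rw [hscale]
    constructor <;> nlinarith
  have hi1 : τ.2 * T ≤ i := by rw [hi, ← hfl]; apply Nat.le_floor; push_cast; exact (hPτ y₀ hy₀).1
  have hi2 : i < (τ.2 + 2) * T := by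
    have := (hlow y₀ hy₀).trans_lt (hPτ y₀ hy₀).2
    exact_mod_cast this
  have mk : ∀ m' : ℕ, (∀ y ∈ P, (m' : ℝ) ≤ y * 2 ^ (l + 1) ∧ y * 2 ^ (l + 1) < m' + 2) →
      P ⊆ arc (l, m') := by
    intro m' h y hy
    obtain ⟨h1, h2⟩ := h y hy
    have e : arcLeft (l, m') + arcLen (l, m') = (m' + 2) / 2 ^ (l + 1) := by
      unfold arcLeft arcLen; simp only; rw [pow_succ]; field_simp
    refine ⟨?_, ?_⟩
    · unfold arcLeft; rw [div_le_iff₀ hp]; exact h1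
    · rw [e, lt_div_iff₀ hp]; exact h2
  by_cases hc : i + 2 ≤ (τ.2 + 2) * T
  · exact ⟨(l, i), rfl, ⟨hl.le, hi1, hc⟩, mk i fun y hy => ⟨hlow y hy, hup y hy⟩⟩
  · have hi3 : i + 1 = (τ.2 + 2) * T := by omega
    have hipos : 1 ≤ i := by nlinarith
    refine ⟨(l, i - 1), rfl, ⟨hl.le, ?_, ?_⟩, mk (i - 1) fun y hy => ⟨?_, ?_⟩⟩
    · grind
    · grind
    · have := hlow y hy; push_cast [hipos]; linarith
    · have h1 := (hPτ y hy).2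
      have h2 : ((i : ℝ) + 1) = (τ.2 + 2) * T := by exact_mod_cast hi3
      push_cast [hipos]; linarith

/-- Every subset of an arc lies in a sub-arc of comparable length, down to scale `2^{-q}`. -/
theorem exists_subArc_cover {τ : ℕ × ℕ} {P : Set ℝ} (hP : P ⊆ arc τ) (hne : P.Nonempty) (q : ℕ) :
    ∃ τ', τ'.1 ≤ max τ.1 q ∧ SubArc τ' τ ∧ P ⊆ arc τ' ∧
      (arcLen τ' ≤ 1 / 2 ^ q ∨ ∃ y ∈ P, ∃ z ∈ P, arcLen τ' ≤ 4 * |y - z|) := by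
  classical
  by_cases hq : q ≤ τ.1
  · refine ⟨τ, le_max_left _ _, SubArc.refl τ, hP, Or.inl ?_⟩
    unfold arcLen
    bound
  push Not at hq
  set good : ℕ → Prop := fun l => ∀ y ∈ P, ∀ z ∈ P, |y - z| ≤ 1 / 2 ^ (l + 1)
  have hbad : ∀ l, ¬ good (l + 1) → ∃ y ∈ P, ∃ z ∈ P, 1 / 2 ^ l ≤ 4 * |y - z| := by
    intro l h; simp only [good] at h
    push Not at h
    obtain ⟨y, hy, z, hz, h⟩ := h
    refine ⟨y, hy, z, hz, ?_⟩
    have : (1 : ℝ) / 2 ^ (l + 1 + 1) = 1 / 2 ^ l / 4 := by grind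
    linarith
  by_cases h1 : good (τ.1 + 1)
  · set l := Nat.findGreatest good q
    have hl1 : τ.1 + 1 ≤ l := Nat.le_findGreatest hq h1
    have hlq : l ≤ q := Nat.findGreatest_le q
    have hgl : good l := Nat.findGreatest_spec (P := good) hq h1
    obtain ⟨τ', e, hs, hPs⟩ := exists_subArc_of_diam hP hne (by omega : τ.1 < l) hgl
    refine ⟨τ', by rw [e]; exact hlq.trans (le_max_right _ _), hs, hPs, ?_⟩
    rcases hlq.eq_or_lt with h | h
    · left; unfold arcLen; rw [e, h]
    · right
      have := hbad l (Nat.findGreatest_is_greatest (P := good) (Nat.lt_succ_self l) h)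
      unfold arcLen; rw [e]; exact this
  · exact ⟨τ, le_max_left _ _, SubArc.refl τ, hP, Or.inr (hbad τ.1 h1)⟩

/-- The `i`-th of the `2^l` dyadic pieces of an arc. -/
def child (τ : ℕ × ℕ) (l i : ℕ) : ℕ × ℕ := (τ.1 + l, τ.2 * 2 ^ l + 2 * i)

theorem child_subArc (τ : ℕ × ℕ) {l i : ℕ} (hi : i < 2 ^ l) : SubArc (child τ l i) τ := by
  refine ⟨by simp [child], by simp [child], ?_⟩
  simp only [child, add_tsub_cancel_left]; nlinarith

theorem arcLen_child (τ : ℕ × ℕ) (l i : ℕ) : arcLen (child τ l i) = arcLen τ / 2 ^ l := by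
  simp only [arcLen, child]; rw [pow_add]; field_simp

theorem arcLeft_child (τ : ℕ × ℕ) (l i : ℕ) :
    arcLeft (child τ l i) = arcLeft τ + i * (arcLen τ / 2 ^ l) := by
  simp only [arcLen, arcLeft, child]; push_cast; rw [pow_add, pow_add, pow_add]; field_simp

/-- The index of the dyadic piece containing `x`. -/
def childIdx (τ : ℕ × ℕ) (l : ℕ) (x : ℝ) : ℕ := ⌊(x - arcLeft τ) / arcLen τ * 2 ^ l⌋₊

theorem childIdx_lt {τ : ℕ × ℕ} {x : ℝ} (hx : x ∈ arc τ) (l : ℕ) : childIdx τ l x < 2 ^ l := by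
  have hp := arcLen_pos τ
  unfold childIdx; rw [Nat.floor_lt' (by positivity)]
  have : (x - arcLeft τ) / arcLen τ < 1 := by rw [div_lt_one hp]; linarith [hx.2]
  simp_all

theorem mem_arc_child_iff {τ : ℕ × ℕ} {x : ℝ} (hx : x ∈ arc τ) (l i : ℕ) :
    x ∈ arc (child τ l i) ↔ childIdx τ l x = i := by
  have hp := arcLen_pos τ
  have h2 : (0 : ℝ) < 2 ^ l := by positivity
  have hnn : 0 ≤ (x - arcLeft τ) / arcLen τ * 2 ^ l := by
    have := hx.1
    positivity
  unfold childIdx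
  rw [Nat.floor_eq_iff hnn, arc, arcLeft_child, arcLen_child, mem_Ico, div_mul_eq_mul_div,
    le_div_iff₀ hp, div_lt_iff₀ hp, mul_div_assoc']
  constructor
  · rintro ⟨a, b⟩
    have a' : i * (arcLen τ) / 2 ^ l ≤ x - arcLeft τ := by linarith
    have b' : x - arcLeft τ < (i + 1) * arcLen τ / 2 ^ l := by grind
    rw [div_le_iff₀ h2] at a'; rw [lt_div_iff₀ h2] at b'; grind
  · rintro ⟨a, b⟩; rw [← div_le_iff₀ h2] at a; rw [← lt_div_iff₀ h2] at b; grind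

theorem childIdx_succ {τ : ℕ × ℕ} (l : ℕ) (x : ℝ) :
    childIdx τ l x = childIdx τ (l + 1) x / 2 := by
  unfold childIdx
  have := Nat.floor_div_natCast ((x - arcLeft τ) / arcLen τ * 2 ^ (l + 1)) 2
  grind

/-! ### Quadratic sublevel sets and dual planks -/

/-- The dual plank of an arc at scale `δ`, in null coordinates: the quadratic polynomial
`x ↦ C - 2 x B + x² A` has all its coefficients, rescaled to the arc, bounded by `δ`. -/
def InPlank (τ : ℕ × ℕ) (δ A B C : ℝ) : Prop :=
  arcLen τ ^ 2 * |A| ≤ δ ∧ arcLen τ * |B - arcLeft τ * A| ≤ δ ∧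
    |C - 2 * arcLeft τ * B + arcLeft τ ^ 2 * A| ≤ δ

theorem inPlank_of_point {τ : ℕ × ℕ} {δ A B C x μ ν κ : ℝ} (hx : x ∈ arc τ)
    (hQ : |C - 2 * x * B + x ^ 2 * A| ≤ κ) (hA : arcLen τ ^ 2 * |A| ≤ μ)
    (hB : arcLen τ * |B - x * A| ≤ ν) (hδ : κ + 2 * ν + μ ≤ δ) :
    InPlank τ δ A B C := by
  have hp := arcLen_pos τ
  have hκ : 0 ≤ κ := (abs_nonneg _).trans hQ
  have hμ : 0 ≤ μ := (mul_nonneg (by positivity) (abs_nonneg A)).trans hA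
  have hν : 0 ≤ ν := (mul_nonneg hp.le (abs_nonneg _)).trans hB
  set y := arcLeft τ
  have h1 : 0 ≤ x - y := by linarith [hx.1]
  have h2 : x - y ≤ arcLen τ := by linarith [hx.2]
  have h3 : |(x - y) * A| * arcLen τ ≤ μ := by rw [abs_mul, abs_of_nonneg h1]; nlinarith
  refine ⟨by linarith, ?_, ?_⟩
  · have e : B - y * A = (B - x * A) + (x - y) * A := by ring
    have := abs_add_le (B - x * A) ((x - y) * A)
    rw [e]; nlinarith
  · have e : C - 2 * y * B + y ^ 2 * A =
      (C - 2 * x * B + x ^ 2 * A) + ((x - y) * (2 * (B - x * A)) + (x - y) * ((x - y) * A)) := by ring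
    have t1 := abs_add_le (C - 2 * x * B + x ^ 2 * A)
      ((x - y) * (2 * (B - x * A)) + (x - y) * ((x - y) * A))
    have t2 := abs_add_le ((x - y) * (2 * (B - x * A))) ((x - y) * ((x - y) * A))
    have t3 : |(x - y) * (2 * (B - x * A))| ≤ 2 * ν := by
      rw [abs_mul, abs_mul, abs_of_nonneg h1, abs_two]
      nlinarith [mul_le_mul_of_nonneg_right h2 (abs_nonneg (B - x * A))]
    have t4 : |(x - y) * ((x - y) * A)| ≤ μ := by
      rw [abs_mul, abs_of_nonneg h1]
      nlinarith [mul_le_mul_of_nonneg_right h2 (abs_nonneg ((x - y) * A))]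
    rw [e]; linarith

/-- A one-sided piece of a quadratic sublevel set fits into one arc whose plank contains the
polynomial. -/
theorem one_sided_arc {τ : ℕ × ℕ} {n : ℕ} {σ A B C : ℝ} (hσ : σ = 1 / 2 ^ n) {P : Set ℝ}
    (hP : P ⊆ arc τ) (hne : P.Nonempty) (hA : |A| ≤ 1)
    (hD : ∀ x ∈ arc τ, |B - x * A| ≤ σ / 2 ^ 13)
    (hQ : ∀ x ∈ P, |C - 2 * x * B + x ^ 2 * A| ≤ σ ^ 2 / 2 ^ 22)
    (hside : ∀ x ∈ P, ∀ y ∈ P, 0 ≤ (B - x * A) * (B - y * A)) :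
    ∃ τ', τ'.1 ≤ max τ.1 (n + 10) ∧ SubArc τ' τ ∧ P ⊆ arc τ' ∧ InPlank τ' (σ ^ 2) A B C ∧
      arcLen τ' ^ 2 * |A| ≤ σ ^ 2 / 2 ^ 13 := by
  have pair : ∀ x ∈ P, ∀ y ∈ P, |x - y| * |B - x * A| ≤ σ ^ 2 / 2 ^ 21 ∧
      |x - y| ^ 2 * |A| ≤ σ ^ 2 / 2 ^ 21 := by
    intro x hx y hy
    have e : (C - 2 * x * B + x ^ 2 * A) - (C - 2 * y * B + y ^ 2 * A) =
        -((x - y) * ((B - x * A) + (B - y * A))) := by ring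
    have h1 : |x - y| * |(B - x * A) + (B - y * A)| ≤ σ ^ 2 / 2 ^ 21 := by
      rw [← abs_mul, ← abs_neg, ← e]; grind
    have hs := hside x hx y hy
    have h4 : |(B - x * A) + (B - y * A)| = |B - x * A| + |B - y * A| := by
      apply abs_add_eq_add_abs_iff _ _ |>.2
      rcases mul_nonneg_iff.1 hs with h | h
      · exact Or.inl h
      · exact Or.inr h
    rw [h4] at h1
    have h5 : |x - y| * |A| ≤ |B - x * A| + |B - y * A| := by
      have := abs_sub (B - y * A) (B - x * A)
      rw [← abs_mul]; grind
    constructor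
    · nlinarith [mul_nonneg (abs_nonneg (x - y)) (abs_nonneg (B - y * A))]
    · nlinarith [mul_le_mul_of_nonneg_left h5 (abs_nonneg (x - y))]
  obtain ⟨τ', h1, h2, h3, h4⟩ := exists_subArc_cover hP hne (n + 10)
  have hq : (1 : ℝ) / 2 ^ (n + 10) = σ / 2 ^ 10 := by rw [hσ, pow_add]; field_simp
  rw [hq] at h4
  have hp := arcLen_pos τ'
  obtain ⟨x, hx⟩ := hne
  have hμ : arcLen τ' ^ 2 * |A| ≤ σ ^ 2 / 2 ^ 13 := by
    rcases h4 with h | ⟨y, hy, z, hz, h⟩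
    · nlinarith
    · have : arcLen τ' ^ 2 ≤ (4 * |y - z|) ^ 2 := pow_le_pow_left₀ hp.le h 2
      have h6 := (pair y hy z hz).2
      nlinarith [abs_nonneg A, sq_nonneg σ]
  have hν : arcLen τ' * |B - x * A| ≤ σ ^ 2 / 2 ^ 13 := by
    rcases h4 with h | ⟨y, hy, z, hz, h⟩
    · have h7 := hD x (hP hx)
      nlinarith
    · have h5 := (pair x hx y hy).1
      have h6 := (pair x hx z hz).1
      have h7 : |y - z| ≤ |x - y| + |x - z| := by
        have := abs_sub (x - z) (x - y)
        grind
      nlinarith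
  refine ⟨τ', h1, h2, h3, inPlank_of_point (h3 hx) (hQ x hx) hμ hν ?_, hμ⟩
  nlinarith

/-- A small piece of a quadratic sublevel set splits into at most two well separated arcs, each
of whose planks contains the polynomial. -/
theorem sublevel_arcs {τ : ℕ × ℕ} {n : ℕ} {σ A B C : ℝ} (hσ : σ = 1 / 2 ^ n) {P : Set ℝ}
    (hP : P ⊆ arc τ) (hne : P.Nonempty) (hA : |A| ≤ 1)
    (hD : ∀ x ∈ arc τ, |B - x * A| ≤ σ / 2 ^ 13)
    (hQ : ∀ x ∈ P, |C - 2 * x * B + x ^ 2 * A| ≤ σ ^ 2 / 2 ^ 22) :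
    (∃ τ', τ'.1 ≤ max τ.1 (n + 10) ∧ SubArc τ' τ ∧ P ⊆ arc τ' ∧ InPlank τ' (σ ^ 2) A B C) ∨
    ∃ τ₁ τ₂, (τ₁.1 ≤ max τ.1 (n + 10) ∧ SubArc τ₁ τ ∧ InPlank τ₁ (σ ^ 2) A B C) ∧
      (τ₂.1 ≤ max τ.1 (n + 10) ∧ SubArc τ₂ τ ∧ InPlank τ₂ (σ ^ 2) A B C) ∧
      Disjoint (arc τ₁) (arc τ₂) ∧ P ⊆ arc τ₁ ∪ arc τ₂ ∧
      ∀ x ∈ P, ∀ y ∈ P, x ∈ arc τ₁ → y ∈ arc τ₂ → σ / 2 ^ 10 < |x - y| := by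
  have hσ0 : 0 < σ := by simp_all
  set P₁ := {x ∈ P | 0 ≤ B - x * A}
  set P₂ := {x ∈ P | B - x * A < 0}
  have hPu : ∀ x ∈ P, x ∈ P₁ ∨ x ∈ P₂ := fun x hx => by grind
  have side₁ : P₁.Nonempty → _ := fun h => one_sided_arc hσ (P := P₁) (fun x hx => hP hx.1) h hA hD
    (fun x hx => hQ x hx.1) (fun x hx y hy => mul_nonneg hx.2 hy.2)
  have side₂ : P₂.Nonempty → _ := fun h => one_sided_arc hσ (P := P₂) (fun x hx => hP hx.1) h hA hD
    (fun x hx => hQ x hx.1) (fun x hx y hy => mul_nonneg_of_nonpos_of_nonpos hx.2.le hy.2.le)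
  rcases P₂.eq_empty_or_nonempty with he | hne₂
  · have hPP : P ⊆ P₁ := fun x hx => (hPu x hx).resolve_right (by rw [he]; exact fun h => h)
    obtain ⟨τ', h1, h2, h3, h4, _⟩ := side₁ (hne.mono hPP)
    grind
  rcases P₁.eq_empty_or_nonempty with he | hne₁
  · grind
  obtain ⟨τ₁, a1, a2, a3, a4, a5⟩ := side₁ hne₁
  obtain ⟨τ₂, b1, b2, b3, b4, b5⟩ := side₂ hne₂
  by_cases hsep : Disjoint (arc τ₁) (arc τ₂) ∧ ∀ x ∈ P, ∀ y ∈ P, x ∈ arc τ₁ → y ∈ arc τ₂ →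
      σ / 2 ^ 10 < |x - y|
  · grind
  left
  have hclose : ∃ u ∈ arc τ₁, ∃ v ∈ arc τ₂, |u - v| ≤ σ / 2 ^ 10 := by
    by_contra hcon
    push Not at hcon
    apply hsep
    refine ⟨Set.disjoint_left.2 fun z hz hz' => ?_, fun x _ y _ hx' hy' => hcon x hx' y hy'⟩
    grind
  obtain ⟨u, hu, v, hv, huv⟩ := hclose
  set S := arcLen τ₁ + arcLen τ₂ + σ / 2 ^ 10 with hS
  have hp1 := arcLen_pos τ₁
  have hp2 := arcLen_pos τ₂
  have hdist : ∀ (κ : ℕ × ℕ) {x y : ℝ}, x ∈ arc κ → y ∈ arc κ → |x - y| ≤ arcLen κ := by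
    intro κ x y hx hy; rw [abs_le]; constructor <;> linarith [hx.1, hx.2, hy.1, hy.2]
  have hcross : ∀ x ∈ arc τ₁, ∀ y ∈ arc τ₂, |x - y| ≤ S := by
    intro x hx y hy
    have := abs_add_le (x - u) ((u - v) + (v - y))
    have h2 := abs_add_le (u - v) (v - y)
    grind
  have hPS : ∀ x ∈ P, ∀ y ∈ P, |x - y| ≤ S := by
    intro x hx y hy
    rcases hPu x hx with h | h <;> rcases hPu y hy with h' | h'
    · grind
    · grind
    · rw [abs_sub_comm]; exact hcross y (a3 h') x (b3 h)
    · grind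
  have hSA : S ^ 2 * |A| ≤ σ ^ 2 / 2 ^ 10 := by
    have h1 : S ^ 2 ≤ 3 * (arcLen τ₁ ^ 2 + arcLen τ₂ ^ 2 + (σ / 2 ^ 10) ^ 2) := by
      rw [hS]; nlinarith [sq_nonneg (arcLen τ₁ - arcLen τ₂), sq_nonneg (arcLen τ₁ - σ / 2 ^ 10),
        sq_nonneg (arcLen τ₂ - σ / 2 ^ 10)]
    have h2 := mul_le_mul_of_nonneg_right h1 (abs_nonneg A)
    have h3 : (σ / 2 ^ 10) ^ 2 * |A| ≤ (σ / 2 ^ 10) ^ 2 := by bound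
    nlinarith [sq_nonneg σ]
  obtain ⟨τ', h1, h2, h3, h4⟩ := exists_subArc_cover hP hne (n + 10)
  have hq : (1 : ℝ) / 2 ^ (n + 10) = σ / 2 ^ 10 := by rw [hσ, pow_add]; field_simp
  rw [hq] at h4
  have hp := arcLen_pos τ'
  have hs' : arcLen τ' ≤ 4 * S := by
    rcases h4 with h | ⟨y, hy, z, hz, h⟩
    · linarith
    · grind
  obtain ⟨x, hx⟩ := hne₁
  obtain ⟨y, hy⟩ := hne₂
  have hμ : arcLen τ' ^ 2 * |A| ≤ σ ^ 2 / 2 ^ 6 := by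
    have : arcLen τ' ^ 2 ≤ (4 * S) ^ 2 := pow_le_pow_left₀ hp.le hs' 2
    nlinarith [abs_nonneg A, mul_le_mul_of_nonneg_right this (abs_nonneg A)]
  have hν : arcLen τ' * |B - x * A| ≤ σ ^ 2 / 2 ^ 8 := by
    have h5 : |B - x * A| ≤ S * |A| := by
      rw [abs_of_nonneg hx.2]
      have h6 := hPS x hx.1 y hy.1
      have h7 : (B - x * A) - (B - y * A) ≤ |x - y| * |A| := by
        rw [← abs_mul]
        have e : (B - x * A) - (B - y * A) = -((x - y) * A) := by ring
        rw [e, ← abs_neg]; exact le_abs_self _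
      have := mul_le_mul_of_nonneg_right h6 (abs_nonneg A)
      linarith [hy.2]
    have h8 : arcLen τ' * |B - x * A| ≤ 4 * S * (S * |A|) :=
      mul_le_mul hs' h5 (abs_nonneg _) (by positivity)
    nlinarith
  refine ⟨τ', h1, h2, h3, inPlank_of_point (h3 hx.1) (hQ x hx.1) hμ hν ?_⟩
  nlinarith [sq_nonneg σ]

theorem near_pair_bounds {σ δ₀ A B C x y p h : ℝ} (hσ0 : 0 < σ) (hσ1 : σ ≤ 1)
    (hδ₀ : δ₀ ≤ σ ^ 2 / 2 ^ 28) (hh : 1 / 4 ≤ h) (hy0 : 0 ≤ y) (hy1 : y ≤ 1)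
    (Dx : |B - x * A| ≤ σ / 2 ^ 13) (Dy : |B - y * A| ≤ σ / 2 ^ 13) (hp : |p| ≤ 2 * δ₀)
    (hq : |C - (x + y) * B + x * y * A| ≤ 4 * δ₀) (hd : h * (x - y) = B - y * (A - p)) :
    |x - y| ≤ σ / 2 ^ 10 ∧ |C - 2 * x * B + x ^ 2 * A| ≤ σ ^ 2 / 2 ^ 22 ∧
      |C - 2 * y * B + y ^ 2 * A| ≤ σ ^ 2 / 2 ^ 22 := by
  have hxy : |x - y| ≤ 5 * (σ / 2 ^ 13) := by
    have t1 : h * |x - y| ≤ |B - y * A| + |p| := by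
      rw [← abs_of_pos (by linarith : 0 < h), ← abs_mul, hd]
      have e : B - y * (A - p) = (B - y * A) + y * p := by ring
      rw [e]
      refine (abs_add_le _ _).trans ?_
      rw [abs_mul, abs_of_nonneg hy0]; nlinarith [abs_nonneg p]
    nlinarith
  have key : ∀ z, |B - z * A| ≤ σ / 2 ^ 13 →
      |x - y| * |B - z * A| ≤ σ ^ 2 * (5 / 2 ^ 26) := by
    intro z hz
    refine (mul_le_mul hxy hz (abs_nonneg _) (by positivity)).trans (le_of_eq (by ring))
  have h5 : 4 * δ₀ + σ ^ 2 * (5 / 2 ^ 26) ≤ σ ^ 2 / 2 ^ 22 := by grind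
  refine ⟨by linarith, ?_, ?_⟩
  · have e : C - 2 * x * B + x ^ 2 * A = (C - (x + y) * B + x * y * A) - (x - y) * (B - x * A) := by
      ring
    rw [e]
    refine (abs_sub _ _).trans ?_
    grind
  · have e : C - 2 * y * B + y ^ 2 * A = (C - (x + y) * B + x * y * A) + (x - y) * (B - y * A) := by
      ring
    rw [e]
    refine (abs_add_le _ _).trans ?_
    grind

section Cone

variable {V : Type*} [NormedAddCommGroup V] [NormedSpace ℝ V] [FiniteDimensional ℝ V]
  [MeasureSpace V] [BorelSpace V] [(volume : Measure V).IsAddHaarMeasure]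

/-- The restriction of `F` to frequencies whose angular parameter lies in the arc `τ`. -/
def cut (θ : V → ℝ) (F : V → ℂ) (τ : ℕ × ℕ) : V → ℂ := {ζ | θ ζ ∈ arc τ}.indicator F

theorem Nice.cut {θ : V → ℝ} (hθ : Measurable θ) {F : V → ℂ} (hF : Nice F) (τ : ℕ × ℕ) :
    Nice (cut θ F τ) := hF.indicator (hθ measurableSet_Ico)

theorem cut_of_mem {θ : V → ℝ} {F : V → ℂ} {τ : ℕ × ℕ} {ζ : V} (h : θ ζ ∈ arc τ) :
    cut θ F τ ζ = F ζ := indicator_of_mem (s := {ζ | θ ζ ∈ arc τ}) h F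

theorem cut_of_notMem {θ : V → ℝ} {F : V → ℂ} {τ : ℕ × ℕ} {ζ : V} (h : θ ζ ∉ arc τ) :
    cut θ F τ ζ = 0 := indicator_of_notMem (s := {ζ | θ ζ ∈ arc τ}) h F

theorem cut_ne_zero {θ : V → ℝ} {F : V → ℂ} {τ : ℕ × ℕ} {ζ : V} (h : cut θ F τ ζ ≠ 0) :
    θ ζ ∈ arc τ ∧ F ζ ≠ 0 := by
  by_cases hm : θ ζ ∈ arc τ
  · rw [cut_of_mem hm] at h; exact ⟨hm, h⟩
  · exact absurd (cut_of_notMem hm) h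

/-- Null coordinates `(a, b, c)` together with an angular parameter `θ`, a height `h` and a
defect `e`; the cone is `(a, b, c) = h (1, θ, θ²)`. -/
structure ConeData (V : Type*) [NormedAddCommGroup V] [NormedSpace ℝ V] [MeasurableSpace V] where
  a : V →L[ℝ] ℝ
  b : V →L[ℝ] ℝ
  c : V →L[ℝ] ℝ
  θ : V → ℝ
  h : V → ℝ
  e : V → ℝ
  meas : Measurable θ

/-- `F` is supported in the `δ₀`-neighbourhood of the cone. -/
structure ConeData.Supports (S : ConeData V) (δ₀ : ℝ) (F : V → ℂ) : Prop where
  nice : Nice F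
  a_eq : ∀ ζ, F ζ ≠ 0 → S.a ζ = S.h ζ + S.e ζ
  b_eq : ∀ ζ, F ζ ≠ 0 → S.b ζ = S.h ζ * S.θ ζ
  c_eq : ∀ ζ, F ζ ≠ 0 → S.c ζ = S.h ζ * S.θ ζ ^ 2 + S.e ζ
  e_le : ∀ ζ, F ζ ≠ 0 → |S.e ζ| ≤ δ₀
  h_ge : ∀ ζ, F ζ ≠ 0 → 1 / 4 ≤ S.h ζ
  h_le : ∀ ζ, F ζ ≠ 0 → S.h ζ ≤ 2
  θ_nonneg : ∀ ζ, F ζ ≠ 0 → 0 ≤ S.θ ζ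
  θ_le : ∀ ζ, F ζ ≠ 0 → S.θ ζ ≤ 1

/-- The dual plank of an arc as a set of frequencies. -/
def ConeData.plank (S : ConeData V) (τ : ℕ × ℕ) (δ : ℝ) : Set V :=
  {ω | InPlank τ δ (S.a ω) (S.b ω) (S.c ω)}

theorem ConeData.measurableSet_plank (S : ConeData V) (τ : ℕ × ℕ) (δ : ℝ) :
    MeasurableSet (S.plank τ δ) := by
  have hb := S.b.continuous
  have hc := S.c.continuous
  have e : S.plank τ δ = {ω | arcLen τ ^ 2 * |S.a ω| ≤ δ} ∩
      ({ω | arcLen τ * |S.b ω - arcLeft τ * S.a ω| ≤ δ} ∩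
        {ω | |S.c ω - 2 * arcLeft τ * S.b ω + arcLeft τ ^ 2 * S.a ω| ≤ δ}) := rfl
  rw [e]
  exact ((isClosed_le (by fun_prop) continuous_const).inter
    ((isClosed_le (by fun_prop) continuous_const).inter
      (isClosed_le (by fun_prop) continuous_const))).measurableSet

/-- The energy of the autocorrelation of an angular piece on its dual plank at scale `4^{-n}`. -/
def ConeData.energy (S : ConeData V) (F : V → ℂ) (τ : ℕ × ℕ) (n : ℕ) : ℝ :=
  ∫ ω in S.plank τ (1 / 4 ^ n), ‖acor (cut S.θ F τ) (cut S.θ F τ) ω‖ ^ 2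

theorem ConeData.energy_nonneg (S : ConeData V) (F : V → ℂ) (τ : ℕ × ℕ) (n : ℕ) :
    0 ≤ S.energy F τ n := integral_nonneg fun _ => by positivity

theorem ConeData.energy_eq (S : ConeData V) (F : V → ℂ) (τ : ℕ × ℕ) (n : ℕ) :
    S.energy F τ n = ∫ ω, (S.plank τ (1 / 4 ^ n)).indicator
      (fun ω => ‖acor (cut S.θ F τ) (cut S.θ F τ) ω‖ ^ 2) ω :=
  (integral_indicator (S.measurableSet_plank _ _)).symm

variable {S : ConeData V} {δ₀ : ℝ} {F : V → ℂ}

theorem ConeData.energy_le_quartic (hF : Nice F) (τ : ℕ × ℕ) (n : ℕ) :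
    S.energy F τ n ≤ quartic (cut S.θ F τ) :=
  setIntegral_le_integral ((hF.cut S.meas τ).acor (hF.cut S.meas τ)).integrable_sq
    (.of_forall fun _ => by positivity)

/-- Algebra of differences of two points near the cone. -/
theorem ConeData.Supports.diff (hF : S.Supports δ₀ F) {ζ ω : V} (h1 : F ζ ≠ 0)
    (h2 : F (ζ - ω) ≠ 0) :
    (S.e ζ - S.e (ζ - ω)) * (1 + S.θ ζ * S.θ (ζ - ω)) =
        S.c ω - (S.θ ζ + S.θ (ζ - ω)) * S.b ω + S.θ ζ * S.θ (ζ - ω) * S.a ω ∧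
      S.h ζ * (S.θ ζ - S.θ (ζ - ω)) =
        S.b ω - S.θ (ζ - ω) * (S.a ω - (S.e ζ - S.e (ζ - ω))) := by
  have a1 := hF.a_eq ζ h1
  have a2 := hF.a_eq _ h2
  have b1 := hF.b_eq ζ h1
  have b2 := hF.b_eq _ h2
  have c1 := hF.c_eq ζ h1
  have c2 := hF.c_eq _ h2
  grind

theorem ConeData.Supports.quad_le (hF : S.Supports δ₀ F) {ζ ω : V} (h1 : F ζ ≠ 0)
    (h2 : F (ζ - ω) ≠ 0) :
    |S.c ω - (S.θ ζ + S.θ (ζ - ω)) * S.b ω + S.θ ζ * S.θ (ζ - ω) * S.a ω| ≤ 4 * δ₀ ∧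
      |S.e ζ - S.e (ζ - ω)| ≤ 2 * δ₀ := by
  have hp : |S.e ζ - S.e (ζ - ω)| ≤ 2 * δ₀ := by
    have := abs_sub (S.e ζ) (S.e (ζ - ω))
    linarith [hF.e_le ζ h1, hF.e_le _ h2]
  refine ⟨?_, hp⟩
  rw [← (hF.diff h1 h2).1, abs_mul]
  have hxy : |1 + S.θ ζ * S.θ (ζ - ω)| ≤ 2 := by
    have := hF.θ_nonneg ζ h1
    have := hF.θ_le ζ h1
    have := hF.θ_nonneg _ h2
    have := hF.θ_le _ h2
    rw [abs_of_nonneg (by positivity)]; nlinarith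
  nlinarith [abs_nonneg (S.e ζ - S.e (ζ - ω)), abs_nonneg (1 + S.θ ζ * S.θ (ζ - ω))]

theorem acor_cut_of_subset {θ : V → ℝ} {F : V → ℂ} {τ τ' : ℕ × ℕ} (hsub : SubArc τ' τ) (ω : V)
    (h : ∀ ζ, cut θ F τ ζ ≠ 0 → cut θ F τ (ζ - ω) ≠ 0 → θ ζ ∈ arc τ' ∧ θ (ζ - ω) ∈ arc τ') :
    acor (cut θ F τ) (cut θ F τ) ω = acor (cut θ F τ') (cut θ F τ') ω := by
  unfold acor; congr 1
  funext ζ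
  have hle : ∀ ξ, cut θ F τ ξ = 0 → cut θ F τ' ξ = 0 := by
    intro ξ h0
    by_contra hc
    obtain ⟨h1, h2⟩ := cut_ne_zero hc
    rw [cut_of_mem (hsub.subset h1)] at h0; exact h2 h0
  by_cases h1 : cut θ F τ ζ = 0
  · grind
  by_cases h2 : cut θ F τ (ζ - ω) = 0
  · grind
  obtain ⟨h3, h4⟩ := h ζ h1 h2
  rw [cut_of_mem h3, cut_of_mem h4, cut_of_mem (hsub.subset h3), cut_of_mem (hsub.subset h4)]

theorem acor_cut_of_disjoint {θ : V → ℝ} (hθ : Measurable θ) {F : V → ℂ} (hF : Nice F)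
    {τ τ₁ τ₂ : ℕ × ℕ} (hsub₁ : SubArc τ₁ τ) (hsub₂ : SubArc τ₂ τ)
    (hd : Disjoint (arc τ₁) (arc τ₂)) (ω : V)
    (h : ∀ ζ, cut θ F τ ζ ≠ 0 → cut θ F τ (ζ - ω) ≠ 0 →
      (θ ζ ∈ arc τ₁ ∧ θ (ζ - ω) ∈ arc τ₁) ∨ (θ ζ ∈ arc τ₂ ∧ θ (ζ - ω) ∈ arc τ₂)) :
    acor (cut θ F τ) (cut θ F τ) ω =
      acor (cut θ F τ₁) (cut θ F τ₁) ω + acor (cut θ F τ₂) (cut θ F τ₂) ω := by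
  have hInt : ∀ τ', Integrable fun ζ => cut θ F τ' ζ * (starRingEnd ℂ) (cut θ F τ' (ζ - ω)) := by
    intro τ'
    have hc := hF.cut hθ τ'
    obtain ⟨M, hM0, hM⟩ := hc.bdd
    refine (hc.mul_bdd (g := fun ζ => (starRingEnd ℂ) (cut θ F τ' (ζ - ω))) ?_
      ⟨M, fun x => by simpa using hM _⟩).integrable
    exact RCLike.continuous_conj.measurable.comp (hc.meas.comp (measurable_id.sub_const ω))
  unfold acor; rw [← integral_add (hInt τ₁) (hInt τ₂)]; congr 1
  funext ζ
  have hle : ∀ {τ'}, SubArc τ' τ → ∀ ξ, cut θ F τ ξ = 0 → cut θ F τ' ξ = 0 := by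
    intro τ' hsub ξ h0
    by_contra hc
    obtain ⟨h1, h2⟩ := cut_ne_zero hc
    rw [cut_of_mem (hsub.subset h1)] at h0; exact h2 h0
  by_cases h1 : cut θ F τ ζ = 0
  · grind
  by_cases h2 : cut θ F τ (ζ - ω) = 0
  · grind
  rcases h ζ h1 h2 with ⟨h3, h4⟩ | ⟨h3, h4⟩
  · rw [cut_of_mem h3, cut_of_mem h4, cut_of_mem (hsub₁.subset h3), cut_of_mem (hsub₁.subset h4),
      cut_of_notMem (τ := τ₂) (Set.disjoint_left.1 hd h3)]
    simp
  · rw [cut_of_mem h3, cut_of_mem h4, cut_of_mem (hsub₂.subset h3), cut_of_mem (hsub₂.subset h4),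
      cut_of_notMem (τ := τ₁) (Set.disjoint_right.1 hd h3)]
    simp

/-- Pointwise Kakeya-type bound: on a small plank the autocorrelation of an angular piece is
controlled by those of its sub-arcs on their own planks. -/
theorem ConeData.Supports.kakeya_pointwise (hF : S.Supports δ₀ F) {τ : ℕ × ℕ} {n₁ n₂ : ℕ}
    (h1 : τ.1 ≤ n₁) (h12 : τ.1 ≤ n₂) (hn : n₂ + τ.1 + 14 ≤ 2 * n₁) (hδ : δ₀ ≤ 1 / 4 ^ (n₂ + 14)) {ω : V}
    (hω : ω ∈ S.plank τ (1 / 4 ^ n₁)) :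
    ‖acor (cut S.θ F τ) (cut S.θ F τ) ω‖ ^ 2 ≤ 2 * ∑ τ' ∈ subArcs τ (n₂ + 10),
      (S.plank τ' (1 / 4 ^ n₂)).indicator
        (fun ω => ‖acor (cut S.θ F τ') (cut S.θ F τ') ω‖ ^ 2) ω := by
  set σ : ℝ := 1 / 2 ^ n₂ with hσ
  have hσ0 : 0 < σ := by positivity
  have hσ1 : σ ≤ 1 := by bound
  have hσ2 : (1 : ℝ) / 4 ^ n₂ = σ ^ 2 := by
    rw [hσ, div_pow, one_pow, ← pow_mul, mul_comm, pow_mul]; norm_num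
  set s := arcLen τ
  have hs0 : 0 < s := arcLen_pos τ
  set δ₁ : ℝ := 1 / 4 ^ n₁ with hδ₁
  have hs_def : s = 1 / 2 ^ τ.1 := rfl
  have e4 : ∀ n : ℕ, (4 : ℝ) ^ n = 2 ^ (2 * n) := fun n => by rw [pow_mul]; norm_num
  have hδs2 : δ₁ ≤ s ^ 2 := by
    rw [hδ₁, hs_def, div_pow, one_pow, ← pow_mul, e4]
    exact one_div_le_one_div_of_le (by positivity) (pow_le_pow_right₀ (by norm_num) (by omega))
  have hδs : δ₁ ≤ σ / 2 ^ 14 * s := by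
    rw [hδ₁, hs_def, hσ, e4, div_div, div_mul_div_comm, one_mul, ← pow_add, ← pow_add]
    bound
  have hδ₀ : δ₀ ≤ σ ^ 2 / 2 ^ 28 := by
    refine hδ.trans (le_of_eq ?_)
    grind
  obtain ⟨p1, p2, p3⟩ := hω
  set A := S.a ω
  set B := S.b ω
  set C := S.c ω
  have hA1 : |A| ≤ 1 := by
    by_contra hc
    push Not at hc; nlinarith [sq_nonneg s, pow_pos hs0 2]
  have hD : ∀ x ∈ arc τ, |B - x * A| ≤ σ / 2 ^ 13 := by
    intro x hx
    have e : B - x * A = (B - arcLeft τ * A) + (arcLeft τ - x) * A := by ring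
    have t := abs_add_le (B - arcLeft τ * A) ((arcLeft τ - x) * A)
    rw [← e, abs_mul] at t
    have h3 : |arcLeft τ - x| ≤ s := by rw [abs_le]; constructor <;> linarith [hx.1, hx.2]
    have h4 : s * |B - x * A| ≤ s * (σ / 2 ^ 13) := by
      have h5 : s * (|arcLeft τ - x| * |A|) ≤ s * (s * |A|) :=
        mul_le_mul_of_nonneg_left (mul_le_mul_of_nonneg_right h3 (abs_nonneg A)) hs0.le
      have h6 := mul_le_mul_of_nonneg_left t hs0.le
      nlinarith
    simp_all
  -- participating angles
  have pairs : ∀ ζ, cut S.θ F τ ζ ≠ 0 → cut S.θ F τ (ζ - ω) ≠ 0 →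
      |S.θ ζ - S.θ (ζ - ω)| ≤ σ / 2 ^ 10 ∧
      |C - 2 * S.θ ζ * B + S.θ ζ ^ 2 * A| ≤ σ ^ 2 / 2 ^ 22 ∧
      |C - 2 * S.θ (ζ - ω) * B + S.θ (ζ - ω) ^ 2 * A| ≤ σ ^ 2 / 2 ^ 22 := by
    intro ζ hz1 hz2
    obtain ⟨m1, f1⟩ := cut_ne_zero hz1
    obtain ⟨m2, f2⟩ := cut_ne_zero hz2
    obtain ⟨_, d2⟩ := hF.diff f1 f2
    obtain ⟨q1, q2⟩ := hF.quad_le f1 f2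
    exact near_pair_bounds hσ0 hσ1 hδ₀ (hF.h_ge ζ f1) (hF.θ_nonneg _ f2) (hF.θ_le _ f2)
      (hD _ m1) (hD _ m2) q2 q1 d2
  set P : Set ℝ := {x | ∃ ζ, cut S.θ F τ ζ ≠ 0 ∧ cut S.θ F τ (ζ - ω) ≠ 0 ∧
    (x = S.θ ζ ∨ x = S.θ (ζ - ω))}
  have hPτ : P ⊆ arc τ := by
    rintro x ⟨ζ, z1, z2, rfl | rfl⟩
    · exact (cut_ne_zero z1).1
    · exact (cut_ne_zero z2).1
  have hPQ : ∀ x ∈ P, |C - 2 * x * B + x ^ 2 * A| ≤ σ ^ 2 / 2 ^ 22 := by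
    rintro x ⟨ζ, z1, z2, rfl | rfl⟩
    · grind
    · grind
  have hmem : ∀ ζ, cut S.θ F τ ζ ≠ 0 → cut S.θ F τ (ζ - ω) ≠ 0 → S.θ ζ ∈ P ∧ S.θ (ζ - ω) ∈ P :=
    fun ζ z1 z2 => ⟨⟨ζ, z1, z2, Or.inl rfl⟩, ⟨ζ, z1, z2, Or.inr rfl⟩⟩
  set f : ℕ × ℕ → ℝ := fun τ' => (S.plank τ' (1 / 4 ^ n₂)).indicator
        (fun ω => ‖acor (cut S.θ F τ') (cut S.θ F τ') ω‖ ^ 2) ω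
  have hf0 : ∀ τ', 0 ≤ f τ' := fun τ' => indicator_nonneg (fun _ _ => by positivity) _
  have hin : ∀ τ', InPlank τ' (σ ^ 2) A B C →
      f τ' = ‖acor (cut S.θ F τ') (cut S.θ F τ') ω‖ ^ 2 := by
    intro τ' h
    apply indicator_of_mem; rw [hσ2]; exact h
  have hmax : max τ.1 (n₂ + 10) = n₂ + 10 := max_eq_right (by omega)
  rcases P.eq_empty_or_nonempty with he | hne
  · have : acor (cut S.θ F τ) (cut S.θ F τ) ω = 0 := by
      unfold acor; rw [← integral_zero V ℂ]; congr 1; funext ζ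
      by_contra hc
      have := (hmem ζ (left_ne_zero_of_mul hc) (by
        have := right_ne_zero_of_mul hc; simpa using this)).1
      grind
    rw [this]; simp only [norm_zero]
    have := sum_nonneg (s := subArcs τ (n₂ + 10)) fun τ' _ => hf0 τ'
    nlinarith
  rcases sublevel_arcs hσ hPτ hne hA1 hD hPQ with ⟨τ', t1, t2, t3, t4⟩ |
    ⟨τ₁, τ₂, ⟨t1, t2, t3⟩, ⟨u1, u2, u3⟩, hd, hcov, hfar⟩
  · rw [acor_cut_of_subset t2 ω fun ζ z1 z2 => ⟨t3 (hmem ζ z1 z2).1, t3 (hmem ζ z1 z2).2⟩, ← hin τ' t4]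
    have := Finset.single_le_sum (f := f) (fun i _ => hf0 i)
      (mem_subArcs.2 ⟨t1.trans hmax.le, t2⟩)
    grind
  · have hne12 : τ₁ ≠ τ₂ := by
      rintro rfl; rw [disjoint_self] at hd
      have : arcLeft τ₁ ∈ arc τ₁ := ⟨le_rfl, by linarith [arcLen_pos τ₁]⟩
      rw [hd] at this; exact this
    rw [acor_cut_of_disjoint S.meas hF.nice t2 u2 hd ω]
    · have hsum : f τ₁ + f τ₂ ≤ ∑ τ' ∈ subArcs τ (n₂ + 10), f τ' := by
        rw [← Finset.sum_pair hne12]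
        refine Finset.sum_le_sum_of_subset_of_nonneg ?_ fun i _ _ => hf0 i
        intro i hi; rw [Finset.mem_insert, Finset.mem_singleton] at hi
        rcases hi with rfl | rfl
        · exact mem_subArcs.2 ⟨t1.trans hmax.le, t2⟩
        · exact mem_subArcs.2 ⟨u1.trans hmax.le, u2⟩
      rw [hin τ₁ t3, hin τ₂ u3] at hsum
      set X := acor (cut S.θ F τ₁) (cut S.θ F τ₁) ω
      set Y := acor (cut S.θ F τ₂) (cut S.θ F τ₂) ω
      have := norm_add_le X Y
      nlinarith [norm_nonneg (X + Y), norm_nonneg X, norm_nonneg Y, sq_nonneg (‖X‖ - ‖Y‖)]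
    · intro ζ z1 z2
      obtain ⟨hx, hy⟩ := hmem ζ z1 z2
      have hclose := (pairs ζ z1 z2).1
      rcases hcov hx with h | h <;> rcases hcov hy with h' | h'
      · grind
      · grind
      · have := hfar _ hy _ hx h' h
        grind
      · grind

theorem ConeData.Supports.kakeya (hF : S.Supports δ₀ F) {τ : ℕ × ℕ} {n₁ n₂ : ℕ}
    (h1 : τ.1 ≤ n₁) (h12 : τ.1 ≤ n₂) (hn : n₂ + τ.1 + 14 ≤ 2 * n₁) (hδ : δ₀ ≤ 1 / 4 ^ (n₂ + 14)) :
    S.energy F τ n₁ ≤ 2 * ∑ τ' ∈ subArcs τ (n₂ + 10), S.energy F τ' n₂ := by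
  have hInt : ∀ τ' n, Integrable ((S.plank τ' (1 / 4 ^ n)).indicator
        (fun ω => ‖acor (cut S.θ F τ') (cut S.θ F τ') ω‖ ^ 2)) := fun τ' n =>
    ((hF.nice.cut S.meas τ').acor (hF.nice.cut S.meas τ')).integrable_sq.indicator
      (S.measurableSet_plank _ _)
  simp_rw [S.energy_eq]; rw [← integral_finsetSum _ fun τ' _ => hInt τ' n₂, ← integral_const_mul]
  refine integral_mono (hInt τ n₁) ((integrable_finsetSum _ fun τ' _ => hInt τ' n₂).const_mul 2) ?_
  intro ω
  by_cases hω : ω ∈ S.plank τ (1 / 4 ^ n₁)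
  · rw [indicator_of_mem hω]; exact hF.kakeya_pointwise h1 h12 hn hδ hω
  · rw [indicator_of_notMem hω]
    exact mul_nonneg (by norm_num) (sum_nonneg fun τ' _ =>
      indicator_nonneg (fun _ _ => by positivity) _)

/-! ### Whitney decomposition of a self-convolution -/

/-- Equal or adjacent indices. -/
def Near (i j : ℕ) : Prop := i ≤ j + 1 ∧ j ≤ i + 1

/-- Non-adjacent indices with adjacent parents. -/
def Whit (i j : ℕ) : Prop := ¬ Near i j ∧ Near (i / 2) (j / 2)

instance : DecidableRel Near := fun _ _ => by unfold Near; infer_instance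
instance : DecidableRel Whit := fun _ _ => by unfold Whit; infer_instance

/-- The sum of the convolutions of the pairs of dyadic pieces in the relation `R`. -/
def pairSum (θ : V → ℝ) (F : V → ℂ) (τ : ℕ × ℕ) (l : ℕ) (R : ℕ → ℕ → Prop) [DecidableRel R]
    (η : V) : ℂ :=
  ∑ p ∈ (Finset.range (2 ^ l) ×ˢ Finset.range (2 ^ l)).filter (fun p => R p.1 p.2),
    conv (cut θ F (child τ l p.1)) (cut θ F (child τ l p.2)) η

variable {θ : V → ℝ}

theorem cut_child (τ : ℕ × ℕ) {l i : ℕ} (hi : i < 2 ^ l) (ζ : V) :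
    cut θ F (child τ l i) ζ = if childIdx τ l (θ ζ) = i then cut θ F τ ζ else 0 := by
  by_cases h : θ ζ ∈ arc τ
  · rw [cut_of_mem h]
    split_ifs with h'
    · exact cut_of_mem ((mem_arc_child_iff h l i).2 h')
    · exact cut_of_notMem fun h'' => h' ((mem_arc_child_iff h l i).1 h'')
  · rw [cut_of_notMem h, ite_self]
    exact cut_of_notMem fun h'' => h ((child_subArc τ hi).subset h'')

theorem sum_cut_child (τ : ℕ × ℕ) (l : ℕ) (R : ℕ → ℕ → Prop) [DecidableRel R] (ζ ζ' : V) :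
    ∑ p ∈ (Finset.range (2 ^ l) ×ˢ Finset.range (2 ^ l)).filter (fun p => R p.1 p.2),
      cut θ F (child τ l p.1) ζ * cut θ F (child τ l p.2) ζ' =
    if R (childIdx τ l (θ ζ)) (childIdx τ l (θ ζ')) then cut θ F τ ζ * cut θ F τ ζ' else 0 := by
  by_cases h : θ ζ ∈ arc τ
  swap
  · rw [cut_of_notMem h]; simp only [zero_mul, ite_self]
    refine sum_eq_zero fun p hp => ?_
    simp only [mem_filter, mem_product, Finset.mem_range] at hp
    rw [cut_child τ hp.1.1, cut_of_notMem h]; simp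
  by_cases h' : θ ζ' ∈ arc τ
  swap
  · rw [cut_of_notMem h']; simp only [mul_zero, ite_self]
    refine sum_eq_zero fun p hp => ?_
    simp only [mem_filter, mem_product, Finset.mem_range] at hp
    rw [cut_child τ hp.1.2, cut_of_notMem h']; simp
  have hz : ∀ p ∈ (Finset.range (2 ^ l) ×ˢ Finset.range (2 ^ l)).filter (fun p => R p.1 p.2),
      p ≠ (childIdx τ l (θ ζ), childIdx τ l (θ ζ')) →
      cut θ F (child τ l p.1) ζ * cut θ F (child τ l p.2) ζ' = 0 := by
    intro p hp hne; simp only [mem_filter, mem_product, Finset.mem_range] at hp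
    rw [cut_child τ hp.1.1, cut_child τ hp.1.2]; grind
  split_ifs with hR
  · rw [Finset.sum_eq_single_of_mem (childIdx τ l (θ ζ), childIdx τ l (θ ζ')) ?_ hz]
    · rw [cut_child τ (childIdx_lt h l), cut_child τ (childIdx_lt h' l)]; simp
    · simp [childIdx_lt h, childIdx_lt h', hR]
  · refine sum_eq_zero fun p hp => hz p hp ?_
    grind

theorem integrable_conv_integrand {F G : V → ℂ} (hF : Nice F) (hG : Nice G) (η : V) :
    Integrable fun ζ => F ζ * G (η - ζ) := by
  obtain ⟨M, hM0, hM⟩ := hG.bdd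
  exact (hF.mul_bdd (g := fun ζ => G (η - ζ)) (hG.meas.comp (measurable_const.sub measurable_id))
    ⟨M, fun x => hM _⟩).integrable

theorem pairSum_eq (hθ : Measurable θ) (hF : Nice F) (τ : ℕ × ℕ) (l : ℕ) (R : ℕ → ℕ → Prop)
    [DecidableRel R] (η : V) :
    Integrable (fun ζ => if R (childIdx τ l (θ ζ)) (childIdx τ l (θ (η - ζ))) then
      cut θ F τ ζ * cut θ F τ (η - ζ) else 0) ∧
    pairSum θ F τ l R η = ∫ ζ, if R (childIdx τ l (θ ζ)) (childIdx τ l (θ (η - ζ))) then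
      cut θ F τ ζ * cut θ F τ (η - ζ) else 0 := by
  simp_rw [← sum_cut_child]
  have hi : ∀ p ∈ (Finset.range (2 ^ l) ×ˢ Finset.range (2 ^ l)).filter (fun p => R p.1 p.2),
      Integrable fun ζ => cut θ F (child τ l p.1) ζ * cut θ F (child τ l p.2) (η - ζ) :=
    fun p _ => integrable_conv_integrand (hF.cut hθ _) (hF.cut hθ _) η
  exact ⟨integrable_finsetSum _ hi, by rw [integral_finsetSum _ hi]; rfl⟩

theorem Near.half {i j : ℕ} (h : Near i j) : Near (i / 2) (j / 2) := by unfold Near at *; omega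

theorem Whit.bounds {i j : ℕ} (h : Whit i j) : (i + 2 ≤ j ∧ j ≤ i + 3) ∨ (j + 2 ≤ i ∧ i ≤ j + 3) := by
  unfold Whit Near at h; omega

theorem pairSum_near_succ (hθ : Measurable θ) (hF : Nice F) (τ : ℕ × ℕ) (l : ℕ) (η : V) :
    pairSum θ F τ l Near η = pairSum θ F τ (l + 1) Near η + pairSum θ F τ (l + 1) Whit η := by
  obtain ⟨i1, e1⟩ := pairSum_eq hθ hF τ (l + 1) Near η
  obtain ⟨i2, e2⟩ := pairSum_eq hθ hF τ (l + 1) Whit η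
  rw [(pairSum_eq hθ hF τ l Near η).2, e1, e2, ← integral_add i1 i2]; congr 1; funext ζ
  rw [childIdx_succ l (θ ζ), childIdx_succ l (θ (η - ζ))]
  set i := childIdx τ (l + 1) (θ ζ)
  set j := childIdx τ (l + 1) (θ (η - ζ))
  by_cases h1 : Near i j
  · have h2 := h1.half
    have h3 : ¬ Whit i j := fun h => h.1 h1
    simp [h1, h2, h3]
  · by_cases h2 : Near (i / 2) (j / 2)
    · have h3 : Whit i j := ⟨h1, h2⟩
      simp [h1, h2, h3]
    · have h3 : ¬ Whit i j := fun h => h2 h.2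
      simp [h1, h2, h3]

theorem child_zero (τ : ℕ × ℕ) : child τ 0 0 = τ := by simp [child]

theorem conv_cut_eq (hθ : Measurable θ) (hF : Nice F) (τ : ℕ × ℕ) (L : ℕ) (η : V) :
    conv (cut θ F τ) (cut θ F τ) η =
      pairSum θ F τ L Near η + ∑ l ∈ Finset.range L, pairSum θ F τ (l + 1) Whit η := by
  induction L with
  | zero =>
    have : ((Finset.range (2 ^ 0) ×ˢ Finset.range (2 ^ 0)).filter (fun p : ℕ × ℕ => Near p.1 p.2)) =
        {(0, 0)} := by decide
    rw [pairSum, this]; simp [child_zero]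
  | succ L ih =>
    rw [ih, pairSum_near_succ hθ hF, sum_range_succ]; ring

/-! ### The base estimate -/

theorem plank_coeff_bounds {δ α β γ X Y Z W d : ℝ} (hX : 0 ≤ X ∧ X ≤ 1) (hY : 0 ≤ Y ∧ Y ≤ 1)
    (hZ : d ≤ Z ∧ Z ≤ d + 1) (hW : d ≤ W ∧ W ≤ d + 1) (hd : (2 ≤ d ∧ d ≤ 3) ∨ (-3 ≤ d ∧ d ≤ -2))
    (h1 : |γ - (X + Y) * β + X * Y * α| ≤ 4 * δ) (h2 : |γ - (Z + W) * β + Z * W * α| ≤ 4 * δ) :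
    |β| ≤ 4 * δ + 9 * |α| ∧ |γ| ≤ 12 * δ + 19 * |α| := by
  have hZa : |Z| ≤ 4 := by grind
  have hWa : |W| ≤ 4 := by grind
  have hZW : |Z * W - X * Y| ≤ 17 := by
    refine (abs_sub _ _).trans ?_
    rw [abs_mul, abs_mul, abs_of_nonneg hX.1, abs_of_nonneg hY.1]
    nlinarith [abs_nonneg Z, abs_nonneg W]
  have hS : 2 ≤ |Z + W - X - Y| := by grind
  have hβ : |β| ≤ 4 * δ + 9 * |α| := by
    have e : (Z + W - X - Y) * β = (γ - (X + Y) * β + X * Y * α) - (γ - (Z + W) * β + Z * W * α) +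
      (Z * W - X * Y) * α := by ring
    have t1 : |(Z + W - X - Y) * β| ≤ 8 * δ + 17 * |α| := by
      rw [e]
      refine (abs_add_le _ _).trans ?_
      have := abs_sub (γ - (X + Y) * β + X * Y * α) (γ - (Z + W) * β + Z * W * α)
      rw [abs_mul]
      bound
    rw [abs_mul] at t1; nlinarith [abs_nonneg β, abs_nonneg α]
  refine ⟨hβ, ?_⟩
  have e : γ = (γ - (X + Y) * β + X * Y * α) + (X + Y) * β - X * Y * α := by ring
  have t2 : |γ| ≤ 4 * δ + 2 * |β| + |α| := by
    rw [e]
    refine (abs_sub _ _).trans ?_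
    have := abs_add_le (γ - (X + Y) * β + X * Y * α) ((X + Y) * β)
    rw [abs_mul (X + Y), abs_of_nonneg (by linarith [hX.1, hY.1] : 0 ≤ X + Y)] at this
    rw [abs_mul, abs_of_nonneg (by nlinarith [hX.1, hY.1] : 0 ≤ X * Y)]
    nlinarith [abs_nonneg β, abs_nonneg α, mul_le_mul hX.2 hY.2 hY.1 zero_le_one, hX.2, hY.2]
  linarith

theorem inPlank_of_two_pairs {τ τ' : ℕ × ℕ} {δ δ₂ A B C x y z w d : ℝ}
    (hlen : arcLen τ' = arcLen τ) (hleft : arcLeft τ' = arcLeft τ + d * arcLen τ)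
    (hd : (2 ≤ d ∧ d ≤ 3) ∨ (-3 ≤ d ∧ d ≤ -2))
    (hx : x ∈ arc τ) (hy : y ∈ arc τ) (hz : z ∈ arc τ') (hw : w ∈ arc τ')
    (h1 : |C - (x + y) * B + x * y * A| ≤ 4 * δ) (h2 : |C - (z + w) * B + z * w * A| ≤ 4 * δ)
    (hA : arcLen τ ^ 2 * |A| ≤ δ₂ / 32) (hδ : δ ≤ δ₂ / 64) : InPlank τ δ₂ A B C := by
  have hp := arcLen_pos τ
  set s := arcLen τ
  set t := arcLeft τ
  have rng : ∀ u ∈ arc τ, 0 ≤ (u - t) / s ∧ (u - t) / s ≤ 1 := fun u hu =>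
    ⟨div_nonneg (by linarith [hu.1]) hp.le, (div_le_one hp).2 (by linarith [hu.2])⟩
  have rng' : ∀ u ∈ arc τ', d ≤ (u - t) / s ∧ (u - t) / s ≤ d + 1 := fun u hu => by
    have h3 := hu.1
    have h4 := hu.2
    rw [hleft] at h3 h4; rw [hlen] at h4
    exact ⟨(le_div_iff₀ hp).2 (by linarith), (div_le_iff₀ hp).2 (by linarith)⟩
  have poly : ∀ u v, C - (u + v) * B + u * v * A =
      (C - 2 * t * B + t ^ 2 * A) - ((u - t) / s + (v - t) / s) * (s * (B - t * A)) +
        (u - t) / s * ((v - t) / s) * (s ^ 2 * A) := fun u v => by field_simp; ring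
  rw [poly] at h1 h2
  obtain ⟨hβ, hγ⟩ := plank_coeff_bounds (rng x hx) (rng y hy) (rng' z hz) (rng' w hw) hd h1 h2
  rw [abs_mul, abs_of_pos hp, abs_mul, abs_of_pos (pow_pos hp 2)] at hβ
  rw [abs_mul (s ^ 2), abs_of_pos (pow_pos hp 2)] at hγ
  have : 0 ≤ s ^ 2 * |A| := by positivity
  exact ⟨by linarith, by linarith, by linarith⟩

theorem sq_sum_le_of_card {ι : Type*} [DecidableEq ι] (s : Finset ι) (x : ι → ℂ) (N : ℕ)
    (hN : (s.filter fun i => x i ≠ 0).card ≤ N) :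
    ‖∑ i ∈ s, x i‖ ^ 2 ≤ N * ∑ i ∈ s, ‖x i‖ ^ 2 := by
  rw [← Finset.sum_filter_ne_zero]
  have h1 := norm_sum_le (s.filter fun i => x i ≠ 0) x
  have h2 := sq_sum_le_card_mul_sum_sq (s := s.filter fun i => x i ≠ 0) (f := fun i => ‖x i‖)
  have h3 : ∑ i ∈ s.filter (fun i => x i ≠ 0), ‖x i‖ ^ 2 ≤ ∑ i ∈ s, ‖x i‖ ^ 2 :=
    Finset.sum_le_sum_of_subset_of_nonneg (Finset.filter_subset _ _) fun _ _ _ => by positivity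
  have h4 : 0 ≤ ∑ i ∈ s.filter (fun i => x i ≠ 0), ‖x i‖ ^ 2 := sum_nonneg fun _ _ => by positivity
  calc _ ≤ (∑ i ∈ s.filter (fun i => x i ≠ 0), ‖x i‖) ^ 2 := pow_le_pow_left₀ (norm_nonneg _) h1 2
    _ ≤ _ := h2
    _ ≤ N * ∑ i ∈ s.filter (fun i => x i ≠ 0), ‖x i‖ ^ 2 :=
        mul_le_mul_of_nonneg_right (by exact_mod_cast hN) h4
    _ ≤ _ := mul_le_mul_of_nonneg_left h3 (by positivity)

/-- A symmetric sum over pairs of indices at distance at most three. -/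
theorem sum_pairs_le (N : ℕ) (R : ℕ → ℕ → Prop) [DecidableRel R]
    (hR : ∀ i j, R i j → i ≤ j + 3 ∧ j ≤ i + 3) (E : ℕ → ℝ) (hE : ∀ i, 0 ≤ E i) :
    ∑ p ∈ (Finset.range N ×ˢ Finset.range N).filter (fun p => R p.1 p.2), (E p.1 + E p.2) / 2 ≤
      7 * ∑ i ∈ Finset.range N, E i := by
  have key : ∀ (R : ℕ → ℕ → Prop) [DecidableRel R], (∀ i j, R i j → i ≤ j + 3 ∧ j ≤ i + 3) →
      ∑ i ∈ Finset.range N, ∑ j ∈ Finset.range N, (if R i j then E i else 0) ≤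
      7 * ∑ i ∈ Finset.range N, E i := by
    intro R _ hR; rw [mul_sum]
    refine sum_le_sum fun i _ => ?_
    rw [← sum_filter, sum_const, nsmul_eq_mul]
    refine mul_le_mul_of_nonneg_right ?_ (hE i)
    have : ((Finset.range N).filter fun j => R i j) ⊆ (Finset.Icc (i - 3) (i + 3)) := by grind
    have h2 := Finset.card_le_card this
    rw [Nat.card_Icc] at h2
    have : ((Finset.range N).filter fun j => R i j).card ≤ 7 := by omega
    simp_all
  rw [sum_filter, Finset.sum_product]
  have h1 := key R hR
  have h2 := key (fun i j => R j i) (fun i j h => (hR j i h).symm)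
  rw [sum_comm] at h2
  have e : ∀ i j, (if R i j then (E i + E j) / 2 else 0) =
      (if R i j then E i else 0) / 2 + (if R i j then E j else 0) / 2 := by grind
  simp_rw [e, Finset.sum_add_distrib, ← Finset.sum_div]; linarith

theorem conv_ne_zero {F G : V → ℂ} {η : V} (h : conv F G η ≠ 0) :
    ∃ ζ, F ζ ≠ 0 ∧ G (η - ζ) ≠ 0 := by
  by_contra hc
  push Not at hc
  apply h; unfold conv; rw [← integral_zero V ℂ]; congr 1; funext ζ
  by_cases h1 : F ζ = 0
  · simp [h1]
  · simp [hc ζ h1]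

theorem acor_ne_zero {F G : V → ℂ} {ω : V} (h : acor F G ω ≠ 0) :
    ∃ ζ, F ζ ≠ 0 ∧ G (ζ - ω) ≠ 0 := by
  by_contra hc
  push Not at hc
  apply h; unfold acor; rw [← integral_zero V ℂ]; congr 1; funext ζ
  by_cases h1 : F ζ = 0
  · simp [h1]
  · simp [hc ζ h1]

/-- At a given frequency, boundedly many pairs of pieces contribute to a pair sum. -/
theorem ConeData.Supports.card_pairs_le (hF : S.Supports δ₀ F) (τ : ℕ × ℕ) (l : ℕ)
    (R : ℕ → ℕ → Prop) [DecidableRel R] (hR : ∀ i j, R i j → i ≤ j + 3 ∧ j ≤ i + 3)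
    (hδ : δ₀ ≤ arcLen τ / 2 ^ l / 16) (η : V) :
    ((((Finset.range (2 ^ l) ×ˢ Finset.range (2 ^ l)).filter (fun p => R p.1 p.2)).filter
      fun p => conv (cut S.θ F (child τ l p.1)) (cut S.θ F (child τ l p.2)) η ≠ 0)).card ≤ 1141 := by
  set ℓ := arcLen τ / 2 ^ l with hℓ
  have hp := arcLen_pos τ
  have hℓ0 : 0 < ℓ := by positivity
  have hℓ1 : ℓ ≤ 1 := by
    rw [hℓ, div_le_one (by positivity)]; exact (arcLen_le_one τ).trans (one_le_pow₀ (by norm_num))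
  set T := (((Finset.range (2 ^ l) ×ˢ Finset.range (2 ^ l)).filter (fun p => R p.1 p.2)).filter
      fun p => conv (cut S.θ F (child τ l p.1)) (cut S.θ F (child τ l p.2)) η ≠ 0) with hT
  have loc : ∀ p ∈ T, p.1 ≤ p.2 + 3 ∧ p.2 ≤ p.1 + 3 ∧ ∃ x ∈ arc (child τ l p.1),
      |S.b η - x * S.a η| ≤ 9 * ℓ ∧ 1 / 4 ≤ S.a η := by
    intro p hp'; rw [hT, mem_filter, mem_filter] at hp'
    obtain ⟨⟨_, hr⟩, hc⟩ := hp'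
    obtain ⟨r1, r2⟩ := hR _ _ hr
    obtain ⟨ζ, z1, z2⟩ := conv_ne_zero hc
    obtain ⟨m1, f1⟩ := cut_ne_zero z1
    obtain ⟨m2, f2⟩ := cut_ne_zero z2
    refine ⟨r1, r2, S.θ ζ, m1, ?_⟩
    have a1 := hF.a_eq _ f1
    have a2 := hF.a_eq _ f2
    have b1 := hF.b_eq _ f1
    have b2 := hF.b_eq _ f2
    simp only [map_sub] at a2 b2
    have e1 := hF.e_le _ f1
    have e2 := hF.e_le _ f2
    have hx0 := hF.θ_nonneg _ f1
    have hx1 := hF.θ_le _ f1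
    set x := S.θ ζ
    set y := S.θ (η - ζ)
    have hxy : |y - x| ≤ 4 * ℓ := by
      simp only [arc, arcLeft_child, arcLen_child, mem_Ico] at m1 m2; rw [← hℓ] at m1 m2
      have c1 : (p.1 : ℝ) ≤ p.2 + 3 := by exact_mod_cast r1
      have c2 : (p.2 : ℝ) ≤ p.1 + 3 := by exact_mod_cast r2
      rw [abs_le]; constructor <;> nlinarith
    have hh1 := hF.h_le _ f2
    have hh0 := hF.h_ge _ f2
    have hh0' := hF.h_ge _ f1
    constructor
    · have e : S.b η - x * S.a η = S.h (η - ζ) * (y - x) - x * (S.e ζ + S.e (η - ζ)) := by grind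
      rw [e]
      refine (abs_sub _ _).trans ?_
      rw [abs_mul, abs_mul, abs_of_nonneg hx0, abs_of_nonneg (by linarith : 0 ≤ S.h (η - ζ))]
      have := abs_add_le (S.e ζ) (S.e (η - ζ))
      have t1 : S.h (η - ζ) * |y - x| ≤ 2 * (4 * ℓ) :=
        mul_le_mul hh1 hxy (abs_nonneg _) (by norm_num)
      have t2 : x * |S.e ζ + S.e (η - ζ)| ≤ 1 * (ℓ / 8) :=
        mul_le_mul hx1 (by linarith) (abs_nonneg _) (by norm_num)
      linarith
    · grind
  rcases T.eq_empty_or_nonempty with he | ⟨p₀, hp₀⟩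
  · rw [he]; simp
  obtain ⟨_, _, x₀, hx₀, hb₀, ha₀⟩ := loc p₀ hp₀
  have close : ∀ p ∈ T, p.1 ≤ p₀.1 + 81 ∧ p₀.1 ≤ p.1 + 81 := by
    intro p hp'
    obtain ⟨_, _, x, hx, hb, ha⟩ := loc p hp'
    have h1 : |x - x₀| ≤ 72 * ℓ := by
      have e : (x - x₀) * S.a η = (S.b η - x₀ * S.a η) - (S.b η - x * S.a η) := by ring
      have h2 : |x - x₀| * S.a η ≤ 18 * ℓ := by
        rw [← abs_of_pos (by linarith : 0 < S.a η), ← abs_mul, e]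
        refine (abs_sub _ _).trans (by linarith)
      nlinarith
    simp only [arc, arcLeft_child, arcLen_child, mem_Ico] at hx hx₀; rw [← hℓ] at hx hx₀
    rw [abs_le] at h1
    have g1 : ((p.1 : ℝ) - p₀.1) * ℓ < 73 * ℓ := by linarith
    have g2 : ((p₀.1 : ℝ) - p.1) * ℓ < 73 * ℓ := by linarith
    have g3 := lt_of_mul_lt_mul_right g1 hℓ0.le
    have g4 := lt_of_mul_lt_mul_right g2 hℓ0.le
    constructor
    · have : (p.1 : ℝ) ≤ p₀.1 + 81 := by linarith
      exact_mod_cast this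
    · have : (p₀.1 : ℝ) ≤ p.1 + 81 := by linarith
      exact_mod_cast this
  have hm : ∀ p ∈ T, p.1 + 81 - p₀.1 < 163 ∧ p.2 + 3 - p.1 < 7 := by
    intro p hp'
    obtain ⟨c1, c2⟩ := close p hp'
    obtain ⟨d1, d2, _⟩ := loc p hp'
    omega
  have hcard : ∀ A B : ℕ, (∀ p ∈ T, p.1 + 81 - p₀.1 < A ∧ p.2 + 3 - p.1 < B) →
      T.card ≤ (Finset.range A ×ˢ Finset.range B).card := by
    intro A B hm
    apply Finset.card_le_card_of_injOn (fun p => (p.1 + 81 - p₀.1, p.2 + 3 - p.1))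
    · exact fun p hp' => Finset.mem_coe.2 (mem_product.2
        ⟨Finset.mem_range.2 (hm p hp').1, Finset.mem_range.2 (hm p hp').2⟩)
    · intro p hp' p' hp'' he
      obtain ⟨c1, c2⟩ := close p hp'
      obtain ⟨d1, d2, _⟩ := loc p hp'
      obtain ⟨c1', c2'⟩ := close p' hp''
      obtain ⟨d1', d2', _⟩ := loc p' hp''
      simp only [Prod.mk.injEq] at he
      ext <;> omega
  have hcard' := hcard 163 7 hm
  rw [Finset.card_product, card_range, card_range] at hcard'; linarith

/-- The `L²` norm of a pair sum is controlled by the plank energies, as soon as the relevant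
frequencies lie in the planks. -/
theorem ConeData.Supports.integral_pairSum_le (hF : S.Supports δ₀ F) (τ : ℕ × ℕ) (l n : ℕ)
    (R : ℕ → ℕ → Prop) [DecidableRel R] (hR : ∀ i j, R i j → i ≤ j + 3 ∧ j ≤ i + 3)
    (hδ : δ₀ ≤ arcLen τ / 2 ^ l / 16)
    (hpl : ∀ i j, R i j → ∀ ω,
      acor (cut S.θ F (child τ l i)) (cut S.θ F (child τ l i)) ω ≠ 0 →
      acor (cut S.θ F (child τ l j)) (cut S.θ F (child τ l j)) ω ≠ 0 →
      ω ∈ S.plank (child τ l i) (1 / 4 ^ n) ∧ ω ∈ S.plank (child τ l j) (1 / 4 ^ n)) :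
    ∫ η, ‖pairSum S.θ F τ l R η‖ ^ 2 ≤
      7987 * ∑ i ∈ Finset.range (2 ^ l), S.energy F (child τ l i) n := by
  set c : ℕ → V → ℂ := fun i => cut S.θ F (child τ l i)
  have hcn : ∀ i, Nice (c i) := fun i => hF.nice.cut S.meas _
  set I := (Finset.range (2 ^ l) ×ˢ Finset.range (2 ^ l)).filter (fun p => R p.1 p.2)
  have hInt : ∀ p ∈ I, Integrable fun η => ‖conv (c p.1) (c p.2) η‖ ^ 2 := fun p _ =>
    ((hcn _).conv (hcn _)).integrable_sq
  have hpair : ∀ p ∈ I, ∫ η, ‖conv (c p.1) (c p.2) η‖ ^ 2 ≤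
      (S.energy F (child τ l p.1) n + S.energy F (child τ l p.2) n) / 2 := by
    intro p hp
    refine (integral_conv_sq_le (hcn _) (hcn _)).trans ?_
    have hin : ∀ i, Integrable ((S.plank (child τ l i) (1 / 4 ^ n)).indicator
        (fun ω => ‖acor (c i) (c i) ω‖ ^ 2)) := fun i =>
      ((hcn i).acor (hcn i)).integrable_sq.indicator (S.measurableSet_plank _ _)
    rw [S.energy_eq, S.energy_eq, ← integral_add (hin _) (hin _), ← integral_div]
    refine integral_mono (((hcn _).acor (hcn _)).integrable_mul_norm ((hcn _).acor (hcn _)))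
      (((hin _).add (hin _)).div_const 2) fun ω => ?_
    show ‖acor (c p.1) (c p.1) ω‖ * ‖acor (c p.2) (c p.2) ω‖ ≤ _
    by_cases h1 : acor (c p.1) (c p.1) ω = 0
    · rw [h1, norm_zero, zero_mul]
      exact div_nonneg (add_nonneg (indicator_nonneg (fun _ _ => by positivity) _)
        (indicator_nonneg (fun _ _ => by positivity) _)) (by norm_num)
    by_cases h2 : acor (c p.2) (c p.2) ω = 0
    · rw [h2, norm_zero, mul_zero]
      exact div_nonneg (add_nonneg (indicator_nonneg (fun _ _ => by positivity) _)
        (indicator_nonneg (fun _ _ => by positivity) _)) (by norm_num)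
    obtain ⟨g1, g2⟩ := hpl _ _ (mem_filter.1 hp).2 ω h1 h2
    rw [indicator_of_mem g1, indicator_of_mem g2]
    have := sq_nonneg (‖acor (c p.1) (c p.1) ω‖ - ‖acor (c p.2) (c p.2) ω‖)
    linarith
  have hsq : ∀ η, ‖pairSum S.θ F τ l R η‖ ^ 2 ≤ (1141 : ℕ) * ∑ p ∈ I, ‖conv (c p.1) (c p.2) η‖ ^ 2 :=
    fun η => sq_sum_le_of_card _ _ _ (hF.card_pairs_le τ l R hR hδ η)
  calc ∫ η, ‖pairSum S.θ F τ l R η‖ ^ 2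
      ≤ ∫ η, (1141 : ℕ) * ∑ p ∈ I, ‖conv (c p.1) (c p.2) η‖ ^ 2 := by
        refine integral_mono_of_nonneg (.of_forall fun _ => by positivity)
          ((integrable_finsetSum _ hInt).const_mul _) (.of_forall hsq)
    _ = (1141 : ℕ) * ∑ p ∈ I, ∫ η, ‖conv (c p.1) (c p.2) η‖ ^ 2 := by
        rw [integral_const_mul, integral_finsetSum _ hInt]
    _ ≤ (1141 : ℕ) * ∑ p ∈ I, (S.energy F (child τ l p.1) n + S.energy F (child τ l p.2) n) / 2 :=
        mul_le_mul_of_nonneg_left (sum_le_sum hpair) (by positivity)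
    _ ≤ (1141 : ℕ) * (7 * ∑ i ∈ Finset.range (2 ^ l), S.energy F (child τ l i) n) :=
        mul_le_mul_of_nonneg_left (sum_pairs_le _ R hR _ fun i => S.energy_nonneg _ _ _) (by positivity)
    _ = _ := by push_cast; ring

theorem ConeData.Supports.plank_of_whit (hF : S.Supports δ₀ F) {τ : ℕ × ℕ} {l n N : ℕ}
    (hthin : ∀ ζ ζ', F ζ ≠ 0 → F ζ' ≠ 0 → |S.h ζ - S.h ζ'| ≤ 1 / (64 * 4 ^ N)) (hn : n ≤ τ.1 + N)
    (hδ : δ₀ ≤ 1 / 4 ^ (n + 14)) {i j : ℕ} (hij : Whit i j) {ω : V}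
    (h1 : acor (cut S.θ F (child τ l i)) (cut S.θ F (child τ l i)) ω ≠ 0)
    (h2 : acor (cut S.θ F (child τ l j)) (cut S.θ F (child τ l j)) ω ≠ 0) :
    ω ∈ S.plank (child τ l i) (1 / 4 ^ n) := by
  obtain ⟨ζ, z1, z2⟩ := acor_ne_zero h1
  obtain ⟨ζ', w1, w2⟩ := acor_ne_zero h2
  obtain ⟨m1, f1⟩ := cut_ne_zero z1
  obtain ⟨m2, f2⟩ := cut_ne_zero z2
  obtain ⟨m3, f3⟩ := cut_ne_zero w1
  obtain ⟨m4, f4⟩ := cut_ne_zero w2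
  have hδ' : δ₀ ≤ 1 / 4 ^ n / 2 ^ 28 := by
    refine hδ.trans (le_of_eq ?_)
    grind
  have h4n : (0 : ℝ) < 1 / 4 ^ n := by positivity
  refine inPlank_of_two_pairs (τ' := child τ l j) (δ := δ₀) (d := (j : ℝ) - i)
    (by rw [arcLen_child, arcLen_child]) (by rw [arcLeft_child, arcLeft_child, arcLen_child]; ring)
    ?_ m1 m2 m3 m4 (hF.quad_le f1 f2).1 (hF.quad_le f3 f4).1 ?_ (by linarith)
  · rcases hij.bounds with ⟨b1, b2⟩ | ⟨b1, b2⟩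
    · left
      have c1 : (i : ℝ) + 2 ≤ j := by exact_mod_cast b1
      have c2 : (j : ℝ) ≤ i + 3 := by exact_mod_cast b2
      grind
    · right
      have c1 : (j : ℝ) + 2 ≤ i := by exact_mod_cast b1
      have c2 : (i : ℝ) ≤ j + 3 := by exact_mod_cast b2
      grind
  · have ha : |S.a ω| ≤ 1 / (64 * 4 ^ N) + 2 * δ₀ := by
      have a1 := hF.a_eq _ f1
      have a2 := hF.a_eq _ f2
      rw [map_sub] at a2
      have e : S.a ω = (S.h ζ - S.h (ζ - ω)) + (S.e ζ - S.e (ζ - ω)) := by linarith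
      rw [e]; exact (abs_add_le _ _).trans (add_le_add (hthin _ _ f1 f2) (hF.quad_le f1 f2).2)
    have hs : arcLen (child τ l i) ^ 2 ≤ arcLen τ ^ 2 := by
      rw [arcLen_child]
      refine pow_le_pow_left₀ (div_nonneg (arcLen_pos τ).le (by positivity)) ?_ 2
      exact div_le_self (arcLen_pos τ).le (one_le_pow₀ (by norm_num))
    have hs1 : arcLen τ ^ 2 ≤ 1 := by have := arcLen_le_one τ; have := arcLen_pos τ; nlinarith
    have hsN : arcLen τ ^ 2 * (1 / (64 * 4 ^ N)) ≤ 1 / 4 ^ n / 64 := by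
      unfold arcLen
      have e2 : ((2 : ℝ) ^ τ.1) ^ 2 = 4 ^ τ.1 := by rw [← pow_mul, mul_comm τ.1, pow_mul]; norm_num
      rw [div_pow, one_pow, e2, div_mul_div_comm, div_div, one_mul]
      apply one_div_le_one_div_of_le (by positivity)
      have : (4 : ℝ) ^ n ≤ 4 ^ (τ.1 + N) := pow_le_pow_right₀ (by norm_num) hn
      grind
    have hδ0 : 0 ≤ δ₀ := (abs_nonneg _).trans (hF.e_le _ f1)
    calc arcLen (child τ l i) ^ 2 * |S.a ω| ≤ arcLen τ ^ 2 * (1 / (64 * 4 ^ N) + 2 * δ₀) :=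
          mul_le_mul hs ha (abs_nonneg _) (by positivity)
      _ ≤ 1 / 4 ^ n / 64 + 2 * δ₀ := by nlinarith
      _ ≤ _ := by linarith

theorem ConeData.Supports.plank_of_fine (hF : S.Supports δ₀ F) {τ : ℕ × ℕ} {n : ℕ}
    (hτ : τ.1 = n + 10) (hδ : δ₀ ≤ 1 / 4 ^ (n + 14)) {ω : V}
    (h1 : acor (cut S.θ F τ) (cut S.θ F τ) ω ≠ 0) : ω ∈ S.plank τ (1 / 4 ^ n) := by
  obtain ⟨ζ, z1, z2⟩ := acor_ne_zero h1
  obtain ⟨m1, f1⟩ := cut_ne_zero z1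
  obtain ⟨m2, f2⟩ := cut_ne_zero z2
  set δ : ℝ := 1 / 4 ^ n
  have hδ' : δ₀ ≤ δ / 2 ^ 28 := by
    refine hδ.trans (le_of_eq ?_)
    grind
  have hs := arcLen_pos τ
  have hs1 := arcLen_le_one τ
  have hsq : arcLen τ ^ 2 = δ / 2 ^ 20 := by
    simp only [arcLen, hτ, δ]
    rw [div_pow, one_pow, ← pow_mul, mul_comm (n + 10), pow_mul, pow_add]; norm_num; ring
  have hδ0 : 0 ≤ δ₀ := (abs_nonneg _).trans (hF.e_le _ f1)
  obtain ⟨q, hp⟩ := hF.quad_le f1 f2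
  have a1 := hF.a_eq _ f1
  have a2 := hF.a_eq _ f2
  have b1 := hF.b_eq _ f1
  have b2 := hF.b_eq _ f2
  simp only [map_sub] at a2 b2
  have x0 := hF.θ_nonneg _ f1
  have x1 := hF.θ_le _ f1
  have hg := hF.h_ge _ f1
  have hl := hF.h_le _ f1
  have hg' := hF.h_ge _ f2
  have hl' := hF.h_le _ f2
  have hδ1 : δ ≤ 1 := by bound
  set x := S.θ ζ
  set y := S.θ (ζ - ω)
  set p := S.e ζ - S.e (ζ - ω)
  have hxy : |x - y| ≤ arcLen τ := by rw [abs_le]; constructor <;> linarith [m1.1, m1.2, m2.1, m2.2]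
  have hA : |S.a ω| ≤ 3 := by grind
  have hB : |S.b ω - x * S.a ω| ≤ 2 * arcLen τ + 2 * δ₀ := by
    have e : S.b ω - x * S.a ω = S.h (ζ - ω) * (x - y) - x * p := by grind
    rw [e]
    refine (abs_sub _ _).trans ?_
    rw [abs_mul, abs_mul, abs_of_nonneg x0, abs_of_nonneg (by linarith : 0 ≤ S.h (ζ - ω))]
    have t1 : S.h (ζ - ω) * |x - y| ≤ 2 * arcLen τ := mul_le_mul hl' hxy (abs_nonneg _) (by norm_num)
    have t2 : x * |p| ≤ 1 * (2 * δ₀) := mul_le_mul x1 hp (abs_nonneg _) (by norm_num)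
    linarith
  have hν : arcLen τ * |S.b ω - x * S.a ω| ≤ δ / 16 := by
    have := mul_le_mul_of_nonneg_left hB hs.le
    nlinarith
  refine inPlank_of_point (μ := δ / 16) (ν := δ / 16) (κ := δ / 2) m1 ?_ (by rw [hsq]; nlinarith)
    hν (by linarith)
  have e : S.c ω - 2 * x * S.b ω + x ^ 2 * S.a ω =
      (S.c ω - (x + y) * S.b ω + x * y * S.a ω) - (x - y) * (S.b ω - x * S.a ω) := by ring
  rw [e]
  refine (abs_sub _ _).trans ?_
  rw [abs_mul]
  have := mul_le_mul_of_nonneg_right hxy (abs_nonneg (S.b ω - x * S.a ω))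
  linarith

/-- Base estimate: for a thin piece of the cone the full quartic energy of an angular piece is
controlled, up to a logarithm, by the plank energies of its sub-arcs. -/
theorem ConeData.Supports.base (hF : S.Supports δ₀ F) {τ : ℕ × ℕ} {n N : ℕ}
    (hthin : ∀ ζ ζ', F ζ ≠ 0 → F ζ' ≠ 0 → |S.h ζ - S.h ζ'| ≤ 1 / (64 * 4 ^ N)) (hn : n ≤ τ.1 + N)
    (hτ : τ.1 ≤ n + 10) (hδ : δ₀ ≤ 1 / 4 ^ (n + 14)) :
    quartic (cut S.θ F τ) ≤ 16000 * ((n + 11 - τ.1 : ℕ) : ℝ) *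
      ∑ τ' ∈ subArcs τ (n + 10), S.energy F τ' n := by
  obtain ⟨L, hL⟩ : ∃ L, τ.1 + L = n + 10 := ⟨n + 10 - τ.1, by omega⟩
  have hLn : n + 11 - τ.1 = L + 1 := by omega
  rw [hLn]
  have hfine : ∀ l ≤ L, δ₀ ≤ arcLen τ / 2 ^ l / 16 := by
    intro l hl
    have e : arcLen τ / 2 ^ l = 1 / 2 ^ (τ.1 + l) := by unfold arcLen; rw [pow_add]; field_simp
    rw [e, div_div]
    refine hδ.trans (one_div_le_one_div_of_le (by positivity) ?_)
    have e4 : (4 : ℝ) ^ (n + 14) = 2 ^ (2 * (n + 14)) := by rw [pow_mul]; norm_num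
    have e16 : (2 : ℝ) ^ (τ.1 + l) * 16 = 2 ^ (τ.1 + l + 4) := by grind
    rw [e4, e16]; exact pow_le_pow_right₀ (by norm_num) (by omega)
  have hnear := hF.integral_pairSum_le τ L n Near (fun i j h => ⟨by have := h.1; omega, by have := h.2; omega⟩)
    (hfine L le_rfl) (fun i j _ ω g1 g2 =>
      ⟨hF.plank_of_fine (by simp [child, hL]) hδ g1, hF.plank_of_fine (by simp [child, hL]) hδ g2⟩)
  have hwhit : ∀ l ∈ Finset.range L, ∫ η, ‖pairSum S.θ F τ (l + 1) Whit η‖ ^ 2 ≤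
      7987 * ∑ i ∈ Finset.range (2 ^ (l + 1)), S.energy F (child τ (l + 1) i) n := by
    intro l hl; rw [Finset.mem_range] at hl
    refine hF.integral_pairSum_le τ (l + 1) n Whit (fun i j h => ?_) (hfine _ (by omega))
      (fun i j hij ω g1 g2 => ⟨hF.plank_of_whit hthin hn hδ hij g1 g2,
        hF.plank_of_whit hthin hn hδ (j := i) (i := j) ?_ g2 g1⟩)
    · have := h.bounds; omega
    · unfold Whit Near at *; omega
  -- sum over levels
  have hE0 : ∀ τ', 0 ≤ S.energy F τ' n := fun τ' => S.energy_nonneg _ _ _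
  set Etot := ∑ τ' ∈ subArcs τ (n + 10), S.energy F τ' n
  have hlevels : ∑ l ∈ Finset.range (L + 1), ∑ i ∈ Finset.range (2 ^ l), S.energy F (child τ l i) n ≤ Etot := by
    rw [Finset.sum_sigma']
    have hinj : Set.InjOn (fun x : (_ : ℕ) × ℕ => child τ x.1 x.2)
        ((Finset.range (L + 1)).sigma fun l => Finset.range (2 ^ l)) := by
      rintro ⟨l, i⟩ _ ⟨l', i'⟩ _ h; simp only [child, Prod.mk.injEq] at h; grind
    rw [← sum_image (f := fun τ' => S.energy F τ' n) hinj]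
    refine Finset.sum_le_sum_of_subset_of_nonneg ?_ fun _ _ _ => hE0 _
    intro τ' h; rw [Finset.mem_image] at h
    obtain ⟨⟨l, i⟩, h1, rfl⟩ := h
    simp only [Finset.mem_sigma, Finset.mem_range] at h1
    exact mem_subArcs.2 ⟨by simp only [child]; omega, child_subArc τ h1.2⟩
  have hlast : ∑ i ∈ Finset.range (2 ^ L), S.energy F (child τ L i) n ≤ Etot := by
    refine le_trans ?_ hlevels
    exact Finset.single_le_sum (f := fun l => ∑ i ∈ Finset.range (2 ^ l), S.energy F (child τ l i) n)
      (fun l _ => sum_nonneg fun i _ => hE0 _) (Finset.mem_range.2 (Nat.lt_succ_self L))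
  have hrest : ∑ l ∈ Finset.range L, ∑ i ∈ Finset.range (2 ^ (l + 1)), S.energy F (child τ (l + 1) i) n ≤ Etot := by
    refine le_trans ?_ hlevels
    rw [sum_range_succ' _ L]
    simp_all
  have hnice := hF.nice.cut S.meas τ
  have hni : ∀ l (R : ℕ → ℕ → Prop) [DecidableRel R], Integrable fun η => ‖pairSum S.θ F τ l R η‖ ^ 2 := by
    intro l R _
    have hm : ∀ p : ℕ × ℕ, MemLp (conv (cut S.θ F (child τ l p.1)) (cut S.θ F (child τ l p.2))) 2 volume :=
      fun p => by
        have hc := (hF.nice.cut S.meas (child τ l p.1)).conv (hF.nice.cut S.meas (child τ l p.2))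
        exact (memLp_two_iff_integrable_sq_norm hc.meas.aestronglyMeasurable).2 hc.integrable_sq
    have hs : MemLp (fun η => ∑ p ∈ (Finset.range (2 ^ l) ×ˢ Finset.range (2 ^ l)).filter
        (fun p => R p.1 p.2), conv (cut S.θ F (child τ l p.1)) (cut S.θ F (child τ l p.2)) η) 2 volume :=
      memLp_finsetSum _ fun p _ => hm p
    exact (memLp_two_iff_integrable_sq_norm hs.aestronglyMeasurable).1 hs
  have hpt : ∀ η, ‖conv (cut S.θ F τ) (cut S.θ F τ) η‖ ^ 2 ≤
      (L + 1 : ℝ) * (‖pairSum S.θ F τ L Near η‖ ^ 2 +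
        ∑ l ∈ Finset.range L, ‖pairSum S.θ F τ (l + 1) Whit η‖ ^ 2) := by
    intro η; rw [conv_cut_eq S.meas hF.nice τ L η]
    set f : ℕ → ℂ := fun l => if l = L then pairSum S.θ F τ L Near η else pairSum S.θ F τ (l + 1) Whit η
    have e : pairSum S.θ F τ L Near η + ∑ l ∈ Finset.range L, pairSum S.θ F τ (l + 1) Whit η =
        ∑ l ∈ Finset.range (L + 1), f l := by
      rw [sum_range_succ, add_comm]; congr 1
      · refine sum_congr rfl fun l hl => ?_
        grind
      · simp [f]
    have e2 : ‖pairSum S.θ F τ L Near η‖ ^ 2 + ∑ l ∈ Finset.range L, ‖pairSum S.θ F τ (l + 1) Whit η‖ ^ 2 =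
        ∑ l ∈ Finset.range (L + 1), ‖f l‖ ^ 2 := by
      rw [sum_range_succ, add_comm]; congr 1
      · refine sum_congr rfl fun l hl => ?_
        grind
      · simp [f]
    rw [e, e2]
    have := sq_sum_le_of_card (Finset.range (L + 1)) f (L + 1)
      ((Finset.card_filter_le _ _).trans (by simp))
    grind
  rw [← integral_conv_sq_self hnice]
  calc ∫ η, ‖conv (cut S.θ F τ) (cut S.θ F τ) η‖ ^ 2
      ≤ ∫ η, (L + 1 : ℝ) * (‖pairSum S.θ F τ L Near η‖ ^ 2 +
        ∑ l ∈ Finset.range L, ‖pairSum S.θ F τ (l + 1) Whit η‖ ^ 2) :=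
        integral_mono (hnice.conv hnice).integrable_sq
          (((hni _ _).add (integrable_finsetSum _ fun l _ => hni _ _)).const_mul _) hpt
    _ = (L + 1 : ℝ) * ((∫ η, ‖pairSum S.θ F τ L Near η‖ ^ 2) +
        ∑ l ∈ Finset.range L, ∫ η, ‖pairSum S.θ F τ (l + 1) Whit η‖ ^ 2) := by
        rw [integral_const_mul, integral_add (hni _ _) (integrable_finsetSum _ fun l _ => hni _ _),
          integral_finsetSum _ fun l _ => hni _ _]
    _ ≤ (L + 1 : ℝ) * (7987 * Etot + 7987 * Etot) := by
        refine mul_le_mul_of_nonneg_left (add_le_add ?_ ?_) (by positivity)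
        · linarith
        · refine (sum_le_sum hwhit).trans ?_
          rw [← mul_sum]; linarith
    _ ≤ 16000 * ((L + 1 : ℕ) : ℝ) * Etot := by
        have : 0 ≤ Etot := sum_nonneg fun _ _ => hE0 _
        push_cast; nlinarith

/-- The step sizes needed for the induction on scales. -/
theorem exists_scale {ρ : ℝ} (hρ : 1 < ρ) : ∃ G : ℕ, 15 ≤ G ∧
    (∀ g : ℕ, G ≤ g → 12 * (g : ℝ) ≤ ρ ^ (g - 14)) ∧
    16000 * (2 * (G : ℝ) + 11) * (3 * (2 * G + 11)) ≤ ρ ^ G := by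
  have h := tendsto_pow_const_div_const_pow_of_one_lt 2 hρ
  have h1 : ∀ᶠ g : ℕ in Filter.atTop, (g : ℝ) ^ 2 / ρ ^ g < 1 / (48000 * 169 * ρ ^ 14) :=
    h.eventually (gt_mem_nhds (by positivity))
  obtain ⟨G, hG⟩ := Filter.eventually_atTop.1 h1
  refine ⟨max G 15, le_max_right _ _, fun g hg => ?_, ?_⟩
  · have h15 : 15 ≤ g := (le_max_right _ _).trans hg
    have := hG g ((le_max_left _ _).trans hg)
    rw [div_lt_div_iff₀ (by positivity) (by positivity)] at this
    have e : ρ ^ g = ρ ^ (g - 14) * ρ ^ 14 := by rw [← pow_add]; congr 1; omega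
    rw [e, one_mul] at this
    have hg1 : (1 : ℝ) ≤ g := by bound
    have h14 : 0 < ρ ^ 14 := by positivity
    have h2 : (g : ℝ) ^ 2 * (48000 * 169) < ρ ^ (g - 14) := by nlinarith
    nlinarith
  · have := hG (max G 15) (le_max_left _ _)
    set g := max G 15
    have h15 : 15 ≤ g := le_max_right _ _
    rw [div_lt_div_iff₀ (by positivity) (by positivity), one_mul] at this
    have hg1 : (1 : ℝ) ≤ g := by bound
    have h14 : 1 ≤ ρ ^ 14 := one_le_pow₀ hρ.le
    nlinarith

theorem ConeData.energy_le_step {ρ C M : ℝ} {τ : ℕ × ℕ} {m n₁ n' n₂ : ℕ}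
    (hρ : 0 < ρ) (hC : 0 ≤ C) (hM : 0 ≤ M) (h1 : n₁ ≤ n') (h2 : n' ≤ n₂) {X : ℝ}
    (hX : X ≤ M * ∑ τ' ∈ subArcs τ (n' + 10), S.energy F τ' n')
    (hm : n' + 10 + 1 - τ.1 ≤ m) (hsmall : M * (3 * m) ≤ ρ ^ (n' - n₁))
    (ih : ∀ τ' ∈ subArcs τ (n' + 10), S.energy F τ' n' ≤
      C * ρ ^ (n₂ - n') * ∑ τ'' ∈ subArcs τ' (n₂ + 10), S.energy F τ'' n₂) :
    X ≤ C * ρ ^ (n₂ - n₁) * ∑ τ' ∈ subArcs τ (n₂ + 10), S.energy F τ' n₂ := by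
  have hE : ∀ τ', 0 ≤ S.energy F τ' n₂ := fun τ' => S.energy_nonneg _ _ _
  set T := ∑ τ' ∈ subArcs τ (n₂ + 10), S.energy F τ' n₂
  have hT : 0 ≤ T := sum_nonneg fun _ _ => hE _
  have hm' : ((3 * (n' + 10 + 1 - τ.1) : ℕ) : ℝ) ≤ 3 * m := by simp_all
  have e : ρ ^ (n₂ - n₁) = ρ ^ (n' - n₁) * ρ ^ (n₂ - n') := by rw [← pow_add]; congr 1; omega
  have hCr : 0 ≤ C * ρ ^ (n₂ - n') := by positivity
  calc X ≤ M * ∑ τ' ∈ subArcs τ (n' + 10), S.energy F τ' n' := hX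
    _ ≤ M * (C * ρ ^ (n₂ - n') * ((3 * m) * T)) := by
        refine mul_le_mul_of_nonneg_left ?_ hM
        refine (sum_le_sum ih).trans ?_
        rw [← mul_sum]
        refine mul_le_mul_of_nonneg_left ?_ hCr
        exact (sum_subArcs_subArcs_le τ _ _ _ hE).trans (mul_le_mul_of_nonneg_right hm' hT)
    _ = (M * (3 * m)) * (C * ρ ^ (n₂ - n') * T) := by ring
    _ ≤ ρ ^ (n' - n₁) * (C * ρ ^ (n₂ - n') * T) :=
        mul_le_mul_of_nonneg_right hsmall (by positivity)
    _ = _ := by rw [e]; ring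

/-- Induction on scales for thin pieces of the cone. -/
theorem ConeData.Supports.energy_le (hF : S.Supports δ₀ F) {ρ : ℝ} (hρ : 1 < ρ) {G : ℕ} (hG : 15 ≤ G)
    (hG1 : ∀ g : ℕ, G ≤ g → 12 * (g : ℝ) ≤ ρ ^ (g - 14))
    (hG2 : 16000 * (2 * (G : ℝ) + 11) * (3 * (2 * G + 11)) ≤ ρ ^ G)
    (hthin : ∀ ζ ζ', F ζ ≠ 0 → F ζ' ≠ 0 → |S.h ζ - S.h ζ'| ≤ 1 / (64 * 4 ^ (2 * G)))
    {n₂ : ℕ} (hδ : δ₀ ≤ 1 / 4 ^ (n₂ + 14)) (k : ℕ) :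
    ∀ (τ : ℕ × ℕ) (n₁ : ℕ), n₂ - n₁ = k → n₁ ≤ n₂ → τ.1 ≤ n₁ + 10 →
    S.energy F τ n₁ ≤ 16000 * (2 * (G : ℝ) + 11) * ρ ^ (n₂ - n₁) *
      ∑ τ' ∈ subArcs τ (n₂ + 10), S.energy F τ' n₂ := by
  induction k using Nat.strong_induction_on with
  | _ k ih =>
  intro τ n₁ hk h12 hτ
  have hT : 0 ≤ ∑ τ' ∈ subArcs τ (n₂ + 10), S.energy F τ' n₂ :=
    sum_nonneg fun _ _ => S.energy_nonneg _ _ _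
  have hC : 0 ≤ 16000 * (2 * (G : ℝ) + 11) := by positivity
  have hpow : ∀ m, 1 ≤ ρ ^ m := fun m => one_le_pow₀ hρ.le
  have hρ0 : 0 < ρ := by linarith
  have hδ' : ∀ n' ≤ n₂, δ₀ ≤ 1 / 4 ^ (n' + 14) := fun n' h' =>
    hδ.trans (one_div_le_one_div_of_le (by positivity) (pow_le_pow_right₀ (by norm_num) (by omega)))
  have direct : ∀ M : ℝ, M ≤ 16000 * (2 * (G : ℝ) + 11) →
      S.energy F τ n₁ ≤ M * ∑ τ' ∈ subArcs τ (n₂ + 10), S.energy F τ' n₂ →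
      S.energy F τ n₁ ≤ 16000 * (2 * (G : ℝ) + 11) * ρ ^ (n₂ - n₁) *
      ∑ τ' ∈ subArcs τ (n₂ + 10), S.energy F τ' n₂ := by
    intro M hM h
    refine h.trans (mul_le_mul_of_nonneg_right (hM.trans ?_) hT)
    bound
  by_cases hg : τ.1 + G ≤ n₁
  · obtain ⟨g, rfl⟩ : ∃ g, n₁ = τ.1 + g := ⟨n₁ - τ.1, by omega⟩
    by_cases hd : n₂ + τ.1 + 14 ≤ 2 * (τ.1 + g)
    · exact direct 2 (by linarith) (hF.kakeya (by omega) (by omega) hd hδ)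
    · have hn' : τ.1 + 2 * g - 14 ≤ n₂ := by omega
      refine ConeData.energy_le_step (n' := τ.1 + 2 * g - 14) (m := 2 * g) (M := 2) hρ0 hC (by norm_num)
        (by omega) hn' (hF.kakeya (by omega) (by omega) (by omega) (hδ' _ hn')) (by omega) ?_ ?_
      · have := hG1 g (by omega)
        have e : τ.1 + 2 * g - 14 - (τ.1 + g) = g - 14 := by omega
        grind
      · intro τ' h'; rw [mem_subArcs] at h'; grind
  · by_cases hd : n₂ ≤ τ.1 + 2 * G
    · refine direct _ ?_ ((S.energy_le_quartic hF.nice τ n₁).trans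
        (hF.base hthin hd (by omega) hδ))
      have : ((n₂ + 11 - τ.1 : ℕ) : ℝ) ≤ ((2 * G + 11 : ℕ) : ℝ) := by exact_mod_cast (by omega)
      grind
    · have hn' : τ.1 + 2 * G ≤ n₂ := by omega
      have hb := (S.energy_le_quartic hF.nice τ n₁).trans
        (hF.base hthin le_rfl (by omega) (hδ' _ hn'))
      have e : τ.1 + 2 * G + 11 - τ.1 = 2 * G + 11 := by omega
      rw [e] at hb
      refine ConeData.energy_le_step (n' := τ.1 + 2 * G) (m := 2 * G + 11)
        hρ0 hC (by positivity) (by omega) hn' hb (by omega) ?_ ?_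
      · push_cast; exact hG2.trans (pow_le_pow_right₀ hρ.le (by omega))
      · intro τ' h'; rw [mem_subArcs] at h'; grind

/-- The quartic energy of a thin piece of the cone is controlled by plank energies at the finest
scale, with an arbitrarily small power loss. -/
theorem ConeData.Supports.quartic_le (hF : S.Supports δ₀ F) {ρ : ℝ} (hρ : 1 < ρ) {G : ℕ} (hG : 15 ≤ G)
    (hG1 : ∀ g : ℕ, G ≤ g → 12 * (g : ℝ) ≤ ρ ^ (g - 14))
    (hG2 : 16000 * (2 * (G : ℝ) + 11) * (3 * (2 * G + 11)) ≤ ρ ^ G)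
    (hthin : ∀ ζ ζ', F ζ ≠ 0 → F ζ' ≠ 0 → |S.h ζ - S.h ζ'| ≤ 1 / (64 * 4 ^ (2 * G)))
    {n : ℕ} (hδ : δ₀ ≤ 1 / 4 ^ (n + 14)) :
    quartic (cut S.θ F (0, 0)) ≤ 16000 * (2 * (G : ℝ) + 11) * ρ ^ n *
      ∑ τ' ∈ subArcs (0, 0) (n + 10), S.energy F τ' n := by
  have hT : 0 ≤ ∑ τ' ∈ subArcs (0, 0) (n + 10), S.energy F τ' n :=
    sum_nonneg fun _ _ => S.energy_nonneg _ _ _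
  have hρ0 : 0 < ρ := by linarith
  have hC : 0 ≤ 16000 * (2 * (G : ℝ) + 11) := by positivity
  by_cases hd : n ≤ 2 * G
  · refine (hF.base hthin (τ := (0, 0)) (n := n) (by simpa using hd) (by simp) hδ).trans ?_
    refine mul_le_mul_of_nonneg_right ?_ hT
    have h1 : ((n + 11 - (0, 0).1 : ℕ) : ℝ) ≤ ((2 * G + 11 : ℕ) : ℝ) := by
      exact_mod_cast (by simpa using hd)
    refine le_trans ?_ (le_mul_of_one_le_right hC (one_le_pow₀ hρ.le))
    grind
  · have hb := hF.base hthin (τ := (0, 0)) (n := 2 * G) (by simp) (by simp)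
      (hδ.trans (one_div_le_one_div_of_le (by positivity)
        (pow_le_pow_right₀ (by norm_num) (by omega))))
    have := ConeData.energy_le_step (C := 16000 * (2 * (G : ℝ) + 11)) (n₁ := 0) (n₂ := n)
      (m := 2 * G + 11) hρ0 hC (by positivity) (Nat.zero_le _) (by omega) hb (by simp) ?_ ?_
    · simpa using this
    · push_cast; exact hG2.trans (pow_le_pow_right₀ hρ.le (by omega))
    · intro τ' h'; rw [mem_subArcs] at h'
      exact hF.energy_le hρ hG hG1 hG2 hthin hδ _ τ' _ rfl (by omega) h'.1

end Cone

section Plancherel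

variable {E : Type*} [NormedAddCommGroup E] [InnerProductSpace ℝ E] [FiniteDimensional ℝ E]
  [MeasurableSpace E] [BorelSpace E]

theorem norm_fourierChar (a : ℝ) : ‖(𝐞 a : ℂ)‖ = 1 := Circle.norm_coe _

theorem continuous_fourier {f : E → ℂ} (hf : Integrable f) : Continuous (𝓕 f) :=
  VectorFourier.fourierIntegral_continuous Real.continuous_fourierChar
    (by exact continuous_inner) hf

theorem continuous_fourierInv {f : E → ℂ} (hf : Integrable f) : Continuous (𝓕⁻ f) := by
  have : 𝓕⁻ f = fun x => 𝓕 f (-x) := funext fun x => Real.fourierInv_eq_fourier_neg f x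
  rw [this]; exact (continuous_fourier hf).comp continuous_neg

theorem norm_fourierInv_le (f : E → ℂ) (x : E) : ‖𝓕⁻ f x‖ ≤ ∫ v, ‖f v‖ := by
  rw [fourierInv_eq]
  refine (norm_integral_le_integral_norm _).trans (le_of_eq ?_)
  simp

theorem norm_fourier_le (f : E → ℂ) (x : E) : ‖𝓕 f x‖ ≤ ∫ v, ‖f v‖ := by
  rw [fourier_eq]
  refine (norm_integral_le_integral_norm _).trans (le_of_eq ?_)
  simp

/-- The `L²` Fourier transform agrees with the Fourier integral on `L¹ ∩ L²`. -/
theorem fourier_toLp_ae {f : E → ℂ} (hf : Integrable f) (hf2 : MemLp f 2 volume) :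
    (𝓕 (hf2.toLp f) : Lp ℂ 2 (volume : Measure E)) =ᵐ[volume] 𝓕 f := by
  refine ae_eq_of_integral_contDiff_smul_eq
    ((Lp.memLp _).locallyIntegrable (by norm_num)) (continuous_fourier hf).locallyIntegrable ?_
  intro g hg hgc
  set gc : E → ℂ := fun x => (g x : ℂ)
  have hgcd : ContDiff ℝ (⊤ : ℕ∞) gc := ofRealCLM.contDiff.comp hg
  have hgcc : HasCompactSupport gc := hgc.comp_left Complex.ofReal_zero
  set φ : SchwartzMap E ℂ := hgcc.toSchwartzMap hgcd
  have hφg : ∀ x, φ x = g x := fun x => rfl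
  have h1 := congrArg (fun T => T φ) (Lp.fourier_toTemperedDistribution_eq (hf2.toLp f))
  simp only [TemperedDistribution.fourier_apply, Lp.toTemperedDistribution_apply] at h1
  have h2 : ∫ x, g x • (𝓕 (hf2.toLp f) : Lp ℂ 2 (volume : Measure E)) x =
      ∫ x, φ x • (𝓕 (hf2.toLp f) : Lp ℂ 2 (volume : Measure E)) x := by simp_all
  rw [h2, ← h1]
  have h3 : ∫ x, (𝓕 φ) x • (hf2.toLp f) x = ∫ x, (𝓕 (φ : E → ℂ)) x • f x := by
    refine integral_congr_ae ?_
    filter_upwards [hf2.coeFn_toLp] with x hx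
    aesop
  rw [h3]
  have h4 := VectorFourier.integral_fourierIntegral_smul_eq_flip (e := Real.fourierChar)
    (μ := (volume : Measure E)) (ν := (volume : Measure E)) (L := innerₗ E) (f := (φ : E → ℂ))
    (g := f) Real.continuous_fourierChar (by exact continuous_inner) φ.integrable hf
  aesop

/-- Plancherel's theorem on `L¹ ∩ L²`. -/
theorem lintegral_fourier_sq {f : E → ℂ} (hf : Integrable f) (hf2 : MemLp f 2 volume) :
    ∫⁻ x, ‖𝓕 f x‖ₑ ^ 2 = ∫⁻ x, ‖f x‖ₑ ^ 2 := by
  have key : eLpNorm (𝓕 f) 2 volume = eLpNorm f 2 volume := by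
    rw [← eLpNorm_congr_ae (fourier_toLp_ae hf hf2), ← eLpNorm_congr_ae hf2.coeFn_toLp]
    have := Lp.norm_fourier_eq (hf2.toLp f)
    rw [Lp.norm_def, Lp.norm_def] at this
    exact (ENNReal.toReal_eq_toReal_iff' (Lp.eLpNorm_ne_top _) (Lp.eLpNorm_ne_top _)).1 this
  have h2 : ∀ g : E → ℂ, ∫⁻ x, ‖g x‖ₑ ^ 2 = eLpNorm g 2 volume ^ 2 := by
    intro g; rw [eLpNorm_eq_lintegral_rpow_enorm_toReal (by norm_num) (by norm_num)]
    rw [← rpow_natCast, ← rpow_mul]; simp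
  rw [h2, h2, key]

theorem lintegral_fourierInv_sq {f : E → ℂ} (hf : Integrable f) (hf2 : MemLp f 2 volume) :
    ∫⁻ x, ‖𝓕⁻ f x‖ₑ ^ 2 = ∫⁻ x, ‖f x‖ₑ ^ 2 := by
  rw [← lintegral_fourier_sq hf hf2, ← lintegral_neg_eq_self (fun x => ‖𝓕 f x‖ₑ ^ 2)]
  simp_rw [Real.fourierInv_eq_fourier_neg]

theorem Nice.memLp_two {f : E → ℂ} (hf : Nice f) : MemLp f 2 volume :=
  (memLp_two_iff_integrable_sq_norm hf.meas.aestronglyMeasurable).2 hf.integrable_sq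

theorem fourierInv_conv {F G : E → ℂ} (hF : Nice F) (hG : Nice G) (x : E) :
    𝓕⁻ (conv F G) x = 𝓕⁻ F x * 𝓕⁻ G x := by
  rw [Real.fourierInv_eq_fourier_neg, Real.fourierInv_eq_fourier_neg, Real.fourierInv_eq_fourier_neg,
    ← Real.fourier_mul_convolution_eq hF.integrable hG.integrable]
  rfl

theorem lintegral_fourierInv_mul_sq {F G : E → ℂ} (hF : Nice F) (hG : Nice G) :
    ∫⁻ x, ‖𝓕⁻ F x * 𝓕⁻ G x‖ₑ ^ 2 = ∫⁻ η, ‖conv F G η‖ₑ ^ 2 := by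
  rw [← lintegral_fourierInv_sq (hF.conv hG).integrable (hF.conv hG).memLp_two]
  simp_rw [fourierInv_conv hF hG]

theorem Nice.lintegral_sq {f : E → ℂ} (hf : Nice f) :
    ∫⁻ x, ‖f x‖ₑ ^ 2 = ofReal (∫ x, ‖f x‖ ^ 2) := by
  rw [ofReal_integral_eq_lintegral_ofReal hf.integrable_sq
    (.of_forall fun x => by positivity)]
  simp

theorem Nice.lintegral_fourierInv_four {F : E → ℂ} (hF : Nice F) :
    ∫⁻ x, ‖𝓕⁻ F x‖ₑ ^ 4 = ofReal (quartic F) := by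
  rw [← integral_conv_sq_self hF, ← (hF.conv hF).lintegral_sq, ← lintegral_fourierInv_mul_sq hF hF]
  refine lintegral_congr fun x => ?_
  rw [enorm_mul]; ring

/-- A uniform bound for the inverse transform controls the quartic energy. -/
theorem Nice.quartic_le_of_bound {F : E → ℂ} (hF : Nice F) {B : ℝ} (hB : 0 ≤ B)
    (h : ∀ x, ‖𝓕⁻ F x‖ ≤ B) : quartic F ≤ B ^ 2 * ∫ x, ‖F x‖ ^ 2 := by
  have h1 : ofReal (quartic F) ≤ ofReal (B ^ 2 * ∫ x, ‖F x‖ ^ 2) := by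
    rw [← hF.lintegral_fourierInv_four, ofReal_mul (by positivity), ← hF.lintegral_sq,
      ← lintegral_fourierInv_sq hF.integrable hF.memLp_two,
      ← lintegral_const_mul' _ _ ofReal_ne_top]
    refine lintegral_mono fun x => ?_
    have : ‖𝓕⁻ F x‖ₑ ≤ ofReal B := by rw [← ofReal_norm]; exact ofReal_le_ofReal (h x)
    calc ‖𝓕⁻ F x‖ₑ ^ 4 = ‖𝓕⁻ F x‖ₑ ^ 2 * ‖𝓕⁻ F x‖ₑ ^ 2 := by ring
      _ ≤ ofReal (B ^ 2) * ‖𝓕⁻ F x‖ₑ ^ 2 := by rw [ofReal_pow hB]; gcongr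
  exact (ENNReal.ofReal_le_ofReal_iff (by positivity)).1 h1

/-- A Fourier multiplier acts as convolution with its kernel. -/
theorem fourierInv_mul_fourier {m f : E → ℂ} (hm : Integrable m) (hf : Integrable f) (x : E) :
    𝓕⁻ (fun ξ => m ξ * 𝓕 f ξ) x = ∫ y, f y * 𝓕⁻ m (x - y) := by
  have hInt : Integrable (uncurry fun ξ y : E =>
      (𝐞 (inner ℝ ξ x) : ℂ) * (m ξ * ((𝐞 (-inner ℝ y ξ) : ℂ) * f y))) (volume.prod volume) := by
    have h0 := hm.mul_prod hf
    refine h0.congr' ?_ ?_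
    · have c1 : Continuous fun p : E × E => (𝐞 (inner ℝ p.1 x) : ℂ) := by fun_prop
      have c2 : Continuous fun p : E × E => (𝐞 (-inner ℝ p.2 p.1) : ℂ) := by fun_prop
      exact c1.aestronglyMeasurable.mul (hm.aestronglyMeasurable.comp_fst.mul
        (c2.aestronglyMeasurable.mul hf.aestronglyMeasurable.comp_snd))
    · refine .of_forall fun p => ?_
      simp only [uncurry, norm_mul, norm_fourierChar, one_mul]
  calc 𝓕⁻ (fun ξ => m ξ * 𝓕 f ξ) x
      = ∫ ξ, ∫ y, (𝐞 (inner ℝ ξ x) : ℂ) * (m ξ * ((𝐞 (-inner ℝ y ξ) : ℂ) * f y)) := by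
        rw [fourierInv_eq]
        refine integral_congr_ae (.of_forall fun ξ => ?_)
        simp only [smul_def, smul_eq_mul]; rw [integral_const_mul, integral_const_mul, fourier_eq]
        bound
    _ = ∫ y, ∫ ξ, (𝐞 (inner ℝ ξ x) : ℂ) * (m ξ * ((𝐞 (-inner ℝ y ξ) : ℂ) * f y)) :=
        integral_integral_swap hInt
    _ = _ := by
        refine integral_congr_ae (.of_forall fun y => ?_)
        simp only; rw [fourierInv_eq, ← integral_const_mul]
        refine integral_congr_ae (.of_forall fun ξ => ?_)
        simp only [smul_def, smul_eq_mul]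
        have e : inner ℝ ξ (x - y) = inner ℝ ξ x + -inner ℝ y ξ := by
          rw [inner_sub_right, real_inner_comm y ξ]; ring
        rw [e, AddChar.map_add_eq_mul, coe_mul]; ring

/-- Composing a one-dimensional multiplier with a linear functional averages along a line. -/
theorem fourierInv_line_multiplier {M : ℝ → ℂ} (hM : Integrable (𝓕⁻ M))
    (hinv : ∀ y, 𝓕 (𝓕⁻ M) y = M y) {G : E → ℂ} (hG : Integrable G) (v x : E) :
    𝓕⁻ (fun ξ => M (inner ℝ v ξ) * G ξ) x = ∫ r : ℝ, 𝓕⁻ M r * 𝓕⁻ G (x - r • v) := by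
  have hInt : Integrable (uncurry fun (ξ : E) (r : ℝ) =>
      (𝐞 (inner ℝ ξ x) : ℂ) * (G ξ * ((𝐞 (-(inner ℝ r (inner ℝ v ξ))) : ℂ) * 𝓕⁻ M r)))
      (volume.prod volume) := by
    have h0 := hG.mul_prod hM
    refine h0.congr' ?_ ?_
    · have c1 : Continuous fun p : E × ℝ => (𝐞 (inner ℝ p.1 x) : ℂ) := by fun_prop
      have c2 : Continuous fun p : E × ℝ => (𝐞 (-(inner ℝ p.2 (inner ℝ v p.1))) : ℂ) := by fun_prop
      exact c1.aestronglyMeasurable.mul (hG.aestronglyMeasurable.comp_fst.mul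
        (c2.aestronglyMeasurable.mul hM.aestronglyMeasurable.comp_snd))
    · refine .of_forall fun p => ?_
      simp only [uncurry, norm_mul, norm_fourierChar, one_mul]
  calc 𝓕⁻ (fun ξ => M (inner ℝ v ξ) * G ξ) x
      = ∫ ξ, ∫ r : ℝ, (𝐞 (inner ℝ ξ x) : ℂ) *
          (G ξ * ((𝐞 (-(inner ℝ r (inner ℝ v ξ))) : ℂ) * 𝓕⁻ M r)) := by
        rw [fourierInv_eq]
        refine integral_congr_ae (.of_forall fun ξ => ?_)
        simp only [smul_def, smul_eq_mul]
        rw [integral_const_mul, integral_const_mul, ← hinv (inner ℝ v ξ), fourier_eq]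
        simp only [smul_def, smul_eq_mul]; ring
    _ = ∫ r : ℝ, ∫ ξ, (𝐞 (inner ℝ ξ x) : ℂ) *
          (G ξ * ((𝐞 (-(inner ℝ r (inner ℝ v ξ))) : ℂ) * 𝓕⁻ M r)) :=
        integral_integral_swap hInt
    _ = _ := by
        refine integral_congr_ae (.of_forall fun r => ?_)
        simp only; rw [fourierInv_eq (V := E), ← integral_const_mul]
        refine integral_congr_ae (.of_forall fun ξ => ?_)
        simp only [smul_def, smul_eq_mul]
        have e : inner ℝ ξ (x - r • v) = inner ℝ ξ x + -(inner ℝ r (inner ℝ v ξ) : ℝ) := by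
          rw [inner_sub_right, inner_smul_right, real_inner_comm v ξ]; simp; ring
        rw [e, AddChar.map_add_eq_mul, coe_mul]; ring

end Plancherel

section Spacetime

/-- The half-wave evolution of the frequency profile `H`. -/
def waveProfile (H : Euc 2 → ℂ) (t : ℝ) (ξ : Euc 2) : ℂ := (𝐞 (t * ‖ξ‖) : ℂ) * H ξ

/-- The profile `H` spread over a neighbourhood of the light cone. -/
def coneLift (k : ℝ → ℝ) (H : Euc 2 → ℂ) (z : Euc 2 × ℝ) : ℂ := (k (z.2 - ‖z.1‖) : ℂ) * H z.1

/-- Bounded measurable cutoffs on the line with bounded support. -/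
abbrev NiceReal (k : ℝ → ℝ) : Prop := Nice fun x => (k x : ℂ)

theorem NiceReal.measurable {k : ℝ → ℝ} (hk : NiceReal k) : Measurable k :=
  Complex.measurable_re.comp hk.meas

theorem Nice.coneLift {k : ℝ → ℝ} {H : Euc 2 → ℂ} (hk : NiceReal k) (hH : Nice H) :
    Nice (coneLift k H) := by
  obtain ⟨M, hM0, hM⟩ := hk.bdd
  obtain ⟨ρ, hρ0, hρ⟩ := hk.supp
  obtain ⟨M', hM0', hM'⟩ := hH.bdd
  obtain ⟨ρ', hρ0', hρ'⟩ := hH.supp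
  refine ⟨(hk.meas.comp (measurable_snd.sub measurable_fst.norm)).mul (hH.meas.comp measurable_fst),
    ⟨M * M', by positivity, fun z => ?_⟩, ⟨ρ + ρ', by positivity, fun z hz => ?_⟩⟩
  · unfold _root_.coneLift; rw [norm_mul]
    bound
  · have h1 := hρ _ (left_ne_zero_of_mul hz)
    have h2 := hρ' _ (right_ne_zero_of_mul hz)
    rw [norm_eq_abs, abs_le] at h1
    have h3 := norm_nonneg z.1
    rw [Prod.norm_def, max_le_iff]
    refine ⟨by linarith, ?_⟩
    rw [norm_eq_abs, abs_le]; grind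

theorem Nice.waveProfile {H : Euc 2 → ℂ} (hH : Nice H) (t : ℝ) : Nice (waveProfile H t) := by
  have hc : Continuous fun ξ : Euc 2 => (𝐞 (t * ‖ξ‖) : ℂ) := by fun_prop
  have := hH.mul_bdd hc.measurable ⟨1, fun x => (norm_fourierChar _).le⟩
  refine (congrArg Nice (funext fun x => ?_)).mp this
  unfold _root_.waveProfile; ring

theorem integral_fourierChar_shift (k : ℝ → ℝ) (t a : ℝ) :
    ∫ ν : ℝ, (𝐞 (ν * t) : ℂ) * (k (ν - a) : ℂ) = (𝐞 (t * a) : ℂ) * 𝓕⁻ (fun x => (k x : ℂ)) t := by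
  rw [← integral_add_right_eq_self _ a, fourierInv_eq, ← integral_const_mul]
  refine integral_congr_ae (.of_forall fun ν => ?_)
  simp only [add_sub_cancel_right, smul_def, smul_eq_mul]
  have e : (ν + a) * t = t * a + inner ℝ ν t := by simp; ring
  rw [e, AddChar.map_add_eq_mul, coe_mul]; ring

instance : (volume : Measure (ℝ × (Euc 2 × ℝ))).IsAddHaarMeasure :=
  inferInstanceAs (Measure.prod (volume : Measure ℝ) (volume : Measure (Euc 2 × ℝ))).IsAddHaarMeasure

/-- The partial Fourier transform of the self-convolution of a lifted profile. -/
theorem fourierInv_conv_coneLift {k : ℝ → ℝ} {H : Euc 2 → ℂ} (hk : NiceReal k) (hH : Nice H)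
    (ξ : Euc 2) (t : ℝ) :
    𝓕⁻ (fun ν => conv (coneLift k H) (coneLift k H) (ξ, ν)) t =
      𝓕⁻ (fun x => (k x : ℂ)) t ^ 2 * conv (waveProfile H t) (waveProfile H t) ξ := by
  set F := coneLift k H with hFd
  set ψ := 𝓕⁻ (fun x => (k x : ℂ)) t
  have hF : Nice F := Nice.coneLift hk hH
  obtain ⟨M, hM0, hM⟩ := hF.bdd
  obtain ⟨ρ, hρ0, hρ⟩ := hF.supp
  have hce : Continuous fun p : ℝ × (Euc 2 × ℝ) => (𝐞 (p.1 * t) : ℂ) := by fun_prop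
  have hT : Measurable fun p : ℝ × (Euc 2 × ℝ) => (ξ, p.1) - p.2 := by fun_prop
  have hInt : Integrable (uncurry fun (ν : ℝ) (z : Euc 2 × ℝ) =>
      (𝐞 (ν * t) : ℂ) * (F z * F ((ξ, ν) - z))) (volume.prod volume) := by
    refine integrable_of_bdd_supp (V := ℝ × (Euc 2 × ℝ)) (M := M * M) (ρ := ρ + ρ) ?_ ?_ ?_
    · exact (hce.measurable.mul ((hF.meas.comp measurable_snd).mul
        (hF.meas.comp hT))).aestronglyMeasurable
    · rintro ⟨ν, z⟩; simp only [uncurry, norm_mul, norm_fourierChar, one_mul]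
      bound
    · rintro ⟨ν, z⟩ hz
      have h0 := right_ne_zero_of_mul hz
      have h1 := hρ _ (left_ne_zero_of_mul h0)
      have h2 := hρ _ (right_ne_zero_of_mul h0)
      have h3 := (norm_snd_le ((ξ, ν) - z)).trans h2
      have h4 := (norm_snd_le z).trans h1
      simp only [Prod.snd_sub] at h3; rw [Prod.norm_def, max_le_iff]
      refine ⟨?_, by linarith⟩
      have := norm_add_le (ν - z.2) z.2
      grind
  have hin : ∀ z : Euc 2 × ℝ, ∫ ν : ℝ, (𝐞 (ν * t) : ℂ) * (F z * F ((ξ, ν) - z)) =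
      F z * (H (ξ - z.1) * (𝐞 (t * (z.2 + ‖ξ - z.1‖)) : ℂ)) * ψ := by
    intro z
    rw [mul_assoc, mul_assoc, ← integral_fourierChar_shift, ← integral_const_mul, ← integral_const_mul]
    refine integral_congr_ae (.of_forall fun ν => ?_)
    simp only [hFd, coneLift, Prod.fst_sub, Prod.snd_sub]; rw [sub_sub]; ring
  have hbd : ∀ z : Euc 2 × ℝ, Measurable fun z : Euc 2 × ℝ =>
      H (ξ - z.1) * (𝐞 (t * (z.2 + ‖ξ - z.1‖)) : ℂ) := by
    intro z
    have hc : Continuous fun z : Euc 2 × ℝ => (𝐞 (t * (z.2 + ‖ξ - z.1‖)) : ℂ) := by fun_prop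
    exact (hH.meas.comp (measurable_const.sub measurable_fst)).mul hc.measurable
  obtain ⟨MH, _, hMH⟩ := hH.bdd
  have hg : Nice fun z : Euc 2 × ℝ => F z * (H (ξ - z.1) * (𝐞 (t * (z.2 + ‖ξ - z.1‖)) : ℂ)) := by
    refine hF.mul_bdd (hbd 0) ⟨MH, fun z => ?_⟩
    rw [norm_mul, norm_fourierChar, mul_one]; exact hMH _
  calc 𝓕⁻ (fun ν => conv F F (ξ, ν)) t
      = ∫ ν : ℝ, ∫ z : Euc 2 × ℝ, (𝐞 (ν * t) : ℂ) * (F z * F ((ξ, ν) - z)) := by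
        rw [fourierInv_eq]
        refine integral_congr_ae (.of_forall fun ν => ?_)
        simp only [smul_def, smul_eq_mul]; rw [integral_const_mul]
        have : (inner ℝ ν t : ℝ) = ν * t := by simp; ring
        rw [this]; rfl
    _ = ∫ z : Euc 2 × ℝ, ∫ ν : ℝ, (𝐞 (ν * t) : ℂ) * (F z * F ((ξ, ν) - z)) :=
        integral_integral_swap hInt
    _ = (∫ z : Euc 2 × ℝ, F z * (H (ξ - z.1) * (𝐞 (t * (z.2 + ‖ξ - z.1‖)) : ℂ))) * ψ := by
        simp_rw [hin]; rw [integral_mul_const]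
    _ = (∫ ζ : Euc 2, ∫ μ : ℝ, F (ζ, μ) * (H (ξ - ζ) * (𝐞 (t * (μ + ‖ξ - ζ‖)) : ℂ))) * ψ := by
        congr 1; exact integral_prod _ hg.integrable
    _ = (∫ ζ : Euc 2, waveProfile H t ζ * waveProfile H t (ξ - ζ) * ψ) * ψ := by
        congr 1
        refine integral_congr_ae (.of_forall fun ζ => ?_)
        have e : ∀ μ : ℝ, F (ζ, μ) * (H (ξ - ζ) * (𝐞 (t * (μ + ‖ξ - ζ‖)) : ℂ)) =
            H ζ * waveProfile H t (ξ - ζ) * ((𝐞 (μ * t) : ℂ) * (k (μ - ‖ζ‖) : ℂ)) := by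
          intro μ
          have : t * (μ + ‖ξ - ζ‖) = μ * t + t * ‖ξ - ζ‖ := by ring
          rw [this, AddChar.map_add_eq_mul, coe_mul]; simp only [hFd, coneLift, waveProfile]; ring
        simp_rw [e]; rw [integral_const_mul, integral_fourierChar_shift]; unfold waveProfile; ring
    _ = _ := by rw [integral_mul_const]; unfold conv; ring

theorem measurable_conv_waveProfile {H : Euc 2 → ℂ} (hH : Nice H) :
    Measurable fun p : ℝ × Euc 2 => conv (waveProfile H p.1) (waveProfile H p.1) p.2 := by
  have hc1 : Continuous fun q : (ℝ × Euc 2) × Euc 2 => (𝐞 (q.1.1 * ‖q.2‖) : ℂ) := by fun_prop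
  have hc2 : Continuous fun q : (ℝ × Euc 2) × Euc 2 => (𝐞 (q.1.1 * ‖q.1.2 - q.2‖) : ℂ) := by
    fun_prop
  refine (StronglyMeasurable.integral_prod_right (f := fun (p : ℝ × Euc 2) (ζ : Euc 2) =>
    waveProfile H p.1 ζ * waveProfile H p.1 (p.2 - ζ)) ?_).measurable
  apply Measurable.stronglyMeasurable
  exact (hc1.measurable.mul (hH.meas.comp measurable_snd)).mul
    (hc2.measurable.mul (hH.meas.comp (by fun_prop)))

theorem measurable_wave {H : Euc 2 → ℂ} (hH : Nice H) :
    Measurable fun p : ℝ × Euc 2 => 𝓕⁻ (waveProfile H p.1) p.2 := by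
  have hc1 : Continuous fun q : (ℝ × Euc 2) × Euc 2 => (𝐞 (q.1.1 * ‖q.2‖) : ℂ) := by fun_prop
  have hc2 : Continuous fun q : (ℝ × Euc 2) × Euc 2 => (𝐞 (inner ℝ q.2 q.1.2) : ℂ) := by fun_prop
  simp_rw [fourierInv_eq, smul_def, smul_eq_mul]
  refine (StronglyMeasurable.integral_prod_right (f := fun (p : ℝ × Euc 2) (ζ : Euc 2) =>
    (𝐞 (inner ℝ ζ p.2) : ℂ) * waveProfile H p.1 ζ) ?_).measurable
  apply Measurable.stronglyMeasurable
  exact hc2.measurable.mul (hc1.measurable.mul (hH.meas.comp measurable_snd))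

theorem Nice.slice {F : Euc 2 × ℝ → ℂ} (hF : Nice F) (ξ : Euc 2) : Nice fun ν => F (ξ, ν) := by
  obtain ⟨M, hM0, hM⟩ := hF.bdd
  obtain ⟨ρ, hρ0, hρ⟩ := hF.supp
  exact ⟨hF.meas.comp measurable_prodMk_left, ⟨M, hM0, fun x => hM _⟩, ⟨ρ, hρ0, fun x hx =>
    (norm_snd_le (ξ, x)).trans (hρ _ hx)⟩⟩

/-- The space-time `L⁴` norm of a time-localized wave is the quartic energy of its lift. -/
theorem lintegral_wave_four {k : ℝ → ℝ} {H : Euc 2 → ℂ} (hk : NiceReal k) (hH : Nice H) :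
    ∫⁻ t : ℝ, ‖𝓕⁻ (fun x => (k x : ℂ)) t‖ₑ ^ 4 * ∫⁻ x, ‖𝓕⁻ (waveProfile H t) x‖ₑ ^ 4 =
      ofReal (quartic (coneLift k H)) := by
  have hF := Nice.coneLift hk hH
  have hψ : Continuous (𝓕⁻ (fun x => (k x : ℂ))) := continuous_fourierInv hk.integrable
  have hC := hF.conv hF
  calc ∫⁻ t : ℝ, ‖𝓕⁻ (fun x => (k x : ℂ)) t‖ₑ ^ 4 * ∫⁻ x, ‖𝓕⁻ (waveProfile H t) x‖ₑ ^ 4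
      = ∫⁻ t : ℝ, ∫⁻ ξ, ‖𝓕⁻ (fun x => (k x : ℂ)) t ^ 2 *
          conv (waveProfile H t) (waveProfile H t) ξ‖ₑ ^ 2 := by
        refine lintegral_congr fun t => ?_
        have h4 : ∫⁻ x, ‖𝓕⁻ (waveProfile H t) x‖ₑ ^ 4 =
            ∫⁻ ξ, ‖conv (waveProfile H t) (waveProfile H t) ξ‖ₑ ^ 2 := by
          rw [← lintegral_fourierInv_mul_sq (hH.waveProfile t) (hH.waveProfile t)]
          refine lintegral_congr fun x => ?_
          rw [enorm_mul]; ring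
        rw [h4, ← lintegral_const_mul' _ _ (by simp)]
        refine lintegral_congr fun ξ => ?_
        rw [enorm_mul, enorm_pow]; ring
    _ = ∫⁻ ξ, ∫⁻ t : ℝ, ‖𝓕⁻ (fun x => (k x : ℂ)) t ^ 2 *
          conv (waveProfile H t) (waveProfile H t) ξ‖ₑ ^ 2 := by
        refine lintegral_lintegral_swap (f := fun t ξ => ‖𝓕⁻ (fun x => (k x : ℂ)) t ^ 2 *
          conv (waveProfile H t) (waveProfile H t) ξ‖ₑ ^ 2) ?_
        exact (((hψ.measurable.comp measurable_fst).pow_const 2).mul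
          (measurable_conv_waveProfile hH)).enorm.pow_const 2 |>.aemeasurable
    _ = ∫⁻ ξ, ∫⁻ ν : ℝ, ‖conv (coneLift k H) (coneLift k H) (ξ, ν)‖ₑ ^ 2 := by
        refine lintegral_congr fun ξ => ?_
        have hs := hC.slice ξ
        rw [← lintegral_fourierInv_sq hs.integrable hs.memLp_two]
        simp_rw [fourierInv_conv_coneLift hk hH]
    _ = ∫⁻ z, ‖conv (coneLift k H) (coneLift k H) z‖ₑ ^ 2 := by
        exact (lintegral_prod _ (hC.meas.enorm.pow_const 2).aemeasurable).symm
    _ = _ := by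
        rw [← integral_conv_sq_self hF, ofReal_integral_eq_lintegral_ofReal hC.integrable_sq
          (.of_forall fun x => by positivity)]
        simp

end Spacetime

section Cotlar

variable {V : Type*} [NormedAddCommGroup V] [NormedSpace ℝ V] [FiniteDimensional ℝ V]
  [MeasureSpace V] [BorelSpace V] [(volume : Measure V).IsAddHaarMeasure]

theorem Nice.integrable_conv {F G : V → ℂ} (hF : Nice F) (hG : Nice G) (η : V) :
    Integrable fun ζ => F ζ * G (η - ζ) := by
  obtain ⟨M, _, hM⟩ := hG.bdd
  exact (hF.mul_bdd (hG.meas.comp (measurable_const.sub measurable_id)) ⟨M, fun x => hM _⟩).integrable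

/-- Cutting a function to a half space increases its quartic energy by at most a constant. -/
theorem quartic_halfSpace_le {G : V → ℂ} (hG : Nice G) (l : V →L[ℝ] ℝ) :
    quartic ({ζ | 0 < l ζ}.indicator G) ≤ 64 * quartic G ∧
      quartic ({ζ | l ζ ≤ 0}.indicator G) ≤ 64 * quartic G := by
  have hlm : Measurable l := l.continuous.measurable
  set P := {ζ | 0 < l ζ}.indicator G with hP
  set N := {ζ | l ζ ≤ 0}.indicator G with hN
  have nP : Nice P := hG.indicator (measurableSet_lt measurable_const hlm)
  have nN : Nice N := hG.indicator (measurableSet_le hlm measurable_const)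
  have hsum : ∀ ζ, G ζ = P ζ + N ζ := by
    intro ζ
    by_cases h : 0 < l ζ
    · simp_all
    · simp_all
  have pP : ∀ ζ, P ζ ≠ 0 → 0 < l ζ := fun ζ h => by
    by_contra hc; exact h (Set.indicator_of_notMem (s := {ζ | 0 < l ζ}) hc G)
  have pN : ∀ ζ, N ζ ≠ 0 → l ζ ≤ 0 := fun ζ h => by
    by_contra hc; exact h (Set.indicator_of_notMem (s := {ζ | l ζ ≤ 0}) hc G)
  have cGl : ∀ {K : V → ℂ}, Nice K → ∀ η, conv G K η = conv P K η + conv N K η := by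
    intro K hK η; unfold conv
    rw [← integral_add (nP.integrable_conv hK η) (nN.integrable_conv hK η)]; grind
  have cGr : ∀ {K : V → ℂ}, Nice K → ∀ η, conv K G η = conv K P η + conv K N η := by
    intro K hK η; unfold conv
    rw [← integral_add (hK.integrable_conv nP η) (hK.integrable_conv nN η)]; grind
  have zP : ∀ η, l η ≤ 0 → conv P P η = 0 := by
    intro η hη; rw [conv, ← integral_zero V ℂ]; congr 1; funext ζ
    by_contra h
    have h1 := pP _ (left_ne_zero_of_mul h)
    have h2 := pP _ (right_ne_zero_of_mul h)
    grind
  have zN : ∀ η, 0 < l η → conv N N η = 0 := by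
    intro η hη; rw [conv, ← integral_zero V ℂ]; congr 1; funext ζ
    grind
  have sq2 : ∀ a b : ℂ, ‖a - b‖ ^ 2 ≤ 2 * ‖a‖ ^ 2 + 2 * ‖b‖ ^ 2 := by
    intro a b
    have := norm_sub_le a b
    nlinarith [sq_nonneg (‖a‖ - ‖b‖), norm_nonneg (a - b), norm_nonneg a, norm_nonneg b]
  have bP : ∀ η, ‖conv P P η‖ ^ 2 ≤ 2 * ‖conv G P η‖ ^ 2 + 2 * ‖conv N G η‖ ^ 2 := by
    intro η
    by_cases h : 0 < l η
    · have : conv P P η = conv G P η - conv N G η := by grind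
      grind
    · rw [zP η (not_lt.1 h)]; simp; positivity
  have bN : ∀ η, ‖conv N N η‖ ^ 2 ≤ 2 * ‖conv G N η‖ ^ 2 + 2 * ‖conv P G η‖ ^ 2 := by
    intro η
    by_cases h : 0 < l η
    · rw [zN η h]; simp; positivity
    · have : conv N N η = conv G N η - conv P G η := by grind
      grind
  have int : ∀ {A B C D E K : V → ℂ}, Nice A → Nice B → Nice C → Nice D → Nice E → Nice K →
      (∀ η, ‖conv A B η‖ ^ 2 ≤ 2 * ‖conv C D η‖ ^ 2 + 2 * ‖conv E K η‖ ^ 2) →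
      ∫ η, ‖conv A B η‖ ^ 2 ≤ 2 * (√(quartic C) * √(quartic D)) + 2 * (√(quartic E) * √(quartic K)) := by
    intro A B C D E K hA hB hC hD hE hK h
    have i1 := (hC.conv hD).integrable_sq
    have i2 := (hE.conv hK).integrable_sq
    refine (integral_mono (hA.conv hB).integrable_sq ((i1.const_mul 2).add (i2.const_mul 2)) h).trans ?_
    rw [integral_add' (i1.const_mul 2) (i2.const_mul 2), integral_const_mul, integral_const_mul]
    have := integral_conv_sq_le_sqrt hC hD
    have := integral_conv_sq_le_sqrt hE hK
    linarith
  have eP := int nP nP hG nP nN hG bP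
  have eN := int nN nN hG nN nP hG bN
  rw [integral_conv_sq_self nP] at eP; rw [integral_conv_sq_self nN] at eN
  have qP := sq_sqrt (quartic_nonneg P)
  have qN := sq_sqrt (quartic_nonneg N)
  have qG := sq_sqrt (quartic_nonneg G)
  have b0 := sqrt_nonneg (quartic N)
  have c0 := sqrt_nonneg (quartic G)
  set a := √(quartic P)
  set b := √(quartic N)
  set c := √(quartic G)
  have hab : a + b ≤ 8 * c := by
    by_contra hc
    push Not at hc; nlinarith [sq_nonneg (a - b)]
  constructor
  · nlinarith
  · nlinarith

theorem Nice.quartic_indicator_le {G : V → ℂ} (hG : Nice G) (l : V →L[ℝ] ℝ) (s : Set V)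
    (hs : s = {ζ | 0 < l ζ} ∨ s = {ζ | l ζ ≤ 0} ∨ s = {ζ | l ζ < 0} ∨ s = {ζ | 0 ≤ l ζ}) :
    Nice (s.indicator G) ∧ quartic (s.indicator G) ≤ 64 * quartic G := by
  have hlm : Measurable l := l.continuous.measurable
  rcases hs with h | h | h | h <;> subst h
  · exact ⟨hG.indicator (measurableSet_lt measurable_const hlm), (quartic_halfSpace_le hG l).1⟩
  · exact ⟨hG.indicator (measurableSet_le hlm measurable_const), (quartic_halfSpace_le hG l).2⟩
  · refine ⟨hG.indicator (measurableSet_lt hlm measurable_const), ?_⟩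
    have := (quartic_halfSpace_le hG (-l)).1
    simpa using this
  · refine ⟨hG.indicator (measurableSet_le measurable_const hlm), ?_⟩
    have := (quartic_halfSpace_le hG (-l)).2
    simpa using this

end Cotlar

section Expansion

/-- A function of two variables with bounded mixed derivative is a superposition of products of
step functions. -/
theorem exists_step_expansion {b bu buv : ℝ → ℝ → ℝ} {bv : ℝ → ℝ} {B : ℝ}
    (h1 : ∀ u ∈ Icc (0 : ℝ) 1, ∀ v ∈ Icc (0 : ℝ) 1, HasDerivAt (fun u => b u v) (bu u v) u)
    (h2 : ∀ u ∈ Icc (0 : ℝ) 1, ∀ v ∈ Icc (0 : ℝ) 1, HasDerivAt (fun v => bu u v) (buv u v) v)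
    (h3 : ∀ v ∈ Icc (0 : ℝ) 1, HasDerivAt (fun v => b 0 v) (bv v) v)
    (m1 : Measurable fun u => bu u 0) (m2 : Measurable (uncurry buv)) (m3 : Measurable bv)
    (c0 : |b 0 0| ≤ B) (c1 : ∀ u ∈ Icc (0 : ℝ) 1, |bu u 0| ≤ B)
    (c2 : ∀ u ∈ Icc (0 : ℝ) 1, ∀ v ∈ Icc (0 : ℝ) 1, |buv u v| ≤ B)
    (c3 : ∀ v ∈ Icc (0 : ℝ) 1, |bv v| ≤ B)
    (i1 : ∀ v ∈ Icc (0 : ℝ) 1, ContinuousOn (fun u => bu u v) (Icc 0 1))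
    (i2 : ∀ u ∈ Icc (0 : ℝ) 1, ContinuousOn (fun v => buv u v) (Icc 0 1))
    (i3 : ContinuousOn bv (Icc 0 1)) :
    ∃ c : ℝ × ℝ → ℝ, Measurable c ∧ (∀ x ∈ Icc (-1 : ℝ) 1 ×ˢ Icc (-1 : ℝ) 1, |c x| ≤ B) ∧
      ∀ u ∈ Icc (0 : ℝ) 1, ∀ v ∈ Icc (0 : ℝ) 1, b u v =
        ∫ x in Ioc (-1 : ℝ) 1 ×ˢ Ioc (-1 : ℝ) 1,
          c x * ((Ioi x.1).indicator (fun _ => (1 : ℝ)) u * (Ioi x.2).indicator (fun _ => (1 : ℝ)) v) := by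
  set c : ℝ × ℝ → ℝ := fun x => if x.1 ≤ 0 then (if x.2 ≤ 0 then b 0 0 else bv x.2)
    else (if x.2 ≤ 0 then bu x.1 0 else buv x.1 x.2) with hc
  have hcm : Measurable c := by
    refine Measurable.ite (measurableSet_le measurable_fst measurable_const) ?_ ?_
    · exact Measurable.ite (measurableSet_le measurable_snd measurable_const) measurable_const
        (m3.comp measurable_snd)
    · exact Measurable.ite (measurableSet_le measurable_snd measurable_const)
        (m1.comp measurable_fst) m2
  have hcb : ∀ x ∈ Icc (-1 : ℝ) 1 ×ˢ Icc (-1 : ℝ) 1, |c x| ≤ B := by grind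
  refine ⟨c, hcm, hcb, fun u hu v hv => ?_⟩
  set f : ℝ × ℝ → ℝ := fun x => c x * ((Ioi x.1).indicator (fun _ => (1 : ℝ)) u *
    (Ioi x.2).indicator (fun _ => (1 : ℝ)) v) with hf
  have e1 : ∀ x : ℝ × ℝ, f x = (Iio u ×ˢ Iio v).indicator c x := by
    rintro ⟨x, y⟩
    by_cases h : x < u <;> by_cases h' : y < v <;> simp [hf, indicator, h, h']
  have hsub : (Ioc (-1 : ℝ) 1 ×ˢ Ioc (-1 : ℝ) 1) ⊆ Icc (-1 : ℝ) 1 ×ˢ Icc (-1 : ℝ) 1 :=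
    prod_mono Ioc_subset_Icc_self Ioc_subset_Icc_self
  have hS : (Ioc (-1 : ℝ) 1 ×ˢ Ioc (-1 : ℝ) 1) ∩ (Iio u ×ˢ Iio v) = Ioo (-1 : ℝ) u ×ˢ Ioo (-1 : ℝ) v := by
    grind
  have e2 : ∫ x in Ioc (-1 : ℝ) 1 ×ˢ Ioc (-1 : ℝ) 1, f x = ∫ x in Ioc (-1 : ℝ) u ×ˢ Ioc (-1 : ℝ) v, c x := by
    simp_rw [e1]; rw [setIntegral_indicator (measurableSet_Iio.prod measurableSet_Iio), hS]
    refine setIntegral_congr_set ?_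
    rw [Measure.volume_eq_prod]; exact Measure.set_prod_ae_eq Ioo_ae_eq_Ioc Ioo_ae_eq_Ioc
  have hInt : IntegrableOn c (Ioc (-1 : ℝ) u ×ˢ Ioc (-1 : ℝ) v) (volume.prod volume) := by
    refine Measure.integrableOn_of_bounded (M := B) ?_ hcm.aestronglyMeasurable ?_
    · rw [Measure.prod_prod]; exact ENNReal.mul_ne_top (by simp) (by simp)
    · rw [ae_restrict_iff' (measurableSet_Ioc.prod measurableSet_Ioc)]
      refine .of_forall fun x hx => hcb x ?_
      grind
  have inner : ∀ (g : ℝ → ℝ) (g0 : ℝ) (G : ℝ → ℝ), ContinuousOn g (Icc 0 1) →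
      (∀ y ∈ Icc (0 : ℝ) 1, HasDerivAt G (g y) y) → G 0 = g0 → ∀ w ∈ Icc (0 : ℝ) 1,
      ∫ y in Ioc (-1 : ℝ) w, (if y ≤ 0 then g0 else g y) = G w := by
    intro g g0 G hg hG hG0 w hw
    have hsubw : Icc 0 w ⊆ Icc (0 : ℝ) 1 := Icc_subset_Icc_right hw.2
    have ig : IntegrableOn g (Ioc 0 w) := ((hg.mono hsubw).integrableOn_compact isCompact_Icc).mono_set
      Ioc_subset_Icc_self
    have split : Ioc (-1 : ℝ) w = Ioc (-1 : ℝ) 0 ∪ Ioc 0 w := (Ioc_union_Ioc_eq_Ioc (by norm_num) hw.1).symm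
    have hdis : Disjoint (Ioc (-1 : ℝ) 0) (Ioc 0 w) := Ioc_disjoint_Ioc_of_le le_rfl
    have ea : ∀ y ∈ Ioc (-1 : ℝ) 0, (if y ≤ 0 then g0 else g y) = g0 := fun y hy => if_pos hy.2
    have eb : ∀ y ∈ Ioc 0 w, (if y ≤ 0 then g0 else g y) = g y := fun y hy => if_neg (not_le.2 hy.1)
    rw [split, setIntegral_union hdis measurableSet_Ioc]
    · rw [setIntegral_congr_fun measurableSet_Ioc ea, setIntegral_congr_fun measurableSet_Ioc eb]
      rw [← intervalIntegral.integral_of_le hw.1, intervalIntegral.integral_eq_sub_of_hasDerivAt (f := G)]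
      · simp [hG0]
      · intro y hy; rw [uIcc_of_le hw.1] at hy; grind
      · rw [intervalIntegrable_iff_integrableOn_Ioc_of_le hw.1]; exact ig
    · exact (integrableOn_congr_fun ea measurableSet_Ioc).2 (by simp)
    · exact (integrableOn_congr_fun eb measurableSet_Ioc).2 ig
  rw [e2, Measure.volume_eq_prod, setIntegral_prod _ hInt]
  have z0 : (0 : ℝ) ∈ Icc (0 : ℝ) 1 := ⟨le_rfl, zero_le_one⟩
  have e3 : ∀ x ∈ Ioc (-1 : ℝ) u, ∫ y in Ioc (-1 : ℝ) v, c (x, y) = if x ≤ 0 then b 0 v else bu x v := by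
    intro x hx
    by_cases h : x ≤ 0
    · simp only [hc, if_pos h]
      bound
    · have hx' : x ∈ Icc (0 : ℝ) 1 := ⟨(not_le.1 h).le, hx.2.trans hu.2⟩
      simp only [hc, if_neg h]
      bound
  rw [setIntegral_congr_fun measurableSet_Ioc e3]
  exact (inner (fun u => bu u v) _ (fun u => b u v) (i1 v hv) (fun y hy => h1 y hy v hv) rfl u hu).symm

/-- The step expansion of a smooth function of the normalized quadratic form. -/
theorem exists_step_expansion_quad {Ψ Ψ' Ψ'' : ℝ → ℝ} (hd : ∀ x, HasDerivAt Ψ (Ψ' x) x)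
    (hd' : ∀ x, HasDerivAt Ψ' (Ψ'' x) x) (hc : Continuous Ψ'') {B : ℝ} (hB : ∀ x, |Ψ x| ≤ B)
    (hB' : ∀ x, |Ψ' x| ≤ B) (hB'' : ∀ x, |Ψ'' x| ≤ B) {q₀ q₁ q₂ x s : ℝ} (hq₀ : |q₀| ≤ 1)
    (hq₁ : |q₁| ≤ 1) (hq₂ : |q₂| ≤ 1) (hx : 0 ≤ x) (hx1 : x ≤ 1) (hs : 0 ≤ s) (hs1 : s ≤ 1) :
    ∃ c : ℝ × ℝ → ℝ, Measurable c ∧ (∀ p ∈ Icc (-1 : ℝ) 1 ×ˢ Icc (-1 : ℝ) 1, |c p| ≤ 2000 * B) ∧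
      ∀ u ∈ Icc (0 : ℝ) 1, ∀ v ∈ Icc (0 : ℝ) 1,
        Ψ ((q₀ - q₁ * (u + v) + q₂ * (u * v)) / (1 + (x + s * u) * (x + s * v))) =
        ∫ p in Ioc (-1 : ℝ) 1 ×ˢ Ioc (-1 : ℝ) 1,
          c p * ((Ioi p.1).indicator (fun _ => (1 : ℝ)) u * (Ioi p.2).indicator (fun _ => (1 : ℝ)) v) := by
  set N : ℝ → ℝ → ℝ := fun u v => q₀ - q₁ * (u + v) + q₂ * (u * v) with hN
  set D : ℝ → ℝ → ℝ := fun u v => 1 + (x + s * u) * (x + s * v) with hD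
  set P : ℝ → ℝ → ℝ := fun u v => (-q₁ + q₂ * v) * D u v - N u v * (s * (x + s * v)) with hP
  set P' : ℝ → ℝ → ℝ := fun u v => q₂ * D u v + (-q₁ + q₂ * v) * (s * (x + s * u))
    - ((-q₁ + q₂ * u) * (s * (x + s * v)) + N u v * (s * s)) with hP'
  have hB0 : 0 ≤ B := (abs_nonneg _).trans (hB 0)
  have hDpos : ∀ u ∈ Icc (0 : ℝ) 1, ∀ v ∈ Icc (0 : ℝ) 1, 1 ≤ D u v ∧ D u v ≤ 5 := by
    intro u hu v hv
    have a0 : 0 ≤ x + s * u := add_nonneg hx (mul_nonneg hs hu.1)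
    have b0 : 0 ≤ x + s * v := add_nonneg hx (mul_nonneg hs hv.1)
    have a1 : x + s * u ≤ 2 := by nlinarith [mul_le_mul hs1 hu.2 hu.1 zero_le_one]
    have b1 : x + s * v ≤ 2 := by nlinarith [mul_le_mul hs1 hv.2 hv.1 zero_le_one]
    constructor <;> nlinarith [mul_nonneg a0 b0, mul_le_mul a1 b1 b0 (by norm_num)]
  have hDs : ∀ u v, D u v = D v u := fun u v => by simp only [hD]; ring
  have dN : ∀ u v, HasDerivAt (fun u => N u v) (-q₁ + q₂ * v) u := by
    intro u v
    have := ((((hasDerivAt_id u).add_const v).const_mul q₁).const_sub q₀).add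
      (((hasDerivAt_id u).mul_const v).const_mul q₂)
    exact this.congr_deriv (by simp)
  have dD : ∀ u v, HasDerivAt (fun u => D u v) (s * (x + s * v)) u := by
    intro u v
    have := ((((hasDerivAt_id u).const_mul s).const_add x).mul_const (x + s * v)).const_add 1
    grind
  have dR : ∀ u ∈ Icc (0 : ℝ) 1, ∀ v ∈ Icc (0 : ℝ) 1,
      HasDerivAt (fun u => N u v / D u v) (P u v / D u v ^ 2) u := by
    intro u hu v hv; exact (dN u v).div (dD u v) (by linarith [(hDpos u hu v hv).1])
  have dR2 : ∀ u ∈ Icc (0 : ℝ) 1, ∀ v ∈ Icc (0 : ℝ) 1,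
      HasDerivAt (fun v => N u v / D u v) (P v u / D v u ^ 2) v := by grind
  have dP : ∀ u v, HasDerivAt (fun v => P u v) (P' u v) v := by
    intro u v
    have dN2 : HasDerivAt (fun v => N u v) (-q₁ + q₂ * u) v := by grind
    have dD2 : HasDerivAt (fun v => D u v) (s * (x + s * u)) v := by grind
    have e1 : HasDerivAt (fun v => -q₁ + q₂ * v) q₂ v := by
      simpa using ((hasDerivAt_id v).const_mul q₂).const_add (-q₁)
    have e2 : HasDerivAt (fun v => s * (x + s * v)) (s * s) v := by
      simpa using (((hasDerivAt_id v).const_mul s).const_add x).const_mul s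
    exact (e1.mul dD2).sub (dN2.mul e2)
  have hNc : Continuous (uncurry N) := by fun_prop
  have hDc : Continuous (uncurry D) := by fun_prop
  have hPc : Continuous (uncurry P) := by fun_prop
  have hPc' : Continuous (uncurry P') := by fun_prop
  have hΨc' : Continuous Ψ' := continuous_iff_continuousAt.2 fun x => (hd' x).continuousAt
  set bu : ℝ → ℝ → ℝ := fun u v => Ψ' (N u v / D u v) * (P u v / D u v ^ 2) with hbu
  set buv : ℝ → ℝ → ℝ := fun u v => Ψ'' (N u v / D u v) * (P v u / D v u ^ 2) * (P u v / D u v ^ 2) +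
    Ψ' (N u v / D u v) * ((P' u v * D u v ^ 2 - P u v * (2 * D u v * (s * (x + s * u)))) / (D u v ^ 2) ^ 2)
    with hbuv
  have absN : ∀ u ∈ Icc (0 : ℝ) 1, ∀ v ∈ Icc (0 : ℝ) 1, |N u v| ≤ 4 := by
    intro u hu v hv; simp only [hN]; rw [abs_le] at *
    have h1 : |q₁ * (u + v)| ≤ 1 * 2 := by
      rw [abs_mul, abs_of_nonneg (add_nonneg hu.1 hv.1)]
      exact mul_le_mul (abs_le.2 hq₁) (by linarith [hu.2, hv.2]) (add_nonneg hu.1 hv.1) zero_le_one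
    have h2 : |q₂ * (u * v)| ≤ 1 * 1 := by
      rw [abs_mul, abs_of_nonneg (mul_nonneg hu.1 hv.1)]
      exact mul_le_mul (abs_le.2 hq₂) (by nlinarith [hu.1, hu.2, hv.1, hv.2]) (mul_nonneg hu.1 hv.1) zero_le_one
    rw [abs_le] at h1 h2; grind
  have absL : ∀ v ∈ Icc (0 : ℝ) 1, |-q₁ + q₂ * v| ≤ 2 := by
    intro v hv
    refine (abs_add_le _ _).trans ?_
    rw [abs_neg, abs_mul, abs_of_nonneg hv.1]; nlinarith [hv.1, hv.2, abs_nonneg q₂]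
  have absS : ∀ v ∈ Icc (0 : ℝ) 1, |s * (x + s * v)| ≤ 2 := by
    intro v hv
    have b0 : 0 ≤ x + s * v := add_nonneg hx (mul_nonneg hs hv.1)
    have b1 : x + s * v ≤ 2 := by nlinarith [mul_le_mul hs1 hv.2 hv.1 zero_le_one]
    rw [abs_of_nonneg (mul_nonneg hs b0)]; nlinarith
  have absD : ∀ u ∈ Icc (0 : ℝ) 1, ∀ v ∈ Icc (0 : ℝ) 1, |D u v| ≤ 5 := by
    intro u hu v hv; grind
  have absP : ∀ u ∈ Icc (0 : ℝ) 1, ∀ v ∈ Icc (0 : ℝ) 1, |P u v| ≤ 18 := by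
    intro u hu v hv; simp only [hP]
    refine (abs_sub _ _).trans ?_
    rw [abs_mul, abs_mul]
    have := mul_le_mul (absL v hv) (absD u hu v hv) (abs_nonneg _) (by norm_num)
    have := mul_le_mul (absN u hu v hv) (absS v hv) (abs_nonneg _) (by norm_num)
    linarith
  have absP' : ∀ u ∈ Icc (0 : ℝ) 1, ∀ v ∈ Icc (0 : ℝ) 1, |P' u v| ≤ 17 := by
    intro u hu v hv; simp only [hP']
    refine (abs_sub _ _).trans ?_
    have t1 := mul_le_mul hq₂ (absD u hu v hv) (abs_nonneg _) (by norm_num)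
    have t2 := mul_le_mul (absL v hv) (absS u hu) (abs_nonneg _) (by norm_num)
    have t3 := mul_le_mul (absL u hu) (absS v hv) (abs_nonneg _) (by norm_num)
    have hss : |s * s| ≤ 1 := by rw [abs_of_nonneg (mul_nonneg hs hs)]; nlinarith
    have t4 := mul_le_mul (absN u hu v hv) hss (abs_nonneg _) (by norm_num)
    rw [← abs_mul] at t1 t2 t3 t4
    have := abs_add_le (q₂ * D u v) ((-q₁ + q₂ * v) * (s * (x + s * u)))
    have := abs_add_le ((-q₁ + q₂ * u) * (s * (x + s * v))) (N u v * (s * s))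
    linarith
  have absRu : ∀ u ∈ Icc (0 : ℝ) 1, ∀ v ∈ Icc (0 : ℝ) 1, |P u v / D u v ^ 2| ≤ 18 := by
    intro u hu v hv
    have h1 := (hDpos u hu v hv).1
    rw [abs_div, abs_of_pos (by positivity : 0 < D u v ^ 2)]
    exact (div_le_self (abs_nonneg _) (by nlinarith)).trans (absP u hu v hv)
  have absRuv : ∀ u ∈ Icc (0 : ℝ) 1, ∀ v ∈ Icc (0 : ℝ) 1,
      |(P' u v * D u v ^ 2 - P u v * (2 * D u v * (s * (x + s * u)))) / (D u v ^ 2) ^ 2| ≤ 785 := by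
    intro u hu v hv
    have h1 := (hDpos u hu v hv).1
    have h5 := (hDpos u hu v hv).2
    have hD2 : D u v ^ 2 ≤ 25 := by nlinarith
    have hD1 : 1 ≤ D u v ^ 2 := by nlinarith
    rw [abs_div, abs_of_pos (by positivity : 0 < (D u v ^ 2) ^ 2)]
    refine (div_le_self (abs_nonneg _) (by nlinarith)).trans ?_
    refine (abs_sub _ _).trans ?_
    rw [abs_mul, abs_mul, abs_mul, abs_mul 2]
    have t1 : |P' u v| * |D u v ^ 2| ≤ 17 * 25 := mul_le_mul (absP' u hu v hv)
      (by rw [abs_of_pos (by linarith)]; exact hD2) (abs_nonneg _) (by norm_num)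
    have t2 : |(2 : ℝ)| * |D u v| * |s * (x + s * u)| ≤ 10 * 2 := mul_le_mul
      (by rw [abs_of_pos (by norm_num : (0 : ℝ) < 2)]; linarith [absD u hu v hv]) (absS u hu)
      (abs_nonneg _) (by norm_num)
    have t3 := mul_le_mul (absP u hu v hv) t2 (by positivity) (by norm_num)
    linarith
  have z0 : (0 : ℝ) ∈ Icc (0 : ℝ) 1 := ⟨le_rfl, zero_le_one⟩
  have contR : ∀ {f g : ℝ → ℝ}, Continuous f → Continuous g → MapsTo f (Icc 0 1) (Icc 0 1) →
      MapsTo g (Icc 0 1) (Icc 0 1) → ContinuousOn (fun y => N (f y) (g y) / D (f y) (g y)) (Icc (0 : ℝ) 1) ∧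
      ContinuousOn (fun y => P (f y) (g y) / D (f y) (g y) ^ 2) (Icc (0 : ℝ) 1) ∧
      ContinuousOn (fun y => (P' (f y) (g y) * D (f y) (g y) ^ 2 - P (f y) (g y) *
        (2 * D (f y) (g y) * (s * (x + s * f y)))) / (D (f y) (g y) ^ 2) ^ 2) (Icc (0 : ℝ) 1) := by
    intro f g hf hg mf mg
    have cN : Continuous fun y => N (f y) (g y) := hNc.comp (hf.prodMk hg)
    have cD : Continuous fun y => D (f y) (g y) := hDc.comp (hf.prodMk hg)
    have cP : Continuous fun y => P (f y) (g y) := hPc.comp (hf.prodMk hg)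
    have cP' : Continuous fun y => P' (f y) (g y) := hPc'.comp (hf.prodMk hg)
    have nz : ∀ y ∈ Icc (0 : ℝ) 1, D (f y) (g y) ≠ 0 := fun y hy => by
      linarith [(hDpos _ (mf hy) _ (mg hy)).1]
    refine ⟨cN.continuousOn.div cD.continuousOn nz, cP.continuousOn.div (cD.pow 2).continuousOn
      fun y hy => pow_ne_zero 2 (nz y hy), ContinuousOn.div (by fun_prop) (by fun_prop)
      fun y hy => pow_ne_zero 2 (pow_ne_zero 2 (nz y hy))⟩
  have hmul : ∀ {a b A B : ℝ}, |a| ≤ A → |b| ≤ B → 0 ≤ A → |a * b| ≤ A * B := by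
    intro a b A B ha hb hA; rw [abs_mul]; exact mul_le_mul ha hb (abs_nonneg _) hA
  refine exists_step_expansion (b := fun u v => Ψ (N u v / D u v)) (bu := bu) (buv := buv)
    (bv := fun v => Ψ' (N 0 v / D 0 v) * (P v 0 / D v 0 ^ 2)) ?_ ?_ ?_ ?_ ?_ ?_ ?_ ?_ ?_ ?_ ?_ ?_ ?_
  · intro u hu v hv; exact (hd _).comp u (dR u hu v hv)
  · intro u hu v hv
    have hDv : HasDerivAt (fun v => D u v) (s * (x + s * u)) v := by
      have := dD v u; simp_rw [hDs _ u] at this; exact this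
    have h1 : HasDerivAt (fun v => Ψ' (N u v / D u v)) (Ψ'' (N u v / D u v) * (P v u / D v u ^ 2)) v :=
      (hd' _).comp v (dR2 u hu v hv)
    have h2 := (dP u v).div (hDv.pow 2) (pow_ne_zero 2 (by linarith [(hDpos u hu v hv).1]))
    have h3 := h1.mul h2
    refine h3.congr_deriv ?_
    simp [*]
  · intro v hv; exact (hd _).comp v (dR2 0 z0 v hv)
  · fun_prop
  · have a1 : Measurable fun p : ℝ × ℝ => N p.1 p.2 := hNc.measurable
    have a2 : Measurable fun p : ℝ × ℝ => D p.1 p.2 := hDc.measurable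
    fun_prop
  · fun_prop
  · grind
  · intro u hu; exact (hmul (hB' _) (absRu u hu 0 z0) hB0).trans (by linarith)
  · intro u hu v hv
    refine (abs_add_le _ _).trans ?_
    have t1 := hmul (hmul (hB'' (N u v / D u v)) (absRu v hv u hu) hB0) (absRu u hu v hv) (by positivity)
    have t2 := hmul (hB' (N u v / D u v)) (absRuv u hu v hv) hB0
    linarith
  · intro v hv; exact (hmul (hB' _) (absRu v hv 0 z0) hB0).trans (by linarith)
  · intro v hv
    obtain ⟨k1, k2, _⟩ := contR continuous_id continuous_const (fun y hy => hy) (fun _ _ => hv)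
    exact (hΨc'.comp_continuousOn k1).mul k2
  · intro u hu
    obtain ⟨k1, k2, k3⟩ := contR continuous_const continuous_id (fun _ _ => hu) (fun y hy => hy)
    obtain ⟨_, k5, _⟩ := contR continuous_id continuous_const (fun y hy => hy) (fun _ _ => hu)
    exact (((hc.comp_continuousOn k1).mul k5).mul k2).add ((hΨc'.comp_continuousOn k1).mul k3)
  · obtain ⟨k1, _, _⟩ := contR continuous_const continuous_id (fun _ _ => z0) (fun y hy => hy)
    obtain ⟨_, k5, _⟩ := contR continuous_id continuous_const (fun y hy => hy) (fun _ _ => z0)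
    exact (hΨc'.comp_continuousOn k1).mul k5

end Expansion

section LightCone

/-- Half-angle parameter of a planar frequency: the tangent of half its argument. -/
def angle (ξ : Euc 2) : ℝ := ξ 1 / (‖ξ‖ + ξ 0)

/-- The first quadrant. -/
def quadrant : Set (Euc 2) := {ξ | 0 < ξ 0 ∧ 0 ≤ ξ 1}

theorem norm_sq_euc (ξ : Euc 2) : ‖ξ‖ ^ 2 = ξ 0 ^ 2 + ξ 1 ^ 2 := by
  rw [EuclideanSpace.norm_sq_eq]; simp

theorem continuous_coord (i : Fin 2) : Continuous fun ξ : Euc 2 => ξ i :=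
  (EuclideanSpace.proj (𝕜 := ℝ) i).continuous

theorem measurable_angle : Measurable angle :=
  (continuous_coord 1).measurable.div (measurable_norm.add (continuous_coord 0).measurable)

theorem measurableSet_quadrant : MeasurableSet quadrant :=
  (measurableSet_lt measurable_const (continuous_coord 0).measurable).inter
    (measurableSet_le measurable_const (continuous_coord 1).measurable)

theorem quadrant_facts {ξ : Euc 2} (h : ξ ∈ quadrant) :
    0 < ‖ξ‖ + ξ 0 ∧ ‖ξ‖ ≤ ‖ξ‖ + ξ 0 ∧ ‖ξ‖ + ξ 0 ≤ 2 * ‖ξ‖ ∧ 0 ≤ angle ξ ∧ angle ξ < 1 ∧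
      ξ 1 = (‖ξ‖ + ξ 0) * angle ξ ∧ ‖ξ‖ - ξ 0 = (‖ξ‖ + ξ 0) * angle ξ ^ 2 := by
  obtain ⟨h0, h1⟩ := h
  have hn := norm_sq_euc ξ
  have hnn := norm_nonneg ξ
  have hle : ξ 0 ≤ ‖ξ‖ := by nlinarith
  have hle1 : ξ 1 ≤ ‖ξ‖ := by nlinarith
  have hp : 0 < ‖ξ‖ + ξ 0 := by linarith
  refine ⟨hp, by linarith, by linarith, div_nonneg h1 hp.le, ?_, ?_, ?_⟩
  · rw [angle, div_lt_one hp]; linarith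
  · unfold angle; field_simp
  · unfold angle; field_simp; nlinarith

/-- The linear functional vanishing on the ray with half-angle parameter `x`. -/
def tilt (x : ℝ) : Euc 2 →L[ℝ] ℝ := innerSL ℝ (!₂[-2 * x, 1 - x ^ 2] : Euc 2)

theorem tilt_apply (x : ℝ) (ξ : Euc 2) : tilt x ξ = (1 - x ^ 2) * ξ 1 - 2 * x * ξ 0 := by
  simp [tilt, PiLp.inner_apply]; ring

theorem tilt_eq {ξ : Euc 2} (h : ξ ∈ quadrant) (x : ℝ) :
    tilt x ξ = (‖ξ‖ + ξ 0) * ((angle ξ - x) * (1 + x * angle ξ)) := by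
  obtain ⟨_, _, _, _, _, e1, e2⟩ := quadrant_facts h
  rw [tilt_apply]; grind

/-- The light cone in `ℝ² × ℝ`. -/
def lightCone : ConeData (Euc 2 × ℝ) where
  a := ContinuousLinearMap.snd ℝ (Euc 2) ℝ +
    (EuclideanSpace.proj (𝕜 := ℝ) (0 : Fin 2)).comp (ContinuousLinearMap.fst ℝ (Euc 2) ℝ)
  b := (EuclideanSpace.proj (𝕜 := ℝ) (1 : Fin 2)).comp (ContinuousLinearMap.fst ℝ (Euc 2) ℝ)
  c := ContinuousLinearMap.snd ℝ (Euc 2) ℝ -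
    (EuclideanSpace.proj (𝕜 := ℝ) (0 : Fin 2)).comp (ContinuousLinearMap.fst ℝ (Euc 2) ℝ)
  θ := fun z => angle z.1
  h := fun z => ‖z.1‖ + z.1 0
  e := fun z => z.2 - ‖z.1‖
  meas := measurable_angle.comp measurable_fst

theorem lightCone_a (z : Euc 2 × ℝ) : lightCone.a z = z.2 + z.1 0 := rfl
theorem lightCone_b (z : Euc 2 × ℝ) : lightCone.b z = z.1 1 := rfl
theorem lightCone_c (z : Euc 2 × ℝ) : lightCone.c z = z.2 - z.1 0 := rfl

/-- Frequency profiles supported in the first quadrant at unit scale. -/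
structure Profile (H : Euc 2 → ℂ) : Prop where
  nice : Nice H
  quad : ∀ ξ, H ξ ≠ 0 → ξ ∈ quadrant
  lo : ∀ ξ, H ξ ≠ 0 → 1 / 4 ≤ ‖ξ‖
  hi : ∀ ξ, H ξ ≠ 0 → ‖ξ‖ ≤ 1

theorem Profile.supports {H : Euc 2 → ℂ} (hH : Profile H) {k : ℝ → ℝ} (hk : NiceReal k) {δ₀ : ℝ}
    (hs : ∀ x, k x ≠ 0 → |x| ≤ δ₀) : lightCone.Supports δ₀ (coneLift k H) := by
  have key : ∀ z : Euc 2 × ℝ, coneLift k H z ≠ 0 → k (z.2 - ‖z.1‖) ≠ 0 ∧ H z.1 ≠ 0 := fun z hz =>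
    ⟨by have := left_ne_zero_of_mul hz; exact_mod_cast this, right_ne_zero_of_mul hz⟩
  refine ⟨Nice.coneLift hk hH.nice, fun z hz => ?_, fun z hz => ?_, fun z hz => ?_, fun z hz => ?_,
    fun z hz => ?_, fun z hz => ?_, fun z hz => ?_, fun z hz => ?_⟩ <;>
  obtain ⟨k1, k2⟩ := key z hz <;>
  obtain ⟨h0, h1, h2, h3, h4, h5, h6⟩ := quadrant_facts (hH.quad _ k2) <;>
  have l1 := hH.lo _ k2 <;> have l2 := hH.hi _ k2
  · rw [lightCone_a]; simp only [lightCone]; ring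
  · rw [lightCone_b]; exact h5
  · rw [lightCone_c]; simp only [lightCone]; linarith
  · exact hs _ k1
  · simp only [lightCone]; linarith
  · simp only [lightCone]; linarith
  · exact h3
  · exact h4.le

theorem cut_coneLift (k : ℝ → ℝ) (H : Euc 2 → ℂ) (τ : ℕ × ℕ) :
    cut lightCone.θ (coneLift k H) τ = coneLift k (cut angle H τ) := by
  funext z
  by_cases h : angle z.1 ∈ arc τ
  · rw [cut_of_mem (θ := lightCone.θ) h, coneLift, coneLift, cut_of_mem h]
  · rw [cut_of_notMem (θ := lightCone.θ) h, coneLift, cut_of_notMem h, mul_zero]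

theorem Profile.cut_angle {H : Euc 2 → ℂ} (hH : Profile H) (τ : ℕ × ℕ) : Profile (cut angle H τ) :=
  ⟨hH.nice.cut measurable_angle τ, fun ξ h => hH.quad ξ (cut_ne_zero h).2,
    fun ξ h => hH.lo ξ (cut_ne_zero h).2, fun ξ h => hH.hi ξ (cut_ne_zero h).2⟩

theorem Profile.cut_root {H : Euc 2 → ℂ} (hH : Profile H) : cut angle H (0, 0) = H := by
  funext ξ
  by_cases h : H ξ = 0
  · unfold cut; simp [indicator, h]
  · obtain ⟨_, _, _, h3, h4, _⟩ := quadrant_facts (hH.quad ξ h)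
    refine cut_of_mem ?_
    simp only [arc, arcLeft, arcLen, mem_Ico]; grind

/-- The autocorrelation of a real cutoff. -/
def autocor (k : ℝ → ℝ) (p : ℝ) : ℝ := ∫ e, k e * k (e - p)

theorem acor_coneLift {k : ℝ → ℝ} {H : Euc 2 → ℂ} (hk : NiceReal k) (hH : Nice H) (ω : Euc 2 × ℝ) :
    acor (coneLift k H) (coneLift k H) ω = ∫ ξ, H ξ * (starRingEnd ℂ) (H (ξ - ω.1)) *
      (autocor k (ω.2 - ‖ξ‖ + ‖ξ - ω.1‖) : ℂ) := by
  have hF := Nice.coneLift hk hH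
  obtain ⟨M, _, hM⟩ := hF.bdd
  have hInt : Integrable (fun z => coneLift k H z * (starRingEnd ℂ) (coneLift k H (z - ω)))
      (volume.prod volume) := by
    refine (hF.mul_bdd (RCLike.continuous_conj.measurable.comp (hF.meas.comp
      (measurable_id.sub measurable_const))) ⟨M, fun x => ?_⟩).integrable
    simp_all
  have e1 : acor (coneLift k H) (coneLift k H) ω = ∫ ξ : Euc 2, ∫ ν : ℝ,
      coneLift k H (ξ, ν) * (starRingEnd ℂ) (coneLift k H ((ξ, ν) - ω)) := integral_prod _ hInt
  rw [e1]
  refine integral_congr_ae (.of_forall fun ξ => ?_)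
  have e2 : ∀ ν : ℝ, coneLift k H (ξ, ν) * (starRingEnd ℂ) (coneLift k H ((ξ, ν) - ω)) =
      H ξ * (starRingEnd ℂ) (H (ξ - ω.1)) *
        ((k (ν - ‖ξ‖) * k (ν - ‖ξ‖ - (ω.2 - ‖ξ‖ + ‖ξ - ω.1‖)) : ℝ) : ℂ) := by
    intro ν
    have : ν - ‖ξ‖ - (ω.2 - ‖ξ‖ + ‖ξ - ω.1‖) = ν - ω.2 - ‖ξ - ω.1‖ := by ring
    rw [this]; simp only [coneLift, Prod.fst_sub, Prod.snd_sub, map_mul, Complex.conj_ofReal]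
    push_cast; ring
  simp_rw [e2]; rw [integral_const_mul, integral_complex_ofReal, autocor]
  rw [integral_sub_right_eq_self (μ := volume) (fun e => k e * k (e - (ω.2 - ‖ξ‖ + ‖ξ - ω.1‖))) ‖ξ‖]

theorem autocor_scale (k : ℝ → ℝ) {δ : ℝ} (hδ : 0 < δ) (p : ℝ) :
    autocor (fun x => k (x / δ)) p = δ * autocor k (p / δ) := by
  unfold autocor
  have := Measure.integral_comp_div (fun e => k e * k (e - p / δ)) δ
  rw [abs_of_pos hδ, smul_eq_mul] at this; grind

/-- The part of the arc piece of `H` with angular parameter beyond the relative position `y`. -/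
def stepCut (H : Euc 2 → ℂ) (τ : ℕ × ℕ) (y : ℝ) : Euc 2 → ℂ :=
  {ξ | y < (angle ξ - arcLeft τ) / arcLen τ}.indicator (cut angle H τ)

theorem Nice.stepCut {H : Euc 2 → ℂ} (hH : Nice H) (τ : ℕ × ℕ) (y : ℝ) : Nice (stepCut H τ y) :=
  (hH.cut measurable_angle τ).indicator (measurableSet_lt measurable_const
    ((measurable_angle.sub measurable_const).div measurable_const))

theorem measurable_stepCut {H : Euc 2 → ℂ} (hH : Nice H) (τ : ℕ × ℕ) :
    Measurable fun p : ℝ × Euc 2 => stepCut H τ p.1 p.2 := by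
  have : (fun p : ℝ × Euc 2 => stepCut H τ p.1 p.2) =
      {p : ℝ × Euc 2 | p.1 < (angle p.2 - arcLeft τ) / arcLen τ}.indicator
        (fun p => cut angle H τ p.2) := by bound
  rw [this]
  refine ((hH.cut measurable_angle τ).meas.comp measurable_snd).indicator
    (measurableSet_lt measurable_fst ?_)
  exact ((measurable_angle.comp measurable_snd).sub measurable_const).div measurable_const

theorem measurable_acor_stepCut {H : Euc 2 → ℂ} (hH : Nice H) (τ : ℕ × ℕ) :
    Measurable fun q : Euc 2 × (ℝ × ℝ) => acor (stepCut H τ q.2.1) (stepCut H τ q.2.2) q.1 := by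
  refine (StronglyMeasurable.integral_prod_right (f := fun (q : Euc 2 × (ℝ × ℝ)) (ζ : Euc 2) =>
    stepCut H τ q.2.1 ζ * (starRingEnd ℂ) (stepCut H τ q.2.2 (ζ - q.1))) ?_).measurable
  apply Measurable.stronglyMeasurable
  have h := measurable_stepCut hH τ
  fun_prop

/-- Cauchy–Schwarz on a finite measure space. -/
theorem sq_lintegral_le {α : Type*} [MeasurableSpace α] (μ : Measure α) {f : α → ℝ≥0∞}
    (hf : AEMeasurable f μ) : (∫⁻ x, f x ∂μ) ^ 2 ≤ μ univ * ∫⁻ x, f x ^ 2 ∂μ := by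
  have h := ENNReal.lintegral_mul_le_Lp_mul_Lq μ Real.HolderConjugate.two_two
    (aemeasurable_const (b := (1 : ℝ≥0∞))) hf
  simp only [Pi.mul_apply, one_mul, ENNReal.one_rpow, lintegral_one] at h
  have e : ∀ x : ℝ≥0∞, (x ^ (1 / 2 : ℝ)) ^ 2 = x := fun x => by
    rw [← rpow_natCast, ← rpow_mul]; norm_num
  calc (∫⁻ x, f x ∂μ) ^ 2 ≤ (μ univ ^ (1 / 2 : ℝ) * (∫⁻ x, f x ^ (2 : ℝ) ∂μ) ^ (1 / 2 : ℝ)) ^ 2 := by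
        gcongr
    _ = _ := by rw [mul_pow, e, e]; norm_num

variable {k₀ Ψ' Ψ'' : ℝ → ℝ} {B : ℝ}

/-- Pointwise bound for the autocorrelation of an arc piece on its plank. -/
theorem enorm_acor_sq_le (hk : NiceReal k₀) (hd : ∀ x, HasDerivAt (autocor k₀) (Ψ' x) x)
    (hd' : ∀ x, HasDerivAt Ψ' (Ψ'' x) x) (hc : Continuous Ψ'') (hB : ∀ x, |autocor k₀ x| ≤ B)
    (hB' : ∀ x, |Ψ' x| ≤ B) (hB'' : ∀ x, |Ψ'' x| ≤ B) {H : Euc 2 → ℂ} (hH : Profile H)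
    {τ : ℕ × ℕ} (hτ : arcLeft τ ≤ 1) {δ : ℝ} (hδ : 0 < δ) {ω : Euc 2 × ℝ}
    (hω : ω ∈ lightCone.plank τ δ) :
    ‖acor (coneLift (fun x => k₀ (x / δ)) (cut angle H τ))
      (coneLift (fun x => k₀ (x / δ)) (cut angle H τ)) ω‖ₑ ^ 2 ≤
      ofReal (16000000 * B ^ 2 * δ ^ 2) * ∫⁻ y in Ioc (-1 : ℝ) 1 ×ˢ Ioc (-1 : ℝ) 1,
        ‖acor (stepCut H τ y.1) (stepCut H τ y.2) ω.1‖ₑ ^ 2 := by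
  have hkδ : NiceReal fun x => k₀ (x / δ) := by
    obtain ⟨M, hM0, hM⟩ := hk.bdd
    obtain ⟨ρ, hρ0, hρ⟩ := hk.supp
    refine ⟨hk.meas.comp (measurable_id.div_const δ), ⟨M, hM0, fun x => hM _⟩,
      ⟨ρ * δ, by positivity, fun x hx => ?_⟩⟩
    have := hρ _ hx
    rwa [norm_div, norm_of_nonneg hδ.le, div_le_iff₀ hδ] at this
  set x₀ := arcLeft τ with hx₀
  set s := arcLen τ with hs
  have hs0 : 0 < s := arcLen_pos τ
  obtain ⟨w1, w2, w3⟩ := hω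
  have hB0 : 0 ≤ B := (abs_nonneg _).trans (hB 0)
  set a := lightCone.a ω with ha
  set b := lightCone.b ω with hb
  set c := lightCone.c ω with hcc
  obtain ⟨C, hCm, hCb, hC⟩ := exists_step_expansion_quad hd hd' hc hB hB' hB''
    (q₀ := (c - 2 * x₀ * b + x₀ ^ 2 * a) / δ) (q₁ := s * (b - x₀ * a) / δ) (q₂ := s ^ 2 * a / δ)
    (x := x₀) (s := s)
    (by rw [abs_div, abs_of_pos hδ, div_le_one hδ]; exact w3)
    (by rw [abs_div, abs_of_pos hδ, div_le_one hδ, abs_mul, abs_of_pos hs0]; exact w2)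
    (by rw [abs_div, abs_of_pos hδ, div_le_one hδ, abs_mul, abs_of_pos (by positivity : 0 < s ^ 2)]; exact w1)
    (arcLeft_nonneg τ) hτ hs0.le (arcLen_le_one τ)
  set K := cut angle H τ with hK
  have hKp : Profile K := hH.cut_angle τ
  set S := Ioc (-1 : ℝ) 1 ×ˢ Ioc (-1 : ℝ) 1 with hS
  have hSm : MeasurableSet S := measurableSet_Ioc.prod measurableSet_Ioc
  have hSv : volume S = 4 := by
    rw [hS, Measure.volume_eq_prod, Measure.prod_prod, volume_Ioc, ← ofReal_mul (by norm_num)]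
    norm_num
  have hpos : ∀ ξ, K ξ ≠ 0 → (angle ξ - x₀) / s ∈ Icc (0 : ℝ) 1 := by
    intro ξ h
    have := (cut_ne_zero h).1
    simp only [arc, mem_Ico] at this
    refine ⟨div_nonneg (by linarith) hs0.le, ?_⟩
    bound
  have hpt : ∀ ξ, K ξ * (starRingEnd ℂ) (K (ξ - ω.1)) *
      (autocor (fun x => k₀ (x / δ)) (ω.2 - ‖ξ‖ + ‖ξ - ω.1‖) : ℂ) =
      (δ : ℂ) * ∫ y in S, (C y : ℂ) * (stepCut H τ y.1 ξ * (starRingEnd ℂ) (stepCut H τ y.2 (ξ - ω.1))) := by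
    intro ξ
    by_cases h1 : K ξ = 0
    · have : ∀ y, stepCut H τ y ξ = 0 := fun y => by simp [stepCut, indicator, ← hK, h1]
      simp [this, h1]
    by_cases h2 : K (ξ - ω.1) = 0
    · have : ∀ y, stepCut H τ y (ξ - ω.1) = 0 := fun y => by simp [stepCut, indicator, ← hK, h2]
      simp [this, h2]
    set u := (angle ξ - x₀) / s with hu
    set v := (angle (ξ - ω.1) - x₀) / s with hv
    have hxu : angle ξ = x₀ + s * u := by rw [hu]; field_simp; ring
    have hxv : angle (ξ - ω.1) = x₀ + s * v := by rw [hv]; field_simp; ring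
    have hstep : ∀ y ζ, stepCut H τ y ζ =
        (((Ioi y).indicator (fun _ => (1 : ℝ)) ((angle ζ - x₀) / s) : ℝ) : ℂ) * K ζ := by
      intro y ζ
      by_cases h : y < (angle ζ - x₀) / s
      · simp [stepCut, indicator, ← hK, ← hx₀, ← hs, h]
      · simp [stepCut, indicator, ← hx₀, ← hs, h]
    obtain ⟨f0, _, _, f3, f4, f5, f6⟩ := quadrant_facts (hKp.quad _ h1)
    obtain ⟨g0, _, _, g3, g4, g5, g6⟩ := quadrant_facts (hKp.quad _ h2)
    have hp : ω.2 - ‖ξ‖ + ‖ξ - ω.1‖ = (c - (angle ξ + angle (ξ - ω.1)) * b +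
        angle ξ * angle (ξ - ω.1) * a) / (1 + angle ξ * angle (ξ - ω.1)) := by
      have hpos' : 0 < 1 + angle ξ * angle (ξ - ω.1) := by positivity
      rw [eq_div_iff hpos'.ne', ha, hb, hcc, lightCone_a, lightCone_b, lightCone_c]
      have c0 : (ξ - ω.1) 0 = ξ 0 - ω.1 0 := rfl
      have c1 : (ξ - ω.1) 1 = ξ 1 - ω.1 1 := rfl
      set x := angle ξ
      set y := angle (ξ - ω.1)
      have k1 : ω.1 0 = ξ 0 - (ξ - ω.1) 0 := by linarith
      have k2 : ω.1 1 = ξ 1 - (ξ - ω.1) 1 := by linarith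
      rw [k1, k2]
      set P := ‖ξ‖
      set Q := ‖ξ - ω.1‖
      have r2 : (ξ - ω.1) 0 = Q - (Q + (ξ - ω.1) 0) * y ^ 2 := by linarith
      generalize (ξ - ω.1) 0 = Y0 at *
      generalize (ξ - ω.1) 1 = Y1 at *
      grind
    rw [hp, autocor_scale k₀ hδ, div_div, mul_comm _ δ, ← div_div]
    have hq : (c - (angle ξ + angle (ξ - ω.1)) * b + angle ξ * angle (ξ - ω.1) * a) / δ /
        (1 + angle ξ * angle (ξ - ω.1)) =
        ((c - 2 * x₀ * b + x₀ ^ 2 * a) / δ - s * (b - x₀ * a) / δ * (u + v) + s ^ 2 * a / δ * (u * v)) /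
          (1 + (x₀ + s * u) * (x₀ + s * v)) := by rw [hxu, hxv]; grind
    rw [hq, hC u (hpos ξ h1) v (hpos _ h2)]; push_cast
    rw [← integral_complex_ofReal, mul_left_comm, ← integral_const_mul]; congr 1
    refine integral_congr_ae (.of_forall fun y => ?_)
    simp only [hstep]; rw [map_mul, Complex.conj_ofReal]; push_cast; ring
  have hInt : Integrable (uncurry fun (ξ : Euc 2) (y : ℝ × ℝ) =>
      (C y : ℂ) * (stepCut H τ y.1 ξ * (starRingEnd ℂ) (stepCut H τ y.2 (ξ - ω.1))))
      (volume.prod (volume.restrict S)) := by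
    obtain ⟨M, hM0, hM⟩ := hKp.nice.bdd
    have hfin : IsFiniteMeasure ((volume : Measure (ℝ × ℝ)).restrict S) :=
      ⟨by rw [Measure.restrict_apply_univ, hSv]; exact ENNReal.ofNat_lt_top⟩
    have h0 : Integrable (fun q : Euc 2 × (ℝ × ℝ) => ‖K q.1‖ * (2000 * B * M))
      (volume.prod (volume.restrict S)) := hKp.nice.integrable.norm.mul_prod (integrable_const _)
    have hle : ∀ y ζ, ‖stepCut H τ y ζ‖ ≤ ‖K ζ‖ := fun y ζ => norm_indicator_le_norm_self _ _
    have h := measurable_stepCut hH.nice τ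
    refine h0.mono' ?_ ?_
    · refine Measurable.aestronglyMeasurable ?_
      fun_prop
    · have : ∀ᵐ q : Euc 2 × (ℝ × ℝ) ∂(volume.prod (volume.restrict S)), q.2 ∈ S := by
        refine Measure.ae_prod_mem_iff_ae_ae_mem (s := {q : Euc 2 × (ℝ × ℝ) | q.2 ∈ S}) (measurable_snd hSm) |>.2 ?_
        exact .of_forall fun _ => ae_restrict_mem hSm
      filter_upwards [this] with q hq
      simp only [uncurry, norm_mul, RCLike.norm_conj, norm_real]
      have b1 : ‖C q.2‖ ≤ 2000 * B := hCb q.2 ⟨Ioc_subset_Icc_self hq.1, Ioc_subset_Icc_self hq.2⟩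
      calc ‖C q.2‖ * (‖stepCut H τ q.2.1 q.1‖ * ‖stepCut H τ q.2.2 (q.1 - ω.1)‖)
          ≤ (2000 * B) * (‖K q.1‖ * M) := by
            refine mul_le_mul b1 (mul_le_mul (hle _ _) ((hle _ _).trans (hM _)) (norm_nonneg _)
              (norm_nonneg _)) (by positivity) (by positivity)
        _ = _ := by ring
  have hA : acor (coneLift (fun x => k₀ (x / δ)) K) (coneLift (fun x => k₀ (x / δ)) K) ω =
      (δ : ℂ) * ∫ y in S, (C y : ℂ) * acor (stepCut H τ y.1) (stepCut H τ y.2) ω.1 := by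
    rw [acor_coneLift hkδ hKp.nice]; simp_rw [hpt]
    rw [integral_const_mul, integral_integral_swap hInt]; simp_rw [integral_const_mul]
    rfl
  have hmeas : AEMeasurable (fun y : ℝ × ℝ => ‖acor (stepCut H τ y.1) (stepCut H τ y.2) ω.1‖ₑ)
      (volume.restrict S) :=
    (((measurable_acor_stepCut hH.nice τ).comp measurable_prodMk_left).enorm).aemeasurable
  have hle : ‖∫ y in S, (C y : ℂ) * acor (stepCut H τ y.1) (stepCut H τ y.2) ω.1‖ₑ ≤
      ofReal (2000 * B) * ∫⁻ y in S, ‖acor (stepCut H τ y.1) (stepCut H τ y.2) ω.1‖ₑ := by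
    refine (enorm_integral_le_lintegral_enorm _).trans ?_
    rw [← lintegral_const_mul'' _ hmeas]
    refine setLIntegral_mono_ae (by fun_prop) (.of_forall fun y hy => ?_)
    rw [enorm_mul]; gcongr; rw [← ofReal_norm, norm_real]
    exact ofReal_le_ofReal (hCb y ⟨Ioc_subset_Icc_self hy.1, Ioc_subset_Icc_self hy.2⟩)
  rw [hA, enorm_mul, mul_pow]
  have hcs := sq_lintegral_le (volume.restrict S) hmeas
  rw [Measure.restrict_apply_univ, hSv] at hcs
  calc ‖(δ : ℂ)‖ₑ ^ 2 * ‖∫ y in S, (C y : ℂ) * acor (stepCut H τ y.1) (stepCut H τ y.2) ω.1‖ₑ ^ 2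
      ≤ ofReal δ ^ 2 * (ofReal (2000 * B) ^ 2 *
        (4 * ∫⁻ y in S, ‖acor (stepCut H τ y.1) (stepCut H τ y.2) ω.1‖ₑ ^ 2)) := by
        refine mul_le_mul' (le_of_eq ?_) ?_
        · rw [← ofReal_norm, norm_real, norm_of_nonneg hδ.le]
        · refine (pow_le_pow_left' hle 2).trans ?_
          rw [mul_pow]; gcongr
    _ = _ := by
        rw [← ofReal_pow hδ.le, ← ofReal_pow (by positivity), ← mul_assoc, ← mul_assoc]; congr 1
        rw [show (4 : ℝ≥0∞) = ofReal 4 by norm_num, ← ofReal_mul (by positivity),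
          ← ofReal_mul (by positivity)]
        congr 1; ring

/-- Plank energies are controlled by planar quartic energies. -/
theorem energy_le_of_quartic_stepCut (hk : NiceReal k₀) (hd : ∀ x, HasDerivAt (autocor k₀) (Ψ' x) x)
    (hd' : ∀ x, HasDerivAt Ψ' (Ψ'' x) x) (hc : Continuous Ψ'') (hB : ∀ x, |autocor k₀ x| ≤ B)
    (hB' : ∀ x, |Ψ' x| ≤ B) (hB'' : ∀ x, |Ψ'' x| ≤ B) {H : Euc 2 → ℂ} (hH : Profile H)
    {τ : ℕ × ℕ} (hτ : arcLeft τ ≤ 1) (n : ℕ) {Q : ℝ}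
    (hQ : ∀ y, quartic (stepCut H τ y) ≤ Q) :
    lightCone.energy (coneLift (fun x => k₀ (x / (1 / 4 ^ n))) H) τ n ≤
      128000000 * B ^ 2 * (1 / 4 ^ n) ^ 3 * Q := by
  set δ : ℝ := 1 / 4 ^ n
  have hδ : 0 < δ := by positivity
  have hQ0 : 0 ≤ Q := (quartic_nonneg _).trans (hQ 0)
  set K := cut angle H τ
  set k := fun x => k₀ (x / δ)
  have hkδ : NiceReal k := by
    obtain ⟨M, hM0, hM⟩ := hk.bdd
    obtain ⟨ρ, hρ0, hρ⟩ := hk.supp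
    refine ⟨hk.meas.comp (measurable_id.div_const δ), ⟨M, hM0, fun x => hM _⟩,
      ⟨ρ * δ, by positivity, fun x hx => ?_⟩⟩
    have := hρ _ hx
    rwa [norm_div, norm_of_nonneg hδ.le, div_le_iff₀ hδ] at this
  have hA : Nice (acor (coneLift k K) (coneLift k K)) :=
    (Nice.coneLift hkδ (hH.cut_angle τ).nice).acor (Nice.coneLift hkδ (hH.cut_angle τ).nice)
  set S := Ioc (-1 : ℝ) 1 ×ˢ Ioc (-1 : ℝ) 1 with hS
  have hSv : volume S = 4 := by
    rw [hS, Measure.volume_eq_prod, Measure.prod_prod, volume_Ioc, ← ofReal_mul (by norm_num)]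
    norm_num
  set W : Euc 2 → ℝ≥0∞ := fun w => ∫⁻ y in S, ‖acor (stepCut H τ y.1) (stepCut H τ y.2) w‖ₑ ^ 2
  have hWm : Measurable W :=
    Measurable.lintegral_prod_right' (f := fun q : Euc 2 × (ℝ × ℝ) =>
      ‖acor (stepCut H τ q.2.1) (stepCut H τ q.2.2) q.1‖ₑ ^ 2)
      ((measurable_acor_stepCut hH.nice τ).enorm.pow_const 2)
  have hWint : ∫⁻ w, W w ≤ ofReal (4 * Q) := by
    rw [lintegral_lintegral_swap (f := fun (w : Euc 2) (y : ℝ × ℝ) =>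
      ‖acor (stepCut H τ y.1) (stepCut H τ y.2) w‖ₑ ^ 2)
      ((measurable_acor_stepCut hH.nice τ).enorm.pow_const 2).aemeasurable]
    calc ∫⁻ y in S, ∫⁻ w, ‖acor (stepCut H τ y.1) (stepCut H τ y.2) w‖ₑ ^ 2
        ≤ ∫⁻ _ in S, ofReal Q := by
          refine lintegral_mono fun y => ?_
          have n1 := hH.nice.stepCut τ y.1
          have n2 := hH.nice.stepCut τ y.2
          simp only; rw [(n1.acor n2).lintegral_sq]
          refine ofReal_le_ofReal ((integral_acor_sq_le_sqrt n1 n2).trans ?_)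
          calc √(quartic (stepCut H τ y.1)) * √(quartic (stepCut H τ y.2)) ≤ √Q * √Q :=
                mul_le_mul (Real.sqrt_le_sqrt (hQ _)) (Real.sqrt_le_sqrt (hQ _)) (sqrt_nonneg _)
                  (sqrt_nonneg _)
            _ = Q := Real.mul_self_sqrt hQ0
      _ = ofReal (4 * Q) := by
          rw [lintegral_const, Measure.restrict_apply_univ, hSv, ofReal_mul (by norm_num), mul_comm]
          norm_num
  have hslice : ∀ w : Euc 2, volume {r : ℝ | (w, r) ∈ lightCone.plank τ δ} ≤ ofReal (2 * δ) := by
    intro w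
    set x := arcLeft τ
    set r₀ := (w 0 + 2 * x * w 1 - x ^ 2 * w 0) / (1 + x ^ 2) with hr₀
    have hsub : {r : ℝ | (w, r) ∈ lightCone.plank τ δ} ⊆ Icc (r₀ - δ) (r₀ + δ) := by
      intro r hr
      have h3 := hr.2.2
      rw [lightCone_a, lightCone_b, lightCone_c] at h3
      have e : r - w 0 - 2 * x * w 1 + x ^ 2 * (r + w 0) = (1 + x ^ 2) * (r - r₀) := by
        rw [hr₀]; field_simp; ring
      simp only at h3; rw [e, abs_mul, abs_of_pos (by positivity)] at h3
      have : |r - r₀| ≤ δ := by nlinarith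
      grind
    refine (measure_mono hsub).trans (le_of_eq ?_)
    rw [volume_Icc]; congr 1; ring
  have hP := lightCone.measurableSet_plank τ δ
  have main : ofReal (lightCone.energy (coneLift k H) τ n) ≤
      ofReal (16000000 * B ^ 2 * δ ^ 2 * (2 * δ) * (4 * Q)) := by
    unfold ConeData.energy
    rw [cut_coneLift, ofReal_integral_eq_lintegral_ofReal hA.integrable_sq.integrableOn
      (.of_forall fun x => by positivity)]
    calc ∫⁻ ω in lightCone.plank τ δ, ofReal (‖acor (coneLift k K) (coneLift k K) ω‖ ^ 2)
        ≤ ∫⁻ ω in lightCone.plank τ δ, ofReal (16000000 * B ^ 2 * δ ^ 2) * W ω.1 := by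
          refine setLIntegral_mono (by fun_prop) fun ω hω => ?_
          rw [ofReal_pow (norm_nonneg _), ofReal_norm]
          exact enorm_acor_sq_le hk hd hd' hc hB hB' hB'' hH hτ hδ hω
      _ = ∫⁻ w, ∫⁻ r : ℝ, (lightCone.plank τ δ).indicator
            (fun ω => ofReal (16000000 * B ^ 2 * δ ^ 2) * W ω.1) (w, r) := by
          rw [← lintegral_indicator hP]
          exact lintegral_prod _ (((by fun_prop : Measurable fun ω : Euc 2 × ℝ =>
            ofReal (16000000 * B ^ 2 * δ ^ 2) * W ω.1).indicator hP).aemeasurable)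
      _ ≤ ∫⁻ w, ofReal (16000000 * B ^ 2 * δ ^ 2) * W w * ofReal (2 * δ) := by
          refine lintegral_mono fun w => ?_
          have hPw : MeasurableSet {r : ℝ | (w, r) ∈ lightCone.plank τ δ} := measurable_prodMk_left hP
          have : ∀ r : ℝ, (lightCone.plank τ δ).indicator
            (fun ω => ofReal (16000000 * B ^ 2 * δ ^ 2) * W ω.1) (w, r) =
            {r : ℝ | (w, r) ∈ lightCone.plank τ δ}.indicator
              (fun _ => ofReal (16000000 * B ^ 2 * δ ^ 2) * W w) r := fun r => by bound
          simp_rw [this]; rw [lintegral_indicator_const hPw]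
          bound
      _ = ofReal (16000000 * B ^ 2 * δ ^ 2) * ofReal (2 * δ) * ∫⁻ w, W w := by
          rw [← lintegral_const_mul _ hWm]; grind
      _ ≤ ofReal (16000000 * B ^ 2 * δ ^ 2) * ofReal (2 * δ) * ofReal (4 * Q) := by gcongr
      _ = _ := by rw [← ofReal_mul (by positivity), ← ofReal_mul (by positivity)]
  have := (ENNReal.ofReal_le_ofReal_iff (by positivity)).1 main
  linarith

end LightCone

section Cutoffs

/-- A smooth cutoff on the line at the scale required by the induction on scales. -/
def timeBump : ContDiffBump (0 : ℝ) := ⟨1 / (2 * 4 ^ 14), 1 / 4 ^ 14, by positivity, by norm_num⟩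

theorem niceReal_bump (b : ContDiffBump (0 : ℝ)) : NiceReal b := by
  refine ⟨Complex.measurable_ofReal.comp b.continuous.measurable, ⟨1, zero_le_one, fun x => ?_⟩,
    ⟨b.rOut, b.rOut_pos.le, fun x hx => ?_⟩⟩
  · rw [norm_real, norm_of_nonneg b.nonneg]; exact b.le_one
  · by_contra h
    apply hx
    have : b x = 0 := b.zero_of_le_dist (by rw [dist_zero_right]; exact (not_le.1 h).le)
    simp [this]

theorem autocor_bump_eq (b : ContDiffBump (0 : ℝ)) :
    autocor b = MeasureTheory.convolution b b (ContinuousLinearMap.lsmul ℝ ℝ) volume := by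
  funext p
  simp only [autocor, MeasureTheory.convolution, ContinuousLinearMap.lsmul_apply, smul_eq_mul]
  congr 1; funext e
  rw [← neg_sub p e, b.neg]

/-- The autocorrelation of the time cutoff is smooth with bounded derivatives. -/
theorem exists_autocor_deriv : ∃ (Ψ' Ψ'' : ℝ → ℝ) (B : ℝ),
    (∀ x, HasDerivAt (autocor timeBump) (Ψ' x) x) ∧ (∀ x, HasDerivAt Ψ' (Ψ'' x) x) ∧
    Continuous Ψ'' ∧ (∀ x, |autocor timeBump x| ≤ B) ∧ (∀ x, |Ψ' x| ≤ B) ∧ ∀ x, |Ψ'' x| ≤ B := by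
  have hcd : ContDiff ℝ 2 (autocor timeBump) := by
    rw [autocor_bump_eq]
    exact timeBump.hasCompactSupport.contDiff_convolution_right _
      timeBump.continuous.locallyIntegrable timeBump.contDiff
  have hcs : HasCompactSupport (autocor timeBump) := by
    rw [autocor_bump_eq]; exact timeBump.hasCompactSupport.convolution _ timeBump.hasCompactSupport
  have hd1 : ContDiff ℝ 1 (deriv (autocor timeBump)) :=
    ((contDiff_succ_iff_deriv (n := 1)).1 hcd).2.2
  have hd2 : Continuous (deriv (deriv (autocor timeBump))) := hd1.continuous_deriv le_rfl
  obtain ⟨B₀, hB₀⟩ := hcs.exists_bound_of_continuous hcd.continuous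
  obtain ⟨B₁, hB₁⟩ := hcs.deriv.exists_bound_of_continuous hd1.continuous
  obtain ⟨B₂, hB₂⟩ := hcs.deriv.deriv.exists_bound_of_continuous hd2
  refine ⟨deriv (autocor timeBump), deriv (deriv (autocor timeBump)), max B₀ (max B₁ B₂),
    fun x => ?_, fun x => ?_, hd2, fun x => ?_, fun x => ?_, fun x => ?_⟩
  · exact (hcd.differentiable (by norm_num) x).hasDerivAt
  · exact (hd1.differentiable (by norm_num) x).hasDerivAt
  · simp_all
  · simp_all
  · simp_all

theorem fourierInv_scale (k : ℝ → ℝ) {δ : ℝ} (hδ : 0 < δ) (t : ℝ) :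
    𝓕⁻ (fun x => (k (x / δ) : ℂ)) t = δ * 𝓕⁻ (fun x => (k x : ℂ)) (δ * t) := by
  rw [fourierInv_eq, fourierInv_eq]
  have := Measure.integral_comp_div (fun v : ℝ => 𝐞 (inner ℝ v (δ * t)) • (k v : ℂ)) δ
  rw [abs_of_pos hδ] at this; rw [← real_smul, ← this]; congr 1; funext v
  have : (inner ℝ (v / δ) (δ * t) : ℝ) = inner ℝ v t := by simp; field_simp
  rw [this]

/-- The Fourier transform of the time cutoff does not vanish near the origin. -/
theorem exists_lower_bound_timeBump : ∃ η c : ℝ, 0 < η ∧ 0 < c ∧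
    ∀ t, |t| ≤ η → c ≤ ‖𝓕⁻ (fun x => (timeBump x : ℂ)) t‖ := by
  have hcont : Continuous (𝓕⁻ (fun x => (timeBump x : ℂ))) :=
    continuous_fourierInv (niceReal_bump timeBump).integrable
  have h0 : 𝓕⁻ (fun x => (timeBump x : ℂ)) 0 = ((∫ x, timeBump x : ℝ) : ℂ) := by
    rw [fourierInv_eq, ← integral_complex_ofReal]; simp
  have hpos : 0 < ‖𝓕⁻ (fun x => (timeBump x : ℂ)) 0‖ := by
    rw [h0, norm_real, norm_pos_iff]; exact timeBump.integral_pos.ne'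
  have hev : ∀ᶠ t in nhds (0 : ℝ), ‖𝓕⁻ (fun x => (timeBump x : ℂ)) 0‖ / 2 <
      ‖𝓕⁻ (fun x => (timeBump x : ℂ)) t‖ :=
    (hcont.norm.tendsto 0).eventually (lt_mem_nhds (by linarith))
  obtain ⟨η, hη, h⟩ := Metric.eventually_nhds_iff.1 hev
  refine ⟨η / 2, _, by linarith, half_pos hpos, fun t ht => (h ?_).le⟩
  rw [dist_zero_right, norm_eq_abs]; linarith

/-- A smooth cutoff used to localize to strips. -/
def stripBump : ContDiffBump (0 : ℝ) := ⟨4, 8, by norm_num, by norm_num⟩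

/-- The strip cutoff as a complex-valued function. -/
def stripC (y : ℝ) : ℂ := (stripBump y : ℂ)

/-- The strip cutoff as a Schwartz function. -/
def stripS : SchwartzMap ℝ ℂ :=
  HasCompactSupport.toSchwartzMap (f := stripC)
    (stripBump.hasCompactSupport.comp_left Complex.ofReal_zero)
    (ofRealCLM.contDiff.comp stripBump.contDiff)

theorem stripS_coe : (stripS : ℝ → ℂ) = stripC := rfl

theorem integrable_fourierInv_strip : Integrable (𝓕⁻ stripC) := by
  rw [← stripS_coe, ← SchwartzMap.fourierInv_coe]; fun_prop

theorem fourier_fourierInv_strip (y : ℝ) : 𝓕 (𝓕⁻ stripC) y = stripC y := by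
  have hc : Continuous stripC := Complex.continuous_ofReal.comp stripBump.continuous
  have hi : Integrable stripC := by rw [← stripS_coe]; exact stripS.integrable
  have hf : Integrable (𝓕 stripC) := by
    rw [← stripS_coe, ← SchwartzMap.fourier_coe]; exact (𝓕 stripS).integrable
  exact congrFun (hc.fourier_fourierInv_eq hi hf) y

/-- The `L¹` norm of the strip kernel. -/
def stripNorm : ℝ := ∫ r, ‖𝓕⁻ stripC r‖

theorem stripNorm_nonneg : 0 ≤ stripNorm := integral_nonneg fun _ => norm_nonneg _

theorem stripC_norm_le (y : ℝ) : ‖stripC y‖ ≤ 1 := by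
  rw [stripC, norm_real, norm_of_nonneg stripBump.nonneg]; exact stripBump.le_one

theorem stripC_eq_one {y : ℝ} (h : |y| ≤ 4) : stripC y = 1 := by
  have : stripBump y = 1 := stripBump.one_of_mem_closedBall (by
    rw [mem_closedBall, dist_zero_right]; exact h)
  rw [stripC, this]; simp

theorem stripC_eq_zero {y : ℝ} (h : 8 ≤ |y|) : stripC y = 0 := by
  have : stripBump y = 0 := stripBump.zero_of_le_dist (by rw [dist_zero_right]; exact h)
  rw [stripC, this]; simp

end Cutoffs

section Strips

/-- The part of `G` in the strip around the direction of `τ`. -/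
def strip (G : Euc 2 → ℂ) (τ : ℕ × ℕ) (ξ : Euc 2) : ℂ :=
  stripC (tilt (arcLeft τ) ξ / arcLen τ) * G ξ

variable {G : Euc 2 → ℂ}

theorem measurable_stripC : Measurable stripC :=
  Complex.measurable_ofReal.comp stripBump.continuous.measurable

theorem Nice.strip (hG : Nice G) (τ : ℕ × ℕ) : Nice (strip G τ) := by
  have := hG.mul_bdd (g := fun ξ => stripC (tilt (arcLeft τ) ξ / arcLen τ))
    (measurable_stripC.comp ((tilt (arcLeft τ)).continuous.measurable.div_const _))
    ⟨1, fun ξ => stripC_norm_le _⟩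
  refine (congrArg Nice (funext fun ξ => ?_)).mp this
  unfold _root_.strip; ring

theorem quartic_strip_le (hG : Nice G) {B : ℝ} (hB : ∀ x, ‖𝓕⁻ G x‖ ≤ B) (τ : ℕ × ℕ) :
    quartic (strip G τ) ≤ (stripNorm * B) ^ 2 * ∫ ξ, ‖strip G τ ξ‖ ^ 2 := by
  have hB0 : 0 ≤ B := (norm_nonneg _).trans (hB 0)
  refine (hG.strip τ).quartic_le_of_bound (mul_nonneg stripNorm_nonneg hB0) fun x => ?_
  set v : Euc 2 := (arcLen τ)⁻¹ • (!₂[-2 * arcLeft τ, 1 - arcLeft τ ^ 2] : Euc 2) with hv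
  have e : strip G τ = fun ξ => stripC (inner ℝ v ξ) * G ξ := by
    funext ξ
    unfold strip; congr 2; rw [hv, real_inner_smul_left, div_eq_inv_mul]; rfl
  rw [e, fourierInv_line_multiplier integrable_fourierInv_strip fourier_fourierInv_strip hG.integrable]
  rw [stripNorm, ← integral_mul_const]
  refine norm_integral_le_of_norm_le (integrable_fourierInv_strip.norm.mul_const B)
    (.of_forall fun r => ?_)
  rw [norm_mul]
  bound

/-- Sharp angular cutoffs in the quadrant are compositions of half-plane cuts. -/
theorem quartic_stepCut_le (hG : Nice G) (hhi : ∀ ξ, G ξ ≠ 0 → ‖ξ‖ ≤ 1) {τ : ℕ × ℕ}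
    (hτ : arcLeft τ + arcLen τ ≤ 1) (y : ℝ) :
    quartic (stepCut (quadrant.indicator G) τ y) ≤ 64 ^ 4 * quartic (strip G τ) := by
  set x₀ := arcLeft τ with hx₀
  set s := arcLen τ with hs
  have hs0 : 0 < s := arcLen_pos τ
  have hx0 : 0 ≤ x₀ := arcLeft_nonneg τ
  set x₁ := x₀ + s
  obtain ⟨S, l, hS, hSq⟩ : ∃ (S : Set (Euc 2)) (l : Euc 2 →L[ℝ] ℝ),
      (S = {ζ | 0 < l ζ} ∨ S = {ζ | l ζ ≤ 0} ∨ S = {ζ | l ζ < 0} ∨ S = {ζ | 0 ≤ l ζ}) ∧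
      ∀ ξ ∈ quadrant, ξ ∈ S ↔ (x₀ ≤ angle ξ ∧ y < (angle ξ - x₀) / s) := by
    by_cases hy : y < 0
    · refine ⟨{ζ | 0 ≤ tilt x₀ ζ}, tilt x₀, by simp, fun ξ hξ => ?_⟩
      obtain ⟨f0, _, _, f3, f4, f5, f6⟩ := quadrant_facts hξ
      have hp : 0 < 1 + x₀ * angle ξ := by positivity
      rw [mem_ofPred_eq, tilt_eq hξ, mul_nonneg_iff_of_pos_left f0, mul_nonneg_iff_of_pos_right hp, sub_nonneg]
      exact ⟨fun h => ⟨h, hy.trans_le (div_nonneg (by linarith) hs0.le)⟩, fun h => h.1⟩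
    · rw [not_lt] at hy
      refine ⟨{ζ | 0 < tilt (x₀ + s * y) ζ}, tilt (x₀ + s * y), by simp, fun ξ hξ => ?_⟩
      obtain ⟨f0, _, _, f3, f4, f5, f6⟩ := quadrant_facts hξ
      have hp : 0 < 1 + (x₀ + s * y) * angle ξ := by positivity
      rw [mem_ofPred_eq, tilt_eq hξ, mul_pos_iff_of_pos_left f0, mul_pos_iff_of_pos_right hp, sub_pos,
        lt_div_iff₀ hs0]
      have := mul_nonneg hs0.le hy
      grind
  have hx1 : ∀ ξ ∈ quadrant, tilt x₁ ξ < 0 ↔ angle ξ < x₁ := by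
    intro ξ hξ
    obtain ⟨f0, _, _, f3, f4, f5, f6⟩ := quadrant_facts hξ
    have hp : 0 < 1 + x₁ * angle ξ := by positivity
    rw [tilt_eq hξ, ← sub_neg (a := angle ξ)]
    constructor
    · intro h
      by_contra hc
      have := mul_nonneg f0.le (mul_nonneg (not_lt.1 hc) hp.le)
      linarith
    · intro h; exact mul_neg_of_pos_of_neg f0 (mul_neg_of_neg_of_pos h hp)
  set p0 : Euc 2 →L[ℝ] ℝ := EuclideanSpace.proj (𝕜 := ℝ) 0
  set p1 : Euc 2 →L[ℝ] ℝ := EuclideanSpace.proj (𝕜 := ℝ) 1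
  obtain ⟨n1, q1⟩ := (hG.strip τ).quartic_indicator_le p0 {ζ | 0 < p0 ζ} (Or.inl rfl)
  obtain ⟨n2, q2⟩ := n1.quartic_indicator_le p1 {ζ | 0 ≤ p1 ζ} (by simp)
  obtain ⟨n3, q3⟩ := n2.quartic_indicator_le l S hS
  obtain ⟨n4, q4⟩ := n3.quartic_indicator_le (tilt x₁) {ζ | tilt x₁ ζ < 0} (by simp)
  have heq : stepCut (quadrant.indicator G) τ y = {ζ | tilt x₁ ζ < 0}.indicator (S.indicator
      ({ζ | 0 ≤ p1 ζ}.indicator ({ζ | 0 < p0 ζ}.indicator (strip G τ)))) := by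
    funext ξ
    by_cases hq : ξ ∈ quadrant
    · have m0 : ξ ∈ {ζ | 0 < p0 ζ} := hq.1
      have m1 : ξ ∈ {ζ | 0 ≤ p1 ζ} := hq.2
      by_cases hc : x₀ ≤ angle ξ ∧ y < (angle ξ - x₀) / s
      · by_cases hc' : angle ξ < x₁
        · have mS := (hSq ξ hq).2 hc
          have mx : ξ ∈ {ζ | tilt x₁ ζ < 0} := (hx1 ξ hq).2 hc'
          have ma : angle ξ ∈ arc τ := ⟨hc.1, hc'⟩
          have mst : ξ ∈ {ξ | y < (angle ξ - arcLeft τ) / arcLen τ} := hc.2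
          rw [stepCut, indicator_of_mem mst, cut_of_mem ma, indicator_of_mem hq, indicator_of_mem mx,
            indicator_of_mem mS, indicator_of_mem m1, indicator_of_mem m0, strip]
          by_cases hz : G ξ = 0
          · rw [hz, mul_zero]
          · obtain ⟨f0, f1, f2, f3, f4, f5, f6⟩ := quadrant_facts hq
            rw [stripC_eq_one, one_mul]
            have hle := hhi ξ hz
            rw [← hx₀, ← hs, tilt_eq hq, abs_div, abs_of_pos hs0, div_le_iff₀ hs0]
            have a0 : 0 ≤ angle ξ - x₀ := by linarith [hc.1]
            have a1 : angle ξ - x₀ ≤ s := by linarith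
            have b0 : 0 ≤ 1 + x₀ * angle ξ := by positivity
            have b1 : 1 + x₀ * angle ξ ≤ 2 := by nlinarith
            rw [abs_of_nonneg (by positivity)]
            have h1 := mul_le_mul a1 b1 b0 hs0.le
            have h2 := mul_le_mul (by linarith : ‖ξ‖ + ξ 0 ≤ 2) h1 (by positivity) (by norm_num)
            linarith
        · have mx : ξ ∉ {ζ | tilt x₁ ζ < 0} := fun h => hc' ((hx1 ξ hq).1 h)
          have ma : angle ξ ∉ arc τ := fun h => hc' h.2
          rw [indicator_of_notMem mx, stepCut]; unfold cut; simp [*]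
      · have mS : ξ ∉ S := fun h => hc ((hSq ξ hq).1 h)
        have : {ζ | tilt x₁ ζ < 0}.indicator (S.indicator
          ({ζ | 0 ≤ p1 ζ}.indicator ({ζ | 0 < p0 ζ}.indicator (strip G τ)))) ξ = 0 := by
          by_cases hm : ξ ∈ {ζ | tilt x₁ ζ < 0}
          · rw [indicator_of_mem hm, indicator_of_notMem mS]
          · rw [indicator_of_notMem hm]
        rw [this, stepCut]
        by_cases hst : ξ ∈ {ξ | y < (angle ξ - arcLeft τ) / arcLen τ}
        · rw [indicator_of_mem hst]
          refine cut_of_notMem fun h => hc ⟨h.1, hst⟩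
        · simp [*]
    · have l0 : stepCut (quadrant.indicator G) τ y ξ = 0 := by
        by_contra h
        have h1 : cut angle (quadrant.indicator G) τ ξ ≠ 0 := fun h0 => h (by
          simp [stepCut, indicator, h0])
        exact (cut_ne_zero h1).2 (indicator_of_notMem hq G)
      rw [l0]
      symm
      by_contra h
      have k1 : ξ ∈ {ζ | tilt x₁ ζ < 0} := mem_of_indicator_ne_zero h
      rw [indicator_of_mem k1] at h
      have k2 := mem_of_indicator_ne_zero h
      rw [indicator_of_mem k2] at h
      have k3 := mem_of_indicator_ne_zero h
      rw [indicator_of_mem k3] at h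
      have k4 := mem_of_indicator_ne_zero h
      exact hq ⟨k4, k3⟩
  rw [heq]; linarith

/-- Strips of a given level overlap boundedly. -/
theorem card_strips_le {ξ : Euc 2} (hlo : 1 / 4 ≤ ‖ξ‖) (k : ℕ) :
    ((Finset.range (2 ^ (k + 1) + 1)).filter fun m =>
      |tilt (arcLeft (k, m)) ξ| ≤ 8 * arcLen (k, m)).card ≤ 400 := by
  wlog h0 : 0 ≤ ξ 0 generalizing ξ
  · have := this (ξ := -ξ) (by simpa using hlo) (by
      have e : (-ξ) 0 = -ξ 0 := rfl
      rw [e]; linarith)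
    simpa using this
  have hn := norm_sq_euc ξ
  set h := ‖ξ‖ + ξ 0 with hh
  have hpos : 0 < h := by linarith
  set θ := ξ 1 / h with hθ
  have e1 : ξ 1 = h * θ := by rw [hθ]; field_simp
  have e2 : ‖ξ‖ - ξ 0 = h * θ ^ 2 := by rw [hθ]; field_simp; rw [hh]; nlinarith
  have e0 : ξ 0 = h * (1 - θ ^ 2) / 2 := by linarith
  have hθ1 : |θ| ≤ 1 := by rw [abs_le_one_iff_mul_self_le_one]; nlinarith
  have et : ∀ x, tilt x ξ = h * ((θ - x) * (1 + x * θ)) := by intro x; rw [tilt_apply, e1, e0]; ring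
  set s : ℝ := 1 / 2 ^ k
  have hs0 : 0 < s := by positivity
  have hs2 : (2 : ℝ) ^ (k + 1) * s = 2 := by grind
  have key : ∀ m ∈ (Finset.range (2 ^ (k + 1) + 1)).filter (fun m =>
      |tilt (arcLeft (k, m)) ξ| ≤ 8 * arcLen (k, m)),
      m ∈ Finset.Icc (⌊2 * |θ| / s⌋₊ - 64) (⌊2 * |θ| / s⌋₊ + 65) ∪ (Finset.range 129 ∪
        Finset.Icc (2 ^ (k + 1) - 128) (2 ^ (k + 1))) := by
    intro m hm; rw [mem_filter, Finset.mem_range] at hm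
    obtain ⟨hm1, hm2⟩ := hm
    have hxe : arcLeft (k, m) = m * s / 2 := arcLeft_eq (k, m)
    have hle : (m : ℝ) ≤ 2 ^ (k + 1) := by exact_mod_cast Nat.lt_succ_iff.1 hm1
    set x := arcLeft (k, m)
    have hx0 : 0 ≤ x := arcLeft_nonneg _
    have hx1 : x ≤ 1 := by
      have := mul_le_mul_of_nonneg_right hle hs0.le
      linarith
    have harc : arcLen (k, m) = s := rfl
    rw [harc, et, abs_mul, abs_of_pos hpos] at hm2
    have hb : |(θ - x) * (1 + x * θ)| ≤ 32 * s := by nlinarith [abs_nonneg ((θ - x) * (1 + x * θ))]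
    rw [Finset.mem_union, Finset.mem_union, Finset.mem_Icc, Finset.mem_range, Finset.mem_Icc]
    rw [abs_le] at hθ1
    rcases le_or_gt 0 θ with hp | hp
    · left
      have h1 : 1 ≤ 1 + x * θ := by nlinarith
      have h2 : |θ - x| ≤ 32 * s := by
        rw [abs_mul, abs_of_pos (by linarith : 0 < 1 + x * θ)] at hb; nlinarith [abs_nonneg (θ - x)]
      rw [abs_le] at h2; rw [abs_of_nonneg hp]
      set c := 2 * θ / s
      have hcs : c * s = 2 * θ := by grind
      have hc0 : 0 ≤ c := by positivity
      have f1 := Nat.floor_le hc0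
      have f2 := Nat.lt_floor_add_one c
      have u1 : (m : ℝ) ≤ c + 64 := by
        have : (m : ℝ) * s ≤ (c + 64) * s := by linarith
        exact le_of_mul_le_mul_right this hs0
      have u2 : c - 64 ≤ m := by
        have : (c - 64) * s ≤ m * s := by linarith
        exact le_of_mul_le_mul_right this hs0
      constructor
      · have : (⌊c⌋₊ : ℝ) ≤ ((m + 64 : ℕ) : ℝ) := by push_cast; linarith
        have := Nat.cast_le.1 this
        omega
      · have : (m : ℝ) < ((⌊c⌋₊ + 65 : ℕ) : ℝ) := by push_cast; linarith
        exact (Nat.cast_lt.1 this).le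
    · right
      have ha : 0 ≤ x * (θ + 1) := mul_nonneg hx0 (by linarith)
      have hA0 : 0 ≤ 1 + x * θ := by linarith
      have hneg : |(θ - x) * (1 + x * θ)| = (x - θ) * (1 + x * θ) := by
        rw [abs_mul, abs_of_neg (by linarith), abs_of_nonneg hA0]; ring
      rw [hneg] at hb
      rcases le_or_gt (1 / 2) (x - θ) with hq | hq
      · right
        have h1 := mul_le_mul_of_nonneg_right hq hA0
        have h2 : 1 - 64 * s ≤ x := by linarith
        refine ⟨?_, Nat.lt_succ_iff.1 hm1⟩
        have h3 : (2 : ℝ) ^ (k + 1) ≤ m + 128 := by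
          have : (2 : ℝ) ^ (k + 1) * s ≤ (m + 128) * s := by linarith
          exact le_of_mul_le_mul_right this hs0
        have h4 : 2 ^ (k + 1) ≤ m + 128 := by exact_mod_cast h3
        omega
      · left
        have h1 : 1 / 2 ≤ 1 + x * θ := by linarith
        have h2 := mul_le_mul (by linarith : x ≤ x - θ) h1 (by norm_num) (by linarith)
        have h3 : (m : ℝ) ≤ 128 := by
          have : (m : ℝ) * s ≤ 128 * s := by linarith
          exact le_of_mul_le_mul_right this hs0
        have h4 : m ≤ 128 := by exact_mod_cast h3
        omega
  refine (Finset.card_le_card key).trans ((Finset.card_union_le _ _).trans ?_)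
  have c1 : (Finset.Icc (⌊2 * |θ| / s⌋₊ - 64) (⌊2 * |θ| / s⌋₊ + 65)).card ≤ 130 := by
    rw [Nat.card_Icc]; omega
  have c2 : (Finset.range 129 ∪ Finset.Icc (2 ^ (k + 1) - 128) (2 ^ (k + 1))).card ≤ 129 + 129 := by
    refine (Finset.card_union_le _ _).trans (add_le_add ?_ ?_)
    · rw [card_range]
    · rw [Nat.card_Icc]; omega
  omega

theorem sum_strip_sq_le (hlo : ∀ ξ, G ξ ≠ 0 → 1 / 4 ≤ ‖ξ‖) (N : ℕ) (ξ : Euc 2) :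
    ∑ τ ∈ subArcs (0, 0) N, ‖strip G τ ξ‖ ^ 2 ≤ 400 * ((N : ℝ) + 1) * ‖G ξ‖ ^ 2 := by
  by_cases hz : G ξ = 0
  · simp [strip, hz]
  have hlo' := hlo ξ hz
  have hsub : subArcs (0, 0) N ⊆ Finset.biUnion (Finset.range (N + 1)) fun k =>
      (Finset.range (2 ^ (k + 1) + 1)).image fun m => (k, m) := by
    rintro ⟨k, m⟩ h; rw [mem_subArcs] at h
    obtain ⟨h1, _, _, h3⟩ := h
    grind
  have hterm : ∀ τ, ‖strip G τ ξ‖ ^ 2 ≤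
      if |tilt (arcLeft τ) ξ| ≤ 8 * arcLen τ then ‖G ξ‖ ^ 2 else 0 := by
    intro τ
    have hs0 := arcLen_pos τ
    split_ifs with h
    · rw [strip, norm_mul, mul_pow]
      have := stripC_norm_le (tilt (arcLeft τ) ξ / arcLen τ)
      simp_all
    · have : stripC (tilt (arcLeft τ) ξ / arcLen τ) = 0 := by
        apply stripC_eq_zero; rw [abs_div, abs_of_pos hs0, le_div_iff₀ hs0]; linarith
      simp [strip, this]
  calc ∑ τ ∈ subArcs (0, 0) N, ‖strip G τ ξ‖ ^ 2
      ≤ ∑ τ ∈ subArcs (0, 0) N, if |tilt (arcLeft τ) ξ| ≤ 8 * arcLen τ then ‖G ξ‖ ^ 2 else 0 :=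
        sum_le_sum fun τ _ => hterm τ
    _ ≤ ∑ τ ∈ Finset.biUnion (Finset.range (N + 1)) fun k =>
        (Finset.range (2 ^ (k + 1) + 1)).image fun m => (k, m),
          if |tilt (arcLeft τ) ξ| ≤ 8 * arcLen τ then ‖G ξ‖ ^ 2 else 0 := by gcongr
    _ ≤ ∑ k ∈ Finset.range (N + 1), ∑ m ∈ Finset.range (2 ^ (k + 1) + 1),
          if |tilt (arcLeft (k, m)) ξ| ≤ 8 * arcLen (k, m) then ‖G ξ‖ ^ 2 else 0 := by
        rw [Finset.sum_biUnion]
        · simp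
        · intro a _ b _ hab; rw [Function.onFun, Finset.disjoint_left]; grind
    _ ≤ ∑ k ∈ Finset.range (N + 1), 400 * ‖G ξ‖ ^ 2 := by
        refine sum_le_sum fun k _ => ?_
        rw [← sum_filter, sum_const, nsmul_eq_mul]
        refine mul_le_mul_of_nonneg_right ?_ (by positivity)
        exact_mod_cast card_strips_le hlo' k
    _ = _ := by rw [sum_const, card_range, nsmul_eq_mul]; push_cast; ring

theorem sum_integral_strip_le (hG : Nice G) (hlo : ∀ ξ, G ξ ≠ 0 → 1 / 4 ≤ ‖ξ‖) (N : ℕ) :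
    ∑ τ ∈ subArcs (0, 0) N, ∫ ξ, ‖strip G τ ξ‖ ^ 2 ≤ 400 * ((N : ℝ) + 1) * ∫ ξ, ‖G ξ‖ ^ 2 := by
  rw [← integral_finsetSum _ fun τ _ => (hG.strip τ).integrable_sq, ← integral_const_mul]
  exact integral_mono (integrable_finsetSum _ fun τ _ => (hG.strip τ).integrable_sq)
    (hG.integrable_sq.const_mul _) fun ξ => sum_strip_sq_le hlo N ξ

end Strips

section LocalSmoothing

theorem NiceReal.scale {k : ℝ → ℝ} (hk : NiceReal k) {δ : ℝ} (hδ : 0 < δ) :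
    NiceReal fun x => k (x / δ) := by
  obtain ⟨M, hM0, hM⟩ := hk.bdd
  obtain ⟨ρ, hρ0, hρ⟩ := hk.supp
  refine ⟨hk.meas.comp (measurable_id.div_const δ), ⟨M, hM0, fun x => hM _⟩,
    ⟨ρ * δ, by positivity, fun x hx => ?_⟩⟩
  have := hρ _ hx
  rwa [norm_div, norm_of_nonneg hδ.le, div_le_iff₀ hδ] at this

theorem exists_linear_le_pow {r : ℝ} (hr : 1 < r) :
    ∃ C : ℝ, 0 ≤ C ∧ ∀ n : ℕ, (n : ℝ) + 11 ≤ C * r ^ n := by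
  have h : 0 < r - 1 := by linarith
  refine ⟨11 + 1 / (r - 1), by positivity, fun n => ?_⟩
  have := one_add_mul_le_pow (by linarith : -2 ≤ r - 1) n
  rw [add_sub_cancel] at this
  have e : (1 + (n : ℝ) * (r - 1)) * (11 + 1 / (r - 1)) = 11 + 1 / (r - 1) + 11 * (n * (r - 1)) + n := by
    field_simp; ring
  have : 0 ≤ 1 / (r - 1) := by positivity
  nlinarith

/-- Quartic energies of thin lifted profiles. -/
theorem exists_quartic_coneLift_le {ρ : ℝ} (hρ : 1 < ρ) : ∃ c C : ℝ, 0 < c ∧ 0 ≤ C ∧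
    ∀ (n : ℕ) (G : Euc 2 → ℂ) (B : ℝ), Nice G → (∀ ξ, G ξ ≠ 0 → 1 / 4 ≤ ‖ξ‖) →
    (∀ ξ, G ξ ≠ 0 → ‖ξ‖ ≤ 1) →
    (∀ ξ ξ', G ξ ≠ 0 → G ξ' ≠ 0 → |(‖ξ‖ + ξ 0) - (‖ξ'‖ + ξ' 0)| ≤ c) → (∀ x, ‖𝓕⁻ G x‖ ≤ B) →
    quartic (coneLift (fun x => timeBump (x / (1 / 4 ^ n))) (quadrant.indicator G)) ≤
      C * ρ ^ n * (1 / 4 ^ n) ^ 3 * (B ^ 2 * ∫ ξ, ‖G ξ‖ ^ 2) := by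
  have hr : 1 < √ρ := by rw [Real.lt_sqrt (by norm_num)]; simpa using hρ
  obtain ⟨D, hD0, hD⟩ := exists_linear_le_pow hr
  obtain ⟨g, hg, hg1, hg2⟩ := exists_scale hr
  obtain ⟨Ψ', Ψ'', b, hd, hd', hc, hb, hb', hb''⟩ := exists_autocor_deriv
  refine ⟨1 / (64 * 4 ^ (2 * g)), 16000 * (2 * (g : ℝ) + 11) * D *
    (128000000 * b ^ 2 * (64 ^ 4 * (stripNorm ^ 2 * 400))), by positivity, by positivity, ?_⟩
  intro n G B hG hlo hhi hthin hB
  set δ : ℝ := 1 / 4 ^ n with hδ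
  have hδ0 : 0 < δ := by positivity
  set H := quadrant.indicator G with hH
  have hne : ∀ ξ, H ξ ≠ 0 → ξ ∈ quadrant ∧ G ξ ≠ 0 := by simp_all
  have hP : Profile H := ⟨hG.indicator measurableSet_quadrant, fun ξ h => (hne ξ h).1,
    fun ξ h => hlo ξ (hne ξ h).2, fun ξ h => hhi ξ (hne ξ h).2⟩
  set k : ℝ → ℝ := fun x => timeBump (x / δ) with hk
  have hkn : NiceReal k := (niceReal_bump timeBump).scale hδ0
  have hsupp : ∀ x, k x ≠ 0 → |x| ≤ 1 / 4 ^ (n + 14) := by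
    intro x hx
    by_contra hcon
    apply hx
    refine timeBump.zero_of_le_dist ?_
    rw [dist_zero_right, norm_div, norm_of_nonneg hδ0.le, le_div_iff₀ hδ0, norm_eq_abs]
    refine le_trans (le_of_eq ?_) (not_le.1 hcon).le
    simp only [timeBump, hδ]; grind
  have hS := hP.supports hkn hsupp
  have hmain := hS.quartic_le hr hg hg1 hg2 (fun ζ ζ' h1 h2 => ?_) (n := n) le_rfl
  · rw [cut_coneLift, hP.cut_root] at hmain
    refine hmain.trans ?_
    have hen : ∀ τ' ∈ subArcs (0, 0) (n + 10), lightCone.energy (coneLift k H) τ' n ≤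
        128000000 * b ^ 2 * δ ^ 3 * (64 ^ 4 * ((stripNorm * B) ^ 2 * ∫ ξ, ‖strip G τ' ξ‖ ^ 2)) := by
      intro τ' hτ'
      have hle := (mem_subArcs.1 hτ').2.le
      have h1 : arcLeft τ' + arcLen τ' ≤ 1 := by
        refine hle.2.trans ?_
        simp [arcLeft, arcLen]
      have hp := arcLen_pos τ'
      refine energy_le_of_quartic_stepCut (niceReal_bump timeBump) hd hd' hc hb hb' hb'' hP
        (by linarith) n fun y => ?_
      exact (quartic_stepCut_le hG hhi h1 y).trans
        (mul_le_mul_of_nonneg_left (quartic_strip_le hG hB τ') (by norm_num))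
    have hsum : ∑ τ' ∈ subArcs (0, 0) (n + 10), lightCone.energy (coneLift k H) τ' n ≤
        128000000 * b ^ 2 * δ ^ 3 * (64 ^ 4 * ((stripNorm * B) ^ 2 *
          (400 * (((n + 10 : ℕ) : ℝ) + 1) * ∫ ξ, ‖G ξ‖ ^ 2))) := by
      refine (sum_le_sum hen).trans ?_
      rw [← mul_sum, ← mul_sum, ← mul_sum]
      have := sum_integral_strip_le hG hlo (n + 10)
      gcongr
    have hρr : ρ ^ n = √ρ ^ n * √ρ ^ n := by rw [← mul_pow, Real.mul_self_sqrt (by linarith)]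
    have hsr : 0 ≤ √ρ ^ n := by positivity
    calc 16000 * (2 * (g : ℝ) + 11) * √ρ ^ n *
          ∑ τ' ∈ subArcs (0, 0) (n + 10), lightCone.energy (coneLift k H) τ' n
        ≤ 16000 * (2 * (g : ℝ) + 11) * √ρ ^ n * (128000000 * b ^ 2 * δ ^ 3 * (64 ^ 4 *
          ((stripNorm * B) ^ 2 * (400 * (D * √ρ ^ n) * ∫ ξ, ‖G ξ‖ ^ 2)))) := by
          refine mul_le_mul_of_nonneg_left (hsum.trans ?_) (by positivity)
          have := hD n
          push_cast; gcongr; linarith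
      _ = _ := by rw [hρr]; ring
  · have k1 := (hne ζ.1 (right_ne_zero_of_mul h1)).2
    have k2 := (hne ζ'.1 (right_ne_zero_of_mul h2)).2
    bound

/-- The time horizon (relative to the scale `4 ^ n`) on which the time cutoff is effective. -/
def horizon : ℝ := exists_lower_bound_timeBump.choose

theorem horizon_pos : 0 < horizon := exists_lower_bound_timeBump.choose_spec.choose_spec.1

theorem exists_wave_four_thin {ρ : ℝ} (hρ : 1 < ρ) : ∃ c C : ℝ, 0 < c ∧ 0 ≤ C ∧
    ∀ (n : ℕ) (G : Euc 2 → ℂ) (B : ℝ), Nice G → (∀ ξ, G ξ ≠ 0 → 1 / 4 ≤ ‖ξ‖) →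
    (∀ ξ, G ξ ≠ 0 → ‖ξ‖ ≤ 1) →
    (∀ ξ ξ', G ξ ≠ 0 → G ξ' ≠ 0 → |(‖ξ‖ + ξ 0) - (‖ξ'‖ + ξ' 0)| ≤ c) → (∀ x, ‖𝓕⁻ G x‖ ≤ B) →
    ∫⁻ t in {t : ℝ | |t| ≤ horizon * 4 ^ n}, ∫⁻ x,
      ‖𝓕⁻ (waveProfile (quadrant.indicator G) t) x‖ₑ ^ 4 ≤
      ofReal (C * ρ ^ n * 4 ^ n * (B ^ 2 * ∫ ξ, ‖G ξ‖ ^ 2)) := by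
  obtain ⟨c₀, hc₀, hlow⟩ := exists_lower_bound_timeBump.choose_spec.choose_spec
  set c₁ := exists_lower_bound_timeBump.choose_spec.choose
  obtain ⟨c, C, hc, hC, h⟩ := exists_quartic_coneLift_le hρ
  refine ⟨c, C / c₁ ^ 4, hc, by positivity, ?_⟩
  obtain ⟨hc₁, hlow⟩ : 0 < c₁ ∧ ∀ t, |t| ≤ horizon → c₁ ≤ ‖𝓕⁻ (fun x => (timeBump x : ℂ)) t‖ :=
    ⟨hc₀, hlow⟩
  intro n G B hG hlo hhi hthin hB
  have hq := h n G B hG hlo hhi hthin hB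
  set δ : ℝ := 1 / 4 ^ n with hδ
  have hδ0 : 0 < δ := by positivity
  have hH : Nice (quadrant.indicator G) := hG.indicator measurableSet_quadrant
  have hkn : NiceReal fun x => timeBump (x / δ) := (niceReal_bump timeBump).scale hδ0
  have hw := lintegral_wave_four hkn hH
  have hI : 0 ≤ ∫ ξ, ‖G ξ‖ ^ 2 := integral_nonneg fun _ => by positivity
  set X := ∫⁻ t in {t : ℝ | |t| ≤ horizon * 4 ^ n}, ∫⁻ x,
      ‖𝓕⁻ (waveProfile (quadrant.indicator G) t) x‖ₑ ^ 4 with hX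
  have h1 : ofReal ((δ * c₁) ^ 4) * X ≤
      ofReal (C * ρ ^ n * δ ^ 3 * (B ^ 2 * ∫ ξ, ‖G ξ‖ ^ 2)) := by
    refine le_trans ?_ (ofReal_le_ofReal hq)
    rw [← hw, hX, ← lintegral_const_mul' _ _ ofReal_ne_top]
    refine le_trans (setLIntegral_mono_ae' ?_ (.of_forall fun t ht => ?_))
      (setLIntegral_le_lintegral _ _)
    · exact (isClosed_le continuous_abs continuous_const).measurableSet
    · gcongr; rw [fourierInv_scale _ hδ0, ofReal_pow (by positivity)]; gcongr
      rw [← ofReal_norm, norm_mul, norm_real, norm_of_nonneg hδ0.le]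
      refine ofReal_le_ofReal (mul_le_mul_of_nonneg_left (hlow _ ?_) hδ0.le)
      rw [abs_mul, abs_of_pos hδ0, hδ, one_div, inv_mul_le_iff₀ (by positivity), mul_comm]; exact ht
  have hpos : 0 < (δ * c₁) ^ 4 := by positivity
  have e : C / c₁ ^ 4 * ρ ^ n * 4 ^ n * (B ^ 2 * ∫ ξ, ‖G ξ‖ ^ 2) =
      ((δ * c₁) ^ 4)⁻¹ * (C * ρ ^ n * δ ^ 3 * (B ^ 2 * ∫ ξ, ‖G ξ‖ ^ 2)) := by
    have : (4 : ℝ) ^ n = δ⁻¹ := by rw [hδ]; simp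
    rw [this]; field_simp
  rw [e, ofReal_mul (by positivity)]
  calc X = ofReal ((δ * c₁) ^ 4)⁻¹ * (ofReal ((δ * c₁) ^ 4) * X) := by
        rw [← mul_assoc, ← ofReal_mul (by positivity), inv_mul_cancel₀ hpos.ne']; simp
    _ ≤ _ := by gcongr

theorem enorm_sum_pow_le {ι : Type*} (s : Finset ι) (f : ι → ℂ) (p : ℕ) :
    ‖∑ i ∈ s, f i‖ₑ ^ (p + 1) ≤ (s.card : ℝ≥0∞) ^ p * ∑ i ∈ s, ‖f i‖ₑ ^ (p + 1) := by
  have h := ENNReal.rpow_sum_le_const_mul_sum_rpow s (fun i => ‖f i‖ₑ) (p := ((p + 1 : ℕ) : ℝ)) (by simp)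
  have e : ((p + 1 : ℕ) : ℝ) - 1 = (p : ℕ) := by push_cast; ring
  rw [e] at h; simp only [rpow_natCast] at h; exact (pow_le_pow_left' (enorm_sum_le _ _) _).trans h

theorem fourierInv_finset_sum {ι : Type*} (s : Finset ι) {g : ι → Euc 2 → ℂ}
    (hg : ∀ i ∈ s, Integrable (g i)) (x : Euc 2) :
    𝓕⁻ (fun ξ => ∑ i ∈ s, g i ξ) x = ∑ i ∈ s, 𝓕⁻ (g i) x := by
  simp_rw [fourierInv_eq, smul_def, smul_sum]
  refine integral_finsetSum s fun i hi => ?_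
  have hc : Continuous fun ξ : Euc 2 => (𝐞 (inner ℝ ξ x) : ℂ) := by fun_prop
  exact ((hg i hi).bdd_mul hc.aestronglyMeasurable (c := 1)
    (.of_forall fun ξ => (norm_fourierChar _).le))

theorem wave_finset_sum {ι : Type*} (s : Finset ι) {g : ι → Euc 2 → ℂ} (hg : ∀ i ∈ s, Nice (g i))
    (t : ℝ) (x : Euc 2) :
    𝓕⁻ (waveProfile (fun ξ => ∑ i ∈ s, g i ξ) t) x = ∑ i ∈ s, 𝓕⁻ (waveProfile (g i) t) x := by
  rw [← fourierInv_finset_sum s fun i hi => ((hg i hi).waveProfile t).integrable]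
  refine congrArg (fun h : Euc 2 → ℂ => 𝓕⁻ h x) (funext fun ξ => ?_)
  simp only [waveProfile, mul_sum]

/-- Space-time `L⁴` norms of finite superpositions of waves. -/
theorem lintegral_wave_four_sum_le {ι : Type*} (s : Finset ι) {g : ι → Euc 2 → ℂ}
    (hg : ∀ i ∈ s, Nice (g i)) (T : Set ℝ) :
    ∫⁻ t in T, ∫⁻ x, ‖𝓕⁻ (waveProfile (fun ξ => ∑ i ∈ s, g i ξ) t) x‖ₑ ^ 4 ≤
      (s.card : ℝ≥0∞) ^ 3 * ∑ i ∈ s, ∫⁻ t in T, ∫⁻ x, ‖𝓕⁻ (waveProfile (g i) t) x‖ₑ ^ 4 := by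
  have hm : ∀ i ∈ s, Measurable fun p : ℝ × Euc 2 => ‖𝓕⁻ (waveProfile (g i) p.1) p.2‖ₑ ^ 4 :=
    fun i hi => (measurable_wave (hg i hi)).enorm.pow_const 4
  rw [← lintegral_finsetSum' s fun i hi => ((hm i hi).lintegral_prod_right').aemeasurable,
    ← lintegral_const_mul' _ _ (by simp)]
  refine lintegral_mono fun t => ?_
  have hmt : ∀ i ∈ s, AEMeasurable (fun x => ‖𝓕⁻ (waveProfile (g i) t) x‖ₑ ^ 4) volume :=
    fun i hi => ((hm i hi).comp (measurable_prodMk_left (x := t))).aemeasurable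
  rw [← lintegral_finsetSum' s hmt, ← lintegral_const_mul' _ _ (by simp)]
  refine lintegral_mono fun x => ?_
  simp only; rw [wave_finset_sum s hg]; exact enorm_sum_pow_le s _ 3

/-- Smooth symbols supported at unit frequency. -/
structure FreqSymbol (m : Euc 2 → ℂ) : Prop where
  smooth : ContDiff ℝ (⊤ : ℕ∞) m
  lo : ∀ ξ, m ξ ≠ 0 → 1 / 4 ≤ ‖ξ‖
  hi : ∀ ξ, m ξ ≠ 0 → ‖ξ‖ ≤ 1

theorem FreqSymbol.hasCompactSupport {m : Euc 2 → ℂ} (hm : FreqSymbol m) : HasCompactSupport m :=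
  HasCompactSupport.intro (isCompact_closedBall 0 1) fun ξ h => by
    by_contra hc; exact h (by rw [mem_closedBall, dist_zero_right]; exact hm.hi ξ hc)

theorem FreqSymbol.nice {m : Euc 2 → ℂ} (hm : FreqSymbol m) : Nice m := by
  obtain ⟨C, hC⟩ := hm.hasCompactSupport.exists_bound_of_continuous hm.smooth.continuous
  exact ⟨hm.smooth.continuous.measurable, ⟨C, (norm_nonneg _).trans (hC 0), hC⟩, ⟨1, zero_le_one, hm.hi⟩⟩

theorem FreqSymbol.integrable_kernel {m : Euc 2 → ℂ} (hm : FreqSymbol m) : Integrable (𝓕⁻ m) := by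
  have e : m = (hm.hasCompactSupport.toSchwartzMap hm.smooth : SchwartzMap (Euc 2) ℂ) := rfl
  rw [e, ← SchwartzMap.fourierInv_coe]; fun_prop

theorem FreqSymbol.nice_mul {m f : Euc 2 → ℂ} (hm : FreqSymbol m) (hf : Integrable f) :
    Nice fun ξ => m ξ * 𝓕 f ξ :=
  hm.nice.mul_bdd (continuous_fourier hf).measurable ⟨_, norm_fourier_le f⟩

theorem FreqSymbol.norm_le {m f : Euc 2 → ℂ} (hm : FreqSymbol m) (hf : Integrable f) {B : ℝ}
    (hB : ∀ x, ‖f x‖ ≤ B) (x : Euc 2) :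
    ‖𝓕⁻ (fun ξ => m ξ * 𝓕 f ξ) x‖ ≤ (∫ y, ‖𝓕⁻ m y‖) * B := by
  rw [fourierInv_mul_fourier hm.nice.integrable hf,
    ← integral_sub_left_eq_self (fun y => ‖𝓕⁻ m y‖) volume x, ← integral_mul_const]
  refine norm_integral_le_of_norm_le ((hm.integrable_kernel.comp_sub_left x).norm.mul_const B)
    (.of_forall fun y => ?_)
  rw [norm_mul, mul_comm]
  bound

theorem memLp_two_of_bound {f : Euc 2 → ℂ} (hf : Integrable f) {B : ℝ} (hB : ∀ x, ‖f x‖ ≤ B) :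
    MemLp f 2 volume := by
  rw [memLp_two_iff_integrable_sq_norm hf.aestronglyMeasurable]
  refine (hf.norm.const_mul B).mono' (hf.aestronglyMeasurable.norm.pow 2)
    (.of_forall fun x => ?_)
  rw [norm_pow, norm_norm, pow_two]
  bound

theorem FreqSymbol.lintegral_sq_le {m f : Euc 2 → ℂ} (hm : FreqSymbol m) (hf : Integrable f)
    (hf2 : MemLp f 2 volume) {M : ℝ} (hM : ∀ ξ, ‖m ξ‖ ≤ M) :
    ofReal (∫ ξ, ‖m ξ * 𝓕 f ξ‖ ^ 2) ≤ ofReal (M ^ 2) * ∫⁻ x, ‖f x‖ₑ ^ 2 := by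
  rw [← (hm.nice_mul hf).lintegral_sq, ← lintegral_fourier_sq hf hf2,
    ← lintegral_const_mul' _ _ ofReal_ne_top]
  refine lintegral_mono fun ξ => ?_
  have : ‖m ξ‖ₑ ^ 2 ≤ ofReal (M ^ 2) := by rw [← ofReal_norm, ← ofReal_pow (norm_nonneg _)]; bound
  rw [enorm_mul, mul_pow]; gcongr

/-- A smooth partition of unity on the line subordinate to intervals of length `2 c`. -/
def slab (c : ℝ) (i : ℕ) (h : ℝ) : ℝ :=
  Real.smoothTransition (h / c - i + 1) - Real.smoothTransition (h / c - i)

theorem sum_slab {c : ℝ} (hc : 0 < c) {N : ℕ} {h : ℝ} (h0 : 0 ≤ h) (hN : h ≤ N * c) :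
    ∑ i ∈ Finset.range (N + 1), slab c i h = 1 := by
  have e : ∀ i ∈ Finset.range (N + 1), slab c i h =
      -(Real.smoothTransition (h / c - ((i + 1 : ℕ) : ℝ) + 1) - Real.smoothTransition (h / c - (i : ℝ) + 1)) := by
    intro i _; unfold slab; push_cast; grind
  rw [sum_congr rfl e, Finset.sum_neg_distrib,
    Finset.sum_range_sub (fun i : ℕ => Real.smoothTransition (h / c - (i : ℝ) + 1))]
  have h1 : 0 ≤ h / c := by positivity
  have h2 : h / c ≤ N := by rwa [div_le_iff₀ hc]
  rw [Real.smoothTransition.zero_of_nonpos (by push_cast; linarith),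
    Real.smoothTransition.one_of_one_le (by push_cast; linarith)]
  norm_num

theorem slab_ne_zero {c : ℝ} (hc : 0 < c) {i : ℕ} {h : ℝ} (hs : slab c i h ≠ 0) :
    |h - i * c| ≤ c := by
  have e : h / c * c = h := by field_simp
  rw [abs_le]
  constructor
  · by_contra hcon
    apply hs
    have : h / c - i + 1 ≤ 0 := by nlinarith
    rw [slab, Real.smoothTransition.zero_of_nonpos this, Real.smoothTransition.zero_of_nonpos (by linarith),
      sub_zero]
  · by_contra hcon
    apply hs
    have : 1 ≤ h / c - i := by nlinarith
    rw [slab, Real.smoothTransition.one_of_one_le this, Real.smoothTransition.one_of_one_le (by linarith),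
      sub_self]

theorem FreqSymbol.slab {m : Euc 2 → ℂ} (hm : FreqSymbol m) (c : ℝ) (i : ℕ) :
    FreqSymbol fun ξ => m ξ * (slab c i (‖ξ‖ + ξ 0) : ℂ) := by
  refine ⟨?_, fun ξ h => hm.lo ξ (left_ne_zero_of_mul h), fun ξ h => hm.hi ξ (left_ne_zero_of_mul h)⟩
  rw [contDiff_iff_contDiffAt]
  intro ξ
  by_cases h0 : ξ = 0
  · refine (contDiffAt_const (c := (0 : ℂ))).congr_of_eventuallyEq ?_
    subst h0
    filter_upwards [Metric.ball_mem_nhds (0 : Euc 2) (by norm_num : (0 : ℝ) < 1 / 4)] with ζ hζ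
    have : m ζ = 0 := by
      by_contra hc
      rw [mem_ball, dist_zero_right] at hζ; linarith [hm.lo ζ hc]
    simp [this]
  · have hh : ContDiffAt ℝ (⊤ : ℕ∞) (fun ζ : Euc 2 => ‖ζ‖ + ζ 0) ξ :=
      (contDiffAt_norm ℝ h0).add (EuclideanSpace.proj (𝕜 := ℝ) (0 : Fin 2)).contDiff.contDiffAt
    refine hm.smooth.contDiffAt.mul (ofRealCLM.contDiff.contDiffAt.comp ξ ?_)
    have hT : ContDiff ℝ (⊤ : ℕ∞) Real.smoothTransition := Real.smoothTransition.contDiff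
    exact (hT.contDiffAt.comp ξ (((hh.div_const c).sub contDiffAt_const).add contDiffAt_const)).sub
      (hT.contDiffAt.comp ξ ((hh.div_const c).sub contDiffAt_const))

/-- Local smoothing for frequencies in the first quadrant. -/
theorem FreqSymbol.exists_wave_four_quadrant {m : Euc 2 → ℂ} (hm : FreqSymbol m) {ρ : ℝ} (hρ : 1 < ρ) :
    ∃ C : ℝ, 0 ≤ C ∧ ∀ (n : ℕ) (f : Euc 2 → ℂ) (B : ℝ), Integrable f → (∀ x, ‖f x‖ ≤ B) →
    ∫⁻ t in {t : ℝ | |t| ≤ horizon * 4 ^ n}, ∫⁻ x,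
      ‖𝓕⁻ (waveProfile (quadrant.indicator fun ξ => m ξ * 𝓕 f ξ) t) x‖ₑ ^ 4 ≤
      ofReal (C * ρ ^ n * 4 ^ n) * (ofReal (B ^ 2) * ∫⁻ x, ‖f x‖ₑ ^ 2) := by
  obtain ⟨c, C, hc, hC, hthin⟩ := exists_wave_four_thin hρ
  set c' := c / 2
  have hc'0 : 0 < c' := by positivity
  set N := ⌈2 / c'⌉₊
  have hNc : 2 ≤ N * c' := by
    have := Nat.le_ceil (2 / c')
    rwa [div_le_iff₀ hc'0] at this
  set mi : ℕ → Euc 2 → ℂ := fun i ξ => m ξ * (_root_.slab c' i (‖ξ‖ + ξ 0) : ℂ) with hmi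
  have hmS : ∀ i, FreqSymbol (mi i) := fun i => hm.slab c' i
  choose M hM0 hM using fun i => (hmS i).nice.bdd
  set κ : ℕ → ℝ := fun i => ∫ y, ‖𝓕⁻ (mi i) y‖
  have hκ0 : ∀ i, 0 ≤ κ i := fun i => integral_nonneg fun _ => norm_nonneg _
  refine ⟨(N + 1) ^ 3 * ∑ i ∈ Finset.range (N + 1), C * (κ i ^ 2 * M i ^ 2), by positivity, ?_⟩
  intro n f B hf hB
  have hf2 := memLp_two_of_bound hf hB
  set g : ℕ → Euc 2 → ℂ := fun i => quadrant.indicator fun ξ => mi i ξ * 𝓕 f ξ with hg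
  have hgn : ∀ i ∈ Finset.range (N + 1), Nice (g i) := fun i _ =>
    ((hmS i).nice_mul hf).indicator measurableSet_quadrant
  have hsum : (quadrant.indicator fun ξ => m ξ * 𝓕 f ξ) = fun ξ => ∑ i ∈ Finset.range (N + 1), g i ξ := by
    funext ξ
    by_cases hq : ξ ∈ quadrant
    · simp only [hg, indicator_of_mem hq]
      by_cases hz : m ξ = 0
      · simp [hmi, hz]
      · obtain ⟨f0, f1, f2, _⟩ := quadrant_facts hq
        have hs := sum_slab hc'0 (N := N) f0.le (by linarith [hm.hi ξ hz])
        simp only [hmi]; rw [← sum_mul, ← mul_sum, ← Complex.ofReal_sum, hs]; simp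
    · simp [*]
  rw [hsum]
  refine (lintegral_wave_four_sum_le _ hgn _).trans ?_
  set I := ∫⁻ x, ‖f x‖ₑ ^ 2
  have hi : ∀ i ∈ Finset.range (N + 1), ∫⁻ t in {t : ℝ | |t| ≤ horizon * 4 ^ n}, ∫⁻ x,
      ‖𝓕⁻ (waveProfile (g i) t) x‖ₑ ^ 4 ≤ ofReal (C * (κ i ^ 2 * M i ^ 2)) *
        (ofReal (ρ ^ n * 4 ^ n) * (ofReal (B ^ 2) * I)) := by
    intro i _
    refine (hthin n _ (κ i * B) ((hmS i).nice_mul hf)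
      (fun ξ h => (hmS i).lo ξ (left_ne_zero_of_mul h))
      (fun ξ h => (hmS i).hi ξ (left_ne_zero_of_mul h)) ?_ ((hmS i).norm_le hf hB)).trans ?_
    · intro ξ ξ' h h'
      have k1 : _root_.slab c' i (‖ξ‖ + ξ 0) ≠ 0 := by
        have := right_ne_zero_of_mul (left_ne_zero_of_mul h); exact_mod_cast this
      have k2 : _root_.slab c' i (‖ξ'‖ + ξ' 0) ≠ 0 := by
        have := right_ne_zero_of_mul (left_ne_zero_of_mul h'); exact_mod_cast this
      have a1 := abs_le.1 (slab_ne_zero hc'0 k1)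
      have a2 := abs_le.1 (slab_ne_zero hc'0 k2)
      grind
    · have e : C * ρ ^ n * 4 ^ n * ((κ i * B) ^ 2 * ∫ ξ, ‖mi i ξ * 𝓕 f ξ‖ ^ 2) =
        (C * κ i ^ 2) * (ρ ^ n * 4 ^ n) * B ^ 2 * ∫ ξ, ‖mi i ξ * 𝓕 f ξ‖ ^ 2 := by ring
      have hsq := (hmS i).lintegral_sq_le hf hf2 (hM i)
      have hκi := hκ0 i
      rw [e, ofReal_mul (by positivity), ofReal_mul (by positivity),
        ofReal_mul (by positivity)]
      calc ofReal (C * κ i ^ 2) * ofReal (ρ ^ n * 4 ^ n) * ofReal (B ^ 2) *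
            ofReal (∫ ξ, ‖mi i ξ * 𝓕 f ξ‖ ^ 2)
          ≤ ofReal (C * κ i ^ 2) * ofReal (ρ ^ n * 4 ^ n) * ofReal (B ^ 2) *
            (ofReal (M i ^ 2) * I) := by gcongr
        _ = _ := by rw [← mul_assoc C, ofReal_mul (by positivity : 0 ≤ C * κ i ^ 2)]; ring
  calc ((Finset.range (N + 1)).card : ℝ≥0∞) ^ 3 * ∑ i ∈ Finset.range (N + 1),
        ∫⁻ t in {t : ℝ | |t| ≤ horizon * 4 ^ n}, ∫⁻ x, ‖𝓕⁻ (waveProfile (g i) t) x‖ₑ ^ 4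
      ≤ ((Finset.range (N + 1)).card : ℝ≥0∞) ^ 3 * ∑ i ∈ Finset.range (N + 1),
        ofReal (C * (κ i ^ 2 * M i ^ 2)) *
        (ofReal (ρ ^ n * 4 ^ n) * (ofReal (B ^ 2) * I)) := by gcongr with i h; exact hi i h
    _ = _ := by
        have hs0 : 0 ≤ ∑ i ∈ Finset.range (N + 1), C * (κ i ^ 2 * M i ^ 2) := by positivity
        rw [← sum_mul, ← ENNReal.ofReal_sum_of_nonneg fun i _ => by positivity, card_range]
        generalize ∑ i ∈ Finset.range (N + 1), C * (κ i ^ 2 * M i ^ 2) = S at hs0 ⊢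
        rw [mul_assoc (_ * _ : ℝ), ofReal_mul (p := ((N : ℝ) + 1) ^ 3 * S) (by positivity),
          ofReal_mul (p := ((N : ℝ) + 1) ^ 3) (by positivity)]
        have : (((N + 1 : ℕ) : ℝ≥0∞)) ^ 3 = ofReal (((N : ℝ) + 1) ^ 3) := by
          rw [ofReal_pow (by positivity), ← Nat.cast_succ, ENNReal.ofReal_natCast]
        rw [this]; ring

end LocalSmoothing

section Rotations

/-- Rotation by a right angle. -/
def rot : Euc 2 ≃ₗᵢ[ℝ] Euc 2 where
  toFun ξ := !₂[-ξ 1, ξ 0]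
  invFun ξ := !₂[ξ 1, -ξ 0]
  map_add' ξ η := by ext i; fin_cases i <;> simp; ring
  map_smul' c ξ := by ext i; fin_cases i <;> simp
  left_inv ξ := by ext i; fin_cases i <;> simp
  right_inv ξ := by ext i; fin_cases i <;> simp
  norm_map' ξ := by
    have h1 := norm_sq_euc (!₂[-ξ 1, ξ 0] : Euc 2)
    have h2 := norm_sq_euc ξ
    have h3 : ‖(!₂[-ξ 1, ξ 0] : Euc 2)‖ ^ 2 = ‖ξ‖ ^ 2 := by rw [h1, h2]; simp; ring
    exact (pow_left_inj₀ (norm_nonneg _) (norm_nonneg _) two_ne_zero).1 h3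

/-- The four rotations by multiples of a right angle. -/
def rotBy (q : Fin 4) : Euc 2 ≃ₗᵢ[ℝ] Euc 2 := rot ^ (q : ℕ)

theorem sum_quadrants {G : Euc 2 → ℂ} (h0 : G 0 = 0) (ξ : Euc 2) :
    G ξ = ∑ q : Fin 4, ((rotBy q) ⁻¹' quadrant).indicator G ξ := by
  have e1 : ∀ ξ, rot ξ 1 = ξ 0 := fun ξ => rfl
  have m0 : ξ ∈ (rotBy 0) ⁻¹' quadrant ↔ 0 < ξ 0 ∧ 0 ≤ ξ 1 := Iff.rfl
  have m1 : ξ ∈ (rotBy 1) ⁻¹' quadrant ↔ 0 < -ξ 1 ∧ 0 ≤ ξ 0 := Iff.rfl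
  have m2 : ξ ∈ (rotBy 2) ⁻¹' quadrant ↔ 0 < -ξ 0 ∧ 0 ≤ -ξ 1 := Iff.rfl
  have m3 : ξ ∈ (rotBy 3) ⁻¹' quadrant ↔ 0 < - -ξ 1 ∧ 0 ≤ -ξ 0 := Iff.rfl
  rw [Fin.sum_univ_four]; simp only [indicator, m0, m1, m2, m3]
  rcases lt_trichotomy (ξ 0) 0 with a | a | a <;> rcases lt_trichotomy (ξ 1) 0 with b | b | b
  · grind
  · grind
  · grind
  · grind
  · have : ξ = 0 := by ext i; fin_cases i <;> simp [a, b]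
    simp [this, h0]
  · grind
  · grind
  · grind
  · grind

theorem wave_comp_isometry (A : Euc 2 ≃ₗᵢ[ℝ] Euc 2) (K : Euc 2 → ℂ) (t : ℝ) (x : Euc 2) :
    𝓕⁻ (waveProfile (K ∘ A) t) x = 𝓕⁻ (waveProfile K t) (A x) := by
  rw [← Real.fourierInv_comp_linearIsometry]
  refine congrArg (fun h : Euc 2 → ℂ => 𝓕⁻ h x) (funext fun ξ => ?_)
  simp [waveProfile]

theorem FreqSymbol.comp_isometry {m : Euc 2 → ℂ} (hm : FreqSymbol m) (A : Euc 2 ≃ₗᵢ[ℝ] Euc 2) : FreqSymbol (m ∘ A) :=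
  ⟨hm.smooth.comp A.toContinuousLinearEquiv.contDiff, fun ξ h => by simpa using hm.lo _ h,
    fun ξ h => by simpa using hm.hi _ h⟩

theorem indicator_preimage_eq (A : Euc 2 ≃ₗᵢ[ℝ] Euc 2) (m f : Euc 2 → ℂ) :
    ((A ⁻¹' quadrant).indicator fun ξ => m ξ * 𝓕 f ξ) =
      (quadrant.indicator fun ξ => (m ∘ A.symm) ξ * 𝓕 (f ∘ A.symm) ξ) ∘ A := by
  funext ξ
  have e : 𝓕 (f ∘ A.symm) (A ξ) = 𝓕 f ξ := by rw [Real.fourier_comp_linearIsometry]; simp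
  by_cases h : A ξ ∈ quadrant
  · simp_all
  · simp_all

theorem lintegral_comp_isometry (A : Euc 2 ≃ₗᵢ[ℝ] Euc 2) (g : Euc 2 → ℝ≥0∞) :
    ∫⁻ x, g (A x) = ∫⁻ x, g x :=
  A.measurePreserving.lintegral_comp_emb A.toHomeomorph.measurableEmbedding g

/-- Local smoothing at unit frequency. -/
theorem FreqSymbol.exists_wave_four {m : Euc 2 → ℂ} (hm : FreqSymbol m) {ρ : ℝ} (hρ : 1 < ρ) :
    ∃ C : ℝ, 0 ≤ C ∧ ∀ (n : ℕ) (f : Euc 2 → ℂ) (B : ℝ), Integrable f → (∀ x, ‖f x‖ ≤ B) →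
    ∫⁻ t in {t : ℝ | |t| ≤ horizon * 4 ^ n}, ∫⁻ x,
      ‖𝓕⁻ (waveProfile (fun ξ => m ξ * 𝓕 f ξ) t) x‖ₑ ^ 4 ≤
      ofReal (C * ρ ^ n * 4 ^ n) * (ofReal (B ^ 2) * ∫⁻ x, ‖f x‖ₑ ^ 2) := by
  choose C hC0 hC using fun q : Fin 4 => (hm.comp_isometry (rotBy q).symm).exists_wave_four_quadrant hρ
  refine ⟨64 * ∑ q, C q, mul_nonneg (by norm_num) (sum_nonneg fun q _ => hC0 q),
    fun n f B hf hB => ?_⟩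
  set g : Fin 4 → Euc 2 → ℂ := fun q => ((rotBy q) ⁻¹' quadrant).indicator fun ξ => m ξ * 𝓕 f ξ with hg
  have hsum : (fun ξ => m ξ * 𝓕 f ξ) = fun ξ => ∑ q, g q ξ := by
    funext ξ
    refine sum_quadrants (G := fun ξ => m ξ * 𝓕 f ξ) ?_ ξ
    have : m 0 = 0 := by by_contra hc; have := hm.lo 0 hc; norm_num at this
    simp [this]
  have hgn : ∀ q ∈ Finset.univ, Nice (g q) := fun q _ =>
    (hm.nice_mul hf).indicator ((rotBy q).continuous.measurable measurableSet_quadrant)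
  rw [hsum]
  refine (lintegral_wave_four_sum_le _ hgn _).trans ?_
  set R := ofReal (ρ ^ n * 4 ^ n) * (ofReal (B ^ 2) * ∫⁻ x, ‖f x‖ₑ ^ 2) with hR
  have hq : ∀ q ∈ (Finset.univ : Finset (Fin 4)), ∫⁻ t in {t : ℝ | |t| ≤ horizon * 4 ^ n}, ∫⁻ x,
      ‖𝓕⁻ (waveProfile (g q) t) x‖ₑ ^ 4 ≤ ofReal (C q) * R := by
    intro q _
    have hfq : Integrable (f ∘ (rotBy q).symm) :=
      ((rotBy q).symm.measurePreserving.integrable_comp_emb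
        (rotBy q).symm.toHomeomorph.measurableEmbedding).2 hf
    have := hC q n (f ∘ (rotBy q).symm) B hfq fun x => hB _
    simp only [hg, indicator_preimage_eq, wave_comp_isometry]
    have e1 : ∀ t, ∫⁻ x, ‖𝓕⁻ (waveProfile (quadrant.indicator fun ξ => (m ∘ (rotBy q).symm) ξ *
        𝓕 (f ∘ (rotBy q).symm) ξ) t) (rotBy q x)‖ₑ ^ 4 = ∫⁻ x, ‖𝓕⁻ (waveProfile (quadrant.indicator
          fun ξ => (m ∘ (rotBy q).symm) ξ * 𝓕 (f ∘ (rotBy q).symm) ξ) t) x‖ₑ ^ 4 := fun t =>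
      lintegral_comp_isometry (rotBy q) (fun x => ‖𝓕⁻ (waveProfile (quadrant.indicator fun ξ =>
        (m ∘ (rotBy q).symm) ξ * 𝓕 (f ∘ (rotBy q).symm) ξ) t) x‖ₑ ^ 4)
    simp_rw [e1]
    refine this.trans (le_of_eq ?_)
    have e : ∫⁻ x, ‖(f ∘ (rotBy q).symm) x‖ₑ ^ 2 = ∫⁻ x, ‖f x‖ₑ ^ 2 :=
      lintegral_comp_isometry (rotBy q).symm (fun x => ‖f x‖ₑ ^ 2)
    rw [e, hR, mul_assoc (C q), ofReal_mul (hC0 q), mul_assoc]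
  refine (mul_le_mul' le_rfl (sum_le_sum hq)).trans (le_of_eq ?_)
  have hs0 := sum_nonneg fun q (_ : q ∈ Finset.univ) => hC0 q
  rw [← sum_mul, ← ENNReal.ofReal_sum_of_nonneg fun q _ => hC0 q, hR]
  generalize ∑ q, C q = S at hs0 ⊢
  rw [mul_assoc (_ * _ : ℝ), ofReal_mul (p := 64 * S) (by positivity),
    ofReal_mul (p := (64 : ℝ)) (by norm_num)]
  have : (((Finset.univ : Finset (Fin 4)).card : ℝ≥0∞)) ^ 3 = ofReal 64 := by norm_num
  rw [this]; ring

end Rotations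

section PlaneGeometry

/-- The rotation of the plane with first axis `(c, s)`. -/
def frame (c s : ℝ) (h : c ^ 2 + s ^ 2 = 1) : Euc 2 ≃ₗᵢ[ℝ] Euc 2 where
  toFun a := !₂[c * a 0 + s * a 1, c * a 1 - s * a 0]
  invFun a := !₂[c * a 0 - s * a 1, s * a 0 + c * a 1]
  map_add' ξ η := by ext i; fin_cases i <;> simp <;> ring
  map_smul' r ξ := by ext i; fin_cases i <;> simp <;> ring
  left_inv a := by
    ext i; fin_cases i <;> simp
    · grind
    · grind
  right_inv a := by
    ext i; fin_cases i <;> simp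
    · grind
    · grind
  norm_map' a := by
    refine (pow_left_inj₀ (norm_nonneg _) (norm_nonneg _) two_ne_zero).1 ?_
    rw [norm_sq_euc, norm_sq_euc]; simp; grind

/-- The component of `a` along `v`. -/
def along (v a : Euc 2) : ℝ := (v 0 * a 0 + v 1 * a 1) / ‖v‖

/-- The component of `a` across `v`. -/
def across (v a : Euc 2) : ℝ := (v 0 * a 1 - v 1 * a 0) / ‖v‖

theorem frame_unit {v : Euc 2} (hv : 0 < ‖v‖) : (v 0 / ‖v‖) ^ 2 + (v 1 / ‖v‖) ^ 2 = 1 := by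
  have := norm_sq_euc v
  rw [div_pow, div_pow, ← add_div, ← this, div_self (by positivity)]

theorem frame_apply {v : Euc 2} (hv : 0 < ‖v‖) (a : Euc 2) :
    frame _ _ (frame_unit hv) a = !₂[along v a, across v a] := by
  change (!₂[_, _] : Euc 2) = _
  ext i; fin_cases i <;> simp [along, across] <;> ring

theorem along_sq_add_across_sq {v : Euc 2} (hv : 0 < ‖v‖) (a : Euc 2) :
    along v a ^ 2 + across v a ^ 2 = ‖a‖ ^ 2 := by
  have h := norm_sq_euc (frame _ _ (frame_unit hv) a)
  rw [LinearIsometryEquiv.norm_map, frame_apply hv] at h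
  simp_all

theorem lintegral_euc_prod {g : Euc 2 → ℝ≥0∞} (hg : Measurable g) :
    ∫⁻ a, g a = ∫⁻ p : ℝ × ℝ, g !₂[p.1, p.2] := by
  rw [← (PiLp.volume_preserving_toLp (Fin 2)).lintegral_comp hg]
  exact ((volume_preserving_finTwoArrow ℝ).symm.lintegral_comp
    (hg.comp (PiLp.volume_preserving_toLp (Fin 2)).measurable)).symm

theorem measurable_pair : Measurable fun p : ℝ × ℝ => (!₂[p.1, p.2] : Euc 2) :=
  Continuous.measurable (by fun_prop)

theorem lintegral_euc {g : Euc 2 → ℝ≥0∞} (hg : Measurable g) :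
    ∫⁻ a, g a = ∫⁻ y : ℝ, ∫⁻ x : ℝ, g !₂[x, y] := by
  rw [lintegral_euc_prod hg]; exact lintegral_prod_symm _ (hg.comp measurable_pair).aemeasurable

theorem measurable_across (v : Euc 2) : Measurable (across v) :=
  ((((continuous_coord 1).const_mul _).sub ((continuous_coord 0).const_mul _)).div_const _).measurable

/-- Integration over a planar set with short slices. -/
theorem lintegral_across_le {v : Euc 2} (hv : 0 < ‖v‖) {S : Set (Euc 2)} (hS : MeasurableSet S)
    {Y : Set ℝ} (hY : MeasurableSet Y) (hSY : ∀ a ∈ S, across v a ∈ Y) {l : ℝ}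
    (hl : ∀ a ∈ S, ∀ b ∈ S, across v a = across v b → |along v a - along v b| ≤ l)
    {g : ℝ → ℝ≥0∞} (hg : Measurable g) :
    ∫⁻ a in S, g (across v a) ≤ ofReal l * ∫⁻ y in Y, g y := by
  set A := frame _ _ (frame_unit hv) with hA
  have hz : ∀ z, !₂[along v (A.symm z), across v (A.symm z)] = z := fun z => by
    rw [← frame_apply hv, ← hA, LinearIsometryEquiv.apply_symm_apply]
  have hal : ∀ z, along v (A.symm z) = z 0 := fun z => congrArg (fun z : Euc 2 => z 0) (hz z)
  have hac : ∀ z, across v (A.symm z) = z 1 := fun z => congrArg (fun z : Euc 2 => z 1) (hz z)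
  have hm : Measurable (S.indicator fun a => g (across v a)) :=
    (hg.comp (measurable_across v)).indicator hS
  rw [← lintegral_indicator hS, ← lintegral_comp_isometry A.symm,
    lintegral_euc (g := fun x => S.indicator (fun a => g (across v a)) (A.symm x))
      (hm.comp A.symm.continuous.measurable), ← lintegral_indicator hY,
    ← lintegral_const_mul _ (hg.indicator hY)]
  refine lintegral_mono fun y => ?_
  by_cases hy : y ∈ Y
  · have hSm : MeasurableSet {x : ℝ | A.symm !₂[x, y] ∈ S} := by
      refine (A.symm.continuous.measurable.comp ?_) hS
      fun_prop
    have e : ∀ x : ℝ, S.indicator (fun a => g (across v a)) (A.symm !₂[x, y]) =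
        {x : ℝ | A.symm !₂[x, y] ∈ S}.indicator (fun _ => g y) x := fun x => by
      by_cases hx : A.symm !₂[x, y] ∈ S <;> simp [indicator, hx, hac]
    simp only [e]; rw [lintegral_indicator_const hSm, indicator_of_mem hy, mul_comm]; gcongr
    refine (Real.volume_le_diam _).trans (ediam_le fun x hx x' hx' => ?_)
    rw [edist_dist, Real.dist_eq]
    refine ofReal_le_ofReal ?_
    simpa [hal] using hl _ hx _ hx' (by simp [hac])
  · have e : ∀ x : ℝ, S.indicator (fun a => g (across v a)) (A.symm !₂[x, y]) = 0 := fun x =>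
      indicator_of_notMem (fun hx => hy (by simpa [hac] using hSY _ hx)) _
    simp [e]

/-- A planar set of dimensions `l × l'` in the frame of `v`. -/
theorem volume_le_of_box {v : Euc 2} (hv : 0 < ‖v‖) {S : Set (Euc 2)} (hS : MeasurableSet S) {l l' : ℝ}
    (hl : ∀ a ∈ S, ∀ b ∈ S, |along v a - along v b| ≤ l)
    (hl' : ∀ a ∈ S, ∀ b ∈ S, |across v a - across v b| ≤ l') :
    volume S ≤ ofReal l * ofReal (2 * l') := by
  rcases S.eq_empty_or_nonempty with rfl | ⟨a₀, ha₀⟩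
  · simp
  have := lintegral_across_le hv hS (Y := Icc (across v a₀ - l') (across v a₀ + l')) measurableSet_Icc
    (fun a ha => by have := abs_le.1 (hl' a ha a₀ ha₀); constructor <;> linarith [this.1, this.2])
    (fun a ha b hb _ => hl a ha b hb) (g := fun _ => 1) measurable_const
  simp only [lintegral_one, Measure.restrict_apply_univ, volume_Icc] at this
  rwa [show across v a₀ + l' - (across v a₀ - l') = 2 * l' by ring] at this

/-- The part of a thin annulus in the first quadrant. -/
def annulus (ν δ : ℝ) : Set (Euc 2) :=
  {a | a ∈ quadrant ∧ 1 / 4 ≤ ‖a‖ ∧ ‖a‖ ≤ 1 ∧ |‖a‖ - ν| ≤ δ}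

theorem measurableSet_annulus (ν δ : ℝ) : MeasurableSet (annulus ν δ) :=
  measurableSet_quadrant.inter ((measurableSet_le measurable_const measurable_norm).inter
    ((measurableSet_le measurable_norm measurable_const).inter
      (measurableSet_le (f := fun a : Euc 2 => |‖a‖ - ν|) (by fun_prop) measurable_const)))

theorem annulus_sq {ν δ : ℝ} {a b : Euc 2} (ha : a ∈ annulus ν δ) (hb : b ∈ annulus ν δ) :
    |‖a‖ ^ 2 - ‖b‖ ^ 2| ≤ 4 * δ := by
  obtain ⟨_, a1, a2, a3⟩ := ha
  obtain ⟨_, b1, b2, b3⟩ := hb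
  have h : |‖a‖ - ‖b‖| ≤ 2 * δ := by grind
  have e : ‖a‖ ^ 2 - ‖b‖ ^ 2 = (‖a‖ - ‖b‖) * (‖a‖ + ‖b‖) := by ring
  rw [e, abs_mul, abs_of_nonneg (by positivity : 0 ≤ ‖a‖ + ‖b‖)]
  have h0 := abs_nonneg (‖a‖ - ‖b‖)
  nlinarith

theorem norm_sq_add_euc (a b : Euc 2) :
    ‖a + b‖ ^ 2 = ‖a‖ ^ 2 + ‖b‖ ^ 2 + 2 * (a 0 * b 0 + a 1 * b 1) := by
  rw [norm_sq_euc, norm_sq_euc, norm_sq_euc]; simp; ring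

theorem quadrant_inner_nonneg {a b : Euc 2} (ha : a ∈ quadrant) (hb : b ∈ quadrant) :
    0 ≤ a 0 * b 0 + a 1 * b 1 := by have ⟨a0, a1⟩ := ha; have ⟨b0, b1⟩ := hb; positivity

theorem norm_le_add_of_quadrant {a b : Euc 2} (ha : a ∈ quadrant) (hb : b ∈ quadrant) : ‖a‖ ≤ ‖a + b‖ := by
  have := norm_sq_add_euc a b
  have := quadrant_inner_nonneg ha hb
  exact (pow_le_pow_iff_left₀ (norm_nonneg _) (norm_nonneg _) two_ne_zero).1 (by nlinarith [sq_nonneg ‖b‖])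

theorem quadrant_add {a b : Euc 2} (ha : a ∈ quadrant) (hb : b ∈ quadrant) : a + b ∈ quadrant :=
  ⟨add_pos ha.1 hb.1, add_nonneg ha.2 hb.2⟩

/-- Pairs in the annulus with prescribed sum. -/
def pairSet (ν δ : ℝ) (v : Euc 2) : Set (Euc 2) := {a | a ∈ annulus ν δ ∧ v - a ∈ annulus ν δ}

theorem measurableSet_pairSet (ν δ : ℝ) (v : Euc 2) : MeasurableSet (pairSet ν δ v) :=
  (measurableSet_annulus ν δ).inter ((measurable_const.sub measurable_id) (measurableSet_annulus ν δ))

theorem pairSet_norm {ν δ : ℝ} {v a : Euc 2} (ha : a ∈ pairSet ν δ v) : 1 / 4 ≤ ‖v‖ ∧ ‖v‖ ≤ 2 := by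
  have h := norm_le_add_of_quadrant ha.1.1 ha.2.1
  have h2 := norm_add_le a (v - a)
  rw [add_sub_cancel] at h h2; exact ⟨ha.1.2.1.trans h, by linarith [ha.1.2.2.1, ha.2.2.2.1]⟩

theorem abs_along_le {v : Euc 2} (hv : 0 < ‖v‖) (a : Euc 2) : |along v a| ≤ ‖a‖ := by
  have := along_sq_add_across_sq hv a
  exact abs_le_of_sq_le_sq (by nlinarith [sq_nonneg (across v a)]) (norm_nonneg _)

theorem abs_across_le {v : Euc 2} (hv : 0 < ‖v‖) (a : Euc 2) : |across v a| ≤ ‖a‖ := by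
  have := along_sq_add_across_sq hv a
  exact abs_le_of_sq_le_sq (by nlinarith [sq_nonneg (along v a)]) (norm_nonneg _)

theorem pairSet_along {ν δ : ℝ} {v a b : Euc 2} (ha : a ∈ pairSet ν δ v) (hb : b ∈ pairSet ν δ v) :
    |along v a - along v b| ≤ 16 * δ := by
  obtain ⟨hv, _⟩ := pairSet_norm ha
  have h1 := abs_le.1 (annulus_sq ha.1 hb.1)
  have h2 := abs_le.1 (annulus_sq ha.2 hb.2)
  have e : along v a - along v b = ((‖a‖ ^ 2 - ‖b‖ ^ 2) - (‖v - a‖ ^ 2 - ‖v - b‖ ^ 2)) / 2 / ‖v‖ := by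
    rw [along, along, norm_sq_euc, norm_sq_euc, norm_sq_euc, norm_sq_euc, ← sub_div]
    congr 1; simp; ring
  rw [e, abs_div, abs_norm, div_le_iff₀ (by linarith)]
  have h3 : |(‖a‖ ^ 2 - ‖b‖ ^ 2 - (‖v - a‖ ^ 2 - ‖v - b‖ ^ 2)) / 2| ≤ 4 * δ := by
    rw [abs_le]; constructor <;> linarith [h1.1, h1.2, h2.1, h2.2]
  nlinarith

theorem pairSet_across {ν δ : ℝ} {v a b : Euc 2} (ha : a ∈ pairSet ν δ v) (hb : b ∈ pairSet ν δ v) :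
    |across v a ^ 2 - across v b ^ 2| ≤ 36 * δ := by
  have hv : 0 < ‖v‖ := by linarith [(pairSet_norm ha).1]
  have h1 := annulus_sq ha.1 hb.1
  have h2 := pairSet_along ha hb
  have e1 := along_sq_add_across_sq hv a
  have e2 := along_sq_add_across_sq hv b
  have e : across v a ^ 2 - across v b ^ 2 = (‖a‖ ^ 2 - ‖b‖ ^ 2) -
      (along v a - along v b) * (along v a + along v b) := by linarith
  rw [e]
  refine (abs_sub _ _).trans ?_
  rw [abs_mul]
  have h3 : |along v a + along v b| ≤ 2 := by
    refine (abs_add_le _ _).trans ?_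
    linarith [abs_along_le hv a, abs_along_le hv b, ha.1.2.2.1, hb.1.2.2.1]
  have h0 := abs_nonneg (along v a - along v b)
  nlinarith

theorem abs_sub_le_of_sq {x y δ η : ℝ} (hδ : 0 < δ) (hη : 0 ≤ η) (hx : η ≤ x) (hy : η ≤ y)
    (h : |x ^ 2 - y ^ 2| ≤ 36 * δ) : |x - y| ≤ 36 * δ / (η + √δ) := by
  have hs : 0 < √δ := sqrt_pos.2 hδ
  have hs2 : √δ ^ 2 = δ := sq_sqrt hδ.le
  rw [le_div_iff₀ (by positivity)]
  have e : |x ^ 2 - y ^ 2| = |x - y| * (x + y) := by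
    rw [← abs_of_nonneg (by linarith : 0 ≤ x + y), ← abs_mul]; congr 1; ring
  rw [e] at h
  have h0 := abs_nonneg (x - y)
  have h1 : |x - y| ≤ x + y := by grind
  have h2 : |x - y| ≤ 6 * √δ := by nlinarith
  nlinarith

/-- Transversality: pairs in the annulus with prescribed sum and prescribed separation. -/
theorem volume_pairSet_le {ν δ : ℝ} (hδ : 0 < δ) (v : Euc 2) {η : ℝ} (hη : 0 ≤ η) :
    volume (pairSet ν δ v ∩ {a | η ≤ |across v a|}) ≤ ofReal (2304 * δ ^ 2 / (η + √δ)) := by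
  rcases (pairSet ν δ v).eq_empty_or_nonempty with h | ⟨a₀, ha₀⟩
  · simp [h]
  have hv : 0 < ‖v‖ := by linarith [(pairSet_norm ha₀).1]
  have hm := measurableSet_pairSet ν δ v
  have m1 : MeasurableSet {a | η ≤ across v a} := measurableSet_le measurable_const (measurable_across v)
  have m2 : MeasurableSet {a | η ≤ -across v a} :=
    measurableSet_le measurable_const (measurable_across v).neg
  have hsub : pairSet ν δ v ∩ {a | η ≤ |across v a|} ⊆
      (pairSet ν δ v ∩ {a | η ≤ across v a}) ∪ (pairSet ν δ v ∩ {a | η ≤ -across v a}) := by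
    rintro a ⟨h1, h2⟩; exact (le_abs.1 (mem_ofPred.1 h2)).imp (⟨h1, ·⟩) (⟨h1, ·⟩)
  have b1 := volume_le_of_box hv (hm.inter m1) (l := 16 * δ) (l' := 36 * δ / (η + √δ))
    (fun a ha b hb => pairSet_along ha.1 hb.1)
    (fun a ha b hb => abs_sub_le_of_sq hδ hη ha.2 hb.2 (pairSet_across ha.1 hb.1))
  have b2 := volume_le_of_box hv (hm.inter m2) (l := 16 * δ) (l' := 36 * δ / (η + √δ))
    (fun a ha b hb => pairSet_along ha.1 hb.1) (fun a ha b hb => by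
      have := abs_sub_le_of_sq hδ hη ha.2 hb.2 (by rw [neg_sq, neg_sq]; exact pairSet_across ha.1 hb.1)
      rwa [neg_sub_neg, abs_sub_comm] at this)
  refine (measure_mono hsub).trans ((measure_union_le _ _).trans ((add_le_add b1 b2).trans (le_of_eq ?_)))
  rw [← ofReal_mul (by positivity), ← ofReal_add (by positivity) (by positivity)]; grind

theorem lintegral_inv_abs_add_le {s : ℝ} (hs : 0 < s) :
    ∫⁻ y in Icc (-1 : ℝ) 1, ofReal (1 / (|y| / 16 + s)) ≤
      ofReal (32 * Real.log ((1 + s) / s)) := by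
  have hi : ∀ y ∈ Icc (0 : ℝ) 1, ofReal (1 / (|y| / 16 + s)) ≤ ofReal (16 * (1 / (y + s))) := by
    intro y hy
    refine ofReal_le_ofReal ?_
    rw [abs_of_nonneg hy.1, mul_one_div, div_le_div_iff₀ (by linarith [hy.1]) (by linarith [hy.1])]
    linarith
  have hpos : ∫⁻ y in Icc (0 : ℝ) 1, ofReal (1 / (|y| / 16 + s)) ≤
      ofReal (16 * Real.log ((1 + s) / s)) := by
    refine (setLIntegral_mono_ae' measurableSet_Icc (.of_forall hi)).trans (le_of_eq ?_)
    have hc : ContinuousOn (fun y : ℝ => 16 * (1 / (y + s))) (Icc 0 1) := by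
      refine continuousOn_const.mul (continuousOn_const.div (by fun_prop) fun y hy => ?_)
      linarith [hy.1]
    rw [← ofReal_integral_eq_lintegral_ofReal hc.integrableOn_Icc
      ((ae_restrict_iff' measurableSet_Icc).2 (.of_forall fun y hy => by
        have := hy.1; positivity)), integral_Icc_eq_integral_Ioc,
      ← intervalIntegral.integral_of_le zero_le_one, intervalIntegral.integral_const_mul,
      intervalIntegral.integral_comp_add_right (fun y => 1 / y), integral_one_div_of_pos (by linarith)
        (by linarith), zero_add]
  have hneg : ∫⁻ y in Icc (-1 : ℝ) 0, ofReal (1 / (|y| / 16 + s)) =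
      ∫⁻ y in Icc (0 : ℝ) 1, ofReal (1 / (|y| / 16 + s)) := by
    rw [← lintegral_indicator measurableSet_Icc, ← lintegral_indicator measurableSet_Icc,
      ← lintegral_neg_eq_self]
    refine lintegral_congr fun y => ?_
    have : -y ∈ Icc (-1 : ℝ) 0 ↔ y ∈ Icc (0 : ℝ) 1 := by
      simp only [mem_Icc]; constructor <;> rintro ⟨a, b⟩ <;> constructor <;> linarith
    simp only [indicator, this, abs_neg]
  rw [← Icc_union_Icc_eq_Icc (by norm_num : (-1 : ℝ) ≤ 0) zero_le_one]
  refine (lintegral_union_le _ _ _).trans ?_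
  rw [hneg]
  refine (add_le_add hpos hpos).trans (le_of_eq ?_)
  have : 0 ≤ Real.log ((1 + s) / s) := Real.log_nonneg (by rw [le_div_iff₀ hs]; linarith)
  rw [← ofReal_add (by positivity) (by positivity)]; congr 1; ring

/-- The planar cross product. -/
def cross (a b : Euc 2) : ℝ := a 0 * b 1 - a 1 * b 0

@[fun_prop]
theorem continuous_cross {X : Type*} [TopologicalSpace X] {f g : X → Euc 2} (hf : Continuous f)
    (hg : Continuous g) : Continuous fun x => cross (f x) (g x) := by unfold cross; fun_prop

theorem cross_comm (a b : Euc 2) : |cross a b| = |cross b a| := by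
  rw [← abs_neg]; congr 1; unfold cross; ring

/-- Triples in the annulus. -/
def tripleSet (ν δ : ℝ) : Set (Euc 2 × Euc 2 × Euc 2) :=
  {z | z.1 ∈ annulus ν δ ∧ z.2.1 ∈ annulus ν δ ∧ z.2.2 ∈ annulus ν δ}

/-- Triples in the annulus whose first two members are the most transversal ones. -/
def orderedTripleSet (ν δ : ℝ) : Set (Euc 2 × Euc 2 × Euc 2) :=
  tripleSet ν δ ∩ ({z | |cross z.1 z.2.2| ≤ |cross z.1 z.2.1|} ∩ {z | |cross z.2.1 z.2.2| ≤ |cross z.1 z.2.1|})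

theorem measurableSet_tripleSet (ν δ : ℝ) : MeasurableSet (tripleSet ν δ) :=
  (measurable_fst (measurableSet_annulus ν δ)).inter
    (((measurable_fst.comp measurable_snd) (measurableSet_annulus ν δ)).inter
      ((measurable_snd.comp measurable_snd) (measurableSet_annulus ν δ)))

theorem measurableSet_orderedTripleSet (ν δ : ℝ) : MeasurableSet (orderedTripleSet ν δ) := by
  exact (measurableSet_tripleSet ν δ).inter ((measurableSet_le (by fun_prop) (by fun_prop)).inter
    (measurableSet_le (by fun_prop) (by fun_prop)))

theorem tripleSet_indicator_le (ν δ : ℝ) (a b c : Euc 2) :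
    (tripleSet ν δ).indicator (M := ℝ≥0∞) 1 (a, b, c) ≤
      (orderedTripleSet ν δ).indicator 1 (a, b, c) + (orderedTripleSet ν δ).indicator 1 (a, c, b) +
        (orderedTripleSet ν δ).indicator 1 (c, b, a) := by
  by_cases h : (a, b, c) ∈ tripleSet ν δ
  swap
  · simp_all
  have ⟨ha, hb, hc⟩ : a ∈ annulus ν δ ∧ b ∈ annulus ν δ ∧ c ∈ annulus ν δ := h
  rw [indicator_of_mem h, Pi.one_apply]
  have : (a, b, c) ∈ orderedTripleSet ν δ ∨ (a, c, b) ∈ orderedTripleSet ν δ ∨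
      (c, b, a) ∈ orderedTripleSet ν δ := by
    simp only [orderedTripleSet, tripleSet, mem_inter_iff, mem_ofPred, ha, hb, hc, cross_comm b a, cross_comm c _]
    grind
  rcases this with h | h | h
  · simp [indicator_of_mem h, add_assoc]
  · rw [add_right_comm]; simp [indicator_of_mem h]
  · simp_all

theorem lintegral_orderedTriple_le {ν δ : ℝ} (hδ : 0 < δ) (w : Euc 2) :
    ∫⁻ c, ∫⁻ a, (orderedTripleSet ν δ).indicator (M := ℝ≥0∞) 1 (a, w - c - a, c) ≤
      ofReal (7077888 * δ ^ 3 * Real.log ((1 + √δ) / √δ)) := by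
  have hs : 0 < √δ := sqrt_pos.2 hδ
  set S : Set (Euc 2) := annulus ν δ ∩ {c | 1 / 16 ≤ w 0 * c 0 + w 1 * c 1}
  have hSm : MeasurableSet S := by
    have := continuous_coord 0
    have := continuous_coord 1
    exact (measurableSet_annulus ν δ).inter (measurableSet_le measurable_const
      (Continuous.measurable (by fun_prop)))
  by_cases hw : 1 / 4 ≤ ‖w‖ ∧ ‖w‖ ≤ 3
  swap
  · have : ∀ c a, (orderedTripleSet ν δ).indicator (M := ℝ≥0∞) 1 (a, w - c - a, c) = 0 := by
      intro c a
      refine indicator_of_notMem (fun h => hw ?_) _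
      obtain ⟨⟨ha, hb, hc⟩, _⟩ := h
      simp only at ha hb hc
      have h1 := norm_le_add_of_quadrant hc.1 (quadrant_add ha.1 hb.1)
      have h2 := norm_add₃_le (a := c) (b := a) (c := w - c - a)
      rw [show c + (a + (w - c - a)) = w by abel] at h1
      rw [show c + a + (w - c - a) = w by abel] at h2
      exact ⟨hc.2.1.trans h1, by linarith [ha.2.2.1, hb.2.2.1, hc.2.2.1]⟩
    simp [this]
  obtain ⟨hw1, hw2⟩ := hw
  have hw0 : 0 < ‖w‖ := by linarith
  have hin : ∀ c, ∫⁻ a, (orderedTripleSet ν δ).indicator (M := ℝ≥0∞) 1 (a, w - c - a, c) ≤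
      S.indicator (fun c => ofReal (2304 * δ ^ 2 * (1 / (|across w c| / 16 + √δ)))) c := by
    intro c
    by_cases hc : c ∈ S
    · rw [indicator_of_mem hc, mul_one_div]
      refine le_trans ?_ (volume_pairSet_le (ν := ν) hδ (w - c) (by positivity : 0 ≤ |across w c| / 16))
      have hmS : MeasurableSet (pairSet ν δ (w - c) ∩ {a | |across w c| / 16 ≤ |across (w - c) a|}) :=
        (measurableSet_pairSet ν δ (w - c)).inter
          (measurableSet_le measurable_const (measurable_across (w - c)).abs)
      rw [← lintegral_indicator_one hmS]
      refine lintegral_mono fun a => ?_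
      simp only
      by_cases h : (a, w - c - a, c) ∈ orderedTripleSet ν δ
      swap
      · simp_all
      obtain ⟨⟨ha, hb, hc'⟩, h1, h2⟩ := h
      simp only [mem_ofPred] at ha hb hc' h1 h2
      have hp : a ∈ pairSet ν δ (w - c) := ⟨ha, hb⟩
      obtain ⟨hv1, hv2⟩ := pairSet_norm hp
      have hv0 : 0 < ‖w - c‖ := by linarith
      have hmem : a ∈ pairSet ν δ (w - c) ∩ {a | |across w c| / 16 ≤ |across (w - c) a|} := by
        refine ⟨hp, ?_⟩
        have e1 : across w c * ‖w‖ = cross a c + cross (w - c - a) c := by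
          rw [across, div_mul_cancel₀ _ hw0.ne']; simp [cross]; ring
        have e2 : across (w - c) a * ‖w - c‖ = -cross a (w - c - a) := by
          rw [across, div_mul_cancel₀ _ hv0.ne']; simp [cross]; ring
        have k1 : |across w c| * ‖w‖ ≤ 2 * |cross a (w - c - a)| := by
          rw [← abs_norm w, ← abs_mul, e1]; exact (abs_add_le _ _).trans (by linarith)
        have k2 : |across (w - c) a| * ‖w - c‖ = |cross a (w - c - a)| := by
          rw [← abs_norm (w - c), ← abs_mul, e2, abs_neg]
        have n1 := abs_nonneg (across w c)
        have n2 := abs_nonneg (across (w - c) a)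
        show |across w c| / 16 ≤ |across (w - c) a|
        nlinarith
      rw [indicator_of_mem hmem]; exact indicator_le_self' (fun _ _ => zero_le) _
    · rw [indicator_of_notMem hc]
      refine le_of_eq ?_
      have : ∀ a, (orderedTripleSet ν δ).indicator (M := ℝ≥0∞) 1 (a, w - c - a, c) = 0 := by
        intro a
        refine indicator_of_notMem (fun h => hc ?_) _
        obtain ⟨⟨ha, hb, hc'⟩, _⟩ := h
        simp only at ha hb hc'
        refine ⟨hc', ?_⟩
        have q1 := quadrant_inner_nonneg hc'.1 ha.1
        have q2 := quadrant_inner_nonneg hc'.1 hb.1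
        have q3 := norm_sq_euc c
        have q4 : 1 / 16 ≤ ‖c‖ ^ 2 := by nlinarith [hc'.2.1]
        simp only [PiLp.sub_apply] at q2
        show 1 / 16 ≤ w 0 * c 0 + w 1 * c 1
        nlinarith
      simp [this]
  refine (lintegral_mono hin).trans ?_
  rw [lintegral_indicator hSm]
  have hx : ∀ c ∈ S, 1 / 48 ≤ along w c := by
    intro c hc
    have : 1 / 16 ≤ w 0 * c 0 + w 1 * c 1 := hc.2
    rw [along, le_div_iff₀ hw0]; linarith
  refine (lintegral_across_le hw0 hSm (Y := Icc (-1) 1) measurableSet_Icc (fun c hc => ?_) (l := 96 * δ)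
    (fun a ha b hb hab => ?_)
    (g := fun y => ofReal (2304 * δ ^ 2 * (1 / (|y| / 16 + √δ)))) ?_).trans ?_
  · exact abs_le.1 ((abs_across_le hw0 c).trans hc.1.2.2.1)
  · have h1 := annulus_sq ha.1 hb.1
    rw [← along_sq_add_across_sq hw0, ← along_sq_add_across_sq hw0, hab, add_sub_add_right_eq_sub] at h1
    have xa := hx a ha
    have xb := hx b hb
    have e : along w a ^ 2 - along w b ^ 2 = (along w a - along w b) * (along w a + along w b) := by ring
    rw [e, abs_mul, abs_of_nonneg (by linarith : 0 ≤ along w a + along w b)] at h1; nlinarith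
  · fun_prop
  · simp_rw [ofReal_mul (by positivity : 0 ≤ 2304 * δ ^ 2)]
    rw [lintegral_const_mul' _ _ ofReal_ne_top]
    refine (mul_le_mul' le_rfl (mul_le_mul' le_rfl (lintegral_inv_abs_add_le hs))).trans (le_of_eq ?_)
    rw [← ofReal_mul (by positivity), ← ofReal_mul (by positivity)]; congr 1; ring

theorem lintegral_lintegral_add {F G : Euc 2 × Euc 2 → ℝ≥0∞} (hF : Measurable F) (hG : Measurable G) :
    ∫⁻ c, ∫⁻ a, (F (c, a) + G (c, a)) = (∫⁻ c, ∫⁻ a, F (c, a)) + ∫⁻ c, ∫⁻ a, G (c, a) := by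
  rw [← lintegral_prod _ hF.aemeasurable, ← lintegral_prod _ hG.aemeasurable, ← lintegral_add_left hF]
  exact (lintegral_prod _ (hF.add hG).aemeasurable).symm

/-- The three-fold self-convolution of a thin annulus. -/
theorem lintegral_triple_le (ν : ℝ) (n : ℕ) (w : Euc 2) :
    ∫⁻ c, ∫⁻ a, (tripleSet ν (1 / 4 ^ n)).indicator (M := ℝ≥0∞) 1 (a, w - c - a, c) ≤
      ofReal (21233664 * (n + 1) * (1 / 4 ^ n) ^ 3) := by
  set δ : ℝ := 1 / 4 ^ n with hδd
  have hδ : 0 < δ := by positivity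
  set O : Euc 2 × Euc 2 × Euc 2 → ℝ≥0∞ := (orderedTripleSet ν δ).indicator 1
  have hOm : Measurable O := measurable_one.indicator (measurableSet_orderedTripleSet ν δ)
  set J := ∫⁻ c, ∫⁻ a, O (a, w - c - a, c) with hJ
  have m1 : Measurable fun p : Euc 2 × Euc 2 => O (p.2, w - p.1 - p.2, p.1) := hOm.comp (by fun_prop)
  have m2 : Measurable fun p : Euc 2 × Euc 2 => O (p.2, p.1, w - p.1 - p.2) := hOm.comp (by fun_prop)
  have m3 : Measurable fun p : Euc 2 × Euc 2 => O (p.1, w - p.1 - p.2, p.2) := hOm.comp (by fun_prop)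
  have e2 : ∫⁻ c, ∫⁻ a, O (a, c, w - c - a) = J := by
    refine (lintegral_lintegral_swap (f := fun c a => O (a, c, w - c - a)) m2.aemeasurable).trans
      (Eq.trans ?_ (lintegral_lintegral_swap (f := fun c a => O (a, w - c - a, c)) m1.aemeasurable).symm)
    refine lintegral_congr fun a => ?_
    rw [← lintegral_sub_left_eq_self _ (w - a)]
    refine lintegral_congr fun c => ?_
    congr 3 <;> abel
  have e3 : ∫⁻ c, ∫⁻ a, O (c, w - c - a, a) = J := by
    rw [lintegral_lintegral_swap m3.aemeasurable, hJ]
    refine lintegral_congr fun a => lintegral_congr fun c => ?_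
    rw [sub_right_comm]
  have hlog : Real.log ((1 + √δ) / √δ) ≤ n + 1 := by
    have hsq : √δ = 1 / 2 ^ n := by
      rw [hδd, show (4 : ℝ) ^ n = (2 ^ n) ^ 2 by rw [← pow_mul, mul_comm, pow_mul]; norm_num,
        Real.sqrt_eq_iff_mul_self_eq (by positivity) (by positivity)]
      field_simp
    have h1 : (1 + √δ) / √δ ≤ 2 ^ (n + 1) := by
      rw [hsq, pow_succ, div_le_iff₀ (by positivity)]
      have : (1 : ℝ) ≤ 2 ^ n := one_le_pow₀ (by norm_num)
      field_simp; nlinarith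
    have h2 := Real.log_le_log (by positivity) h1
    rw [Real.log_pow] at h2
    have h3 : Real.log 2 ≤ 1 := by linarith [Real.log_two_lt_d9]
    push_cast at h2; nlinarith
  have hJle : J ≤ ofReal (7077888 * (n + 1) * δ ^ 3) := by
    refine (lintegral_orderedTriple_le hδ w).trans (ofReal_le_ofReal ?_)
    nlinarith [pow_pos hδ 3]
  calc ∫⁻ c, ∫⁻ a, (tripleSet ν δ).indicator (M := ℝ≥0∞) 1 (a, w - c - a, c)
      ≤ ∫⁻ c, ∫⁻ a, (O (a, w - c - a, c) + O (a, c, w - c - a) + O (c, w - c - a, a)) :=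
        lintegral_mono fun c => lintegral_mono fun a => tripleSet_indicator_le ν δ a (w - c - a) c
    _ = J + J + J := by
        have h12 := lintegral_lintegral_add m1 (m2.add m3)
        have h23 := lintegral_lintegral_add m2 m3
        simp only [Pi.add_apply] at h12; simp_rw [add_assoc]; rw [h12, h23, e2, e3]
    _ ≤ _ := by
        refine (add_le_add (add_le_add hJle hJle) hJle).trans (le_of_eq ?_)
        rw [← ofReal_add (by positivity) (by positivity),
          ← ofReal_add (by positivity) (by positivity)]
        congr 1; ring

end PlaneGeometry

section SquareFunction

/-- An `L⁶` extension estimate for thin annuli. -/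
theorem lintegral_fourierInv_six_le {g : Euc 2 → ℂ} (hg : Nice g) {ν : ℝ} {n : ℕ}
    (hs : ∀ ξ, g ξ ≠ 0 → ξ ∈ annulus ν (1 / 4 ^ n)) :
    ∫⁻ x, ‖𝓕⁻ g x‖ₑ ^ 6 ≤
      ofReal (21233664 * (n + 1) * (1 / 4 ^ n) ^ 3) * (∫⁻ ξ, ‖g ξ‖ₑ ^ 2) ^ 3 := by
  set δ : ℝ := 1 / 4 ^ n
  set K := ofReal (21233664 * (n + 1) * δ ^ 3)
  have hgg := hg.conv hg
  have h3 := hg.conv hgg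
  have hgm : Measurable fun ξ => ‖g ξ‖ₑ := hg.meas.enorm
  set F : Euc 2 × (Euc 2 × Euc 2) → ℝ≥0∞ := fun q =>
    ‖g q.2.1‖ₑ * (‖g q.2.2‖ₑ * ‖g (q.1 - q.2.1 - q.2.2)‖ₑ) with hF
  have hFm : Measurable F := (hgm.comp (by fun_prop)).mul ((hgm.comp (by fun_prop)).mul
    (hgm.comp (by fun_prop)))
  have hFw : ∀ w, Measurable fun p => F (w, p) := fun w => hFm.comp (by fun_prop)
  have hpt : ∀ w, ‖conv g (conv g g) w‖ₑ ^ 2 ≤ K * ∫⁻ p : Euc 2 × Euc 2, F (w, p) ^ 2 := by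
    intro w
    have h1 : ‖conv g (conv g g) w‖ₑ ≤ ∫⁻ p, F (w, p) := by
      rw [Measure.volume_eq_prod, lintegral_prod _ (hFw w).aemeasurable]
      refine (enorm_integral_le_lintegral_enorm _).trans (lintegral_mono fun c => ?_)
      simp only [hF]; rw [enorm_mul, lintegral_const_mul' _ _ enorm_ne_top]; gcongr
      refine (enorm_integral_le_lintegral_enorm _).trans (le_of_eq (lintegral_congr fun a => ?_))
      rw [enorm_mul]
    set E : Set (Euc 2 × Euc 2) := {p | (p.2, w - p.1 - p.2, p.1) ∈ tripleSet ν δ}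
    have hEm : MeasurableSet E :=
      (by fun_prop : Measurable fun p : Euc 2 × Euc 2 => (p.2, w - p.1 - p.2, p.1))
        (measurableSet_tripleSet ν δ)
    have hsub : ∀ p, p ∉ E → F (w, p) = 0 := by
      intro p hp
      by_contra hne
      simp only [hF, mul_eq_zero, enorm_eq_zero, not_or] at hne
      exact hp ⟨hs _ hne.2.1, hs _ hne.2.2, hs _ hne.1⟩
    have h2 : ∫⁻ p, F (w, p) = ∫⁻ p in E, F (w, p) := by
      rw [← lintegral_indicator hEm]
      refine lintegral_congr fun p => ?_
      by_cases hp : p ∈ E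
      · simp_all
      · simp_all
    have h3 : volume E ≤ K := by
      rw [← lintegral_indicator_one hEm, Measure.volume_eq_prod,
        lintegral_prod _ (measurable_one.indicator hEm).aemeasurable]
      exact lintegral_triple_le ν n w
    calc ‖conv g (conv g g) w‖ₑ ^ 2 ≤ (∫⁻ p in E, F (w, p)) ^ 2 := by rw [← h2]; gcongr
      _ ≤ (volume.restrict E) univ * ∫⁻ p in E, F (w, p) ^ 2 := sq_lintegral_le _ (hFw w).aemeasurable
      _ ≤ _ := by
        rw [Measure.restrict_apply_univ]; exact mul_le_mul' h3 (setLIntegral_le_lintegral _ _)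
  have htot : ∫⁻ w, ∫⁻ p : Euc 2 × Euc 2, F (w, p) ^ 2 = (∫⁻ ξ, ‖g ξ‖ₑ ^ 2) ^ 3 := by
    rw [lintegral_lintegral_swap (f := fun w p => F (w, p) ^ 2) (hFm.pow_const 2).aemeasurable]
    have hw : ∀ p : Euc 2 × Euc 2, ∫⁻ w, F (w, p) ^ 2 =
        ‖g p.1‖ₑ ^ 2 * ‖g p.2‖ₑ ^ 2 * ∫⁻ ξ, ‖g ξ‖ₑ ^ 2 := by
      intro p
      rw [← lintegral_sub_right_eq_self (fun ξ => ‖g ξ‖ₑ ^ 2) (p.1 + p.2),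
        ← lintegral_const_mul' _ _ (by simp [ENNReal.mul_eq_top])]
      refine lintegral_congr fun w => ?_
      simp only [hF]; rw [sub_sub]; ring
    simp_rw [hw]
    have h2m : Measurable fun ξ => ‖g ξ‖ₑ ^ 2 := hgm.pow_const 2
    rw [lintegral_mul_const _ (show Measurable fun p : Euc 2 × Euc 2 => ‖g p.1‖ₑ ^ 2 * ‖g p.2‖ₑ ^ 2 from
      (h2m.comp measurable_fst).mul (h2m.comp measurable_snd)), Measure.volume_eq_prod, lintegral_prod_mul h2m.aemeasurable h2m.aemeasurable]
    ring
  calc ∫⁻ x, ‖𝓕⁻ g x‖ₑ ^ 6 = ∫⁻ x, ‖𝓕⁻ (conv g (conv g g)) x‖ₑ ^ 2 := by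
        refine lintegral_congr fun x => ?_
        rw [fourierInv_conv hg hgg, fourierInv_conv hg hg, enorm_mul, enorm_mul]; ring
    _ = ∫⁻ w, ‖conv g (conv g g) w‖ₑ ^ 2 := lintegral_fourierInv_sq h3.integrable h3.memLp_two
    _ ≤ ∫⁻ w, K * ∫⁻ p : Euc 2 × Euc 2, F (w, p) ^ 2 := lintegral_mono hpt
    _ = _ := by rw [lintegral_const_mul' _ _ ofReal_ne_top, htot]

/-- Minkowski's inequality in `L³`. -/
theorem lintegral_lintegral_pow_three_le {X Y : Type*} [MeasurableSpace X] [MeasurableSpace Y]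
    {μ : Measure X} {κ : Measure Y} [SFinite μ] [SFinite κ] {a : X × Y → ℝ≥0∞} (ha : Measurable a) :
    ∫⁻ x, (∫⁻ y, a (x, y) ∂κ) ^ 3 ∂μ ≤ (∫⁻ y, (∫⁻ x, a (x, y) ^ 3 ∂μ) ^ (1 / 3 : ℝ) ∂κ) ^ 3 := by
  set b : Y → ℝ≥0∞ := fun y => (∫⁻ x, a (x, y) ^ 3 ∂μ) ^ (1 / 3 : ℝ) with hb
  have hbm : Measurable b := ((ha.pow_const 3).lintegral_prod_left').pow_const _
  have hax : ∀ x, Measurable fun y => a (x, y) := fun x => ha.comp measurable_prodMk_left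
  have hay : ∀ y, Measurable fun x => a (x, y) := fun y => ha.comp measurable_prodMk_right
  have key : ∀ f : Y → ℝ≥0∞, Measurable f →
      (∫⁻ y, f y ∂κ) ^ 3 = ∫⁻ y₁, ∫⁻ y₂, ∫⁻ y₃, f y₁ * f y₂ * f y₃ ∂κ ∂κ ∂κ := by
    intro f hf
    simp_rw [lintegral_const_mul _ hf, lintegral_mul_const _ (hf.const_mul _), lintegral_const_mul _ hf,
      mul_assoc]
    rw [lintegral_mul_const _ hf]; ring
  have hcube : ∀ c : ℝ≥0∞, (c ^ 3) ^ (3⁻¹ : ℝ) = c := by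
    intro c; rw [← rpow_natCast, ← rpow_mul]; norm_num
  have hH : ∀ y₁ y₂ y₃, ∫⁻ x, a (x, y₁) * a (x, y₂) * a (x, y₃) ∂μ ≤ b y₁ * b y₂ * b y₃ := by
    intro y₁ y₂ y₃
    have := ENNReal.lintegral_prod_norm_pow_le (μ := μ) (Finset.univ : Finset (Fin 3))
      (f := fun i x => a (x, ![y₁, y₂, y₃] i) ^ 3) (p := fun _ => 1 / 3)
      (fun i _ => ((hay _).pow_const 3).aemeasurable) (by norm_num) (fun _ _ => by norm_num)
    simpa [Fin.prod_univ_three, hcube, hb] using this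
  have m3 : Measurable fun q : X × Y × Y × Y => a (q.1, q.2.1) * a (q.1, q.2.2.1) * a (q.1, q.2.2.2) :=
    ((ha.comp (by fun_prop)).mul (ha.comp (by fun_prop))).mul (ha.comp (by fun_prop))
  rw [key b hbm]; simp_rw [key _ (hax _)]
  have m1 : Measurable fun q : X × Y => ∫⁻ y₂, ∫⁻ y₃, a (q.1, q.2) * a (q.1, y₂) * a (q.1, y₃) ∂κ ∂κ := by
    fun_prop
  rw [lintegral_lintegral_swap m1.aemeasurable]
  refine lintegral_mono fun y₁ => ?_
  have m2 : Measurable fun q : X × Y => ∫⁻ y₃, a (q.1, y₁) * a (q.1, q.2) * a (q.1, y₃) ∂κ :=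
    Measurable.lintegral_prod_right' (f := fun r : (X × Y) × Y =>
        a (r.1.1, y₁) * a (r.1.1, r.1.2) * a (r.1.1, r.2))
        (m3.comp (by fun_prop : Measurable fun r : (X × Y) × Y => (r.1.1, y₁, r.1.2, r.2)))
  rw [lintegral_lintegral_swap m2.aemeasurable]
  refine lintegral_mono fun y₂ => ?_
  have m4 : Measurable fun r : X × Y => a (r.1, y₁) * a (r.1, y₂) * a (r.1, r.2) :=
    m3.comp (by fun_prop : Measurable fun r : X × Y => (r.1, y₁, y₂, r.2))
  rw [lintegral_lintegral_swap m4.aemeasurable]; exact lintegral_mono fun y₃ => hH y₁ y₂ y₃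

/-- The spatial inverse transform of a lifted profile. -/
def liftField (k : ℝ → ℝ) (H : Euc 2 → ℂ) (x : Euc 2) (ν : ℝ) : ℂ := 𝓕⁻ (fun ξ => coneLift k H (ξ, ν)) x

theorem measurable_liftField {k : ℝ → ℝ} {H : Euc 2 → ℂ} (hk : NiceReal k) (hH : Nice H) :
    Measurable fun p : Euc 2 × ℝ => liftField k H p.1 p.2 := by
  have hc2 : Continuous fun q : (Euc 2 × ℝ) × Euc 2 => (𝐞 (inner ℝ q.2 q.1.1) : ℂ) := by fun_prop
  unfold liftField; simp_rw [fourierInv_eq, smul_def, smul_eq_mul]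
  refine (StronglyMeasurable.integral_prod_right (f := fun (p : Euc 2 × ℝ) (ξ : Euc 2) =>
    (𝐞 (inner ℝ ξ p.1) : ℂ) * coneLift k H (ξ, p.2)) ?_).measurable
  apply Measurable.stronglyMeasurable
  exact hc2.measurable.mul ((Nice.coneLift hk hH).meas.comp (by fun_prop))

theorem Nice.slice_right {F : Euc 2 × ℝ → ℂ} (hF : Nice F) (ν : ℝ) : Nice fun ξ => F (ξ, ν) := by
  obtain ⟨M, hM0, hM⟩ := hF.bdd
  obtain ⟨ρ, hρ0, hρ⟩ := hF.supp
  exact ⟨hF.meas.comp measurable_prodMk_right, ⟨M, hM0, fun x => hM _⟩, ⟨ρ, hρ0, fun x hx =>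
    (norm_fst_le (x, ν)).trans (hρ _ hx)⟩⟩

theorem nice_liftField {k : ℝ → ℝ} {H : Euc 2 → ℂ} (hk : NiceReal k) (hH : Nice H) (x : Euc 2) :
    Nice (liftField k H x) := by
  have hF := Nice.coneLift hk hH
  obtain ⟨M, hM0, hM⟩ := hk.bdd
  obtain ⟨ρ, hρ0, hρ⟩ := hF.supp
  have hj := measurable_liftField hk hH
  have hm : Measurable (liftField k H x) := hj.of_uncurry_left
  have hI : 0 ≤ ∫ ξ, M * ‖H ξ‖ := integral_nonneg fun ξ => mul_nonneg hM0 (norm_nonneg _)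
  have hb : ∀ ν, ‖liftField k H x ν‖ ≤ ∫ ξ, M * ‖H ξ‖ := by
    intro ν
    refine (norm_fourierInv_le _ x).trans (integral_mono (hF.slice_right ν).integrable.norm
      (hH.integrable.norm.const_mul M) fun ξ => ?_)
    simp only [coneLift, norm_mul]
    bound
  have hz : ∀ ν, liftField k H x ν ≠ 0 → ‖ν‖ ≤ ρ := by
    intro ν hν
    by_contra hc
    apply hν
    have : (fun ξ => coneLift k H (ξ, ν)) = fun _ => 0 := by
      funext ξ
      by_contra hne
      exact hc ((norm_snd_le (ξ, ν)).trans (hρ _ hne))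
    rw [liftField, this, fourierInv_eq]; simp
  exact ⟨hm, ⟨_, hI, hb⟩, ⟨ρ, hρ0, hz⟩⟩

theorem fourierInv_liftField {k : ℝ → ℝ} {H : Euc 2 → ℂ} (hk : NiceReal k) (hH : Nice H) (x : Euc 2)
    (t : ℝ) : 𝓕⁻ (liftField k H x) t = 𝓕⁻ (fun x => (k x : ℂ)) t * 𝓕⁻ (waveProfile H t) x := by
  have hF := Nice.coneLift hk hH
  have c1 : Continuous fun p : Euc 2 × ℝ => (𝐞 (p.2 * t) : ℂ) * (𝐞 (inner ℝ p.1 x) : ℂ) := by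
    fun_prop
  have hInt : Integrable (fun p : Euc 2 × ℝ =>
      coneLift k H p * ((𝐞 (p.2 * t) : ℂ) * (𝐞 (inner ℝ p.1 x) : ℂ))) (volume.prod volume) :=
    (hF.mul_bdd c1.measurable ⟨1, fun p => by rw [norm_mul, norm_fourierChar, norm_fourierChar, one_mul]⟩).integrable
  calc 𝓕⁻ (liftField k H x) t
      = ∫ ν : ℝ, ∫ ξ, coneLift k H (ξ, ν) * ((𝐞 (ν * t) : ℂ) * (𝐞 (inner ℝ ξ x) : ℂ)) := by
        rw [fourierInv_eq]
        refine integral_congr_ae (.of_forall fun ν => ?_)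
        have : (inner ℝ ν t : ℝ) = ν * t := by simp; ring
        simp only [smul_def, smul_eq_mul, liftField, fourierInv_eq, this]; rw [← integral_const_mul]
        grind
    _ = ∫ ξ, ∫ ν : ℝ, coneLift k H (ξ, ν) * ((𝐞 (ν * t) : ℂ) * (𝐞 (inner ℝ ξ x) : ℂ)) :=
        (integral_integral_swap hInt).symm
    _ = _ := by
        rw [fourierInv_eq (waveProfile H t), ← integral_const_mul]
        refine integral_congr_ae (.of_forall fun ξ => ?_)
        have e : ∀ ν : ℝ, coneLift k H (ξ, ν) * ((𝐞 (ν * t) : ℂ) * (𝐞 (inner ℝ ξ x) : ℂ)) =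
            (H ξ * (𝐞 (inner ℝ ξ x) : ℂ)) * ((𝐞 (ν * t) : ℂ) * (k (ν - ‖ξ‖) : ℂ)) := by
          intro ν; simp only [coneLift]; ring
        simp_rw [e]; rw [integral_const_mul, integral_fourierChar_shift]
        simp only [smul_def, smul_eq_mul, waveProfile]; ring

theorem lintegral_time_sq {k : ℝ → ℝ} {H : Euc 2 → ℂ} (hk : NiceReal k) (hH : Nice H) (x : Euc 2) :
    ∫⁻ t : ℝ, ‖𝓕⁻ (fun x => (k x : ℂ)) t‖ₑ ^ 2 * ‖𝓕⁻ (waveProfile H t) x‖ₑ ^ 2 =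
      ∫⁻ ν : ℝ, ‖liftField k H x ν‖ₑ ^ 2 := by
  have hn := nice_liftField hk hH x
  rw [← lintegral_fourierInv_sq hn.integrable hn.memLp_two]
  refine lintegral_congr fun t => ?_
  rw [fourierInv_liftField hk hH, enorm_mul, mul_pow]

/-- The square function estimate on a quadrant. -/
theorem exists_wave_square_quadrant : ∃ C : ℝ, 0 ≤ C ∧ ∀ (n : ℕ) (H : Euc 2 → ℂ), Nice H →
    (∀ ξ, H ξ ≠ 0 → ξ ∈ quadrant) → (∀ ξ, H ξ ≠ 0 → 1 / 4 ≤ ‖ξ‖) → (∀ ξ, H ξ ≠ 0 → ‖ξ‖ ≤ 1) →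
    ∫⁻ x, (∫⁻ t in {t : ℝ | |t| ≤ horizon * 4 ^ n}, ‖𝓕⁻ (waveProfile H t) x‖ₑ ^ 2) ^ 3 ≤
      ofReal (C * (n + 1)) * (∫⁻ ξ, ‖H ξ‖ₑ ^ 2) ^ 3 := by
  obtain ⟨c₀, hc₀, hlow⟩ := exists_lower_bound_timeBump.choose_spec.choose_spec
  set c₁ := exists_lower_bound_timeBump.choose_spec.choose
  obtain ⟨hc₁, hlow⟩ : 0 < c₁ ∧ ∀ t, |t| ≤ horizon → c₁ ≤ ‖𝓕⁻ (fun x => (timeBump x : ℂ)) t‖ :=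
    ⟨hc₀, hlow⟩
  refine ⟨21233664 * 8 / c₁ ^ 6, by positivity, fun n H hH hq hlo hhi => ?_⟩
  set δ : ℝ := 1 / 4 ^ n with hδ
  have hδ0 : 0 < δ := by positivity
  set k : ℝ → ℝ := fun x => timeBump (x / δ)
  have hkn : NiceReal k := (niceReal_bump timeBump).scale hδ0
  have hF := Nice.coneLift hkn hH
  have hsupp : ∀ x, k x ≠ 0 → |x| ≤ δ := by
    intro x hx
    by_contra hcon
    apply hx
    refine timeBump.zero_of_le_dist ?_
    rw [dist_zero_right, norm_div, norm_of_nonneg hδ0.le, le_div_iff₀ hδ0, norm_eq_abs]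
    refine le_trans ?_ (not_le.1 hcon).le
    refine mul_le_of_le_one_left hδ0.le ?_
    simp only [timeBump]; norm_num
  set I := ∫⁻ ξ, ‖H ξ‖ₑ ^ 2 with hI
  set K := ofReal (21233664 * (n + 1) * δ ^ 3) with hK
  have hksq : ∫⁻ x, ‖(k x : ℂ)‖ₑ ^ 2 ≤ ofReal (2 * δ) := by
    have : ∀ x, ‖(k x : ℂ)‖ₑ ^ 2 ≤ (Icc (-δ) δ).indicator (fun _ => 1) x := by
      intro x
      by_cases hx : x ∈ Icc (-δ) δ
      · rw [indicator_of_mem hx]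
        refine pow_le_one₀ (by positivity) ?_
        rw [← ofReal_norm, norm_real, norm_of_nonneg timeBump.nonneg]
        exact ofReal_le_one.2 timeBump.le_one
      · have : k x = 0 := by grind
        simp [this]
    refine (lintegral_mono this).trans (le_of_eq ?_)
    rw [lintegral_indicator_const measurableSet_Icc, one_mul, volume_Icc]; congr 1; ring
  have hg : ∀ ν, (∫⁻ x, (‖liftField k H x ν‖ₑ ^ 2) ^ 3) ^ (1 / 3 : ℝ) ≤
      K ^ (1 / 3 : ℝ) * ∫⁻ ξ, ‖coneLift k H (ξ, ν)‖ₑ ^ 2 := by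
    intro ν
    have h6 := lintegral_fourierInv_six_le (hF.slice_right ν) (ν := ν) (n := n) fun ξ hξ => by
      have h1 : H ξ ≠ 0 := right_ne_zero_of_mul hξ
      have h2 : k (ν - ‖ξ‖) ≠ 0 := by have := left_ne_zero_of_mul hξ; exact_mod_cast this
      exact ⟨hq ξ h1, hlo ξ h1, hhi ξ h1, by rw [abs_sub_comm]; exact hsupp _ h2⟩
    simp_rw [← pow_mul]
    have := rpow_le_rpow h6 (by norm_num : (0 : ℝ) ≤ 1 / 3)
    refine this.trans (le_of_eq ?_)
    rw [mul_rpow_of_nonneg _ _ (by norm_num), ← rpow_natCast (n := 3), ← rpow_mul]; simp [*]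
  have hkH : ∫⁻ ν : ℝ, ∫⁻ ξ, ‖coneLift k H (ξ, ν)‖ₑ ^ 2 ≤ ofReal (2 * δ) * I := by
    rw [lintegral_lintegral_swap ((hF.meas.comp measurable_swap).enorm.pow_const 2).aemeasurable, hI,
      ← lintegral_const_mul' _ _ ofReal_ne_top]
    refine lintegral_mono fun ξ => ?_
    simp only [coneLift, enorm_mul, mul_pow]
    rw [lintegral_mul_const' _ _ (by simp), lintegral_sub_right_eq_self (fun ν => ‖(k ν : ℂ)‖ₑ ^ 2)]
    gcongr
  have hmain : ∫⁻ x, (∫⁻ ν : ℝ, ‖liftField k H x ν‖ₑ ^ 2) ^ 3 ≤ K * (ofReal (2 * δ) * I) ^ 3 := by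
    refine (lintegral_lintegral_pow_three_le (a := fun p : Euc 2 × ℝ => ‖liftField k H p.1 p.2‖ₑ ^ 2)
      ((measurable_liftField hkn hH).enorm.pow_const 2)).trans ?_
    have hle : ∫⁻ ν : ℝ, (∫⁻ x, (‖liftField k H x ν‖ₑ ^ 2) ^ 3) ^ (1 / 3 : ℝ) ≤
        K ^ (1 / 3 : ℝ) * (ofReal (2 * δ) * I) := by
      refine (lintegral_mono hg).trans ?_
      rw [lintegral_const_mul' _ _ (by simp [hK])]; gcongr
    refine (pow_le_pow_left' hle 3).trans (le_of_eq ?_)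
    · rw [mul_pow, ← rpow_natCast (n := 3) (x := K ^ (1 / 3 : ℝ)), ← rpow_mul]; norm_num
  set X := ∫⁻ x, (∫⁻ t in {t : ℝ | |t| ≤ horizon * 4 ^ n}, ‖𝓕⁻ (waveProfile H t) x‖ₑ ^ 2) ^ 3 with hX
  have h1 : ofReal ((δ * c₁) ^ 6) * X ≤ K * (ofReal (2 * δ) * I) ^ 3 := by
    refine le_trans ?_ hmain
    rw [hX, ← lintegral_const_mul' _ _ ofReal_ne_top]
    refine lintegral_mono fun x => ?_
    simp only
    rw [show (δ * c₁) ^ 6 = ((δ * c₁) ^ 2) ^ 3 by ring, ofReal_pow (by positivity), ← mul_pow]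
    refine pow_le_pow_left' ?_ 3
    rw [← lintegral_time_sq hkn hH, ← lintegral_const_mul' _ _ ofReal_ne_top]
    refine le_trans (setLIntegral_mono_ae' ?_ (.of_forall fun t ht => ?_))
      (setLIntegral_le_lintegral _ _)
    · exact (isClosed_le continuous_abs continuous_const).measurableSet
    · gcongr; rw [fourierInv_scale _ hδ0, ofReal_pow (by positivity)]; gcongr
      rw [← ofReal_norm, norm_mul, norm_real, norm_of_nonneg hδ0.le]
      refine ofReal_le_ofReal (mul_le_mul_of_nonneg_left (hlow _ ?_) hδ0.le)
      rw [abs_mul, abs_of_pos hδ0, hδ, one_div, inv_mul_le_iff₀ (by positivity), mul_comm]; exact ht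
  have hpos : 0 < (δ * c₁) ^ 6 := by positivity
  calc X = ofReal ((δ * c₁) ^ 6)⁻¹ * (ofReal ((δ * c₁) ^ 6) * X) := by
        rw [← mul_assoc, ← ofReal_mul (by positivity), inv_mul_cancel₀ hpos.ne']; simp
    _ ≤ ofReal ((δ * c₁) ^ 6)⁻¹ * (K * (ofReal (2 * δ) * I) ^ 3) := by gcongr
    _ = _ := by
        rw [mul_pow (ofReal _), ← ofReal_pow (by positivity), hK, ← mul_assoc, ← mul_assoc,
          ← ofReal_mul (by positivity), ← ofReal_mul (by positivity)]
        grind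

/-- The square function estimate at unit frequency. -/
theorem exists_wave_square : ∃ C : ℝ, 0 ≤ C ∧ ∀ (n : ℕ) (H : Euc 2 → ℂ), Nice H →
    (∀ ξ, H ξ ≠ 0 → 1 / 4 ≤ ‖ξ‖) → (∀ ξ, H ξ ≠ 0 → ‖ξ‖ ≤ 1) →
    ∫⁻ x, (∫⁻ t in {t : ℝ | |t| ≤ horizon * 4 ^ n}, ‖𝓕⁻ (waveProfile H t) x‖ₑ ^ 2) ^ 3 ≤
      ofReal (C * (n + 1)) * (∫⁻ ξ, ‖H ξ‖ₑ ^ 2) ^ 3 := by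
  obtain ⟨C, hC0, hC⟩ := exists_wave_square_quadrant
  refine ⟨64 * (16 * (4 * C)), by positivity, fun n H hH hlo hhi => ?_⟩
  set T : Set ℝ := {t : ℝ | |t| ≤ horizon * 4 ^ n}
  set G : Fin 4 → Euc 2 → ℂ := fun q => quadrant.indicator (H ∘ (rotBy q).symm) with hG
  set g : Fin 4 → Euc 2 → ℂ := fun q => G q ∘ rotBy q with hg
  set I := ∫⁻ ξ, ‖H ξ‖ₑ ^ 2 with hI
  have hHq : ∀ q, Nice (H ∘ (rotBy q).symm) := fun q => by
    obtain ⟨M, hM0, hM⟩ := hH.bdd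
    obtain ⟨ρ, hρ0, hρ⟩ := hH.supp
    exact ⟨hH.meas.comp (rotBy q).symm.continuous.measurable, ⟨M, hM0, fun x => hM _⟩,
      ⟨ρ, hρ0, fun x hx => by simpa using hρ _ hx⟩⟩
  have hGn : ∀ q, Nice (G q) := fun q => (hHq q).indicator measurableSet_quadrant
  have hge : ∀ q, g q = ((rotBy q) ⁻¹' quadrant).indicator H := by
    intro q; funext ξ
    by_cases h : rotBy q ξ ∈ quadrant
    · simp [*]
    · simp [*]
  have hgn : ∀ q ∈ Finset.univ, Nice (g q) := fun q _ => by
    rw [hge]; exact hH.indicator ((rotBy q).continuous.measurable measurableSet_quadrant)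
  have hsum : H = fun ξ => ∑ q, g q ξ := by
    funext ξ
    simp_rw [hge]
    refine sum_quadrants ?_ ξ
    by_contra hc; have := hlo 0 hc; norm_num at this
  set U : Fin 4 → Euc 2 → ℝ≥0∞ := fun q x => ∫⁻ t in T, ‖𝓕⁻ (waveProfile (g q) t) x‖ₑ ^ 2 with hU
  have hUm : ∀ q, Measurable (U q) := fun q =>
    Measurable.lintegral_prod_left' ((measurable_wave (hgn q (Finset.mem_univ _))).enorm.pow_const 2)
  have hUq : ∀ q, ∫⁻ x, U q x ^ 3 ≤ ofReal (C * (n + 1)) * I ^ 3 := by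
    intro q
    have hne : ∀ ξ, G q ξ ≠ 0 → ξ ∈ quadrant ∧ H ((rotBy q).symm ξ) ≠ 0 := by
      intro ξ h
      have hm := mem_of_indicator_ne_zero h
      simp only [hG] at h; rw [indicator_of_mem hm] at h; exact ⟨hm, h⟩
    have := hC n (G q) (hGn q) (fun ξ h => (hne ξ h).1)
      (fun ξ h => by simpa using hlo _ (hne ξ h).2) (fun ξ h => by simpa using hhi _ (hne ξ h).2)
    have e : ∫⁻ x, U q x ^ 3 = ∫⁻ x, (∫⁻ t in T, ‖𝓕⁻ (waveProfile (G q) t) x‖ₑ ^ 2) ^ 3 := by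
      rw [← lintegral_comp_isometry (rotBy q)
        (fun x => (∫⁻ t in T, ‖𝓕⁻ (waveProfile (G q) t) x‖ₑ ^ 2) ^ 3)]
      simp only [hU, hg, wave_comp_isometry]
    rw [e]
    refine this.trans ?_
    gcongr; rw [hI, ← lintegral_comp_isometry (rotBy q).symm (fun ξ => ‖H ξ‖ₑ ^ 2)]
    refine lintegral_mono fun ξ => ?_
    simp only [hG]; gcongr; exact enorm_indicator_le_enorm_self _ _
  have hpt : ∀ x, (∫⁻ t in T, ‖𝓕⁻ (waveProfile H t) x‖ₑ ^ 2) ^ 3 ≤ 64 * (16 * ∑ q, U q x ^ 3) := by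
    intro x
    have hmq : ∀ q ∈ (Finset.univ : Finset (Fin 4)),
        AEMeasurable (fun t => ‖𝓕⁻ (waveProfile (g q) t) x‖ₑ ^ 2) (volume.restrict T) := fun q hq =>
      (((measurable_wave (hgn q hq)).comp (measurable_prodMk_right (y := x))).enorm.pow_const 2).aemeasurable
    have h1 : ∫⁻ t in T, ‖𝓕⁻ (waveProfile H t) x‖ₑ ^ 2 ≤ 4 * ∑ q, U q x := by
      simp only [hU]; rw [← lintegral_finsetSum' _ hmq, ← lintegral_const_mul' _ _ (by simp)]
      refine lintegral_mono fun t => ?_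
      simp only
      conv_lhs => rw [hsum]
      rw [wave_finset_sum _ hgn]
      simpa using enorm_sum_pow_le (Finset.univ : Finset (Fin 4)) (fun q => 𝓕⁻ (waveProfile (g q) t) x) 1
    have h2 : (∑ q, U q x) ^ 3 ≤ 16 * ∑ q, U q x ^ 3 := by
      have := ENNReal.rpow_sum_le_const_mul_sum_rpow (Finset.univ : Finset (Fin 4)) (fun q => U q x)
        (p := ((3 : ℕ) : ℝ)) (by norm_num)
      simp only [rpow_natCast] at this
      refine this.trans (le_of_eq ?_)
      norm_num
    calc _ ≤ (4 * ∑ q, U q x) ^ 3 := pow_le_pow_left' h1 3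
      _ = 64 * (∑ q, U q x) ^ 3 := by ring_nf
      _ ≤ _ := by gcongr
  refine (lintegral_mono hpt).trans ?_
  rw [lintegral_const_mul' _ _ (by simp), lintegral_const_mul' _ _ (by simp),
    lintegral_finsetSum' _ fun q _ => ((hUm q).pow_const 3).aemeasurable]
  refine (mul_le_mul' le_rfl (mul_le_mul' le_rfl (sum_le_sum fun q _ => hUq q))).trans (le_of_eq ?_)
  rw [sum_const, Finset.card_univ, Fintype.card_fin, nsmul_eq_mul,
    show 64 * (16 * (4 * C)) * ((n : ℝ) + 1) = 64 * (16 * (4 * (C * (n + 1)))) by ring,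
    ofReal_mul (p := 64) (by norm_num), ofReal_mul (p := 16) (by norm_num),
    ofReal_mul (p := 4) (by norm_num)]
  norm_num [mul_assoc]

end SquareFunction

section CircularMeans
open Real (cos sin)
open scoped Real Pointwise

/-- The unit vector with polar angle `θ`. -/
def circ (θ : ℝ) : Euc 2 := !₂[cos θ, sin θ]

theorem continuous_circ : Continuous circ := by unfold circ; fun_prop

theorem norm_circ (θ : ℝ) : ‖circ θ‖ = 1 := by
  have := norm_sq_euc (circ θ)
  simp only [circ, PiLp.toLp_apply, Matrix.cons_val_zero, Matrix.cons_val_one,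
    Real.cos_sq_add_sin_sq] at this
  exact (pow_eq_one_iff_of_nonneg (norm_nonneg _) two_ne_zero).1 this

theorem toSphere_preimage {A : Set (Euc 2)} (hA : MeasurableSet A) :
    (volume : Measure (Euc 2)).toSphere (Subtype.val ⁻¹' A) =
      (volume.restrict (Ioo (-π) π)) (circ ⁻¹' A) := by
  set E : Set (Euc 2) := {x | (0 < ‖x‖ ∧ ‖x‖ < 1) ∧ ‖x‖⁻¹ • x ∈ A} with hE
  have hEm : MeasurableSet E := by
    refine MeasurableSet.inter ((measurableSet_lt measurable_const measurable_norm).inter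
      (measurableSet_lt measurable_norm measurable_const)) ?_
    exact (measurable_norm.inv.smul measurable_id) hA
  have hEq : Ioo (0 : ℝ) 1 • (Subtype.val '' (Subtype.val ⁻¹' A : Set (sphere (0 : Euc 2) 1))) = E := by
    ext x; rw [mem_smul]
    constructor
    · rintro ⟨r, hr, _, ⟨y, hy, rfl⟩, rfl⟩
      have h1 : ‖(y : Euc 2)‖ = 1 := by simp
      have h2 : ‖r • (y : Euc 2)‖ = r := by rw [norm_smul, h1, mul_one, norm_of_nonneg hr.1.le]
      refine ⟨by rw [h2]; exact hr, ?_⟩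
      rw [h2, smul_smul, inv_mul_cancel₀ hr.1.ne', one_smul]; exact hy
    · rintro ⟨⟨h0, h1⟩, h2⟩
      refine ⟨‖x‖, ⟨h0, h1⟩, ‖x‖⁻¹ • x, ⟨⟨‖x‖⁻¹ • x, ?_⟩, h2, rfl⟩, ?_⟩
      · simp [norm_smul, h0.ne']
      · simp_all
  have hmc : MeasurableSet (circ ⁻¹' A) := continuous_circ.measurable hA
  have hpt : ∀ p ∈ polarCoord.target, ofReal p.1 •
      E.indicator (1 : Euc 2 → ℝ≥0∞) !₂[(polarCoord.symm p).1, (polarCoord.symm p).2] =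
      (Iio 1).indicator (fun r => ofReal r) p.1 * (circ ⁻¹' A).indicator 1 p.2 := by
    rintro ⟨r, θ⟩ hp
    have hr : 0 < r := hp.1
    have e : (!₂[(polarCoord.symm (r, θ)).1, (polarCoord.symm (r, θ)).2] : Euc 2) = r • circ θ := by
      ext i; fin_cases i <;> simp [circ]
    have hm : r • circ θ ∈ E ↔ r < 1 ∧ θ ∈ circ ⁻¹' A := by
      simp only [hE, mem_ofPred_eq, norm_smul, norm_circ, mul_one, norm_of_nonneg hr.le, smul_smul,
        inv_mul_cancel₀ hr.ne', one_smul, hr, true_and, mem_preimage]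
    rw [e]
    by_cases h1 : r < 1 <;> by_cases h2 : θ ∈ circ ⁻¹' A <;>
      simp only [indicator, hm, h1, h2, and_self, and_true, and_false, if_true, if_false,
        mem_Iio, smul_eq_mul, mul_one, mul_zero, Pi.one_apply]
  have hhalf : ∫⁻ r in Ioi (0 : ℝ), (Iio (1 : ℝ)).indicator (fun r => ofReal r) r =
      ofReal (1 / 2) := by
    rw [lintegral_indicator measurableSet_Iio, Measure.restrict_restrict measurableSet_Iio,
      show Iio (1 : ℝ) ∩ Ioi 0 = Ioo 0 1 by ext; simp [and_comm], restrict_Ioo_eq_restrict_Ioc,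
      ← ofReal_integral_eq_lintegral_ofReal, ← intervalIntegral.integral_of_le zero_le_one, integral_id]
    · norm_num
    · exact (continuous_id.integrableOn_Icc).mono_set Ioc_subset_Icc_self
    · exact (ae_restrict_iff' measurableSet_Ioc).2 (.of_forall fun r hr => hr.1.le)
  have hI1 : Measurable (E.indicator (1 : Euc 2 → ℝ≥0∞)) := measurable_one.indicator hEm
  rw [Measure.toSphere_apply' _ (measurable_subtype_coe hA), hEq, ← lintegral_indicator_one hEm,
    lintegral_euc_prod hI1, ← lintegral_comp_polarCoord_symm,
    setLIntegral_congr_fun polarCoord.open_target.measurableSet hpt,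
    polarCoord_target, Measure.volume_eq_prod, ← Measure.prod_restrict, lintegral_prod_mul
      (ENNReal.measurable_ofReal.indicator measurableSet_Iio).aemeasurable
      (measurable_one.indicator hmc).aemeasurable, hhalf, lintegral_indicator_one hmc,
    finrank_euclideanSpace_fin, ← mul_assoc]
  norm_num; rw [← ofReal_ofNat, ← ofReal_mul (by norm_num)]; norm_num

theorem sphereMeasure_two : sphereMeasure 2 =
    (ofReal (2 * π))⁻¹ • (volume.restrict (Ioo (-π) π)).map circ := by
  have h : ((volume : Measure (Euc 2)).toSphere).map Subtype.val =
      (volume.restrict (Ioo (-π) π)).map circ := by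
    ext A hA
    rw [Measure.map_apply measurable_subtype_coe hA, Measure.map_apply continuous_circ.measurable hA,
      toSphere_preimage hA]
  have h1 := toSphere_preimage (A := univ) MeasurableSet.univ
  rw [preimage_univ, preimage_univ, Measure.restrict_apply_univ, Real.volume_Ioo] at h1
  rw [sphereMeasure, h, h1, sub_neg_eq_add, two_mul]

theorem sphAvg_eq {g : Euc 2 → ℂ} (hg : Continuous g) (t : ℝ) (x : Euc 2) :
    sphAvg g t x = ((2 * π)⁻¹ : ℝ) * ∫ θ in (-π)..π, g (x - t • circ θ) := by
  have hcont : Continuous fun y : Euc 2 => g (x - t • y) := by fun_prop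
  rw [sphAvg, sphereMeasure_two, integral_smul_measure, integral_map continuous_circ.aemeasurable
    hcont.aestronglyMeasurable, intervalIntegral.integral_of_le (by linarith [pi_pos]),
    ← restrict_Ioo_eq_restrict_Ioc, toReal_inv, toReal_ofReal (by positivity),
    real_smul]

theorem enorm_sphAvg_le_of_bound {g : Euc 2 → ℂ} (hg : Continuous g) {t : ℝ} {M : ℝ≥0∞} {x : Euc 2}
    (hM : ∀ y, ‖y‖ = 1 → ‖g (x - t • y)‖ₑ ≤ M) : ‖sphAvg g t x‖ₑ ≤ M := by
  have hp := pi_pos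
  rw [sphAvg_eq hg, enorm_mul, intervalIntegral.integral_of_le (by linarith), ← ofReal_norm, norm_real,
    norm_of_nonneg (by positivity)]
  calc _ ≤ ofReal (2 * π)⁻¹ * ∫⁻ _ in Ioc (-π) π, M := by
        gcongr
        exact (enorm_integral_le_lintegral_enorm _).trans (lintegral_mono fun θ => hM _ (norm_circ θ))
    _ = ofReal (2 * π)⁻¹ * ofReal (2 * π) * M := by
        rw [setLIntegral_const, volume_Ioc, sub_neg_eq_add, two_mul]; ring
    _ = M := by
        rw [← ofReal_mul (by positivity), inv_mul_cancel₀ (by positivity), ofReal_one, one_mul]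

theorem sphAvg_sum {ι : Type*} (s : Finset ι) {g : ι → Euc 2 → ℂ} (hg : ∀ i ∈ s, Continuous (g i)) (t : ℝ)
    (x : Euc 2) : sphAvg (fun u => ∑ i ∈ s, g i u) t x = ∑ i ∈ s, sphAvg (g i) t x := by
  rw [sphAvg_eq (continuous_finsetSum s hg), intervalIntegral.integral_finsetSum, mul_sum]
  · exact sum_congr rfl fun i hi => (sphAvg_eq (hg i hi) t x).symm
  · have := continuous_circ
    exact fun i hi => ((hg i hi).comp (by fun_prop)).intervalIntegrable _ _

theorem continuous_sphAvg {g : Euc 2 → ℂ} (hg : Continuous g) :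
    Continuous (uncurry fun t x => sphAvg g t x) := by
  have := continuous_circ
  simp only [Function.uncurry_def, sphAvg_eq hg]; fun_prop

/-- The exponential averaged over a circle. -/
theorem integral_circ (t : ℝ) (ξ : Euc 2) :
    ∫ θ in (-π)..π, (𝐞 (inner ℝ ξ (t • circ θ)) : ℂ) =
      2 * ∫ φ in (0 : ℝ)..(π / 2), ((𝐞 (t * cos φ * ‖ξ‖) : ℂ) + (𝐞 (-(t * cos φ) * ‖ξ‖) : ℂ)) := by
  obtain ⟨θ₀, h0, h1⟩ : ∃ θ₀ : ℝ, ξ 0 = ‖ξ‖ * cos θ₀ ∧ ξ 1 = ‖ξ‖ * sin θ₀ := by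
    set z : ℂ := ⟨ξ 0, ξ 1⟩
    have hn : ‖z‖ = ‖ξ‖ := by
      refine (pow_left_inj₀ (norm_nonneg _) (norm_nonneg _) two_ne_zero).1 ?_
      rw [norm_sq_euc, Complex.sq_norm, Complex.normSq_apply]; ring
    refine ⟨z.arg, ?_, ?_⟩
    · rw [← hn, Complex.norm_mul_cos_arg]
    · rw [← hn, Complex.norm_mul_sin_arg]
  set g : ℝ → ℂ := fun s => (𝐞 (t * s * ‖ξ‖) : ℂ)
  have hgc : Continuous g := by fun_prop
  have hgi : ∀ a b : ℝ, IntervalIntegrable (fun θ => g (cos θ)) volume a b := fun a b =>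
    (hgc.comp Real.continuous_cos).intervalIntegrable _ _
  have hgn : IntervalIntegrable (fun θ => g (-cos θ)) volume 0 (π / 2) :=
    (hgc.comp Real.continuous_cos.neg).intervalIntegrable _ _
  have e1 : ∀ θ, (𝐞 (inner ℝ ξ (t • circ θ)) : ℂ) = g (cos (θ - θ₀)) := by
    intro θ; congr 2; rw [inner_smul_right, PiLp.inner_apply, Fin.sum_univ_two, Real.cos_sub]
    simp only [circ, RCLike.inner_apply, conj_trivial, PiLp.toLp_apply, Matrix.cons_val_zero,
      Matrix.cons_val_one, h0, h1]
    ring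
  simp_rw [e1]
  have hper : Function.Periodic (fun θ => g (cos θ)) (2 * π) := fun θ => by simp [Real.cos_add_two_pi]
  rw [intervalIntegral.integral_comp_sub_right (fun θ => g (cos θ))]
  have e2 := hper.intervalIntegral_add_eq (-π - θ₀) (-π)
  rw [show -π - θ₀ + 2 * π = π - θ₀ by ring, show -π + 2 * π = π by ring] at e2
  rw [e2, ← intervalIntegral.integral_add_adjacent_intervals (hgi (-π) 0) (hgi 0 π)]
  have e3 : ∫ θ in (-π)..0, g (cos θ) = ∫ θ in (0 : ℝ)..π, g (cos θ) := by
    rw [← neg_zero, ← intervalIntegral.integral_comp_neg]; simp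
  have e4 : ∫ θ in (π / 2)..π, g (cos θ) = ∫ θ in (0 : ℝ)..(π / 2), g (-cos θ) := by
    have := intervalIntegral.integral_comp_sub_left (a := 0) (b := π / 2) (fun θ => g (cos θ)) π
    simp only [Real.cos_pi_sub] at this; grind
  rw [e3, ← two_mul, ← intervalIntegral.integral_add_adjacent_intervals (hgi 0 (π / 2)) (hgi (π / 2) π), e4,
    ← intervalIntegral.integral_add (hgi _ _) hgn]
  grind

theorem integrable_fourierChar_smul {g : Euc 2 → ℂ} (hg : Integrable g) (x : Euc 2) :
    Integrable fun ξ => 𝐞 (inner ℝ ξ x) • g ξ := by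
  simpa using (Real.fourierIntegral_convergent_iff (f := g) (-x)).2 hg

/-- Circular means in terms of the half-wave evolution. -/
theorem sphAvg_fourierInv {H : Euc 2 → ℂ} (hH : Nice H) (t : ℝ) (x : Euc 2) :
    sphAvg (𝓕⁻ H) t x = (π⁻¹ : ℝ) * ∫ φ in (0 : ℝ)..(π / 2),
      (𝓕⁻ (waveProfile H (t * cos φ)) x + 𝓕⁻ (waveProfile H (-(t * cos φ))) x) := by
  have hsw : ∀ (a b : ℝ) (ψ : ℝ × Euc 2 → ℂ), Continuous ψ → (∃ M : ℝ, ∀ p, ‖ψ p‖ ≤ M) → a ≤ b →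
      ∫ θ in a..b, ∫ ξ, H ξ * ψ (θ, ξ) = ∫ ξ, H ξ * ∫ θ in a..b, ψ (θ, ξ) := by
    intro a b ψ hψ ⟨M, hM⟩ hab; rw [intervalIntegral.integral_of_le hab]
    have hInt : Integrable (uncurry fun θ ξ => H ξ * ψ (θ, ξ))
        ((volume.restrict (Ioc a b)).prod volume) := by
      have h1 : Integrable (fun p : ℝ × Euc 2 => (1 : ℂ) * H p.2) ((volume.restrict (Ioc a b)).prod volume) :=
        (integrable_const (1 : ℂ)).mul_prod hH.integrable
      refine (h1.mul_bdd (c := M) hψ.aestronglyMeasurable (.of_forall hM)).congr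
        (.of_forall fun p => ?_)
      simp [uncurry]
    rw [integral_integral_swap hInt]
    refine integral_congr_ae (.of_forall fun ξ => ?_)
    simp only [intervalIntegral.integral_of_le hab]; rw [integral_const_mul]
  have h1 : ∀ θ, 𝓕⁻ H (x - t • circ θ) =
      ∫ ξ, H ξ * ((𝐞 (inner ℝ ξ x) : ℂ) * (𝐞 (inner ℝ ξ ((-t) • circ θ)) : ℂ)) := by
    intro θ; rw [fourierInv_eq]
    refine integral_congr_ae (.of_forall fun ξ => ?_)
    simp only [smul_def, smul_eq_mul]
    rw [← coe_mul, ← AddChar.map_add_eq_mul, ← inner_add_right, neg_smul, ← sub_eq_add_neg, mul_comm]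
  have h2 : ∀ φ, 𝓕⁻ (waveProfile H (t * cos φ)) x + 𝓕⁻ (waveProfile H (-(t * cos φ))) x =
      ∫ ξ, H ξ * ((𝐞 (inner ℝ ξ x) : ℂ) *
        ((𝐞 (t * cos φ * ‖ξ‖) : ℂ) + (𝐞 (-(t * cos φ) * ‖ξ‖) : ℂ))) := by
    intro φ
    have hi := fun τ => integrable_fourierChar_smul (hH.waveProfile τ).integrable x
    rw [fourierInv_eq, fourierInv_eq, ← integral_add (hi _) (hi _)]
    refine integral_congr_ae (.of_forall fun ξ => ?_)
    simp only [smul_def, smul_eq_mul, waveProfile]; ring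
  have hb : ∀ a : ℝ, ‖(𝐞 a : ℂ)‖ ≤ 1 := fun a => (norm_fourierChar a).le
  have cc := continuous_circ
  rw [sphAvg_eq (continuous_fourierInv hH.integrable)]; simp_rw [h1, h2]
  rw [hsw (-π) π (fun p => (𝐞 (inner ℝ p.2 x) : ℂ) * (𝐞 (inner ℝ p.2 ((-t) • circ p.1)) : ℂ)) (by fun_prop)
      ⟨1, fun p => by rw [norm_mul, norm_fourierChar, norm_fourierChar, one_mul]⟩ (by linarith [pi_pos]),
    hsw 0 (π / 2) (fun p => (𝐞 (inner ℝ p.2 x) : ℂ) *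
        ((𝐞 (t * cos p.1 * ‖p.2‖) : ℂ) + (𝐞 (-(t * cos p.1) * ‖p.2‖) : ℂ))) (by fun_prop)
      ⟨2, fun p => by
        rw [norm_mul, norm_fourierChar, one_mul]
        exact (norm_add_le _ _).trans (by linarith [hb (t * cos p.1 * ‖p.2‖), hb (-(t * cos p.1) * ‖p.2‖)])⟩
      (by linarith [pi_pos]), ← integral_const_mul, ← integral_const_mul]
  refine integral_congr_ae (.of_forall fun ξ => ?_)
  simp only [intervalIntegral.integral_const_mul]; rw [integral_circ]
  have e : ∀ φ, ((𝐞 (-t * cos φ * ‖ξ‖) : ℂ) + (𝐞 (-(-t * cos φ) * ‖ξ‖) : ℂ)) =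
      (𝐞 (t * cos φ * ‖ξ‖) : ℂ) + (𝐞 (-(t * cos φ) * ‖ξ‖) : ℂ) := by grind
  simp_rw [e]
  generalize (∫ φ in (0 : ℝ)..(π / 2), _ : ℂ) = J
  push_cast; grind

end CircularMeans

section WaveAverages
open Real (cos sin)
open scoped Real

/-- The profile of the time primitive of a wave. -/
def primitiveProfile (H : Euc 2 → ℂ) (ξ : Euc 2) : ℂ := (2 * π * Complex.I * ‖ξ‖)⁻¹ * H ξ

theorem FreqSymbol.primitive {m : Euc 2 → ℂ} (hm : FreqSymbol m) : FreqSymbol (primitiveProfile m) := by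
  have hne : ∀ ξ, primitiveProfile m ξ ≠ 0 → m ξ ≠ 0 := fun ξ h => right_ne_zero_of_mul h
  refine ⟨contDiff_iff_contDiffAt.2 fun ξ => ?_, fun ξ h => hm.lo ξ (hne ξ h), fun ξ h => hm.hi ξ (hne ξ h)⟩
  by_cases hξ : ξ = 0
  · have : primitiveProfile m =ᶠ[nhds ξ] fun _ => 0 := by
      filter_upwards [ball_mem_nhds ξ (show (0 : ℝ) < 1 / 4 by norm_num)] with η hη
      by_contra hc
      have := hm.lo η (hne η hc)
      rw [hξ, mem_ball, dist_zero_right] at hη; linarith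
    exact contDiffAt_const.congr_of_eventuallyEq this
  · have h1 : ContDiffAt ℝ (⊤ : ℕ∞) (fun ξ : Euc 2 => ((‖ξ‖ : ℝ) : ℂ)) ξ :=
      ofRealCLM.contDiff.contDiffAt.comp ξ (contDiffAt_norm ℝ hξ)
    refine ((contDiffAt_const.mul h1).inv ?_).mul hm.smooth.contDiffAt
    simp_all

theorem continuous_wave {H : Euc 2 → ℂ} (hH : Nice H) (x : Euc 2) :
    Continuous fun τ => 𝓕⁻ (waveProfile H τ) x := by
  simp_rw [fourierInv_eq]
  refine continuous_of_dominated (bound := fun ξ => ‖H ξ‖)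
    (fun τ => (integrable_fourierChar_smul (hH.waveProfile τ).integrable x).aestronglyMeasurable)
    (fun τ => .of_forall fun ξ => ?_) hH.integrable.norm
    (.of_forall fun ξ => ?_)
  · rw [Circle.norm_smul, waveProfile, norm_mul, norm_fourierChar, one_mul]
  · simp only [waveProfile, smul_def]; fun_prop

theorem hasDerivAt_wave {H : Euc 2 → ℂ} (hH : Nice H) (hP : Nice (primitiveProfile H)) (h0 : H 0 = 0)
    (x : Euc 2) (τ : ℝ) : HasDerivAt (fun τ => 𝓕⁻ (waveProfile (primitiveProfile H) τ) x)
      (𝓕⁻ (waveProfile H τ) x) τ := by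
  simp_rw [fourierInv_eq]
  refine (hasDerivAt_integral_of_dominated_loc_of_deriv_le (bound := fun ξ => ‖H ξ‖)
    (F := fun τ ξ => 𝐞 (inner ℝ ξ x) • waveProfile (primitiveProfile H) τ ξ)
    (F' := fun τ ξ => 𝐞 (inner ℝ ξ x) • waveProfile H τ ξ) Filter.univ_mem
    (.of_forall fun τ =>
      (integrable_fourierChar_smul (hP.waveProfile τ).integrable x).aestronglyMeasurable)
    (integrable_fourierChar_smul (hP.waveProfile τ).integrable x)
    (integrable_fourierChar_smul (hH.waveProfile τ).integrable x).aestronglyMeasurable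
    (.of_forall fun ξ τ _ => ?_) hH.integrable.norm
    (.of_forall fun ξ τ _ => ?_)).2
  · rw [Circle.norm_smul, waveProfile, norm_mul, norm_fourierChar, one_mul]
  · have h1 : HasDerivAt (fun τ : ℝ => (𝐞 (τ * ‖ξ‖) : ℂ)) (‖ξ‖ • (2 * π * Complex.I * 𝐞 (τ * ‖ξ‖))) τ :=
      HasDerivAt.scomp (g₁ := fun a => (𝐞 a : ℂ)) τ (Real.hasDerivAt_fourierChar (τ * ‖ξ‖))
        (hasDerivAt_mul_const ‖ξ‖)
    simp only [waveProfile, smul_def]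
    refine ((h1.mul_const _).fun_const_smul _).congr_deriv ?_
    by_cases hξ : ξ = 0
    · simp_all
    · have : (‖ξ‖ : ℂ) ≠ 0 := by simpa using hξ
      simp only [primitiveProfile, smul_eq_mul, real_smul]; field_simp

/-- The size of a wave and of its time primitive. -/
def waveSize (H : Euc 2 → ℂ) (τ : ℝ) (x : Euc 2) : ℝ≥0∞ :=
  ‖𝓕⁻ (waveProfile H τ) x‖ₑ + ‖𝓕⁻ (waveProfile (primitiveProfile H) τ) x‖ₑ

/-- Stationary phase for circular means: after one integration by parts the average of the wave over
`t cos φ` carries a weight of mass `O(Λ ^ (-1/2))`. -/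
theorem enorm_sphAvg_le {H : Euc 2 → ℂ} (hH : Nice H) (hP : Nice (primitiveProfile H)) (h0 : H 0 = 0)
    {Λ t : ℝ} (hΛ : 1 ≤ Λ) (ht : Λ / 2 ≤ t) (x : Euc 2) :
    ‖sphAvg (𝓕⁻ H) t x‖ₑ ≤ ∫⁻ φ in Ioc 0 (π / 2), ofReal (4 / (Λ * sin φ ^ 2 + 1) * cos φ) *
      (waveSize H (t * cos φ) x + waveSize H (-(t * cos φ)) x) := by
  have ht0 : 0 < t := by linarith
  set U := fun τ => 𝓕⁻ (waveProfile H τ) x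
  set W := fun τ => 𝓕⁻ (waveProfile (primitiveProfile H) τ) x
  have hUc : Continuous U := continuous_wave hH x
  have hWc : Continuous W := continuous_wave hP x
  have hD : ∀ φ, 0 < Λ * sin φ ^ 2 + 1 := fun φ => by positivity
  set b' : ℝ → ℝ := fun φ => (Λ + 1) * cos φ * (1 - Λ * sin φ ^ 2) / (Λ * sin φ ^ 2 + 1) ^ 2 with hb'
  have hder : ∀ φ, HasDerivAt (fun φ => (((Λ + 1) * sin φ / (Λ * sin φ ^ 2 + 1) : ℝ) : ℂ) *
      (W (t * cos φ) - W (-(t * cos φ))))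
      ((b' φ : ℂ) * (W (t * cos φ) - W (-(t * cos φ))) -
        (t * ((Λ + 1) * sin φ ^ 2 / (Λ * sin φ ^ 2 + 1)) : ℝ) * (U (t * cos φ) + U (-(t * cos φ)))) φ := by
    intro φ
    have h1 : HasDerivAt (fun φ => (Λ + 1) * sin φ / (Λ * sin φ ^ 2 + 1)) (b' φ) φ := by
      refine (((Real.hasDerivAt_sin φ).const_mul (Λ + 1)).div ((((Real.hasDerivAt_sin φ).pow 2).const_mul
        Λ).add_const 1) (hD φ).ne').congr_deriv ?_
      simp only [hb', Pi.pow_apply]; push_cast; ring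
    have hc : HasDerivAt (fun φ => t * cos φ) (t * -sin φ) φ := (Real.hasDerivAt_cos φ).const_mul t
    have h2 : HasDerivAt (fun φ => W (t * cos φ)) ((t * -sin φ) • U (t * cos φ)) φ :=
      HasDerivAt.scomp (g₁ := W) φ (hasDerivAt_wave hH hP h0 x (t * cos φ)) hc
    have h3 : HasDerivAt (fun φ => W (-(t * cos φ))) ((-(t * -sin φ)) • U (-(t * cos φ))) φ :=
      HasDerivAt.scomp (g₁ := W) φ (hasDerivAt_wave hH hP h0 x (-(t * cos φ))) hc.fun_neg
    refine (h1.ofReal_comp.mul (h2.sub h3)).congr_deriv ?_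
    simp only [real_smul, Pi.sub_apply]; push_cast; ring
  have hcb : Continuous b' := by
    exact Continuous.div (by fun_prop) (by fun_prop) fun φ => (pow_pos (hD φ) 2).ne'
  have hca : Continuous fun φ => (Λ + 1) * sin φ ^ 2 / (Λ * sin φ ^ 2 + 1) :=
    Continuous.div (by fun_prop) (by fun_prop) fun φ => (hD φ).ne'
  have hcG : Continuous fun φ => (b' φ : ℂ) * (W (t * cos φ) - W (-(t * cos φ))) -
      (t * ((Λ + 1) * sin φ ^ 2 / (Λ * sin φ ^ 2 + 1)) : ℝ) * (U (t * cos φ) + U (-(t * cos φ))) := by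
    fun_prop
  have hcV : Continuous fun φ => U (t * cos φ) + U (-(t * cos φ)) := by fun_prop
  have hz := intervalIntegral.integral_eq_sub_of_hasDerivAt (a := 0) (b := π / 2) (fun φ _ => hder φ)
    (hcG.intervalIntegrable _ _)
  simp only [Real.sin_zero, Real.cos_pi_div_two, mul_zero, zero_div, Complex.ofReal_zero, zero_mul, neg_zero,
    sub_self] at hz
  rw [sphAvg_fourierInv hH, ← add_zero (∫ φ in (0 : ℝ)..(π / 2), _), ← mul_zero (((t⁻¹ : ℝ)) : ℂ), ← hz,
    ← intervalIntegral.integral_const_mul,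
    ← intervalIntegral.integral_add (hcV.intervalIntegrable _ _) ((hcG.const_mul _).intervalIntegrable _ _),
    enorm_mul, intervalIntegral.integral_of_le (by positivity)]
  have hπ : ‖((π⁻¹ : ℝ) : ℂ)‖ₑ ≤ 1 := by
    rw [← ofReal_norm, norm_real, norm_of_nonneg (by positivity), ← ofReal_one]
    exact ofReal_le_ofReal (inv_le_one_of_one_le₀ (by linarith [Real.pi_gt_three]))
  refine (mul_le_of_le_one_left zero_le hπ).trans ((enorm_integral_le_lintegral_enorm _).trans
    (setLIntegral_mono' measurableSet_Ioc fun φ hφ => ?_))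
  have hcos : 0 ≤ cos φ := Real.cos_nonneg_of_mem_Icc ⟨by linarith [hφ.1, pi_pos], hφ.2⟩
  set D := Λ * sin φ ^ 2 + 1 with hDd
  have hD0 : 0 < D := hD φ
  have hsz : waveSize H (t * cos φ) x + waveSize H (-(t * cos φ)) x = ofReal
      (‖U (t * cos φ)‖ + ‖W (t * cos φ)‖ + (‖U (-(t * cos φ))‖ + ‖W (-(t * cos φ))‖)) := by
    rw [ofReal_add (by positivity) (by positivity), ofReal_add (by positivity) (by positivity),
      ofReal_add (by positivity) (by positivity)]
    simp only [ofReal_norm]; rfl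
  rw [hsz, ← ofReal_mul (by positivity), ← ofReal_norm]
  refine ofReal_le_ofReal ?_
  have hs2 : sin φ ^ 2 = 1 - cos φ ^ 2 := by linarith [Real.sin_sq_add_cos_sq φ]
  have e : U (t * cos φ) + U (-(t * cos φ)) + (t⁻¹ : ℝ) *
      ((b' φ : ℂ) * (W (t * cos φ) - W (-(t * cos φ))) -
        (t * ((Λ + 1) * sin φ ^ 2 / D) : ℝ) * (U (t * cos φ) + U (-(t * cos φ)))) =
      ((cos φ ^ 2 / D : ℝ) : ℂ) * (U (t * cos φ) + U (-(t * cos φ))) +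
        ((t⁻¹ * b' φ : ℝ) : ℂ) * (W (t * cos φ) - W (-(t * cos φ))) := by
    have h1 : cos φ ^ 2 / D = 1 - t⁻¹ * (t * ((Λ + 1) * sin φ ^ 2 / D)) := by field_simp; linarith
    rw [h1]; push_cast; ring
  have hq : 0 ≤ 4 / D * cos φ := by positivity
  have b1 : |cos φ ^ 2 / D| ≤ 4 / D * cos φ := by
    rw [abs_of_nonneg (by positivity), div_mul_eq_mul_div]; gcongr; nlinarith
  have b2 : |t⁻¹ * b' φ| ≤ 4 / D * cos φ := by
    have h1 : |1 - Λ * sin φ ^ 2| ≤ D := by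
      have : 0 ≤ Λ * sin φ ^ 2 := by positivity
      rw [abs_le]; constructor <;> rw [hDd] <;> linarith
    have h2 : |b' φ| ≤ (Λ + 1) * cos φ / D := by
      rw [abs_div, abs_mul, abs_of_nonneg (by positivity : 0 ≤ (Λ + 1) * cos φ), abs_of_pos (pow_pos hD0 2),
        div_le_div_iff₀ (by positivity) hD0]
      have := mul_le_mul_of_nonneg_left h1 (by positivity : 0 ≤ (Λ + 1) * cos φ * D)
      linarith
    rw [abs_mul, abs_of_pos (inv_pos.2 ht0), inv_mul_le_iff₀ ht0]
    refine h2.trans ?_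
    rw [show t * (4 / D * cos φ) = t * 4 * cos φ / D by ring]; gcongr; linarith
  rw [e]
  refine (norm_add_le _ _).trans ?_
  rw [norm_mul, norm_mul, norm_real, norm_real, norm_eq_abs, norm_eq_abs]
  have := mul_le_mul b1 (norm_add_le (U (t * cos φ)) (U (-(t * cos φ)))) (norm_nonneg _) hq
  have := mul_le_mul b2 (norm_sub_le (W (t * cos φ)) (W (-(t * cos φ)))) (norm_nonneg _) hq
  linarith

theorem lintegral_weight_le {Λ : ℝ} (hΛ : 1 ≤ Λ) :
    ∫⁻ φ in Ioc 0 (π / 2), ofReal (4 / (Λ * sin φ ^ 2 + 1)) ≤ ofReal (20 / √Λ) := by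
  set c := 2 / π * √Λ
  have hc0 : 0 < c := by positivity
  have hi : Integrable fun φ : ℝ => 4 * (1 + (c * φ) ^ 2)⁻¹ :=
    (integrable_inv_one_add_sq.comp_mul_left' hc0.ne').const_mul 4
  calc _ ≤ ∫⁻ φ in Ioc 0 (π / 2), ofReal (4 * (1 + (c * φ) ^ 2)⁻¹) := by
        refine setLIntegral_mono' measurableSet_Ioc fun φ hφ => ofReal_le_ofReal ?_
        rw [← div_eq_mul_inv]; gcongr 4 / ?_
        have h1 := Real.mul_le_sin hφ.1.le hφ.2
        have h2 : 0 ≤ 2 / π * φ := by have := pi_pos; have := hφ.1; positivity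
        have h3 : (c * φ) ^ 2 = Λ * (2 / π * φ) ^ 2 := by grind
        rw [h3, add_comm]; gcongr
    _ ≤ ∫⁻ φ, ofReal (4 * (1 + (c * φ) ^ 2)⁻¹) := setLIntegral_le_lintegral _ _
    _ = ofReal (4 * (c⁻¹ * π)) := by
        rw [← ofReal_integral_eq_lintegral_ofReal hi (.of_forall fun _ => by positivity),
          integral_const_mul, Measure.integral_comp_mul_left (fun y : ℝ => (1 + y ^ 2)⁻¹),
          integral_univ_inv_one_add_sq, abs_of_pos (inv_pos.2 hc0), smul_eq_mul]
    _ ≤ _ := by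
        refine ofReal_le_ofReal ?_
        have hp := pi_pos
        have : 4 * (c⁻¹ * π) = 2 * π ^ 2 / √Λ := by grind
        rw [this]; gcongr; nlinarith [Real.pi_lt_d2]

theorem ofReal_mul_lintegral_comp_mul_le {g : ℝ → ℝ≥0∞} (hg : Measurable g) {c R : ℝ} (h0 : 0 ≤ c)
    (h1 : c ≤ 1) : ofReal c * ∫⁻ t in {t : ℝ | |t| ≤ R}, g (t * c) ≤ ∫⁻ τ in {τ : ℝ | |τ| ≤ R}, g τ := by
  rcases h0.eq_or_lt with rfl | hc
  · simp
  have hS : MeasurableSet {τ : ℝ | |τ| ≤ R} := (isClosed_le continuous_abs continuous_const).measurableSet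
  rw [← lintegral_indicator hS, ← lintegral_indicator hS]
  have hG := hg.indicator hS
  have h2 : ∫⁻ t, {τ : ℝ | |τ| ≤ R}.indicator g (t * c) =
      ofReal c⁻¹ * ∫⁻ τ, {τ : ℝ | |τ| ≤ R}.indicator g τ := by
    rw [← lintegral_map hG (measurable_mul_const c), Real.map_volume_mul_right hc.ne',
      lintegral_smul_measure, abs_of_pos (inv_pos.2 hc), smul_eq_mul]
  calc _ ≤ ofReal c * ∫⁻ t, {τ : ℝ | |τ| ≤ R}.indicator g (t * c) := by
        gcongr with t
        by_cases ht : t ∈ {τ : ℝ | |τ| ≤ R}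
        swap
        · simp_all
        rw [indicator_of_mem ht, indicator_of_mem]
        change |t * c| ≤ R
        rw [abs_mul, abs_of_pos hc]; exact (mul_le_of_le_one_right (abs_nonneg t) h1).trans ht
    _ = _ := by rw [h2, ← mul_assoc, ← ofReal_mul h0, mul_inv_cancel₀ hc.ne', ofReal_one, one_mul]

theorem add_pow_le_two_pow_mul (a b : ℝ≥0∞) (k : ℕ) : (a + b) ^ k ≤ 2 ^ k * (a ^ k + b ^ k) := by
  rcases le_total a b with h | h
  · calc (a + b) ^ k ≤ (2 * b) ^ k := by rw [two_mul]; gcongr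
      _ ≤ _ := by rw [mul_pow]; gcongr; exact le_add_self
  · calc (a + b) ^ k ≤ (2 * a) ^ k := by rw [two_mul]; gcongr
      _ ≤ _ := by rw [mul_pow]; gcongr; exact le_self_add

theorem lintegral_pow_le_of_two_or_four {α : Type*} [MeasurableSpace α] (μ : Measure α) {f : α → ℝ≥0∞}
    (hf : AEMeasurable f μ) {k : ℕ} (hk : k = 2 ∨ k = 4) :
    (∫⁻ x, f x ∂μ) ^ k ≤ μ univ ^ (k - 1) * ∫⁻ x, f x ^ k ∂μ := by
  have h2 := sq_lintegral_le μ hf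
  rcases hk with rfl | rfl
  · simpa using h2
  · have h4 := sq_lintegral_le μ (hf.pow_const 2)
    calc (∫⁻ x, f x ∂μ) ^ 4 = ((∫⁻ x, f x ∂μ) ^ 2) ^ 2 := by rw [← pow_mul]
      _ ≤ (μ univ * ∫⁻ x, f x ^ 2 ∂μ) ^ 2 := by gcongr
      _ ≤ μ univ ^ 2 * (μ univ * ∫⁻ x, (f x ^ 2) ^ 2 ∂μ) := by rw [mul_pow]; gcongr
      _ = _ := by ring_nf

theorem measurable_waveSize {H : Euc 2 → ℂ} (hH : Nice H) (hP : Nice (primitiveProfile H)) :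
    Measurable (uncurry (waveSize H)) :=
  (measurable_wave hH).enorm.add (measurable_wave hP).enorm

theorem lintegral_sphAvg_pow_le {H : Euc 2 → ℂ} (hH : Nice H) (hP : Nice (primitiveProfile H)) (h0 : H 0 = 0)
    {Λ : ℝ} (hΛ : 1 ≤ Λ) {k : ℕ} (hk : k = 2 ∨ k = 4) (x : Euc 2) :
    ∫⁻ t in Icc (Λ / 2) (4 * Λ), ‖sphAvg (𝓕⁻ H) t x‖ₑ ^ k ≤ ofReal (20 / √Λ) ^ k * (2 * 4 ^ k *
      ∫⁻ τ in {τ : ℝ | |τ| ≤ 4 * Λ}, (‖𝓕⁻ (waveProfile H τ) x‖ₑ ^ k +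
        ‖𝓕⁻ (waveProfile (primitiveProfile H) τ) x‖ₑ ^ k)) := by
  set s : ℝ → ℝ≥0∞ := fun τ => waveSize H τ x
  have hsm : Measurable s := (measurable_waveSize hH hP).of_uncurry_right
  set Z : ℝ → ℝ≥0∞ := fun τ => s τ + s (-τ)
  have hZm : Measurable Z := hsm.add (hsm.comp measurable_neg)
  set w : ℝ → ℝ≥0∞ := fun φ => ofReal (4 / (Λ * sin φ ^ 2 + 1) * cos φ) with hw
  have hwm : Measurable w := by fun_prop
  have hwt : ∀ φ, w φ ≠ ∞ := fun φ => ofReal_ne_top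
  set M := ofReal (20 / √Λ)
  set S := {τ : ℝ | |τ| ≤ 4 * Λ} with hS
  have hSm : MeasurableSet S := (isClosed_le continuous_abs continuous_const).measurableSet
  set ν := (volume.restrict (Ioc 0 (π / 2))).withDensity w with hν
  have hcos : ∀ φ ∈ Ioc 0 (π / 2), 0 ≤ cos φ := fun φ hφ =>
    Real.cos_nonneg_of_mem_Icc ⟨by linarith [hφ.1, pi_pos], hφ.2⟩
  have hν1 : ν univ ≤ M := by
    rw [hν, withDensity_apply _ MeasurableSet.univ, Measure.restrict_univ]
    refine (setLIntegral_mono' measurableSet_Ioc fun φ hφ => ofReal_le_ofReal ?_).trans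
      (lintegral_weight_le hΛ)
    exact mul_le_of_le_one_right (by positivity) (cos_le_one φ)
  have hJ : ∫⁻ τ in S, Z τ ^ k ≤ 2 * 4 ^ k * ∫⁻ τ in S, (‖𝓕⁻ (waveProfile H τ) x‖ₑ ^ k +
        ‖𝓕⁻ (waveProfile (primitiveProfile H) τ) x‖ₑ ^ k) := by
    have hneg : ∫⁻ τ in S, s (-τ) ^ k = ∫⁻ τ in S, s τ ^ k := by
      have := (Measure.measurePreserving_neg (volume : Measure ℝ)).setLIntegral_comp_preimage hSm
        (hsm.pow_const k)
      rwa [show (Neg.neg ⁻¹' S) = S by ext τ; simp only [hS, mem_preimage, mem_ofPred_eq, abs_neg]] at this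
    calc _ ≤ ∫⁻ τ in S, 2 ^ k * (s τ ^ k + s (-τ) ^ k) := by
          gcongr with τ; exact add_pow_le_two_pow_mul _ _ _
      _ = 2 ^ k * (2 * ∫⁻ τ in S, s τ ^ k) := by
          rw [lintegral_const_mul' _ _ (by finiteness), lintegral_add_left (hsm.pow_const k), hneg, two_mul]
      _ ≤ 2 ^ k * (2 * ∫⁻ τ in S, 2 ^ k * (‖𝓕⁻ (waveProfile H τ) x‖ₑ ^ k +
            ‖𝓕⁻ (waveProfile (primitiveProfile H) τ) x‖ₑ ^ k)) := by
          gcongr with τ; exact add_pow_le_two_pow_mul _ _ _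
      _ = _ := by
          rw [lintegral_const_mul' _ _ (by finiteness), show (4 : ℝ≥0∞) = 2 * 2 by norm_num, mul_pow]; ring
  calc _ ≤ ∫⁻ t in Icc (Λ / 2) (4 * Λ), M ^ (k - 1) * ∫⁻ φ in Ioc 0 (π / 2), w φ * Z (t * cos φ) ^ k := by
        refine setLIntegral_mono' measurableSet_Icc fun t ht => ?_
        have hZt : Measurable fun φ => Z (t * cos φ) := hZm.comp (by fun_prop)
        have h1 : ‖sphAvg (𝓕⁻ H) t x‖ₑ ≤ ∫⁻ φ, Z (t * cos φ) ∂ν := by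
          rw [hν, lintegral_withDensity_eq_lintegral_mul _ hwm hZt]
          exact enorm_sphAvg_le hH hP h0 hΛ ht.1 x
        refine (pow_le_pow_left' h1 k).trans ((lintegral_pow_le_of_two_or_four ν hZt.aemeasurable hk).trans ?_)
        rw [hν, lintegral_withDensity_eq_lintegral_mul _ hwm (hZt.pow_const k)]; gcongr
        rfl
    _ = M ^ (k - 1) * ∫⁻ φ in Ioc 0 (π / 2), w φ * ∫⁻ t in Icc (Λ / 2) (4 * Λ), Z (t * cos φ) ^ k := by
        rw [lintegral_const_mul' _ _ (by finiteness), lintegral_lintegral_swap]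
        · simp_rw [lintegral_const_mul' _ _ (hwt _)]
        · fun_prop
    _ ≤ M ^ (k - 1) * ∫⁻ φ in Ioc 0 (π / 2), ofReal (4 / (Λ * sin φ ^ 2 + 1)) * ∫⁻ τ in S, Z τ ^ k := by
        gcongr M ^ (k - 1) * ?_
        refine setLIntegral_mono' measurableSet_Ioc fun φ hφ => ?_
        simp only [hw]; rw [ofReal_mul (by positivity), mul_assoc]; gcongr
        refine le_trans ?_ (ofReal_mul_lintegral_comp_mul_le (hZm.pow_const k) (hcos φ hφ) (cos_le_one φ))
        gcongr; grind
    _ ≤ M ^ (k - 1) * (M * ∫⁻ τ in S, Z τ ^ k) := by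
        rw [lintegral_mul_const _ (by fun_prop)]
        gcongr; exact lintegral_weight_le hΛ
    _ = M ^ k * ∫⁻ τ in S, Z τ ^ k := by rw [← mul_assoc, ← pow_succ, Nat.sub_add_cancel (by omega)]
    _ ≤ _ := by gcongr

end WaveAverages

section UnitFrequency

theorem exists_horizon_exponent {ρ : ℝ} (hρ : 1 < ρ) : ∃ N : ℕ, ∀ j : ℕ, ∃ n : ℕ,
    4 * 2 ^ j ≤ horizon * 4 ^ n ∧ ρ ^ n ≤ ρ ^ N * ρ ^ j ∧ (4 : ℝ) ^ n ≤ 4 ^ N * 2 ^ j := by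
  obtain ⟨n₀, hn₀⟩ := pow_unbounded_of_one_lt (4 / horizon) (show (1 : ℝ) < 4 by norm_num)
  rw [div_lt_iff₀ horizon_pos] at hn₀
  refine ⟨n₀ + 1, fun j => ⟨j / 2 + 1 + n₀, ?_, ?_, ?_⟩⟩
  · have h1 : (2 : ℝ) ^ j ≤ 4 ^ (j / 2 + 1) := by
      rw [show (4 : ℝ) = 2 ^ 2 by norm_num, ← pow_mul]
      exact pow_le_pow_right₀ one_le_two (by omega)
    calc 4 * (2 : ℝ) ^ j ≤ (4 ^ n₀ * horizon) * 4 ^ (j / 2 + 1) := by gcongr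
      _ = _ := by ring
  · rw [← pow_add]; exact pow_le_pow_right₀ hρ.le (by omega)
  · rw [show (4 : ℝ) = 2 ^ 2 by norm_num, ← pow_mul, ← pow_mul, ← pow_add]
    exact pow_le_pow_right₀ one_le_two (by omega)

theorem FreqSymbol.lintegral_enorm_sq_le {m : Euc 2 → ℂ} (hm : FreqSymbol m) : ∃ C : ℝ≥0,
    ∀ (f : Euc 2 → ℂ) (B : ℝ), Integrable f → (∀ x, ‖f x‖ ≤ B) →
      ∫⁻ ξ, ‖m ξ * 𝓕 f ξ‖ₑ ^ 2 ≤ C * ∫⁻ x, ‖f x‖ₑ ^ 2 := by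
  obtain ⟨M, -, hM⟩ := hm.nice.bdd
  refine ⟨(M ^ 2).toNNReal, fun f B hf hB => ?_⟩
  rw [(hm.nice_mul hf).lintegral_sq]; exact hm.lintegral_sq_le hf (memLp_two_of_bound hf hB) hM

/-- The wave estimates on the time interval `|τ| ≤ 4 · 2 ^ j`. -/
theorem FreqSymbol.exists_wave_bounds {m : Euc 2 → ℂ} (hm : FreqSymbol m) {ρ : ℝ} (hρ : 1 < ρ) :
    ∃ C : ℝ≥0, ∀ (j : ℕ) (f : Euc 2 → ℂ) (B : ℝ), Integrable f → (∀ x, ‖f x‖ ≤ B) →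
    (∫⁻ τ in {τ : ℝ | |τ| ≤ 4 * 2 ^ j}, ∫⁻ x, ‖𝓕⁻ (waveProfile (fun ξ => m ξ * 𝓕 f ξ) τ) x‖ₑ ^ 2 ≤
      C * (2 ^ j * ∫⁻ x, ‖f x‖ₑ ^ 2)) ∧
    (∫⁻ τ in {τ : ℝ | |τ| ≤ 4 * 2 ^ j}, ∫⁻ x, ‖𝓕⁻ (waveProfile (fun ξ => m ξ * 𝓕 f ξ) τ) x‖ₑ ^ 4 ≤
      C * (ofReal ρ ^ j * 2 ^ j * (ofReal (B ^ 2) * ∫⁻ x, ‖f x‖ₑ ^ 2))) ∧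
    ∫⁻ x, (∫⁻ τ in {τ : ℝ | |τ| ≤ 4 * 2 ^ j}, ‖𝓕⁻ (waveProfile (fun ξ => m ξ * 𝓕 f ξ) τ) x‖ₑ ^ 2) ^ 3 ≤
      C * (ofReal ρ ^ j * (∫⁻ x, ‖f x‖ₑ ^ 2) ^ 3) := by
  have hρ0 : 0 < ρ := by linarith
  obtain ⟨C₄, h40, h4⟩ := hm.exists_wave_four hρ
  obtain ⟨C₆, h60, h6⟩ := exists_wave_square
  obtain ⟨C₂, h2⟩ := hm.lintegral_enorm_sq_le
  obtain ⟨D, hD0, hD⟩ := exists_linear_le_pow hρ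
  obtain ⟨N, hN⟩ := exists_horizon_exponent hρ
  have hKp : ∀ j : ℕ, ofReal (ρ ^ j) = ofReal ρ ^ j := fun j => ofReal_pow hρ0.le j
  have h2p : ∀ j : ℕ, ofReal (2 ^ j) = 2 ^ j := fun j => by simp
  set A₂ : ℝ≥0 := 8 * C₂ with hA₂
  set A₄ : ℝ := C₄ * ρ ^ N * 4 ^ N with hA₄
  have hA0 : 0 ≤ A₄ := by positivity
  set A₆ : ℝ≥0 := (C₆ * (D * ρ ^ N)).toNNReal * C₂ ^ 3 with hA₆
  refine ⟨A₂ + A₄.toNNReal + A₆, fun j f B hf hB => ?_⟩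
  obtain ⟨n, hn1, hn2, hn3⟩ := hN j
  have hsub : {τ : ℝ | |τ| ≤ 4 * 2 ^ j} ⊆ {τ : ℝ | |τ| ≤ horizon * 4 ^ n} := fun τ hτ => le_trans hτ hn1
  have hH := hm.nice_mul hf
  have hne : ∀ ξ, m ξ * 𝓕 f ξ ≠ 0 → m ξ ≠ 0 := fun ξ h => left_ne_zero_of_mul h
  have h2f := h2 f B hf hB
  refine ⟨?_, ?_, ?_⟩
  · calc _ = ∫⁻ τ in {τ : ℝ | |τ| ≤ 4 * 2 ^ j}, ∫⁻ ξ, ‖m ξ * 𝓕 f ξ‖ₑ ^ 2 := by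
          refine lintegral_congr fun τ => ?_
          rw [lintegral_fourierInv_sq (hH.waveProfile τ).integrable (hH.waveProfile τ).memLp_two]
          refine lintegral_congr fun ξ => ?_
          rw [waveProfile, enorm_mul, ← ofReal_norm (𝐞 (τ * ‖ξ‖) : ℂ), norm_fourierChar, ofReal_one, one_mul]
      _ ≤ ∫⁻ τ in {τ : ℝ | |τ| ≤ 4 * 2 ^ j}, C₂ * ∫⁻ x, ‖f x‖ₑ ^ 2 := lintegral_mono fun τ => h2f
      _ = A₂ * (2 ^ j * ∫⁻ x, ‖f x‖ₑ ^ 2) := by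
          rw [setLIntegral_const, show {τ : ℝ | |τ| ≤ 4 * 2 ^ j} = Icc (-(4 * 2 ^ j)) (4 * 2 ^ j) by
            ext τ; simp [abs_le], volume_Icc, show (4 : ℝ) * 2 ^ j - -(4 * 2 ^ j) = 8 * 2 ^ j by ring,
            ofReal_mul (by norm_num), h2p, hA₂, ofReal_ofNat]
          push_cast; ring
      _ ≤ _ := by gcongr; exact le_self_add.trans le_self_add
  · calc _ ≤ _ := (lintegral_mono_set hsub).trans (h4 n f B hf hB)
      _ ≤ ofReal (A₄ * (ρ ^ j * 2 ^ j)) * (ofReal (B ^ 2) * ∫⁻ x, ‖f x‖ₑ ^ 2) := by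
          gcongr ofReal ?_ * _
          calc C₄ * ρ ^ n * 4 ^ n ≤ C₄ * (ρ ^ N * ρ ^ j) * (4 ^ N * 2 ^ j) := by gcongr
            _ = A₄ * (ρ ^ j * 2 ^ j) := by rw [hA₄]; ring
      _ = ofReal A₄ * (ofReal ρ ^ j * 2 ^ j * (ofReal (B ^ 2) * ∫⁻ x, ‖f x‖ₑ ^ 2)) := by
          rw [ofReal_mul hA0, ofReal_mul (p := ρ ^ j) (by positivity), hKp, h2p]; ring
      _ ≤ _ := by gcongr; push_cast; exact le_add_self.trans le_self_add
  · calc _ ≤ _ := (lintegral_mono fun x => pow_le_pow_left' (lintegral_mono_set hsub) 3).trans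
            (h6 n _ hH (fun ξ h => hm.lo ξ (hne ξ h)) (fun ξ h => hm.hi ξ (hne ξ h)))
      _ ≤ ofReal (C₆ * (D * ρ ^ N) * ρ ^ j) * (C₂ * ∫⁻ x, ‖f x‖ₑ ^ 2) ^ 3 := by
          gcongr ofReal ?_ * ?_ ^ 3; rw [mul_assoc, mul_assoc]; gcongr
          exact (by linarith [hD n] : (n : ℝ) + 1 ≤ D * ρ ^ n).trans (by gcongr)
      _ = A₆ * (ofReal ρ ^ j * (∫⁻ x, ‖f x‖ₑ ^ 2) ^ 3) := by
          rw [ofReal_mul (p := C₆ * (D * ρ ^ N)) (by positivity), hKp, hA₆, mul_pow, ENNReal.coe_mul,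
            ENNReal.coe_pow, ENNReal.ofNNReal_toNNReal]
          ring
      _ ≤ _ := by bound

/-- The endpoint estimates for circular means at unit frequency and times comparable to `2 ^ j`. -/
theorem FreqSymbol.exists_endpoint_bounds {m : Euc 2 → ℂ} (hm : FreqSymbol m) {ρ : ℝ} (hρ : 1 < ρ) :
    ∃ C : ℝ≥0, ∀ (j : ℕ) (f : Euc 2 → ℂ) (B : ℝ), Integrable f → (∀ x, ‖f x‖ ≤ B) →
    (∫⁻ x, ∫⁻ t in Icc (2 ^ j / 2 : ℝ) (4 * 2 ^ j), ‖sphAvg (𝓕⁻ fun ξ => m ξ * 𝓕 f ξ) t x‖ₑ ^ 2 ≤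
      C * ∫⁻ x, ‖f x‖ₑ ^ 2) ∧
    (∫⁻ x, (∫⁻ t in Icc (2 ^ j / 2 : ℝ) (4 * 2 ^ j), ‖sphAvg (𝓕⁻ fun ξ => m ξ * 𝓕 f ξ) t x‖ₑ ^ 2) ^ 3 ≤
      C * (ofReal ρ ^ j * (2 ^ j)⁻¹ ^ 3 * (∫⁻ x, ‖f x‖ₑ ^ 2) ^ 3)) ∧
    (∫⁻ x, ∫⁻ t in Icc (2 ^ j / 2 : ℝ) (4 * 2 ^ j), ‖sphAvg (𝓕⁻ fun ξ => m ξ * 𝓕 f ξ) t x‖ₑ ^ 4 ≤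
      C * (ofReal ρ ^ j * (2 ^ j)⁻¹ * (ofReal (B ^ 2) * ∫⁻ x, ‖f x‖ₑ ^ 2))) ∧
    ∀ t x, ‖sphAvg (𝓕⁻ fun ξ => m ξ * 𝓕 f ξ) t x‖ₑ ≤ C * ofReal B := by
  obtain ⟨C₁, h1⟩ := hm.exists_wave_bounds hρ
  obtain ⟨C₂, h2⟩ := hm.primitive.exists_wave_bounds hρ
  set A : ℝ≥0 := 400 * 2 * 4 ^ 2 * (C₁ + C₂)
  set A₄ : ℝ≥0 := 400 ^ 2 * (2 * 4 ^ 4 * (C₁ + C₂)) with hA₄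
  set A₆ : ℝ≥0 := (400 * (2 * 4 ^ 2)) ^ 3 * (2 ^ 3 * (C₁ + C₂)) with hA₆
  set A₀ : ℝ≥0 := (∫ y, ‖𝓕⁻ m y‖).toNNReal
  refine ⟨A + A₄ + A₆ + A₀, fun j f B hf hB => ?_⟩
  obtain ⟨p2, p4, p6⟩ := h1 j f B hf hB
  obtain ⟨q2, q4, q6⟩ := h2 j f B hf hB
  set H := fun ξ => m ξ * 𝓕 f ξ with hHdef
  have hPe : (fun ξ => primitiveProfile m ξ * 𝓕 f ξ) = primitiveProfile H := by
    funext ξ; simp only [primitiveProfile, hHdef, mul_assoc]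
  rw [hPe] at q2 q4 q6
  have hH : Nice H := hm.nice_mul hf
  have hP : Nice (primitiveProfile H) := hPe ▸ hm.primitive.nice_mul hf
  have h0 : H 0 = 0 := by
    have : m 0 = 0 := by by_contra hc; have := hm.lo 0 hc; norm_num at this
    simp [*]
  have hΛ : (1 : ℝ) ≤ 2 ^ j := one_le_pow₀ one_le_two
  have hM : ofReal (20 / √(2 ^ j)) ^ 2 = 400 * (2 ^ j)⁻¹ := by
    rw [← ofReal_pow (by positivity), div_pow, sq_sqrt (by positivity),
      ENNReal.ofReal_div_of_pos (by positivity), ofReal_pow zero_le_two]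
    norm_num [div_eq_mul_inv]
  have hmeas : ∀ {G : Euc 2 → ℂ} (_ : Nice G) (k : ℕ), Measurable (uncurry fun (x : Euc 2) (τ : ℝ) =>
      ‖𝓕⁻ (waveProfile G τ) x‖ₑ ^ k) := fun hG k =>
    (((measurable_wave hG).comp measurable_swap).enorm.pow_const k)
  have hmx : ∀ {G : Euc 2 → ℂ} (_ : Nice G) (k : ℕ) (x : Euc 2), Measurable fun τ : ℝ =>
      ‖𝓕⁻ (waveProfile G τ) x‖ₑ ^ k := fun hG k x => (hmeas hG k).of_uncurry_left
  have hsw : ∀ {G : Euc 2 → ℂ} (_ : Nice G) (k : ℕ),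
      ∫⁻ x, ∫⁻ τ in {τ : ℝ | |τ| ≤ 4 * 2 ^ j}, ‖𝓕⁻ (waveProfile G τ) x‖ₑ ^ k =
      ∫⁻ τ in {τ : ℝ | |τ| ≤ 4 * 2 ^ j}, ∫⁻ x, ‖𝓕⁻ (waveProfile G τ) x‖ₑ ^ k := fun hG k =>
    lintegral_lintegral_swap (hmeas hG k).aemeasurable
  have hk : ∀ k : ℕ, k = 2 ∨ k = 4 →
      ∫⁻ x, ∫⁻ t in Icc (2 ^ j / 2 : ℝ) (4 * 2 ^ j), ‖sphAvg (𝓕⁻ H) t x‖ₑ ^ k ≤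
      ofReal (20 / √(2 ^ j)) ^ k * (2 * 4 ^ k *
        ((∫⁻ τ in {τ : ℝ | |τ| ≤ 4 * 2 ^ j}, ∫⁻ x, ‖𝓕⁻ (waveProfile H τ) x‖ₑ ^ k) +
        ∫⁻ τ in {τ : ℝ | |τ| ≤ 4 * 2 ^ j}, ∫⁻ x, ‖𝓕⁻ (waveProfile (primitiveProfile H) τ) x‖ₑ ^ k)) := by
    intro k hk
    refine (lintegral_mono fun x => lintegral_sphAvg_pow_le hH hP h0 hΛ hk x).trans (le_of_eq ?_)
    rw [lintegral_const_mul' _ _ (by finiteness), lintegral_const_mul' _ _ (by finiteness), ← hsw hH, ← hsw hP,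
      ← lintegral_add_left (Measurable.lintegral_prod_right (hmeas hH k))]
    simp_rw [lintegral_add_left (hmx hH k _)]
  have hLL : ((2 : ℝ≥0∞) ^ j)⁻¹ * 2 ^ j = 1 := inv_mul_cancel (by simp) (by finiteness)
  refine ⟨?_, ?_, ?_, fun t x => ?_⟩
  · refine (hk 2 (Or.inl rfl)).trans ?_
    rw [hM]
    calc _ ≤ 400 * (2 ^ j)⁻¹ * (2 * 4 ^ 2 * (C₁ * (2 ^ j * ∫⁻ x, ‖f x‖ₑ ^ 2) +
          C₂ * (2 ^ j * ∫⁻ x, ‖f x‖ₑ ^ 2))) := by gcongr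
      _ = A * ((2 ^ j)⁻¹ * 2 ^ j * ∫⁻ x, ‖f x‖ₑ ^ 2) := by simp only [A]; push_cast; ring
      _ ≤ _ := by rw [hLL, one_mul]; gcongr; exact (le_self_add.trans le_self_add).trans le_self_add
  · calc _ ≤ ∫⁻ x, (400 * (2 ^ j)⁻¹ * (2 * 4 ^ 2 *
            ((∫⁻ τ in {τ : ℝ | |τ| ≤ 4 * 2 ^ j}, ‖𝓕⁻ (waveProfile H τ) x‖ₑ ^ 2) +
            ∫⁻ τ in {τ : ℝ | |τ| ≤ 4 * 2 ^ j}, ‖𝓕⁻ (waveProfile (primitiveProfile H) τ) x‖ₑ ^ 2))) ^ 3 := by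
          refine lintegral_mono fun x => pow_le_pow_left' ?_ 3
          have := lintegral_sphAvg_pow_le hH hP h0 hΛ (Or.inl rfl : 2 = 2 ∨ 2 = 4) x
          rwa [hM, lintegral_add_left (hmx hH 2 x)] at this
      _ ≤ ∫⁻ x, (400 * (2 ^ j)⁻¹ * (2 * 4 ^ 2)) ^ 3 * (2 ^ 3 *
            ((∫⁻ τ in {τ : ℝ | |τ| ≤ 4 * 2 ^ j}, ‖𝓕⁻ (waveProfile H τ) x‖ₑ ^ 2) ^ 3 +
            (∫⁻ τ in {τ : ℝ | |τ| ≤ 4 * 2 ^ j}, ‖𝓕⁻ (waveProfile (primitiveProfile H) τ) x‖ₑ ^ 2) ^ 3)) := by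
          refine lintegral_mono fun x => ?_
          rw [← mul_assoc, mul_pow]; gcongr; exact add_pow_le_two_pow_mul _ _ _
      _ ≤ (400 * (2 ^ j)⁻¹ * (2 * 4 ^ 2)) ^ 3 * (2 ^ 3 *
            (C₁ * (ofReal ρ ^ j * (∫⁻ x, ‖f x‖ₑ ^ 2) ^ 3) +
            C₂ * (ofReal ρ ^ j * (∫⁻ x, ‖f x‖ₑ ^ 2) ^ 3))) := by
          rw [lintegral_const_mul' _ _ (by finiteness), lintegral_const_mul' _ _ (by finiteness),
            lintegral_add_left ((Measurable.lintegral_prod_right (hmeas hH 2)).pow_const 3)]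
          gcongr
      _ = A₆ * (ofReal ρ ^ j * (2 ^ j)⁻¹ ^ 3 * (∫⁻ x, ‖f x‖ₑ ^ 2) ^ 3) := by
          simp only [hA₆]; push_cast; ring
      _ ≤ _ := by gcongr; exact le_add_self.trans le_self_add
  · refine (hk 4 (Or.inr rfl)).trans ?_
    rw [show 4 = 2 * 2 from rfl, pow_mul, hM]
    calc _ ≤ (400 * (2 ^ j)⁻¹) ^ 2 * (2 * 4 ^ 4 * (
          C₁ * (ofReal ρ ^ j * 2 ^ j * (ofReal (B ^ 2) * ∫⁻ x, ‖f x‖ₑ ^ 2)) +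
          C₂ * (ofReal ρ ^ j * 2 ^ j * (ofReal (B ^ 2) * ∫⁻ x, ‖f x‖ₑ ^ 2)))) := by gcongr
      _ = A₄ * (ofReal ρ ^ j * ((2 ^ j)⁻¹ * ((2 ^ j)⁻¹ * 2 ^ j)) *
          (ofReal (B ^ 2) * ∫⁻ x, ‖f x‖ₑ ^ 2)) := by simp only [hA₄]; push_cast; ring
      _ ≤ _ := by rw [hLL, mul_one]; gcongr; exact (le_add_self.trans le_self_add).trans le_self_add
  · have hI : 0 ≤ ∫ y, ‖𝓕⁻ m y‖ := integral_nonneg fun _ => norm_nonneg _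
    calc ‖sphAvg (𝓕⁻ H) t x‖ₑ ≤ ofReal ((∫ y, ‖𝓕⁻ m y‖) * B) :=
          enorm_sphAvg_le_of_bound (continuous_fourierInv hH.integrable) fun y _ => by
            rw [← ofReal_norm]; exact ofReal_le_ofReal (hm.norm_le hf hB _)
      _ = A₀ * ofReal B := ofReal_mul hI
      _ ≤ _ := by bound

end UnitFrequency

section Rescaling

/-- Interpolation of mixed norms between the endpoint estimates. -/
theorem lintegral_mixed_le {F : Euc 2 → ℝ → ℝ≥0∞} (hF : Measurable (uncurry F)) (μ : Measure ℝ)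
    [SFinite μ] {D : ℝ≥0∞} (hD : D ≠ ∞) (hFD : ∀ x t, F x t ≤ D) {p s u v w z : ℝ} (hs : 0 < s)
    (hu : 0 ≤ u) (hv : 0 ≤ v) (hw : 0 ≤ w) (hz : 0 ≤ z) (h1 : u + v + w = 1) (h2 : u + 3 * v + w = s)
    (h3 : 2 * u + 6 * v + 4 * w + z = p * s) :
    ∫⁻ x, (∫⁻ t, F x t ^ p ∂μ) ^ s ≤ (∫⁻ x, ∫⁻ t, F x t ^ 2 ∂μ) ^ u *
      (∫⁻ x, (∫⁻ t, F x t ^ 2 ∂μ) ^ 3) ^ v * (∫⁻ x, ∫⁻ t, F x t ^ 4 ∂μ) ^ w * D ^ z := by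
  have hk : ∀ k : ℕ, Measurable fun x => ∫⁻ t, F x t ^ k ∂μ := fun k => (hF.pow_const k).lintegral_prod_right
  have e : ∀ (a : ℝ≥0∞) (k : ℕ) (c : ℝ), (a ^ k) ^ c = a ^ (k * c) := fun a k c => by
    rw [← rpow_natCast, ← rpow_mul]
  have hx : ∀ x, (∫⁻ t, F x t ^ p ∂μ) ^ s ≤
      D ^ z * ((∫⁻ t, F x t ^ 2 ∂μ) ^ (u + 3 * v) * (∫⁻ t, F x t ^ 4 ∂μ) ^ w) := by
    intro x
    have hFx : Measurable (F x) := hF.of_uncurry_left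
    have hp : p = z / s + (2 * ((u + 3 * v) / s) + 4 * (w / s)) := by grind
    calc _ ≤ (D ^ (z / s) * ((∫⁻ t, F x t ^ 2 ∂μ) ^ ((u + 3 * v) / s) *
          (∫⁻ t, F x t ^ 4 ∂μ) ^ (w / s))) ^ s := by
          refine rpow_le_rpow ?_ hs.le
          refine le_trans ?_ (mul_le_mul_right (ENNReal.lintegral_mul_norm_pow_le
            (hFx.pow_const 2).aemeasurable (hFx.pow_const 4).aemeasurable (by positivity)
            (by positivity) (by field_simp; linarith)) _)
          rw [← lintegral_const_mul' _ _ (rpow_ne_top_of_nonneg (by positivity) hD)]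
          refine lintegral_mono fun t => ?_
          rw [e, e, ← rpow_add_of_nonneg _ _ (by positivity) (by positivity)]
          nth_rw 1 [hp]
          rw [rpow_add_of_nonneg _ _ (by positivity) (by positivity)]; push_cast; gcongr
          exact hFD x t
      _ = _ := by
          rw [mul_rpow_of_nonneg _ _ hs.le, mul_rpow_of_nonneg _ _ hs.le]
          simp only [← rpow_mul, div_mul_cancel₀ _ hs.ne']
  refine (lintegral_mono hx).trans ?_
  rw [lintegral_const_mul' _ _ (rpow_ne_top_of_nonneg hz hD), mul_comm (D ^ z)]; gcongr ?_ * _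
  have := ENNReal.lintegral_prod_norm_pow_le (μ := volume) Finset.univ
    (f := ![fun x => ∫⁻ t, F x t ^ 2 ∂μ, fun x => (∫⁻ t, F x t ^ 2 ∂μ) ^ 3, fun x => ∫⁻ t, F x t ^ 4 ∂μ])
    (p := ![u, v, w]) (by
      intro i _
      fin_cases i
      exacts [(hk 2).aemeasurable, ((hk 2).pow_const 3).aemeasurable, (hk 4).aemeasurable])
    (by simpa [Fin.sum_univ_three] using h1) (by intro i _; fin_cases i <;> assumption)
  simp only [Fin.prod_univ_three, Matrix.cons_val_zero, Matrix.cons_val_one, Matrix.cons_val_two, Matrix.tail_cons,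
    Matrix.head_cons] at this
  refine le_trans (lintegral_mono fun x => ?_) this
  rw [rpow_add_of_nonneg _ _ hu (by positivity), e]; exact le_rfl

theorem lintegral_comp_smul_pos {E : Type*} [NormedAddCommGroup E] [NormedSpace ℝ E] [MeasureSpace E]
    [BorelSpace E] [FiniteDimensional ℝ E] [(volume : Measure E).IsAddHaarMeasure] {g : E → ℝ≥0∞}
    (hg : Measurable g) {r : ℝ} (hr : 0 < r) :
    ∫⁻ x, g (r • x) = ofReal (r ^ Module.finrank ℝ E)⁻¹ * ∫⁻ x, g x := by
  rw [← lintegral_map hg (measurable_const_smul r), Measure.map_addHaar_smul _ hr.ne', lintegral_smul_measure,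
    abs_of_pos (by positivity), smul_eq_mul]

/-- The dyadic symbols rescaled to unit frequency. -/
def unitSymbol (β₀ : ℝ → ℝ) : ℕ → Euc 2 → ℂ
  | 0 => fun ξ => β₀ (1 * ‖ξ‖)
  | _ + 1 => fun ξ => β₀ (1 * ‖ξ‖) - β₀ (2 * ‖ξ‖)

theorem betaJ_eq (β₀ : ℝ → ℝ) (j : ℕ) (ξ : Euc 2) :
    (betaJ β₀ j ‖ξ‖ : ℂ) = unitSymbol β₀ j (((2 : ℝ) ^ j)⁻¹ • ξ) := by
  cases j with
  | zero => simp [betaJ, unitSymbol]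
  | succ j =>
    have e : ‖((2 : ℝ) ^ (j + 1))⁻¹ • ξ‖ = ((2 : ℝ) ^ (j + 1))⁻¹ * ‖ξ‖ := by
      rw [norm_smul, norm_of_nonneg (by positivity)]
    simp only [betaJ, unitSymbol, e, one_mul, Complex.ofReal_sub]; congr 3
    rw [zpow_neg, zpow_natCast, pow_succ]; field_simp

variable {β₀ : ℝ → ℝ}

theorem IsBump.contDiff_norm (hβ : IsBump β₀) {c : ℝ} (hc : 0 < c) :
    ContDiff ℝ (⊤ : ℕ∞) fun ξ : Euc 2 => (β₀ (c * ‖ξ‖) : ℂ) := by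
  refine contDiff_iff_contDiffAt.2 fun ξ => ?_
  by_cases hξ : ξ = 0
  · refine (contDiffAt_const (c := (1 : ℂ))).congr_of_eventuallyEq ?_
    filter_upwards [ball_mem_nhds ξ (show 0 < 1 / (2 * c) by positivity)] with η hη
    rw [hξ, mem_ball, dist_zero_right, lt_div_iff₀ (by positivity)] at hη
    rw [hβ.2.1 _ (by rw [abs_of_nonneg (by positivity)]; linarith), Complex.ofReal_one]
  · exact ofRealCLM.contDiff.contDiffAt.comp ξ
      (hβ.1.contDiffAt.comp ξ (contDiffAt_const.mul (contDiffAt_norm ℝ hξ)))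

theorem IsBump.eq_zero (hβ : IsBump β₀) {c : ℝ} (hc : 1 ≤ c) {ξ : Euc 2} (hξ : 1 < ‖ξ‖) : β₀ (c * ‖ξ‖) = 0 :=
  hβ.2.2 _ (by rw [abs_of_nonneg (by positivity)]; nlinarith)

theorem IsBump.freqSymbol (hβ : IsBump β₀) (j : ℕ) : FreqSymbol (unitSymbol β₀ (j + 1)) := by
  refine ⟨(hβ.contDiff_norm one_pos).sub (hβ.contDiff_norm two_pos), fun ξ h => ?_, fun ξ h => ?_⟩ <;> by_contra! hc
  · refine h ?_
    have h1 : ∀ c : ℝ, 0 < c → c ≤ 2 → β₀ (c * ‖ξ‖) = 1 := fun c h0 hc2 =>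
      hβ.2.1 _ (by rw [abs_of_nonneg (by positivity)]; nlinarith [norm_nonneg ξ])
    simp only [unitSymbol]; rw [h1 1 one_pos one_le_two, h1 2 two_pos le_rfl, sub_self]
  · exact h (by simp only [unitSymbol]; rw [hβ.eq_zero le_rfl hc, hβ.eq_zero one_le_two hc, sub_self])

theorem exists_kernel_decay {b : Euc 2 → ℂ} (hb : ContDiff ℝ (⊤ : ℕ∞) b) (hc : HasCompactSupport b) :
    ∃ C : ℝ, 0 ≤ C ∧ ∀ w, ‖𝓕⁻ b w‖ ≤ C / (1 + ‖w‖) ^ 4 := by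
  set φ : SchwartzMap (Euc 2) ℂ := 𝓕⁻ (hc.toSchwartzMap hb) with hφ
  have e : 𝓕⁻ b = φ := by rw [hφ, SchwartzMap.fourierInv_coe]; rfl
  obtain ⟨C₀, h0, hC₀⟩ := φ.decay 0 0
  obtain ⟨C₄, h4, hC₄⟩ := φ.decay 4 0
  refine ⟨8 * (C₀ + C₄), by positivity, fun w => ?_⟩
  have a0 := hC₀ w
  have a4 := hC₄ w
  rw [norm_iteratedFDeriv_zero] at a0 a4; rw [e, le_div_iff₀ (by positivity)]
  have := mul_le_mul_of_nonneg_left (add_pow_le zero_le_one (norm_nonneg w) 4) (norm_nonneg (φ w))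
  norm_num at this a0; nlinarith

theorem IsBump.unitSymbol_zero (hβ : IsBump β₀) :
    ContDiff ℝ (⊤ : ℕ∞) (unitSymbol β₀ 0) ∧ HasCompactSupport (unitSymbol β₀ 0) :=
  ⟨hβ.contDiff_norm one_pos, HasCompactSupport.intro (isCompact_closedBall 0 1) fun ξ h => by
    simp only [unitSymbol]
    rw [hβ.eq_zero le_rfl (by simpa using h), Complex.ofReal_zero]⟩

theorem IsBump.exists_kernel_decay (hβ : IsBump β₀) :
    ∃ C : ℝ, 0 ≤ C ∧ ∀ j w, ‖𝓕⁻ (unitSymbol β₀ j) w‖ ≤ C / (1 + ‖w‖) ^ 4 := by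
  obtain ⟨C, h0, hC⟩ := _root_.exists_kernel_decay hβ.unitSymbol_zero.1 hβ.unitSymbol_zero.2
  obtain ⟨C', h0', hC'⟩ := _root_.exists_kernel_decay (hβ.freqSymbol 0).smooth (hβ.freqSymbol 0).hasCompactSupport
  refine ⟨C + C', by positivity, fun j w => ?_⟩
  cases j with
  | zero => exact (hC w).trans (by gcongr; linarith)
  | succ j => exact (hC' w).trans (by gcongr; linarith)

theorem IsBump.integrable_symbol (hβ : IsBump β₀) (j : ℕ) :
    Integrable fun ξ : Euc 2 => (betaJ β₀ j ‖ξ‖ : ℂ) := by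
  simp_rw [betaJ_eq]
  refine Integrable.comp_smul (f := unitSymbol β₀ j) ?_ (inv_ne_zero (by positivity))
  cases j with
  | zero => exact hβ.unitSymbol_zero.1.continuous.integrable_of_hasCompactSupport hβ.unitSymbol_zero.2
  | succ j => exact (hβ.freqSymbol j).nice.integrable

theorem freqLoc_eq (hβ : IsBump β₀) (j : ℕ) {f : Euc 2 → ℂ} (hf : Integrable f) (x : Euc 2) :
    freqLoc 2 β₀ j f x =
      ∫ y, f y * (((2 ^ j) ^ 2 : ℝ) * 𝓕⁻ (unitSymbol β₀ j) ((2 ^ j : ℝ) • (x - y))) := by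
  rw [freqLoc, fourierInv_mul_fourier (hβ.integrable_symbol j) hf]
  refine integral_congr_ae (.of_forall fun y => ?_)
  simp only [fourierInv_eq, betaJ_eq]
  have := Measure.integral_comp_inv_smul volume (fun ξ : Euc 2 => 𝐞 (inner ℝ ξ ((2 ^ j : ℝ) • (x - y))) •
    unitSymbol β₀ j ξ) (2 ^ j)
  rw [finrank_euclideanSpace_fin, abs_of_pos (by positivity), real_smul] at this; rw [← this]
  congr 2
  funext ξ
  rw [inner_smul_left, inner_smul_right, conj_trivial, inv_mul_cancel_left₀ (by positivity)]

/-- The restricted strong type estimate at frequency `2 ^ (j + 1)`. -/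
theorem IsBump.exists_restricted_bound (hβ : IsBump β₀) {ρ : ℝ} (hρ : 1 < ρ) {p s u v w z : ℝ} (hs : 0 < s)
    (hu : 0 ≤ u) (hv : 0 ≤ v) (hw : 0 ≤ w) (hz : 0 ≤ z) (h1 : u + v + w = 1) (h2 : u + 3 * v + w = s)
    (h3 : 2 * u + 6 * v + 4 * w + z = p * s) : ∃ C : ℝ≥0, ∀ (j : ℕ) (f : Euc 2 → ℂ) (B : ℝ), j ≠ 0 →
    Measurable f → Integrable f → (∀ x, ‖f x‖ ≤ B) →
    ∫⁻ x, (∫⁻ t in Icc (1 / 2 : ℝ) 4, ‖sphAvg (freqLoc 2 β₀ j f) t x‖ₑ ^ p) ^ s ≤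
      C * (ofReal ρ ^ j * (2 ^ j) ^ (s - 2 - (3 * v + w)) * ((∫⁻ x, ‖f x‖ₑ ^ 2) ^ s * ofReal B ^ (2 * w + z))) := by
  obtain ⟨C, hC⟩ := (hβ.freqSymbol 0).exists_endpoint_bounds hρ
  refine ⟨C ^ (1 + z), fun j f B hj hfm hf hB => ?_⟩
  have hB0 : 0 ≤ B := (norm_nonneg _).trans (hB 0)
  set Λ : ℝ := 2 ^ j with hΛ
  have hΛ0 : 0 < Λ := by positivity
  set g : Euc 2 → ℂ := fun y => f (Λ⁻¹ • y)
  have hgi : Integrable g := hf.comp_smul (inv_ne_zero hΛ0.ne')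
  set G := sphAvg (𝓕⁻ fun ξ => unitSymbol β₀ 1 ξ * 𝓕 g ξ) with hG
  obtain ⟨b1, b2, b3, b4⟩ := hC j g B hgi fun x => hB _
  have hGm : Measurable (uncurry fun (x : Euc 2) t => ‖G t x‖ₑ) :=
    ((continuous_sphAvg (continuous_fourierInv ((hβ.freqSymbol 0).nice_mul hgi).integrable)).comp
      continuous_swap).measurable.enorm
  have hfg : ∀ x, freqLoc 2 β₀ j f x = 𝓕⁻ (fun ξ => unitSymbol β₀ 1 ξ * 𝓕 g ξ) (Λ • x) := by
    intro x
    obtain ⟨i, rfl⟩ := Nat.exists_eq_succ_of_ne_zero hj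
    rw [freqLoc_eq hβ _ hf, fourierInv_mul_fourier (hβ.freqSymbol 0).nice.integrable hgi]
    have := Measure.integral_comp_inv_smul volume
      (fun y => f y * 𝓕⁻ (unitSymbol β₀ 1) (Λ • x - Λ • y)) Λ
    simp only [smul_inv_smul₀ hΛ0.ne', finrank_euclideanSpace_fin, abs_of_pos (pow_pos hΛ0 2),
      real_smul] at this
    rw [this, ← integral_const_mul]
    refine integral_congr_ae (.of_forall fun y => ?_)
    simp only [smul_sub]; exact mul_left_comm _ _ _
  have hA : ∀ t x, sphAvg (freqLoc 2 β₀ j f) t x = G (Λ * t) (Λ • x) := fun t x => by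
    simp only [hG, sphAvg, hfg, smul_sub, smul_smul]
  have hS : ∫⁻ x, ‖g x‖ₑ ^ 2 = (2 ^ j) ^ 2 * ∫⁻ x, ‖f x‖ₑ ^ 2 := by
    rw [show (fun x => ‖g x‖ₑ ^ 2) = fun x => (fun y => ‖f y‖ₑ ^ 2) (Λ⁻¹ • x) from rfl, lintegral_comp_smul_pos
      (hfm.enorm.pow_const 2) (inv_pos.2 hΛ0), finrank_euclideanSpace_fin, inv_pow, inv_inv, hΛ,
      ofReal_pow (by positivity), ofReal_pow zero_le_two, ofReal_ofNat]
  have hin : ∀ x, ∫⁻ t in Icc (1 / 2 : ℝ) 4, ‖G (Λ * t) x‖ₑ ^ p =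
      (2 ^ j)⁻¹ * ∫⁻ t in Icc (2 ^ j / 2 : ℝ) (4 * 2 ^ j), ‖G t x‖ₑ ^ p := by
    intro x
    have h := lintegral_comp_smul_pos (((hGm.of_uncurry_left (x := x)).pow_const p).indicator
      (measurableSet_Icc (a := Λ / 2) (b := 4 * Λ))) hΛ0
    rw [Module.finrank_self, pow_one, lintegral_indicator measurableSet_Icc, hΛ, ofReal_inv_of_pos hΛ0,
      ofReal_pow zero_le_two, ofReal_ofNat] at h
    rw [← h, ← lintegral_indicator measurableSet_Icc]
    refine lintegral_congr fun t => ?_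
    simp only [indicator, mem_Icc, smul_eq_mul]; congr 1; field_simp
  set L : ℝ≥0∞ := 2 ^ j with hL
  have hL0 : L ≠ 0 := by simp [hL]
  have hLt : L ≠ ∞ := by finiteness
  set Q : Euc 2 → ℝ≥0∞ := fun x => (∫⁻ t in Icc (2 ^ j / 2 : ℝ) (4 * 2 ^ j), ‖G t x‖ₑ ^ p) ^ s with hQ
  have hQm : Measurable Q := (hGm.pow_const p).lintegral_prod_right.pow_const s
  have hmix := lintegral_mixed_le hGm (volume.restrict (Icc (2 ^ j / 2 : ℝ) (4 * 2 ^ j)))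
    (D := C * ofReal B) (by finiteness) (fun x t => b4 t x) hs hu hv hw hz h1 h2 h3
  calc _ = ∫⁻ x, (L⁻¹) ^ s * Q (Λ • x) := by simp_rw [hA, hin, hQ, mul_rpow_of_nonneg _ _ hs.le]
    _ = (L⁻¹) ^ s * ((L ^ 2)⁻¹ * ∫⁻ x, Q x) := by
        rw [lintegral_const_mul' _ _ (by finiteness), lintegral_comp_smul_pos hQm hΛ0, finrank_euclideanSpace_fin,
          ofReal_inv_of_pos (by positivity), hΛ, ofReal_pow (by positivity),
          ofReal_pow zero_le_two, ofReal_ofNat]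
    _ ≤ (L⁻¹) ^ s * ((L ^ 2)⁻¹ * ((C * ∫⁻ x, ‖g x‖ₑ ^ 2) ^ u *
          (C * (ofReal ρ ^ j * L⁻¹ ^ 3 * (∫⁻ x, ‖g x‖ₑ ^ 2) ^ 3)) ^ v *
          (C * (ofReal ρ ^ j * L⁻¹ * (ofReal (B ^ 2) * ∫⁻ x, ‖g x‖ₑ ^ 2))) ^ w * (C * ofReal B) ^ z)) := by
        gcongr; exact hmix.trans (by gcongr)
    _ ≤ _ := by
        have e : ∀ (a : ℝ≥0∞) (k : ℕ) (c : ℝ), (a ^ k) ^ c = a ^ (k * c) := fun a k c => by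
          rw [← rpow_natCast, ← rpow_mul]
        have hP : (ofReal ρ ^ j) ^ (v + w) ≤ ofReal ρ ^ j := by
          refine (rpow_le_rpow_of_exponent_le (one_le_pow₀ ?_) (by linarith : v + w ≤ 1)).trans_eq
            (rpow_one _)
          rw [one_le_ofReal]; exact hρ.le
        have hLe : L⁻¹ ^ s * (L ^ 2)⁻¹ * L⁻¹ ^ (3 * v) * L⁻¹ ^ w * L ^ (2 * s) = L ^ (s - 2 - (3 * v + w)) := by
          rw [← rpow_natCast L 2]; simp only [inv_rpow, ← rpow_neg, ← rpow_add _ _ hL0 hLt]; grind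
        rw [hS, ofReal_pow hB0, coe_rpow_of_nonneg _ (by positivity)]
        have hv3 : 0 ≤ ((3 : ℕ) : ℝ) * v := by positivity
        generalize ofReal ρ ^ j = P at hP ⊢
        simp only [mul_rpow_of_nonneg, hv3, hu, hv, hw, hz, e]
        generalize (∫⁻ x, ‖f x‖ₑ ^ 2) = S
        push_cast
        calc _ = C ^ (u + v + w + z) * (P ^ (v + w) * (L⁻¹ ^ s * (L ^ 2)⁻¹ * L⁻¹ ^ (3 * v) * L⁻¹ ^ w *
              (L ^ (2 * u) * L ^ (2 * (3 * v)) * L ^ (2 * w))) * (S ^ (u + 3 * v + w) * ofReal B ^ (2 * w + z))) := by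
              rw [rpow_add_of_nonneg _ z (by positivity) hz, rpow_add_of_nonneg _ w (by positivity) hw,
                rpow_add_of_nonneg _ v hu hv, rpow_add_of_nonneg _ w hv hw,
                rpow_add_of_nonneg _ w (by positivity) hw, rpow_add_of_nonneg _ _ hu (by positivity),
                rpow_add_of_nonneg _ z (by positivity) hz]
              ring
          _ ≤ _ := by
              rw [← rpow_add _ _ hL0 hLt, ← rpow_add _ _ hL0 hLt,
                show 2 * u + 2 * (3 * v) + 2 * w = 2 * s by linarith, hLe, h1, h2]
              gcongr

theorem IsBump.integrable_mul_fourier (hβ : IsBump β₀) (j : ℕ) {f : Euc 2 → ℂ} (hf : Integrable f) :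
    Integrable fun ξ => (betaJ β₀ j ‖ξ‖ : ℂ) * 𝓕 f ξ :=
  (hβ.integrable_symbol j).mul_bdd (continuous_fourier hf).aestronglyMeasurable
    (.of_forall fun ξ => norm_fourier_le f ξ)

theorem continuous_freqLoc (hβ : IsBump β₀) (j : ℕ) {f : Euc 2 → ℂ} (hf : Integrable f) :
    Continuous (freqLoc 2 β₀ j f) := continuous_fourierInv (hβ.integrable_mul_fourier j hf)

theorem freqLoc_sum (hβ : IsBump β₀) (j : ℕ) {ι : Type*} (s : Finset ι) {g : ι → Euc 2 → ℂ}
    (hg : ∀ i ∈ s, Integrable (g i)) (x : Euc 2) :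
    freqLoc 2 β₀ j (fun y => ∑ i ∈ s, g i y) x = ∑ i ∈ s, freqLoc 2 β₀ j (g i) x := by
  simp only [freqLoc]
  rw [← fourierInv_finset_sum s fun i hi => hβ.integrable_mul_fourier j (hg i hi)]
  refine congrArg (fun h : Euc 2 → ℂ => 𝓕⁻ h x) (funext fun ξ => ?_)
  rw [← mul_sum]; simp only [fourier_eq, smul_sum]
  rw [integral_finsetSum s fun i hi => by simpa using (Real.fourierIntegral_convergent_iff (f := g i) ξ).2 (hg i hi)]

theorem IsBump.exists_avg_bound (hβ : IsBump β₀) : ∃ C : ℝ≥0, ∀ (j : ℕ) (f : Euc 2 → ℂ) (x : Euc 2) (t : ℝ)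
    (κ : Euc 2 → ℝ), Integrable f →
    (∀ y ω, f y ≠ 0 → ‖ω‖ = 1 → (2 ^ j) ^ 2 / (1 + 2 ^ j * ‖x - t • ω - y‖) ^ 4 ≤ κ y) →
    ‖sphAvg (freqLoc 2 β₀ j f) t x‖ₑ ≤ C * ∫⁻ y, ‖f y‖ₑ * ofReal (κ y) := by
  obtain ⟨C, hC0, hC⟩ := hβ.exists_kernel_decay
  refine ⟨C.toNNReal, fun j f x t κ hf hκ => enorm_sphAvg_le_of_bound (continuous_freqLoc hβ j hf) fun ω hω => ?_⟩
  rw [freqLoc_eq hβ j hf, ENNReal.ofNNReal_toNNReal, ← lintegral_const_mul' _ _ ofReal_ne_top]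
  refine (enorm_integral_le_lintegral_enorm _).trans (lintegral_mono fun y => ?_)
  by_cases hy : f y = 0
  · simp [hy]
  rw [enorm_mul, mul_left_comm, ← ofReal_mul hC0, ← ofReal_norm (_ * _), norm_mul, norm_real,
    norm_of_nonneg (by positivity)]
  gcongr _ * ofReal ?_
  have h := hC j ((2 ^ j : ℝ) • (x - t • ω - y))
  rw [norm_smul, norm_of_nonneg (by positivity)] at h
  have := mul_le_mul_of_nonneg_left (hκ y ω hy hω) hC0
  refine (mul_le_mul_of_nonneg_left h (by positivity)).trans (le_trans (le_of_eq ?_) this)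
  ring

theorem lintegral_conv {h w : Euc 2 → ℝ≥0∞} (hh : Measurable h) (hw : Measurable w) :
    ∫⁻ x, ∫⁻ y, h y * w (x - y) = (∫⁻ x, w x) * ∫⁻ y, h y := by
  rw [lintegral_lintegral_swap (by fun_prop), mul_comm, ← lintegral_mul_const _ hh]
  refine lintegral_congr fun y => ?_
  rw [lintegral_const_mul _ (by fun_prop), lintegral_sub_right_eq_self]

/-- Young's inequality for a kernel bounded by one. -/
theorem lintegral_rpow_conv_le {h w : Euc 2 → ℝ≥0∞} (hh : Measurable h) (hw : Measurable w) (hw1 : ∀ x, w x ≤ 1)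
    {s : ℝ} (hs : 1 ≤ s) : ∫⁻ x, (∫⁻ y, h y * w (x - y)) ^ s ≤ (∫⁻ x, w x) * (∫⁻ y, h y) ^ s := by
  have e : ∀ a : ℝ≥0∞, a ^ s = a * a ^ (s - 1) := fun a => by
    nth_rw 2 [← rpow_one a]
    rw [← rpow_add_of_nonneg _ _ zero_le_one (by linarith), add_sub_cancel]
  have hm : Measurable (uncurry fun x y => h y * w (x - y)) :=
    (hh.comp measurable_snd).mul (hw.comp (measurable_fst.sub measurable_snd))
  calc _ ≤ ∫⁻ x, (∫⁻ y, h y * w (x - y)) * (∫⁻ y, h y) ^ (s - 1) := by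
        refine lintegral_mono fun x => ?_
        simp only [e]; gcongr with y
        bound
    _ = _ := by
        rw [lintegral_mul_const _ hm.lintegral_prod_right, lintegral_conv hh hw, e, mul_assoc]

/-- The tail weight. -/
def tail (w : Euc 2) : ℝ≥0∞ := ofReal ((1 + ‖w‖) ^ 4)⁻¹

theorem measurable_tail : Measurable tail := by unfold tail; fun_prop

theorem tail_le_one (w : Euc 2) : tail w ≤ 1 :=
  ofReal_le_one.2 (inv_le_one_of_one_le₀ (one_le_pow₀ (by linarith [norm_nonneg w])))

theorem lintegral_tail_ne_top : ∫⁻ w, tail w ≠ ∞ := by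
  have h := (integrable_one_add_norm (E := Euc 2) (μ := volume) (r := 4) (by norm_num)).lintegral_lt_top
  refine ne_top_of_le_ne_top h.ne (lintegral_mono fun w => ofReal_le_ofReal (le_of_eq ?_))
  simp

theorem lintegral_tail_conv_le {h : Euc 2 → ℝ≥0∞} (hh : Measurable h) {p s : ℝ} (hp : 1 ≤ p) (hs : 1 ≤ s) :
    ∫⁻ x, (∫⁻ y, h y * tail (x - y)) ^ (p * s) ≤
      (∫⁻ w, tail w) ^ ((p - 1) * s + 1) * (∫⁻ y, h y ^ p) ^ s := by
  have hp0 : 0 < p := by linarith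
  have hx : ∀ x, (∫⁻ y, h y * tail (x - y)) ^ p ≤ (∫⁻ w, tail w) ^ (p - 1) * ∫⁻ y, h y ^ p * tail (x - y) := by
    intro x
    have hwx : Measurable fun y => tail (x - y) := measurable_tail.comp (measurable_const.sub measurable_id)
    have := ENNReal.lintegral_mul_norm_pow_le (μ := volume) (f := fun y => h y ^ p * tail (x - y))
      (g := fun y => tail (x - y)) ((hh.pow_const p).mul hwx).aemeasurable hwx.aemeasurable
      (p := 1 / p) (q := (p - 1) / p) (by positivity) (div_nonneg (by linarith) hp0.le) (by field_simp; ring)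
    have h2 := rpow_le_rpow this hp0.le
    rw [mul_rpow_of_nonneg _ _ hp0.le, ← rpow_mul, ← rpow_mul, div_mul_cancel₀ _ hp0.ne',
      div_mul_cancel₀ _ hp0.ne', rpow_one, lintegral_sub_left_eq_self, mul_comm] at h2
    refine le_trans (rpow_le_rpow (lintegral_mono fun y => le_of_eq ?_) hp0.le) h2
    rw [mul_rpow_of_nonneg _ _ (by positivity), ← rpow_mul, mul_one_div_cancel hp0.ne',
      rpow_one, mul_assoc, ← rpow_add_of_nonneg _ _ (by positivity) (div_nonneg (by linarith) hp0.le),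
      show 1 / p + (p - 1) / p = 1 by field_simp; ring, rpow_one]
  have hs0 : 0 ≤ s := by linarith
  have hq : 0 ≤ (p - 1) * s := mul_nonneg (by linarith) hs0
  calc _ ≤ ∫⁻ x, (∫⁻ w, tail w) ^ ((p - 1) * s) * (∫⁻ y, h y ^ p * tail (x - y)) ^ s := by
        refine lintegral_mono fun x => ?_
        rw [rpow_mul, rpow_mul, ← mul_rpow_of_nonneg _ _ hs0]; exact rpow_le_rpow (hx x) hs0
    _ ≤ _ := by
        rw [lintegral_const_mul' _ _ (rpow_ne_top_of_nonneg hq lintegral_tail_ne_top),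
          rpow_add_of_nonneg _ _ hq zero_le_one, rpow_one, mul_assoc]
        gcongr; exact lintegral_rpow_conv_le (hh.pow_const p) measurable_tail tail_le_one hs

/-- The `L ^ p` norm in time of the averages of a frequency localized function. -/
def avgNorm (β₀ : ℝ → ℝ) (p : ℝ) (j : ℕ) (f : Euc 2 → ℂ) (x : Euc 2) : ℝ≥0∞ :=
  eLpNorm' (fun t => sphAvg (freqLoc 2 β₀ j f) t x) p (volume.restrict (Icc (1 / 2 : ℝ) 4))

theorem continuous_avg (hβ : IsBump β₀) (j : ℕ) {f : Euc 2 → ℂ} (hf : Integrable f) (x : Euc 2) :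
    Continuous fun t => sphAvg (freqLoc 2 β₀ j f) t x :=
  (continuous_sphAvg (continuous_freqLoc hβ j hf)).uncurry_right x

theorem measurable_avgNorm (hβ : IsBump β₀) (p : ℝ) (j : ℕ) {f : Euc 2 → ℂ} (hf : Integrable f) :
    Measurable (avgNorm β₀ p j f) :=
  ((((continuous_sphAvg (continuous_freqLoc hβ j hf)).comp continuous_swap).measurable.enorm.pow_const
    p).lintegral_prod_right).pow_const _

theorem avgNorm_sum_le (hβ : IsBump β₀) {p : ℝ} (hp : 1 ≤ p) (j : ℕ) {ι : Type*} (s : Finset ι)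
    {g : ι → Euc 2 → ℂ} (hg : ∀ i ∈ s, Integrable (g i)) (x : Euc 2) :
    avgNorm β₀ p j (fun y => ∑ i ∈ s, g i y) x ≤ ∑ i ∈ s, avgNorm β₀ p j (g i) x := by
  refine le_trans (le_of_eq ?_)
    (eLpNorm'_sum_le (fun i hi => (continuous_avg hβ j (hg i hi) x).aestronglyMeasurable) hp)
  refine congrArg (eLpNorm' · p _) (funext fun t => ?_)
  rw [Finset.sum_apply, ← sphAvg_sum s fun i hi => continuous_freqLoc hβ j (hg i hi)]
  exact congrArg (sphAvg · t x) (funext fun y => freqLoc_sum hβ j s hg y)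

theorem avgNorm_le {p : ℝ} (hp : 1 ≤ p) {j : ℕ} {f : Euc 2 → ℂ} {x : Euc 2} {M : ℝ≥0∞}
    (hM : ∀ t ∈ Icc (1 / 2 : ℝ) 4, ‖sphAvg (freqLoc 2 β₀ j f) t x‖ₑ ≤ M) : avgNorm β₀ p j f x ≤ 4 * M := by
  have hp0 : 0 < p := by linarith
  calc _ ≤ (∫⁻ t in Icc (1 / 2 : ℝ) 4, M ^ p) ^ (1 / p) :=
        rpow_le_rpow (setLIntegral_mono' measurableSet_Icc fun t ht =>
          rpow_le_rpow (hM t ht) hp0.le) (by positivity)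
    _ ≤ (4 ^ p * M ^ p) ^ (1 / p) := by
        rw [setLIntegral_const, mul_comm, volume_Icc]; gcongr
        calc ofReal (4 - 1 / 2) ≤ ofReal 4 := ofReal_le_ofReal (by norm_num)
          _ = 4 ^ (1 : ℝ) := by simp
          _ ≤ _ := rpow_le_rpow_of_exponent_le (by norm_num) hp
    _ = _ := by
        rw [← mul_rpow_of_nonneg _ _ hp0.le, ← rpow_mul, mul_one_div_cancel hp0.ne', rpow_one]

/-- Rapid decay of the averages away from the support. -/
theorem IsBump.exists_far_bound (hβ : IsBump β₀) : ∃ C : ℝ≥0, ∀ {p : ℝ}, 1 ≤ p → ∀ (j : ℕ) (f : Euc 2 → ℂ)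
    (x : Euc 2), Integrable f → (∀ y, f y ≠ 0 → j = 0 ∨ 9 ≤ ‖x - y‖) →
    avgNorm β₀ p j f x ≤ C * ((2 ^ j)⁻¹ ^ 2 * ∫⁻ y, ‖f y‖ₑ * tail (x - y)) := by
  obtain ⟨C, hC⟩ := hβ.exists_avg_bound
  refine ⟨4 * (625 * C), fun {p} hp j f x hf hfar => ?_⟩
  have e : ∀ y, ofReal (625 * ((2 ^ j)⁻¹ ^ 2 * ((1 + ‖x - y‖) ^ 4)⁻¹)) =
      625 * ((2 ^ j)⁻¹ ^ 2 * tail (x - y)) := fun y => by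
    rw [ofReal_mul (by norm_num), ofReal_mul (by positivity), ofReal_pow (by positivity),
      ofReal_inv_of_pos (by positivity), ofReal_pow zero_le_two, ofReal_ofNat,
      ofReal_ofNat, tail]
  refine (avgNorm_le hp (M := C * (625 * ((2 ^ j)⁻¹ ^ 2 * ∫⁻ y, ‖f y‖ₑ * tail (x - y)))) fun t ht => ?_).trans
    (le_of_eq (by push_cast; ring))
  refine (hC j f x t (fun y => 625 * ((2 ^ j)⁻¹ ^ 2 * ((1 + ‖x - y‖) ^ 4)⁻¹)) hf fun y ω hy hω => ?_).trans ?_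
  · have h1 : ‖x - y‖ ≤ ‖x - t • ω - y‖ + 4 := by
      have := norm_add_le (x - t • ω - y) (t • ω)
      rw [norm_smul, hω, mul_one, norm_of_nonneg (by linarith [ht.1]),
        show x - t • ω - y + t • ω = x - y by abel] at this
      linarith [ht.2]
    have h2 : 2 ^ j * (1 + ‖x - y‖) ≤ 5 * (1 + 2 ^ j * ‖x - t • ω - y‖) := by
      have h0 := norm_nonneg (x - t • ω - y)
      rcases hfar y hy with rfl | h9
      · linarith
      · have := mul_le_mul_of_nonneg_left (by linarith : 1 + ‖x - y‖ ≤ 5 * ‖x - t • ω - y‖)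
          (by positivity : (0 : ℝ) ≤ 2 ^ j)
        linarith
    have h3 := pow_le_pow_left₀ (by positivity) h2 4
    rw [div_le_iff₀ (by positivity), ← mul_le_mul_iff_right₀ (by positivity : (0 : ℝ) < (2 ^ j) ^ 2 * (1 + ‖x - y‖) ^ 4)]
    field_simp; linarith
  · simp_rw [e, ← mul_assoc (625 : ℝ≥0∞), mul_left_comm (‖f _‖ₑ)]
    rw [lintegral_const_mul' _ _ (by finiteness)]

/-- The part of `h` of size at most `2 ^ i N`. -/
def lowPart (h : Euc 2 → ℂ) (N : ℝ) (i : ℕ) : Euc 2 → ℂ := {y | ‖h y‖ ≤ 2 ^ i * N}.indicator h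

/-- The dyadic level parts of `h` above the height `N`. -/
def levelPart (h : Euc 2 → ℂ) (N : ℝ) : ℕ → Euc 2 → ℂ
  | 0 => lowPart h N 0
  | i + 1 => lowPart h N (i + 1) - lowPart h N i

theorem sum_levelPart (h : Euc 2 → ℂ) (N : ℝ) (n : ℕ) (y : Euc 2) :
    ∑ i ∈ Finset.range (n + 1), levelPart h N i y = lowPart h N n y := by
  rw [sum_range_succ']; simp only [levelPart, Pi.sub_apply]
  rw [Finset.sum_range_sub (lowPart h N · y), sub_add_cancel]

theorem levelPart_cases (h : Euc 2 → ℂ) {N : ℝ} (hN : 0 ≤ N) (i : ℕ) (y : Euc 2) : levelPart h N i y = 0 ∨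
    levelPart h N i y = h y ∧ ‖h y‖ ≤ 2 ^ i * N ∧ (i = 0 ∨ 2 ^ i * N ≤ 2 * ‖h y‖) := by
  cases i with
  | zero => by_cases hy : ‖h y‖ ≤ N <;> simp [levelPart, lowPart, indicator, hy]
  | succ i =>
    have h2 : 2 ^ i * N ≤ 2 ^ (i + 1) * N := by bound
    by_cases hy : ‖h y‖ ≤ 2 ^ i * N
    · simp [levelPart, lowPart, indicator, hy, hy.trans h2]
    · by_cases hy' : ‖h y‖ ≤ 2 ^ (i + 1) * N
      · refine Or.inr ⟨by simp [levelPart, lowPart, indicator, hy, hy'], hy', Or.inr ?_⟩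
        rw [pow_succ]; linarith
      · simp [levelPart, lowPart, indicator, hy, hy']

theorem integrable_lowPart {h : Euc 2 → ℂ} (hm : Measurable h) (hi : Integrable h) (N : ℝ) (i : ℕ) :
    Measurable (lowPart h N i) ∧ Integrable (lowPart h N i) :=
  have hs : MeasurableSet {y | ‖h y‖ ≤ 2 ^ i * N} := measurableSet_le hm.norm measurable_const
  ⟨hm.indicator hs, hi.indicator hs⟩

theorem integrable_levelPart {h : Euc 2 → ℂ} (hm : Measurable h) (hi : Integrable h) (N : ℝ) (i : ℕ) :
    Measurable (levelPart h N i) ∧ Integrable (levelPart h N i) := by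
  cases i with
  | zero => exact integrable_lowPart hm hi N 0
  | succ i =>
    have h1 := integrable_lowPart hm hi N (i + 1)
    have h2 := integrable_lowPart hm hi N i
    exact ⟨h1.1.sub h2.1, h1.2.sub h2.2⟩

theorem levelPart_energy_le {h : Euc 2 → ℂ} (hm : Measurable h) {N p : ℝ} (hN : 0 ≤ N) (hp : 2 ≤ p)
    {E : Set (Euc 2)} (hE : MeasurableSet E) (hs : ∀ y, h y ≠ 0 → y ∈ E) (i : ℕ) :
    (∫⁻ y, ‖levelPart h N i y‖ₑ ^ 2) * ofReal (2 ^ i * N) ^ (p - 2) ≤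
      2 ^ p * (∫⁻ y, ‖h y‖ₑ ^ p) + volume E * ofReal N ^ p := by
  have hp2 : 0 ≤ p - 2 := by linarith
  have e : ∀ a : ℝ≥0∞, a ^ 2 * a ^ (p - 2) = a ^ p := fun a => by
    rw [← rpow_natCast, ← rpow_add_of_nonneg _ _ (by norm_num) hp2]; norm_num
  calc _ ≤ ∫⁻ y, (2 ^ p * ‖h y‖ₑ ^ p + E.indicator (fun _ => ofReal N ^ p) y) := by
        rw [← lintegral_mul_const' _ _ (by finiteness)]
        refine lintegral_mono fun y => ?_
        rcases levelPart_cases h hN i y with h0 | ⟨h1, h2, h3⟩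
        · simp [h0]
        rw [h1]
        have hle : ‖h y‖ₑ ≤ ofReal (2 ^ i * N) := by rw [← ofReal_norm]; exact ofReal_le_ofReal h2
        rcases h3 with rfl | h3
        · by_cases hy : h y = 0
          · simp [hy]
          refine le_add_left ?_
          rw [indicator_of_mem (hs y hy), ← e]; norm_num at hle ⊢; gcongr
        · refine le_add_right ?_
          have : ofReal (2 ^ i * N) ≤ 2 * ‖h y‖ₑ := by
            rw [← ofReal_norm, ← ofReal_ofNat, ← ofReal_mul zero_le_two]; gcongr
          calc _ ≤ ‖h y‖ₑ ^ 2 * (2 * ‖h y‖ₑ) ^ (p - 2) := by gcongr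
            _ = 2 ^ (p - 2) * ‖h y‖ₑ ^ p := by rw [mul_rpow_of_nonneg _ _ hp2, ← e]; ring
            _ ≤ _ := by
                gcongr
                · norm_num
                · linarith
    _ = _ := by
        rw [lintegral_add_left (by fun_prop), lintegral_const_mul _ (by fun_prop), lintegral_indicator_const hE, mul_comm
          (volume E)]

theorem lintegral_sub_lowPart_le {h : Euc 2 → ℂ} (hm : Measurable h) {N p : ℝ} (hN : 0 ≤ N) (hp : 2 ≤ p)
    (hNp : ∫⁻ y, ‖h y‖ₑ ^ p = ofReal N ^ p) (n : ℕ) : ∫⁻ y, ‖h y - lowPart h N n y‖ₑ ≤ (2 ^ n)⁻¹ * ofReal N := by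
  have hp0 : 0 < p := by linarith
  have hp1 : 0 ≤ p - 1 := by linarith
  have hle : (∫⁻ y, ‖h y - lowPart h N n y‖ₑ) * (2 ^ n * ofReal N ^ (p - 1)) ≤ ofReal N ^ p := by
    rw [← hNp, ← lintegral_mul_const' _ _ (by finiteness)]
    refine lintegral_mono fun y => ?_
    by_cases hy : ‖h y‖ ≤ 2 ^ n * N
    · simp [lowPart, hy]
    simp only [lowPart, indicator, mem_ofPred_eq, hy, if_false, sub_zero]
    have h1 : 2 ^ n * ofReal N ≤ ‖h y‖ₑ := by
      rw [← ofReal_norm, ← ofReal_ofNat, ← ofReal_pow zero_le_two, ← ofReal_mul (by positivity)]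
      bound
    calc _ ≤ ‖h y‖ₑ ^ (1 : ℝ) * ‖h y‖ₑ ^ (p - 1) := by
          rw [rpow_one]; gcongr
          refine le_trans ?_ (rpow_le_rpow h1 hp1)
          rw [mul_rpow_of_nonneg _ _ hp1]; gcongr
          nth_rw 1 [← rpow_one (2 ^ n)]
          exact rpow_le_rpow_of_exponent_le (one_le_pow₀ one_le_two) (by linarith)
      _ = _ := by rw [← rpow_add_of_nonneg _ _ zero_le_one hp1, add_sub_cancel]
  rcases hN.eq_or_lt with rfl | hN
  · rw [ENNReal.ofReal_zero, ENNReal.zero_rpow_of_pos hp0, lintegral_eq_zero_iff (by fun_prop)] at hNp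
    rw [lintegral_congr_ae (g := 0)]
    · simp
    filter_upwards [hNp] with y hy
    have : h y = 0 := by simp_all
    by_cases h0 : ‖h y‖ ≤ 2 ^ n * 0 <;> simp [lowPart, indicator, this]
  · have hb : ofReal N ≠ 0 := by simpa using hN
    have hc : ofReal N ^ (p - 1) ≠ 0 := by simp [hb]
    rw [← ENNReal.mul_le_mul_iff_left (mul_ne_zero (pow_ne_zero n two_ne_zero) hc) (by finiteness)]
    refine hle.trans (le_of_eq ?_)
    rw [mul_mul_mul_comm, inv_mul_cancel (by simp) (by finiteness), one_mul]
    nth_rw 2 [← rpow_one (ofReal N)]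
    rw [← rpow_add_of_nonneg _ _ zero_le_one hp1, add_sub_cancel]

/-- The estimate for functions supported in a ball. -/
theorem IsBump.exists_local_bound (hβ : IsBump β₀) {ρ : ℝ} (hρ : 1 < ρ) {p s u v w z : ℝ} (hp : 2 ≤ p)
    (hs : 1 ≤ s) (hu : 0 ≤ u) (hv : 0 ≤ v) (hw : 0 ≤ w) (hz : 0 ≤ z) (h1 : u + v + w = 1)
    (h2 : u + 3 * v + w = s) (h3 : 2 * u + 6 * v + 4 * w + z = p * s) (h4 : -(p * s) ≤ s - 2 - (3 * v + w)) :
    ∃ C : ℝ≥0, ∀ (j : ℕ) (h : Euc 2 → ℂ) (a : Euc 2), j ≠ 0 → Measurable h → Integrable h →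
    (∀ y, h y ≠ 0 → y ∈ ball a 10) → ∫⁻ y, ‖h y‖ₑ ^ p ≠ ∞ →
    ∫⁻ x in ball a 1, avgNorm β₀ p j h x ^ (p * s) ≤ C * (((3 * j + 2 : ℕ) : ℝ≥0∞) ^ (p * s) *
      (ofReal ρ ^ j * (2 ^ j) ^ (s - 2 - (3 * v + w))) * (∫⁻ y, ‖h y‖ₑ ^ p) ^ s) := by
  obtain ⟨C₀, hC₀⟩ := hβ.exists_avg_bound
  obtain ⟨C₁, hC₁⟩ := hβ.exists_restricted_bound hρ (by linarith : 0 < s) hu hv hw hz h1 h2 h3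
  have hp0 : 0 < p := by linarith
  have hs0 : 0 ≤ s := by linarith
  have hq : 1 ≤ p * s := by nlinarith
  have hq0 : 0 ≤ p * s := by linarith
  set V : ℝ → ℝ≥0 := fun R => (volume (ball (0 : Euc 2) R)).toNNReal with hV
  have hvol : ∀ R a, volume (ball (a : Euc 2) R) = V R := fun R a => by simp [*]
  set M₁ : ℝ≥0 := V 1 * (4 * C₀) ^ (p * s) with hM₁
  set M₂ : ℝ≥0 := C₁ * (2 ^ p + V 10) ^ s with hM₂
  refine ⟨M₁ + M₂, fun j h a hj hm hi hsupp hfin => ?_⟩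
  set L : ℝ≥0∞ := 2 ^ j with hL
  set I := ∫⁻ y, ‖h y‖ₑ ^ p with hI
  set e := s - 2 - (3 * v + w) with he
  set P := ofReal ρ ^ j with hP
  have hP1 : 1 ≤ P := one_le_pow₀ (by rw [one_le_ofReal]; exact hρ.le)
  have hL1 : 1 ≤ L := one_le_pow₀ one_le_two
  set N : ℝ := (I ^ (1 / p)).toReal with hN
  have hb : ofReal N = I ^ (1 / p) := ofReal_toReal (by finiteness)
  have hb' : ofReal N ^ p = I := by rw [hb, ← rpow_mul, one_div_mul_cancel hp0.ne', rpow_one]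
  have hN0 : 0 ≤ N := ENNReal.toReal_nonneg
  set g : ℕ → Euc 2 → ℂ := fun i => Nat.casesOn i (h - lowPart h N (3 * j)) (levelPart h N) with hg
  have hgi : ∀ i, Measurable (g i) ∧ Integrable (g i) := fun i => by
    cases i with
    | zero =>
      have := integrable_lowPart hm hi N (3 * j)
      exact ⟨hm.sub this.1, hi.sub this.2⟩
    | succ i => exact integrable_levelPart hm hi N i
  have hsum : h = fun y => ∑ i ∈ Finset.range (3 * j + 2), g i y := by
    funext y
    rw [sum_range_succ']; simp only [hg]; rw [sum_levelPart]; simp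
  have hpiece : ∀ i, ∫⁻ x in ball a 1, avgNorm β₀ p j (g i) x ^ (p * s) ≤ (M₁ + M₂ : ℝ≥0) * (P * L ^ e * I ^ s) := by
    intro i
    cases i with
    | zero =>
      have hx : ∀ x, avgNorm β₀ p j (g 0) x ≤ 4 * C₀ * (L⁻¹ * ofReal N) := fun x => by
        refine (avgNorm_le (by linarith) (M := C₀ * (L⁻¹ * ofReal N)) fun t _ => ?_).trans_eq (by ring)
        refine (hC₀ j (g 0) x t (fun _ => (2 ^ j) ^ 2) (hgi 0).2 fun y ω _ _ => div_le_self (by positivity)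
          (one_le_pow₀ (by linarith [(by positivity : 0 ≤ 2 ^ j * ‖x - t • ω - y‖)]))).trans ?_
        rw [lintegral_mul_const' _ _ ofReal_ne_top, ofReal_pow (by positivity),
          ofReal_pow zero_le_two, ofReal_ofNat, ← hL]
        refine mul_le_mul_right ?_ _
        calc _ ≤ (2 ^ (3 * j))⁻¹ * ofReal N * L ^ 2 :=
              mul_le_mul_left (lintegral_sub_lowPart_le hm hN0 hp hb'.symm _) _
          _ = L⁻¹ * ofReal N * ((L ^ 2)⁻¹ * L ^ 2) := by
              rw [mul_comm 3, pow_mul, ← hL, pow_succ, ENNReal.mul_inv (by simp [hL]) (by simp [hL])]; ring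
          _ = _ := by rw [inv_mul_cancel (by simp [hL]) (by finiteness), mul_one]
      calc _ ≤ ∫⁻ x in ball a 1, (4 * C₀ * (L⁻¹ * ofReal N)) ^ (p * s) :=
            lintegral_mono fun x => rpow_le_rpow (hx x) hq0
        _ = M₁ * (1 * L ^ (-(p * s)) * I ^ s) := by
            rw [setLIntegral_const, hvol, mul_rpow_of_nonneg (4 * C₀) _ hq0, mul_rpow_of_nonneg L⁻¹ _ hq0,
              rpow_mul (ofReal N), hb', inv_rpow, rpow_neg, hM₁]
            push_cast [coe_rpow_of_nonneg _ hq0]; ring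
        _ ≤ _ := by gcongr; exact le_self_add
    | succ i =>
      have hB : ∀ y, ‖levelPart h N i y‖ ≤ 2 ^ i * N := fun y => by
        rcases levelPart_cases h hN0 i y with h0 | ⟨h0, h0', -⟩
        · rw [h0, norm_zero]; positivity
        · rwa [h0]
      calc _ ≤ _ := setLIntegral_le_lintegral _ _
        _ = ∫⁻ x, (∫⁻ t in Icc (1 / 2 : ℝ) 4, ‖sphAvg (freqLoc 2 β₀ j (levelPart h N i)) t x‖ₑ ^ p) ^ s := by
            refine lintegral_congr fun x => ?_
            rw [avgNorm, eLpNorm', ← rpow_mul, ← mul_assoc, one_div_mul_cancel hp0.ne', one_mul]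
        _ ≤ _ := hC₁ j _ _ hj (hgi (i + 1)).1 (hgi (i + 1)).2 hB
        _ ≤ C₁ * (P * L ^ e * ((2 ^ p + V 10) * I) ^ s) := by
            gcongr
            rw [show 2 * w + z = (p - 2) * s by linarith, rpow_mul, ← mul_rpow_of_nonneg _ _ hs0]
            refine rpow_le_rpow ?_ hs0
            have := levelPart_energy_le hm hN0 hp measurableSet_ball hsupp i
            rwa [hvol, hb', ← hI, ← add_mul] at this
        _ = M₂ * (P * L ^ e * I ^ s) := by
            rw [mul_rpow_of_nonneg _ _ hs0, hM₂]
            push_cast [coe_rpow_of_nonneg _ hs0, coe_rpow_of_nonneg _ hp0.le]; ring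
        _ ≤ _ := by bound
  calc _ ≤ ∫⁻ x in ball a 1, ((3 * j + 2 : ℕ) : ℝ≥0∞) ^ (p * s - 1) *
        ∑ i ∈ Finset.range (3 * j + 2), avgNorm β₀ p j (g i) x ^ (p * s) := by
        refine lintegral_mono fun x => ?_
        have h5 := avgNorm_sum_le hβ (by linarith : 1 ≤ p) j (Finset.range (3 * j + 2)) (fun i _ => (hgi i).2) x
        rw [← hsum] at h5
        have := ENNReal.rpow_sum_le_const_mul_sum_rpow (Finset.range (3 * j + 2))
          (fun i => avgNorm β₀ p j (g i) x) hq
        rw [card_range] at this; exact (rpow_le_rpow h5 hq0).trans this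
    _ ≤ ((3 * j + 2 : ℕ) : ℝ≥0∞) ^ (p * s - 1) * ∑ i ∈ Finset.range (3 * j + 2),
          (M₁ + M₂ : ℝ≥0) * (P * L ^ e * I ^ s) := by
        rw [lintegral_const_mul' _ _ (by finiteness), lintegral_finsetSum _ fun i _ =>
          (measurable_avgNorm hβ p j (hgi i).2).pow_const _]
        bound
    _ = _ := by
        rw [sum_const, card_range, nsmul_eq_mul]
        have : ((3 * j + 2 : ℕ) : ℝ≥0∞) ^ (p * s) = (3 * j + 2 : ℕ) ^ (p * s - 1) * (3 * j + 2 : ℕ) := by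
          nth_rw 3 [← rpow_one ((3 * j + 2 : ℕ) : ℝ≥0∞)]
          rw [← rpow_add_of_nonneg _ _ (by linarith) zero_le_one, sub_add_cancel]
        rw [this]; ring

theorem setLIntegral_ball (F : Euc 2 → ℝ≥0∞) (a : Euc 2) (R : ℝ) :
    ∫⁻ x in ball a R, F x = ∫⁻ x, F x * (ball 0 R).indicator 1 (a - x) := by
  rw [← lintegral_indicator measurableSet_ball]
  refine lintegral_congr fun x => ?_
  simp only [indicator, mem_ball, dist_comm x a, dist_eq_norm, sub_zero]; norm_num

/-- Summation of the local estimates. -/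
theorem IsBump.exists_global_bound (hβ : IsBump β₀) {ρ : ℝ} (hρ : 1 < ρ) {p s u v w z : ℝ} (hp : 2 ≤ p)
    (hs : 1 ≤ s) (hu : 0 ≤ u) (hv : 0 ≤ v) (hw : 0 ≤ w) (hz : 0 ≤ z) (h1 : u + v + w = 1)
    (h2 : u + 3 * v + w = s) (h3 : 2 * u + 6 * v + 4 * w + z = p * s) (h4 : -(p * s) ≤ s - 2 - (3 * v + w)) :
    ∃ C : ℝ≥0, ∀ (j : ℕ) (f : Euc 2 → ℂ), Measurable f → Integrable f → ∫⁻ y, ‖f y‖ₑ ^ p ≠ ∞ →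
    ∫⁻ x, avgNorm β₀ p j f x ^ (p * s) ≤ C * (((3 * j + 2 : ℕ) : ℝ≥0∞) ^ (p * s) *
      (ofReal ρ ^ j * (2 ^ j) ^ (s - 2 - (3 * v + w))) * (∫⁻ y, ‖f y‖ₑ ^ p) ^ s) := by
  obtain ⟨C₁, hC₁⟩ := hβ.exists_far_bound
  obtain ⟨C₂, hC₂⟩ := hβ.exists_local_bound hρ hp hs hu hv hw hz h1 h2 h3 h4
  have hp1 : 1 ≤ p := by linarith
  have hp0 : 0 < p := by linarith
  have hq : 1 ≤ p * s := by nlinarith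
  have hq0 : 0 ≤ p * s := by linarith
  have hb : ∀ R : ℝ, ∫⁻ x, (ball (0 : Euc 2) R).indicator (1 : Euc 2 → ℝ≥0∞) x ≠ ∞ := fun R => by
    rw [lintegral_indicator_one measurableSet_ball]; exact measure_ball_lt_top.ne
  have hbm : ∀ R : ℝ, Measurable ((ball (0 : Euc 2) R).indicator (1 : Euc 2 → ℝ≥0∞)) := fun R =>
    measurable_one.indicator measurableSet_ball
  lift ∫⁻ w, tail w to ℝ≥0 using lintegral_tail_ne_top with W hW
  set V : ℝ → ℝ≥0 := fun R => (∫⁻ x, (ball (0 : Euc 2) R).indicator (1 : Euc 2 → ℝ≥0∞) x).toNNReal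
  have hVe : ∀ R, ∫⁻ x, (ball (0 : Euc 2) R).indicator (1 : Euc 2 → ℝ≥0∞) x = V R := fun R =>
    (coe_toNNReal (hb R)).symm
  have hV1 : (V 1 : ℝ≥0∞) ≠ 0 := by
    rw [← hVe, lintegral_indicator_one measurableSet_ball]; exact (measure_ball_pos _ _ one_pos).ne'
  set M : ℝ≥0 := C₁ ^ (p * s) * W ^ ((p - 1) * s + 1) with hM
  refine ⟨M + 2 ^ (p * s - 1) * (M + (V 1)⁻¹ * (C₂ * V 10)), fun j f hm hi hfin => ?_⟩
  set I := ∫⁻ y, ‖f y‖ₑ ^ p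
  set L : ℝ≥0∞ := 2 ^ j
  set K : ℝ≥0∞ := ((3 * j + 2 : ℕ) : ℝ≥0∞) ^ (p * s)
  set P := ofReal ρ ^ j
  set e := s - 2 - (3 * v + w)
  have hP1 : 1 ≤ P := one_le_pow₀ (by rw [one_le_ofReal]; exact hρ.le)
  have hL1 : 1 ≤ L := one_le_pow₀ one_le_two
  have hK1 : 1 ≤ K := ENNReal.one_le_rpow (by norm_cast; omega) (by linarith)
  set Φ : Euc 2 → ℝ≥0∞ := fun x => (C₁ * (L⁻¹ ^ 2 * ∫⁻ y, ‖f y‖ₑ * tail (x - y))) ^ (p * s) with hΦ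
  have ht := measurable_tail
  have hΦm : Measurable Φ := by
    have : Measurable (uncurry fun x y : Euc 2 => ‖f y‖ₑ * tail (x - y)) := by fun_prop
    exact ((this.lintegral_prod_right.const_mul _).const_mul _).pow_const _
  have hΦi : ∫⁻ x, Φ x ≤ M * (K * (P * L ^ e) * I ^ s) := by
    calc _ = (C₁ : ℝ≥0∞) ^ (p * s) * (L⁻¹ ^ 2) ^ (p * s) *
            ∫⁻ x, (∫⁻ y, ‖f y‖ₑ * tail (x - y)) ^ (p * s) := by
          simp only [hΦ, mul_rpow_of_nonneg _ _ hq0, ← mul_assoc]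
          rw [lintegral_const_mul' _ _ (by finiteness)]
      _ ≤ (C₁ : ℝ≥0∞) ^ (p * s) * L ^ e * (W ^ ((p - 1) * s + 1) * I ^ s) := by
          have := lintegral_tail_conv_le hm.enorm hp1 hs
          rw [← hW] at this; gcongr
          refine le_trans (rpow_le_rpow (pow_le_of_le_one zero_le (ENNReal.inv_le_one.2 hL1)
            two_ne_zero) hq0) ?_
          rw [inv_rpow, ← rpow_neg]; exact rpow_le_rpow_of_exponent_le hL1 h4
      _ = M * (1 * (1 * L ^ e) * I ^ s) := by
          have : 0 ≤ (p - 1) * s + 1 := by nlinarith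
          rw [hM]; push_cast [coe_rpow_of_nonneg _ hq0, coe_rpow_of_nonneg _ this]; ring
      _ ≤ _ := by gcongr
  rcases eq_or_ne j 0 with hj | hj
  · calc _ ≤ ∫⁻ x, Φ x := lintegral_mono fun x =>
          rpow_le_rpow (hC₁ hp1 j f x hi fun _ _ => Or.inl hj) hq0
      _ ≤ _ := hΦi
      _ ≤ _ := by bound
  set Y : Euc 2 → ℝ≥0∞ := fun a => ∫⁻ y, ‖f y‖ₑ ^ p * (ball 0 10).indicator 1 (a - y) with hY
  have hloc : ∀ a, ∫⁻ x in ball a 1, avgNorm β₀ p j f x ^ (p * s) ≤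
      2 ^ (p * s - 1) * ((∫⁻ x in ball a 1, Φ x) + C₂ * (K * (P * L ^ e) * Y a ^ s)) := by
    intro a
    set h := (ball a 10).indicator f with hh
    have hhm : Measurable h := hm.indicator measurableSet_ball
    have hhi : Integrable h := hi.indicator measurableSet_ball
    have hpw : ∀ y, ‖h y‖ₑ ^ p = (ball a 10).indicator (fun y => ‖f y‖ₑ ^ p) y := fun y => by
      by_cases hy : y ∈ ball a 10 <;> simp [hh, hy, hp0]
    have hYa : ∫⁻ y, ‖h y‖ₑ ^ p = Y a := by
      simp_rw [hpw, hY, ← setLIntegral_ball, lintegral_indicator measurableSet_ball]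
    have hYf : Y a ≠ ∞ := by
      rw [← hYa]; simp_rw [hpw]
      exact ne_top_of_le_ne_top hfin (lintegral_mono (indicator_le_self _ _))
    calc _ ≤ ∫⁻ x in ball a 1, 2 ^ (p * s - 1) * (Φ x + avgNorm β₀ p j h x ^ (p * s)) := by
          refine setLIntegral_mono' measurableSet_ball fun x hx => ?_
          have h5 := avgNorm_sum_le hβ hp1 j Finset.univ (g := ![f - h, h])
            (fun i _ => by fin_cases i; exacts [hi.sub hhi, hhi]) x
          simp only [Fin.sum_univ_two, Matrix.cons_val_zero, Matrix.cons_val_one, Pi.sub_apply, sub_add_cancel] at h5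
          refine (rpow_le_rpow h5 hq0).trans ((ENNReal.rpow_add_le_mul_rpow_add_rpow _ _ hq).trans ?_)
          gcongr
          refine rpow_le_rpow ((hC₁ hp1 j (f - h) x (hi.sub hhi) fun y hy => Or.inr ?_).trans ?_) hq0
          · have : y ∉ ball a 10 := fun hy' => hy (by simp [hh, hy'])
            rw [mem_ball, not_lt] at this; rw [← dist_eq_norm]
            linarith [dist_triangle y x a, mem_ball.1 hx, dist_comm x y]
          · gcongr with y
            by_cases hy : y ∈ ball a 10 <;> simp [hh, hy]
      _ ≤ _ := by
          rw [lintegral_const_mul' _ _ (by finiteness), lintegral_add_left hΦm]; gcongr; rw [← hYa]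
          exact hC₂ j h a hj hhm hhi (fun y hy => by by_contra hc; exact hy (indicator_of_notMem hc f)) (hYa ▸ hYf)
  have hA := (measurable_avgNorm hβ p j hi).pow_const (p * s)
  have key : V 1 * ∫⁻ x, avgNorm β₀ p j f x ^ (p * s) ≤
      2 ^ (p * s - 1) * (V 1 * (∫⁻ x, Φ x) + C₂ * (K * (P * L ^ e) * (V 10 * I ^ s))) := by
    rw [← hVe 1, ← lintegral_conv hA (hbm 1), ← lintegral_conv hΦm (hbm 1)]
    simp_rw [← setLIntegral_ball]
    refine (lintegral_mono hloc).trans ?_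
    have hm1 : Measurable fun a => ∫⁻ x in ball a 1, Φ x := by
      simp_rw [setLIntegral_ball]
      have := (hΦm.comp measurable_snd).mul ((hbm 1).comp (measurable_fst.sub measurable_snd))
      exact this.lintegral_prod_right
    rw [lintegral_const_mul' _ _ (by finiteness), lintegral_add_left hm1,
      lintegral_const_mul' _ _ (by finiteness), lintegral_const_mul' _ _ (by finiteness)]
    gcongr; rw [← hVe 10]
    exact lintegral_rpow_conv_le (hm.enorm.pow_const p) (hbm 10) (fun x => indicator_le_self' (by simp) x) hs
  calc _ = (V 1 : ℝ≥0∞)⁻¹ * (V 1 * ∫⁻ x, avgNorm β₀ p j f x ^ (p * s)) := by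
        rw [← mul_assoc, inv_mul_cancel hV1 (by finiteness), one_mul]
    _ ≤ (V 1 : ℝ≥0∞)⁻¹ * (2 ^ (p * s - 1) * (V 1 * (M * (K * (P * L ^ e) * I ^ s)) +
          C₂ * (K * (P * L ^ e) * (V 10 * I ^ s)))) := mul_le_mul_right (key.trans (by gcongr)) _
    _ = 2 ^ (p * s - 1) * ((V 1 : ℝ≥0∞)⁻¹ * V 1 * M + (V 1 : ℝ≥0∞)⁻¹ * (C₂ * V 10)) * (K * (P * L ^ e) * I ^ s) := by ring
    _ ≤ _ := by
        rw [inv_mul_cancel hV1 (by finiteness), one_mul]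
        push_cast [coe_rpow_of_nonneg _ (by linarith : 0 ≤ p * s - 1), ENNReal.coe_inv (by simpa using hV1)]
        bound

theorem IsBump.exists_mixed_bound (hβ : IsBump β₀) {χ : ℝ → ℝ} (hχ : IsCutoff χ) {p q u v w z : ℝ} (hp : 2 ≤ p)
    (hpq : p ≤ q) (hu : 0 ≤ u) (hv : 0 ≤ v) (hw : 0 ≤ w) (hz : 0 ≤ z) (h1 : u + v + w = 1)
    (h2 : u + 3 * v + w = q / p) (h3 : 2 * u + 6 * v + 4 * w + z = q) (h4 : -q ≤ q / p - 2 - (3 * v + w))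
    {r : ℝ≥0∞} (hr0 : 0 < r) (hr : r ≤ ofReal p) {ε : ℝ} (hε : 0 < ε) : ∃ C : ℝ≥0, ∀ (j : ℕ) (f : Euc 2 → ℂ),
    mixedNorm 2 (ofReal q) r (Aj 2 χ β₀ j f) ≤
      C * 2 ^ (j * ((q / p - 2 - (3 * v + w)) / q + ε)) * eLpNorm f (ofReal p) volume := by
  have hp0 : 0 < p := by linarith
  have hq0 : 0 < q := by linarith
  have e1 : p * (q / p) = q := mul_div_cancel₀ q hp0.ne'
  set ρ : ℝ := 2 ^ (ε / 2) with hρ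
  have hρ1 : 1 < ρ := Real.one_lt_rpow one_lt_two (by positivity)
  obtain ⟨C, hC⟩ := hβ.exists_global_bound hρ1 hp ((one_le_div hp0).2 hpq) hu hv hw hz h1 h2 (e1.symm ▸ h3)
    (e1.symm ▸ h4)
  rw [e1] at hC
  obtain ⟨D, hD0, hD⟩ := exists_linear_le_pow hρ1
  obtain ⟨X, hX⟩ := (HasCompactSupport.of_support_subset_isCompact isCompact_Icc hχ.2.2).exists_bound_of_continuous
    hχ.1.continuous
  set b := r.toReal with hb
  have hb0 : 0 < b := ENNReal.toReal_pos hr0.ne' (ne_top_of_le_ne_top ofReal_ne_top hr)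
  have hbp : b ≤ p := ENNReal.toReal_le_of_le_ofReal hp0.le hr
  set A : ℝ≥0∞ := ofReal X * (volume (Icc (1 / 2 : ℝ) 4)) ^ (1 / b - 1 / p) with hA
  have hAt : A ≠ ∞ := by rw [hA, volume_Icc]; finiteness
  set e := (q / p - 2 - (3 * v + w))
  refine ⟨A.toNNReal * (C ^ (1 / q) * (3 * D).toNNReal) + 1, fun j f => ?_⟩
  obtain ⟨g, hgm, hgi, hgF, hgn⟩ : ∃ g : Euc 2 → ℂ, Measurable g ∧ Integrable g ∧ 𝓕 g = 𝓕 f ∧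
      eLpNorm g (ofReal p) volume ≤ eLpNorm f (ofReal p) volume := by
    by_cases hf : Integrable f
    · refine ⟨hf.1.mk f, hf.1.stronglyMeasurable_mk.measurable, hf.congr hf.1.ae_eq_mk, funext fun ξ => ?_,
        (eLpNorm_congr_ae hf.1.ae_eq_mk).ge⟩
      rw [fourier_eq, fourier_eq]
      refine integral_congr_ae ?_
      filter_upwards [hf.1.ae_eq_mk] with y hy
      rw [hy]
    · refine ⟨0, measurable_zero, integrable_zero _ _ _, funext fun ξ => ?_, by simp⟩
      rw [fourier_eq, fourier_eq, integral_undef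
        (mt (Real.fourierIntegral_convergent_iff (f := f) ξ).1 hf)]
      simp
  have hfl : freqLoc 2 β₀ j f = freqLoc 2 β₀ j g := by simp only [freqLoc, hgF]
  by_cases hfin : ∫⁻ y, ‖g y‖ₑ ^ p = ∞
  · have : eLpNorm f (ofReal p) volume = ∞ := by
      refine top_le_iff.1 (le_trans (top_le_iff.2 ?_) hgn)
      rw [eLpNorm_eq_lintegral_rpow_enorm_toReal (by simpa) ofReal_ne_top, toReal_ofReal hp0.le, hfin,
        ENNReal.top_rpow_of_pos (by positivity)]
    simp [*]
  have hin : ∀ x, lqNorm r (fun t => (‖Aj 2 χ β₀ j f x t‖₊ : ℝ≥0∞)) volume ≤ A * avgNorm β₀ p j g x := by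
    intro x; rw [lqNorm, if_neg (ne_top_of_le_ne_top ofReal_ne_top hr)]
    have hle := eLpNorm'_le_eLpNorm'_mul_rpow_measure_univ hb0 hbp
      ((continuous_avg hβ j hgi x).aestronglyMeasurable (μ := volume.restrict (Icc (1 / 2 : ℝ) 4)))
    rw [Measure.restrict_apply_univ] at hle
    calc _ ≤ (∫⁻ t in Icc (1 / 2 : ℝ) 4, ofReal X ^ b * ‖sphAvg (freqLoc 2 β₀ j g) t x‖ₑ ^ b) ^ (1 / b) := by
          rw [← lintegral_indicator measurableSet_Icc]; gcongr with t
          by_cases ht : t ∈ Icc (1 / 2 : ℝ) 4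
          · rw [indicator_of_mem ht, ← mul_rpow_of_nonneg _ _ hb0.le, Aj, hfl]
            refine rpow_le_rpow ?_ hb0.le
            rw [← enorm_eq_nnnorm, enorm_mul, ← ofReal_norm (χ t : ℂ), norm_real]; gcongr
            exact hX t
          · have : χ t = 0 := by by_contra hc; exact ht (hχ.2.2 hc)
            simp [Aj, this, hb0, ← hb]
      _ = ofReal X * eLpNorm' (fun t => sphAvg (freqLoc 2 β₀ j g) t x) b (volume.restrict (Icc (1 / 2 : ℝ) 4)) := by
          rw [lintegral_const_mul' _ _ (by finiteness), mul_rpow_of_nonneg _ _ (by positivity),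
            ← rpow_mul, mul_one_div_cancel hb0.ne', rpow_one, eLpNorm']
      _ ≤ ofReal X * (avgNorm β₀ p j g x * volume (Icc (1 / 2 : ℝ) 4) ^ (1 / b - 1 / p)) := by gcongr; exact hle
      _ = _ := by rw [hA]; ring
  have hnorm : (∫⁻ y, ‖g y‖ₑ ^ p) ^ (1 / p) = eLpNorm g (ofReal p) volume := by
    rw [eLpNorm_eq_lintegral_rpow_enorm_toReal (by simpa) ofReal_ne_top, toReal_ofReal hp0.le]
  have hρj : ((3 * j + 2 : ℕ) : ℝ≥0∞) * (ofReal ρ ^ j) ^ (1 / q) ≤ (3 * D).toNNReal * 2 ^ (j * ε) := by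
    have hr1 : (ofReal ρ ^ j) ^ (1 / q) ≤ ofReal ρ ^ j :=
      (rpow_le_rpow_of_exponent_le (one_le_pow₀ (by rw [one_le_ofReal]; exact hρ1.le))
        ((div_le_one hq0).2 (by linarith : 1 ≤ q))).trans_eq (rpow_one _)
    have hr2 : ((3 * j + 2 : ℕ) : ℝ≥0∞) ≤ ofReal (3 * D) * ofReal ρ ^ j := by
      rw [← ofReal_pow (by positivity), ← ofReal_mul (by positivity), ← ENNReal.ofReal_natCast]
      refine ofReal_le_ofReal ?_
      push_cast; linarith [hD j]
    calc _ ≤ ofReal (3 * D) * ofReal ρ ^ j * ofReal ρ ^ j := by gcongr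
      _ = _ := by
          rw [mul_assoc, ← mul_pow, hρ, ← ENNReal.ofReal_rpow_of_pos two_pos, ofReal_ofNat,
            ← rpow_add _ _ two_ne_zero (by simp), add_halves, ← ENNReal.rpow_mul_natCast, mul_comm ε]
          rfl
  rw [mixedNorm, lqNorm, if_neg ofReal_ne_top, toReal_ofReal hq0.le]
  have e2 : 1 / q * (q / p) = 1 / p := by field_simp
  have hq1 : 0 ≤ 1 / q := by positivity
  calc _ ≤ (∫⁻ x, A ^ q * avgNorm β₀ p j g x ^ q) ^ (1 / q) := by
        gcongr with x; rw [← mul_rpow_of_nonneg _ _ hq0.le]; exact rpow_le_rpow (hin x) hq0.le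
    _ ≤ (A ^ q * (C * (((3 * j + 2 : ℕ) : ℝ≥0∞) ^ q * (ofReal ρ ^ j * (2 ^ j) ^ e) *
          (∫⁻ y, ‖g y‖ₑ ^ p) ^ (q / p)))) ^ (1 / q) := by
        rw [lintegral_const_mul' _ _ (by finiteness)]; gcongr
        bound
    _ = A * (C ^ (1 / q) * (((3 * j + 2 : ℕ) * (ofReal ρ ^ j) ^ (1 / q)) * 2 ^ (j * (e / q)) *
          eLpNorm g (ofReal p) volume)) := by
        simp only [mul_rpow_of_nonneg _ _ hq1, ← rpow_mul, mul_one_div_cancel hq0.ne',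
          rpow_one]
        rw [← rpow_natCast 2, ← rpow_mul, mul_comm (q / p), e2, hnorm, mul_one_div]; ring
    _ ≤ A * (C ^ (1 / q) * ((3 * D).toNNReal * 2 ^ (j * ε) * 2 ^ (j * (e / q)) *
          eLpNorm f (ofReal p) volume)) := by gcongr
    _ = A * (C ^ (1 / q) * (3 * D).toNNReal) * 2 ^ (j * (e / q + ε)) * eLpNorm f (ofReal p) volume := by
        rw [mul_add, add_comm (_ * (e / q)), rpow_add _ _ two_ne_zero (by simp)]; ring
    _ ≤ _ := by
        gcongr; push_cast [coe_rpow_of_nonneg _ hq1]; rw [coe_toNNReal hAt]; exact le_self_add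

end Rescaling

/-- Two-dimensional single scale bounds in the regions (B₁) and (B₂). -/
theorem single_scale_bounds_dim2 (χ β₀ : ℝ → ℝ) (hχ : IsCutoff χ) (hβ : IsBump β₀) :
    -- (B₁)
    (∀ p q r : ℝ≥0∞,
      (1 / 3 : ℝ) * (1 - p⁻¹.toReal) ≤ q⁻¹.toReal → q⁻¹ ≤ p⁻¹ →
      2 < q → q ≤ 4 → 2 < p → p ≤ 4 → 0 < r → r ≤ p →
      ∀ ε : ℝ, 0 < ε → ∃ C : ℝ≥0, ∀ (j : ℕ) (f : Euc 2 → ℂ),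
        mixedNorm 2 q r (Aj 2 χ β₀ j f) ≤
          C * (2 : ℝ≥0∞) ^
              (-((j : ℝ) * ((1 / 2 : ℝ) * (q⁻¹.toReal + (1 - p⁻¹.toReal)))) + j * ε) *
            eLpNorm f p volume) ∧
    -- (B₂)
    (∀ p q r : ℝ≥0∞,
      q⁻¹.toReal ≤ (1 / 3 : ℝ) * (1 - p⁻¹.toReal) → q⁻¹ ≤ p⁻¹ →
      4 ≤ q → q ≤ 6 → 0 < r → r ≤ p →
      ∀ ε : ℝ, 0 < ε → ∃ C : ℝ≥0, ∀ (j : ℕ) (f : Euc 2 → ℂ),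
        mixedNorm 2 q r (Aj 2 χ β₀ j f) ≤
          C * (2 : ℝ≥0∞) ^ (-(2 * (j : ℝ) * q⁻¹.toReal) + j * ε) *
            eLpNorm f p volume) := by
  have hk : ∀ {p q : ℝ≥0∞}, q⁻¹ ≤ p⁻¹ → 2 ≤ q → q ≤ 6 → 2 ≤ p → ∃ a b : ℝ, p = ofReal a ∧
      q = ofReal b ∧ p⁻¹.toReal = a⁻¹ ∧ q⁻¹.toReal = b⁻¹ ∧ 2 ≤ a ∧ a ≤ b := by
    intro p q hpq h2 h6 hp
    have hpq' : p ≤ q := inv_le_inv.1 hpq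
    have hq : q ≠ ∞ := ne_top_of_le_ne_top (by simp) h6
    have hp' : p ≠ ∞ := ne_top_of_le_ne_top hq hpq'
    refine ⟨p.toReal, q.toReal, (ofReal_toReal hp').symm, (ofReal_toReal hq).symm,
      toReal_inv p, toReal_inv q, ?_, toReal_mono hq hpq'⟩
    simpa using toReal_mono hp' hp
  refine ⟨fun p q r h1 h2 h3 h4 h5 h6 hr0 hr ε hε => ?_, fun p q r h1 h2 h3 h4 hr0 hr ε hε => ?_⟩
  · obtain ⟨a, b, rfl, rfl, ha, hb, ha2, hab⟩ := hk h2 h3.le (h4.trans (by norm_num)) h5.le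
    rw [ha, hb] at h1
    rw [ha, hb]
    have ha0 : 0 < a := by linarith
    have hb0 : 0 < b := by linarith
    have hs : 1 ≤ b / a := (one_le_div ha0).2 hab
    have hs2 : b / a ≤ b / 2 := by gcongr
    have h7 := mul_le_mul_of_nonneg_left h1 (by positivity : 0 ≤ 3 * b)
    have h8 : b - b / a ≤ 3 := by field_simp at h7 ⊢; linarith
    obtain ⟨C, hC⟩ := hβ.exists_mixed_bound hχ (p := a) (q := b) (u := (3 + b / a - b) / 2) (v := (b / a - 1) / 2)
      (w := (b - 2 * (b / a)) / 2) (z := 0) ha2 hab (by linarith) (by linarith) (by linarith) le_rfl (by ring)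
      (by ring) (by ring) (by linarith) hr0 hr hε
    refine ⟨C, fun j f => (hC j f).trans_eq ?_⟩
    congr 3
    field_simp; ring
  · have hp2 : 2 ≤ p := by
      have h6 : (6 : ℝ)⁻¹ ≤ q⁻¹.toReal := by
        have := toReal_mono (by simpa using (zero_lt_four.trans_le h3).ne') (inv_le_inv.2 h4)
        simpa using this
      have h7 : p⁻¹.toReal ≤ 2⁻¹ := by norm_num at h6 h1 ⊢; linarith
      rw [← inv_le_inv]
      rcases eq_or_ne p⁻¹ ∞ with h | h
      · exact absurd (hr.trans_eq (ENNReal.inv_eq_top.1 h)) hr0.not_ge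
      · simpa [ofReal_inv_of_pos] using (ENNReal.le_ofReal_iff_toReal_le h (by norm_num : (0 : ℝ) ≤ 2⁻¹)).2 h7
    obtain ⟨a, b, rfl, rfl, ha, hb, ha2, hab⟩ := hk h2 (le_trans (by norm_num) h3) h4 hp2
    rw [ha, hb] at h1
    rw [hb]
    have ha0 : 0 < a := by linarith
    have hb0 : 0 < b := by linarith
    have hb6 : b ≤ 6 := by simpa using h4
    have hs : 1 ≤ b / a := (one_le_div ha0).2 hab
    have hs3 : b / a ≤ 3 := by rw [div_le_iff₀ ha0]; linarith
    have h7 := mul_le_mul_of_nonneg_left h1 (by positivity : 0 ≤ 3 * b)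
    have h8 : 3 ≤ b - b / a := by field_simp at h7 ⊢; linarith
    obtain ⟨C, hC⟩ := hβ.exists_mixed_bound hχ (p := a) (q := b) (u := 0) (v := (b / a - 1) / 2)
      (w := (3 - b / a) / 2) (z := b - 3 - b / a) ha2 hab le_rfl (by linarith) (by linarith) (by linarith) (by ring)
      (by ring) (by ring) (by linarith) hr0 hr hε
    refine ⟨C, fun j f => (hC j f).trans_eq ?_⟩
    congr 3
    field_simp; ring
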